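/- Let d ≥ 2 be even and let n = p + q > d with p, q ≥ 1, and let 0 < κ < n − d. Let {I_t}_{t>0} be a decreasing family of bounded measurable subsets of ℝ with Lebesgue measures |I_t| = c·t^{−κ} for some constant c > 0. Then there exists ν > 0 such that for almost all F ∈ Y_{p,q}^{(d)} there is a constant c_F > 0 and a constant C_F > 0 such that for all sufficiently large t: | #{v ∈ ℤⁿ : F(v) ∈ I_t and ‖v‖ ≤ t} − c_F·|I_t|·t^{n−d} | ≤ C_F·t^{n−d−κ−ν}. -/

import Mathlib

open MeasureTheory Matrix Filter

noncomputable section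

/-- `SL_n(ℝ)`. -/
abbrev SLR (n : ℕ) := Matrix.SpecialLinearGroup (Fin n) ℝ

instance (n : ℕ) : TopologicalSpace (SLR n) :=
  TopologicalSpace.induced (fun g => (g : Matrix (Fin n) (Fin n) ℝ)) inferInstance

instance (n : ℕ) : MeasurableSpace (SLR n) := borel _

/-- Euclidean norm on `ℝⁿ`. -/
def eucNorm {n : ℕ} (v : Fin n → ℝ) : ℝ := Real.sqrt (∑ i, v i ^ 2)

/-- `F₀(v) = Σ_{i=1}^p v_i^d − Σ_{i=p+1}^n v_i^d` on `ℝ^{p+q}`. -/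
def F0 (p q d : ℕ) (v : Fin (p + q) → ℝ) : ℝ :=
  ∑ i : Fin (p + q), (if (i : ℕ) < p then (1 : ℝ) else -1) * v i ^ d

/-- The polynomial `F = g·F₀`, i.e. `F(v) = F₀(v g)` (row vectors, right action). -/
def Fg (p q d : ℕ) (g : SLR (p + q)) (v : Fin (p + q) → ℝ) : ℝ :=
  F0 p q d (Matrix.vecMul v (g : Matrix (Fin (p + q)) (Fin (p + q)) ℝ))

/-- The coercion `ℤⁿ → ℝⁿ`. -/
def intVec {n : ℕ} (v : Fin n → ℤ) : Fin n → ℝ := fun i => (v i : ℝ)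

/-- `#{v ∈ ℤⁿ : F(v) ∈ I, ‖v‖ ≤ t}` for `F = g·F₀`. -/
def NF (p q d : ℕ) (g : SLR (p + q)) (I : Set ℝ) (t : ℝ) : ℕ :=
  Nat.card {v : Fin (p + q) → ℤ | Fg p q d g (intVec v) ∈ I ∧ eucNorm (intVec v) ≤ t}

theorem SLR.isInducing_coe (n : ℕ) :
    Topology.IsInducing (fun g : SLR n => (g : Matrix (Fin n) (Fin n) ℝ)) := ⟨rfl⟩

theorem SLR.continuous_coe (n : ℕ) :
    Continuous (fun g : SLR n => (g : Matrix (Fin n) (Fin n) ℝ)) :=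
  (SLR.isInducing_coe n).continuous

theorem SLR.isClosedEmbedding_coe (n : ℕ) :
    Topology.IsClosedEmbedding (fun g : SLR n => (g : Matrix (Fin n) (Fin n) ℝ)) := by
  refine ⟨⟨SLR.isInducing_coe n, Subtype.val_injective⟩, ?_⟩
  have : Set.range (fun g : SLR n => (g : Matrix (Fin n) (Fin n) ℝ)) = {A | A.det = 1} := by
    ext A
    constructor
    · rintro ⟨g, rfl⟩
      exact g.2
    · intro h
      exact ⟨⟨A, h⟩, rfl⟩
  rw [this]
  exact isClosed_eq (continuous_id.matrix_det) continuous_const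

instance (n : ℕ) : BorelSpace (SLR n) := ⟨rfl⟩

instance (n : ℕ) : IsTopologicalGroup (SLR n) where
  continuous_mul := by
    rw [(SLR.isInducing_coe n).continuous_iff]
    exact ((SLR.continuous_coe n).comp continuous_fst).matrix_mul
      ((SLR.continuous_coe n).comp continuous_snd)
  continuous_inv := by
    rw [(SLR.isInducing_coe n).continuous_iff]
    exact (SLR.continuous_coe n).matrix_adjugate

instance (n : ℕ) : SecondCountableTopology (SLR n) := by
  have : SecondCountableTopology (Matrix (Fin n) (Fin n) ℝ) :=
    inferInstanceAs (SecondCountableTopology (Fin n → Fin n → ℝ))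
  exact (SLR.isInducing_coe n).secondCountableTopology

instance (n : ℕ) : T2Space (SLR n) := (SLR.isClosedEmbedding_coe n).isEmbedding.t2Space

instance (n : ℕ) : SigmaCompactSpace (SLR n) := by
  have : SigmaCompactSpace (Matrix (Fin n) (Fin n) ℝ) :=
    inferInstanceAs (SigmaCompactSpace (Fin n → Fin n → ℝ))
  exact (SLR.isClosedEmbedding_coe n).sigmaCompactSpace

/-- The entrywise `ℓ¹` norm of a matrix. -/
def mnorm {n : ℕ} (A : Matrix (Fin n) (Fin n) ℝ) : ℝ := ∑ i, ∑ j, |A i j|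

theorem mnorm_nonneg {n : ℕ} (A : Matrix (Fin n) (Fin n) ℝ) : 0 ≤ mnorm A :=
  Finset.sum_nonneg fun _ _ => Finset.sum_nonneg fun _ _ => abs_nonneg _

theorem abs_le_mnorm {n : ℕ} (A : Matrix (Fin n) (Fin n) ℝ) (i j : Fin n) : |A i j| ≤ mnorm A :=
  (Finset.single_le_sum (f := fun j => |A i j|) (fun _ _ => abs_nonneg _)
    (Finset.mem_univ j)).trans
    (Finset.single_le_sum (f := fun i => ∑ j, |A i j|)
      (fun _ _ => Finset.sum_nonneg fun _ _ => abs_nonneg _) (Finset.mem_univ i))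

theorem mnorm_add_le {n : ℕ} (A B : Matrix (Fin n) (Fin n) ℝ) :
    mnorm (A + B) ≤ mnorm A + mnorm B := by
  unfold mnorm
  rw [← Finset.sum_add_distrib]
  refine Finset.sum_le_sum fun i _ => ?_
  rw [← Finset.sum_add_distrib]
  exact Finset.sum_le_sum fun j _ => abs_add_le _ _

theorem mnorm_neg {n : ℕ} (A : Matrix (Fin n) (Fin n) ℝ) : mnorm (-A) = mnorm A := by
  simp [mnorm]

theorem mnorm_smul {n : ℕ} (c : ℝ) (A : Matrix (Fin n) (Fin n) ℝ) :
    mnorm (c • A) = |c| * mnorm A := by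
  simp [mnorm, abs_mul, Finset.mul_sum]

theorem mnorm_mul_le {n : ℕ} (A B : Matrix (Fin n) (Fin n) ℝ) :
    mnorm (A * B) ≤ mnorm A * mnorm B := by
  have h1 : ∀ i j, |(A * B) i j| ≤ ∑ k, |A i k| * |B k j| := fun i j => by
    rw [Matrix.mul_apply]
    refine (Finset.abs_sum_le_sum_abs _ _).trans (le_of_eq ?_)
    simp [abs_mul]
  calc mnorm (A * B) ≤ ∑ i, ∑ j, ∑ k, |A i k| * |B k j| :=
        Finset.sum_le_sum fun i _ => Finset.sum_le_sum fun j _ => h1 i j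
    _ = ∑ i, ∑ k, |A i k| * ∑ j, |B k j| := by
        refine Finset.sum_congr rfl fun i _ => ?_
        rw [Finset.sum_comm]
        simp [Finset.mul_sum]
    _ ≤ ∑ i, ∑ k, |A i k| * mnorm B := by
        refine Finset.sum_le_sum fun i _ => Finset.sum_le_sum fun k _ => ?_
        refine mul_le_mul_of_nonneg_left ?_ (abs_nonneg _)
        exact Finset.single_le_sum (f := fun i => ∑ j, |B i j|)
          (fun _ _ => Finset.sum_nonneg fun _ _ => abs_nonneg _) (Finset.mem_univ k)
    _ = mnorm A * mnorm B := by
        simp [mnorm, Finset.sum_mul]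

theorem mnorm_one {n : ℕ} : mnorm (1 : Matrix (Fin n) (Fin n) ℝ) = n := by
  simp [mnorm, Matrix.one_apply, apply_ite abs]

theorem continuous_mnorm {n : ℕ} :
    Continuous (fun A : Matrix (Fin n) (Fin n) ℝ => mnorm A) := by
  unfold mnorm
  refine continuous_finsetSum _ fun i _ => continuous_finsetSum _ fun j _ => ?_
  exact (continuous_id.matrix_elem i j).abs

theorem norm_vecMul_le {n : ℕ} (v : Fin n → ℝ) (A : Matrix (Fin n) (Fin n) ℝ) :
    ‖v ᵥ* A‖ ≤ mnorm A * ‖v‖ := by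
  rw [pi_norm_le_iff_of_nonneg (mul_nonneg (mnorm_nonneg _) (norm_nonneg _))]
  intro j
  rw [Real.norm_eq_abs, Matrix.vecMul, dotProduct, mnorm, Finset.sum_mul]
  refine (Finset.abs_sum_le_sum_abs _ _).trans (Finset.sum_le_sum fun i _ => ?_)
  rw [abs_mul, mul_comm]
  refine mul_le_mul ?_ (norm_le_pi_norm v i) (abs_nonneg _)
    (Finset.sum_nonneg fun _ _ => abs_nonneg _)
  exact Finset.single_le_sum (f := fun j => |A i j|) (fun _ _ => abs_nonneg _)
    (Finset.mem_univ j)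

theorem mnorm_vecMulVec {n : ℕ} (a b : Fin n → ℝ) :
    mnorm (vecMulVec a b) = (∑ i, |a i|) * ∑ j, |b j| := by
  simp [mnorm, vecMulVec_apply, abs_mul, Finset.sum_mul_sum]

theorem sum_abs_le {n : ℕ} (a : Fin n → ℝ) : ∑ i, |a i| ≤ n * ‖a‖ := by
  calc ∑ i, |a i| ≤ ∑ _i : Fin n, ‖a‖ := Finset.sum_le_sum fun i _ => norm_le_pi_norm a i
    _ = n * ‖a‖ := by simp

theorem mnorm_vecMulVec_le {n : ℕ} (a b : Fin n → ℝ) :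
    mnorm (vecMulVec a b) ≤ n ^ 2 * ‖a‖ * ‖b‖ := by
  rw [mnorm_vecMulVec]
  calc _ ≤ (n * ‖a‖) * (n * ‖b‖) :=
        mul_le_mul (sum_abs_le a) (sum_abs_le b)
          (Finset.sum_nonneg fun _ _ => abs_nonneg _) (by positivity)
    _ = _ := by ring

/-- The compact set of `g` with entrywise norm at most `L`. -/
def KL (n : ℕ) (L : ℝ) : Set (SLR n) := {g | mnorm (g : Matrix (Fin n) (Fin n) ℝ) ≤ L}

theorem isClosed_KL (n : ℕ) (L : ℝ) : IsClosed (KL n L) :=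
  isClosed_le (continuous_mnorm.comp (SLR.continuous_coe n)) continuous_const

theorem measurableSet_KL (n : ℕ) (L : ℝ) : MeasurableSet (KL n L) :=
  (isClosed_KL n L).measurableSet

theorem isCompact_KL (n : ℕ) (L : ℝ) : IsCompact (KL n L) := by
  have h : IsCompact {A : Matrix (Fin n) (Fin n) ℝ | mnorm A ≤ L} := by
    have h1 : IsCompact (Set.pi Set.univ fun _ : Fin n => Set.pi Set.univ fun _ : Fin n =>
        Set.Icc (-L) L) :=
      isCompact_univ_pi fun _ => isCompact_univ_pi fun _ => isCompact_Icc
    refine IsCompact.of_isClosed_subset (X := Matrix (Fin n) (Fin n) ℝ) h1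
      (isClosed_le continuous_mnorm continuous_const) ?_
    intro A hA i _ j _
    exact abs_le.1 ((abs_le_mnorm A i j).trans hA)
  exact (SLR.isClosedEmbedding_coe n).isCompact_preimage h

theorem KL_mono {n : ℕ} {L L' : ℝ} (h : L ≤ L') : KL n L ⊆ KL n L' := fun _ hg => le_trans hg h

theorem mnorm_coe_mul_le {n : ℕ} (g h : SLR n) :
    mnorm ((g * h : SLR n) : Matrix (Fin n) (Fin n) ℝ) ≤
      mnorm (g : Matrix (Fin n) (Fin n) ℝ) * mnorm (h : Matrix (Fin n) (Fin n) ℝ) :=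
  mnorm_mul_le _ _

theorem mul_mem_KL {n : ℕ} {g h : SLR n} {K L : ℝ}
    (hg : g ∈ KL n K) (hh : h ∈ KL n L) : g * h ∈ KL n (K * L) :=
  (mnorm_coe_mul_le g h).trans
    (mul_le_mul hg hh (mnorm_nonneg _) ((mnorm_nonneg _).trans hg))

/-- The inverse is bounded on `KL`. -/
theorem exists_mnorm_inv_le (n : ℕ) (L : ℝ) :
    ∃ C ≥ (1 : ℝ), ∀ g ∈ KL n L, mnorm ((g⁻¹ : SLR n) : Matrix (Fin n) (Fin n) ℝ) ≤ C := by
  obtain ⟨C, hC⟩ := (isCompact_KL n L).bddAbove_image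
    (f := fun g : SLR n => mnorm ((g⁻¹ : SLR n) : Matrix (Fin n) (Fin n) ℝ))
    ((continuous_mnorm.comp ((SLR.continuous_coe n).comp continuous_inv)).continuousOn)
  refine ⟨max 1 C, le_max_left _ _, fun g hg => ?_⟩
  exact (hC ⟨g, hg, rfl⟩).trans (le_max_right _ _)

/-- Action on row vectors. -/
def act {n : ℕ} (x : Fin n → ℝ) (g : SLR n) : Fin n → ℝ :=
  x ᵥ* (g : Matrix (Fin n) (Fin n) ℝ)

theorem act_mul {n : ℕ} (x : Fin n → ℝ) (g h : SLR n) : act x (g * h) = act (act x g) h := by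
  simp [act, Matrix.vecMul_vecMul]

theorem act_one {n : ℕ} (x : Fin n → ℝ) : act x 1 = x := by
  simp [act]

theorem act_inv_act {n : ℕ} (x : Fin n → ℝ) (g : SLR n) : act (act x g) g⁻¹ = x := by
  rw [← act_mul, mul_inv_cancel, act_one]

theorem act_act_inv {n : ℕ} (x : Fin n → ℝ) (g : SLR n) : act (act x g⁻¹) g = x := by
  rw [← act_mul, inv_mul_cancel, act_one]

theorem act_add {n : ℕ} (x y : Fin n → ℝ) (g : SLR n) : act (x + y) g = act x g + act y g := by
  simp [act, Matrix.add_vecMul]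

theorem act_smul {n : ℕ} (c : ℝ) (x : Fin n → ℝ) (g : SLR n) :
    act (c • x) g = c • act x g := by
  simp [act, Matrix.smul_vecMul]

theorem norm_act_le {n : ℕ} (x : Fin n → ℝ) (g : SLR n) :
    ‖act x g‖ ≤ mnorm (g : Matrix (Fin n) (Fin n) ℝ) * ‖x‖ := norm_vecMul_le _ _

theorem norm_le_norm_act {n : ℕ} (x : Fin n → ℝ) (g : SLR n) :
    ‖x‖ ≤ mnorm ((g⁻¹ : SLR n) : Matrix (Fin n) (Fin n) ℝ) * ‖act x g‖ := by
  conv_lhs => rw [← act_inv_act x g]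
  exact norm_act_le _ _

theorem continuous_act {n : ℕ} :
    Continuous (fun a : (Fin n → ℝ) × SLR n => act a.1 a.2) :=
  continuous_fst.matrix_vecMul ((SLR.continuous_coe n).comp continuous_snd)

theorem continuous_act_right {n : ℕ} (x : Fin n → ℝ) : Continuous (fun g : SLR n => act x g) :=
  continuous_act.comp (Continuous.prodMk_right x)

theorem measurable_act {n : ℕ} (x : Fin n → ℝ) : Measurable (fun g : SLR n => act x g) :=
  (continuous_act_right x).measurable

/-- The signed sum of `d`-th powers. -/
def Fs {n : ℕ} (σ : Fin n → ℝ) (d : ℕ) (v : Fin n → ℝ) : ℝ := ∑ i, σ i * v i ^ d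

theorem continuous_Fs {n : ℕ} (σ : Fin n → ℝ) (d : ℕ) : Continuous (Fs σ d) := by
  unfold Fs
  fun_prop

theorem measurable_Fs_act {n : ℕ} (σ : Fin n → ℝ) (d : ℕ) (x : Fin n → ℝ) :
    Measurable (fun g : SLR n => Fs σ d (act x g)) :=
  ((continuous_Fs σ d).comp (continuous_act_right x)).measurable

/-- A function whose derivative is at least `m` in absolute value takes values in `J` on a set of
measure at most `|J| / m`. -/
theorem volume_Icc_inter_preimage_le {φ φ' : ℝ → ℝ} {r m : ℝ} (hm : 0 < m)
    (hφ : ∀ τ, HasDerivAt φ (φ' τ) τ) (hφm : ∀ τ ∈ Set.Icc 0 r, m ≤ |φ' τ|)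
    {J : Set ℝ} (hJ : MeasurableSet J) :
    volume (Set.Icc 0 r ∩ φ ⁻¹' J) ≤ ENNReal.ofReal (1 / m) * volume J := by
  have hcont : Continuous φ := continuous_iff_continuousAt.2 fun τ => (hφ τ).continuousAt
  have hs : MeasurableSet (Set.Icc 0 r ∩ φ ⁻¹' J) :=
    measurableSet_Icc.inter (hcont.measurable hJ)
  have hlt : ∀ a ∈ Set.Icc 0 r, ∀ b ∈ Set.Icc 0 r, a < b → φ a ≠ φ b := by
    intro a ha b hb hab h
    obtain ⟨c, hc, hc'⟩ := exists_hasDerivAt_eq_zero hab hcont.continuousOn h fun x _ => hφ x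
    have := hφm c ⟨ha.1.trans hc.1.le, hc.2.le.trans hb.2⟩
    rw [hc', abs_zero] at this
    linarith
  have hinj : Set.InjOn φ (Set.Icc 0 r ∩ φ ⁻¹' J) := by
    intro a ha b hb hab
    rcases lt_trichotomy a b with h | h | h
    · exact absurd hab (hlt a ha.1 b hb.1 h)
    · exact h
    · exact absurd hab.symm (hlt b hb.1 a ha.1 h)
  have key := lintegral_image_eq_lintegral_abs_deriv_mul hs
    (fun x _ => (hφ x).hasDerivWithinAt) hinj (fun _ => 1)
  simp only [lintegral_one, Measure.restrict_apply_univ, mul_one] at key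
  have h1 : ENNReal.ofReal m * volume (Set.Icc 0 r ∩ φ ⁻¹' J) ≤ volume J := by
    calc ENNReal.ofReal m * volume (Set.Icc 0 r ∩ φ ⁻¹' J)
        = ∫⁻ _ in Set.Icc 0 r ∩ φ ⁻¹' J, ENNReal.ofReal m := by simp
      _ ≤ ∫⁻ x in Set.Icc 0 r ∩ φ ⁻¹' J, ENNReal.ofReal |φ' x| :=
          setLIntegral_mono' hs fun x hx => ENNReal.ofReal_le_ofReal (hφm x hx.1)
      _ = volume (φ '' (Set.Icc 0 r ∩ φ ⁻¹' J)) := key.symm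
      _ ≤ volume J := by
          refine measure_mono ?_
          rintro _ ⟨x, hx, rfl⟩
          exact hx.2
  calc volume (Set.Icc 0 r ∩ φ ⁻¹' J)
      = ENNReal.ofReal (1 / m) * (ENNReal.ofReal m * volume (Set.Icc 0 r ∩ φ ⁻¹' J)) := by
        rw [← mul_assoc, ← ENNReal.ofReal_mul (by positivity), one_div_mul_cancel hm.ne']
        simp
    _ ≤ _ := by gcongr

/-- The shear `1 + τ f ⊗ ζ`. -/
def shear {n : ℕ} (f ζ : Fin n → ℝ) (h : f ⬝ᵥ ζ = 0) (τ : ℝ) : SLR n :=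
  ⟨1 + τ • vecMulVec f ζ, by
    rw [← smul_vecMulVec, vecMulVec_eq (Fin 1), det_one_add_replicateCol_mul_replicateRow]
    rw [dotProduct_smul, dotProduct_comm, h]
    simp⟩

theorem coe_shear {n : ℕ} (f ζ : Fin n → ℝ) (h : f ⬝ᵥ ζ = 0) (τ : ℝ) :
    (shear f ζ h τ : Matrix (Fin n) (Fin n) ℝ) = 1 + τ • vecMulVec f ζ := rfl

theorem act_shear {n : ℕ} (f ζ : Fin n → ℝ) (h : f ⬝ᵥ ζ = 0) (τ : ℝ) (x : Fin n → ℝ) :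
    act x (shear f ζ h τ) = x + (τ * (x ⬝ᵥ f)) • ζ := by
  rw [act, coe_shear, vecMul_add, vecMul_one, vecMul_smul, vecMul_vecMulVec, smul_smul]

theorem continuous_shear {n : ℕ} (f ζ : Fin n → ℝ) (h : f ⬝ᵥ ζ = 0) :
    Continuous (shear f ζ h) := by
  rw [(SLR.isInducing_coe n).continuous_iff]
  change Continuous fun τ : ℝ => (1 + τ • vecMulVec f ζ : Matrix (Fin n) (Fin n) ℝ)
  fun_prop

theorem shear_inv {n : ℕ} (f ζ : Fin n → ℝ) (h : f ⬝ᵥ ζ = 0) (τ : ℝ) :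
    shear f ζ h (-τ) * shear f ζ h τ = 1 := by
  apply Subtype.ext
  change (1 + (-τ) • vecMulVec f ζ) * (1 + τ • vecMulVec f ζ) = (1 : Matrix (Fin n) (Fin n) ℝ)
  rw [add_mul, mul_add, one_mul, mul_add, mul_one, one_mul, smul_mul_smul_comm, vecMulVec_mul_vecMulVec,
    dotProduct_comm, h]
  simp

/-- The differential of `Fs`. -/
def dFs {n : ℕ} (σ : Fin n → ℝ) (d : ℕ) (y h : Fin n → ℝ) : ℝ :=
  ∑ i, σ i * (d * y i ^ (d - 1)) * h i

theorem dFs_add {n : ℕ} (σ : Fin n → ℝ) (d : ℕ) (y h k : Fin n → ℝ) :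
    dFs σ d y (h + k) = dFs σ d y h + dFs σ d y k := by
  simp [dFs, mul_add, Finset.sum_add_distrib]

theorem dFs_smul {n : ℕ} (σ : Fin n → ℝ) (d : ℕ) (y h : Fin n → ℝ) (c : ℝ) :
    dFs σ d y (c • h) = c * dFs σ d y h := by
  simp only [dFs, Pi.smul_apply, smul_eq_mul, Finset.mul_sum]
  exact Finset.sum_congr rfl fun i _ => by ring

theorem hasDerivAt_Fs_line {n : ℕ} (σ : Fin n → ℝ) (d : ℕ) (y h : Fin n → ℝ) (τ : ℝ) :
    HasDerivAt (fun τ : ℝ => Fs σ d (y + τ • h)) (dFs σ d (y + τ • h) h) τ := by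
  unfold Fs dFs
  refine HasDerivAt.fun_sum fun i _ => ?_
  have h1 : HasDerivAt (fun τ : ℝ => y i + τ * h i) (h i) τ := by
    simpa using ((hasDerivAt_id τ).mul_const (h i)).const_add (y i)
  have h2 := (h1.pow d).const_mul (σ i)
  simp only [Pi.add_apply, Pi.smul_apply, smul_eq_mul]
  rw [mul_assoc]
  exact h2

theorem continuous_dFs {n : ℕ} (σ : Fin n → ℝ) (d : ℕ) :
    Continuous fun a : (Fin n → ℝ) × (Fin n → ℝ) => dFs σ d a.1 a.2 := by
  unfold dFs
  fun_prop

theorem abs_dFs_sub_le {n : ℕ} {σ : Fin n → ℝ} (hσ : ∀ i, |σ i| = 1) {d : ℕ} (hd : 2 ≤ d)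
    {R δ : ℝ} {y y' h : Fin n → ℝ} (hy : ‖y‖ ≤ R) (hy' : ‖y'‖ ≤ R)
    (hyy : ‖y - y'‖ ≤ δ * R) :
    |dFs σ d y h - dFs σ d y' h| ≤ n * d ^ 2 * δ * R ^ (d - 1) * ‖h‖ := by
  have hR : 0 ≤ R := (norm_nonneg _).trans hy
  have hδR : 0 ≤ δ * R := (norm_nonneg _).trans hyy
  have e : dFs σ d y h - dFs σ d y' h
      = ∑ i, σ i * d * (y i ^ (d - 1) - y' i ^ (d - 1)) * h i := by
    rw [dFs, dFs, ← Finset.sum_sub_distrib]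
    exact Finset.sum_congr rfl fun i _ => by ring
  rw [e]
  have hterm : ∀ i, |σ i * d * (y i ^ (d - 1) - y' i ^ (d - 1)) * h i|
      ≤ d ^ 2 * δ * R ^ (d - 1) * ‖h‖ := by
    intro i
    rw [abs_mul, abs_mul, abs_mul, hσ, one_mul, Nat.abs_cast]
    have h1 : |y i ^ (d - 1) - y' i ^ (d - 1)| ≤ d * δ * R ^ (d - 1) := by
      obtain ⟨k, rfl⟩ : ∃ k, d = k + 2 := ⟨d - 2, by omega⟩
      have h2 := abs_pow_sub_pow_le (y i) (y' i) (k + 2 - 1)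
      have h3 : |y i - y' i| ≤ δ * R := (norm_le_pi_norm (y - y') i).trans hyy
      have h4 : max |y i| |y' i| ≤ R :=
        max_le ((norm_le_pi_norm y i).trans hy) ((norm_le_pi_norm y' i).trans hy')
      have h5 : k + 2 - 1 = k + 1 := by omega
      rw [h5] at h2 ⊢
      calc _ ≤ |y i - y' i| * (k + 1 : ℕ) * max |y i| |y' i| ^ (k + 1 - 1) := h2
        _ ≤ (δ * R) * (k + 2 : ℕ) * R ^ k := by
            gcongr
            · omega
            · exact pow_le_pow_left₀ (le_max_of_le_left (abs_nonneg _)) h4 k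
        _ = _ := by ring
    calc (d : ℝ) * |y i ^ (d - 1) - y' i ^ (d - 1)| * |h i|
        ≤ d * (d * δ * R ^ (d - 1)) * ‖h‖ := by
          have := norm_le_pi_norm h i
          rw [Real.norm_eq_abs] at this
          have h6 : 0 ≤ d * δ * R ^ (d - 1) := (abs_nonneg _).trans h1
          gcongr
      _ = _ := by ring
  calc _ ≤ ∑ i, |σ i * d * (y i ^ (d - 1) - y' i ^ (d - 1)) * h i| :=
        Finset.abs_sum_le_sum_abs _ _
    _ ≤ ∑ _i : Fin n, d ^ 2 * δ * R ^ (d - 1) * ‖h‖ := Finset.sum_le_sum fun i _ => hterm i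
    _ = _ := by simp; ring

/-- Averaging over a shear: the part of the mass where the derivative along the shear is large. -/
theorem measure_shear_le {n : ℕ} (σ : Fin n → ℝ) (d : ℕ) (μ : Measure (SLR n)) [μ.IsHaarMeasure]
    {K L r m : ℝ} (hr : 0 < r) (hm : 0 < m) (f ζ x v : Fin n → ℝ) (hfζ : f ⬝ᵥ ζ = 0)
    (hvf : v ⬝ᵥ f = 0) (hxf : x ⬝ᵥ f ≠ 0)
    (hrL : ∀ τ ∈ Set.Icc 0 r, mnorm (shear f ζ hfζ (-τ) : Matrix (Fin n) (Fin n) ℝ) ≤ K)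
    (hlip : ∀ g ∈ KL n (K * L), ∀ τ ∈ Set.Icc 0 r, ∀ τ' ∈ Set.Icc 0 r,
      |dFs σ d (act (x + (τ * (x ⬝ᵥ f)) • ζ) g) (act ζ g)
        - dFs σ d (act (x + (τ' * (x ⬝ᵥ f)) • ζ) g) (act ζ g)| ≤ m / 2)
    {S : Set (Fin n → ℝ)} (hS : MeasurableSet S) {J : Set ℝ} (hJ : MeasurableSet J) :
    μ {g | g ∈ KL n L ∧ Fs σ d (act x g) ∈ J ∧ act v g ∈ S ∧
        m ≤ |dFs σ d (act x g) (act ζ g)|}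
      ≤ ENNReal.ofReal (2 / (r * m * |x ⬝ᵥ f|)) * volume J *
        μ {g | g ∈ KL n (K * L) ∧ act v g ∈ S} := by
  set E := {g | g ∈ KL n L ∧ Fs σ d (act x g) ∈ J ∧ act v g ∈ S ∧
        m ≤ |dFs σ d (act x g) (act ζ g)|} with hE
  set B := shear f ζ hfζ with hB
  set E2 := {g | g ∈ KL n (K * L) ∧ act v g ∈ S} with hE2
  have hEm : MeasurableSet E := by
    refine (measurableSet_KL n L).inter ((measurable_Fs_act σ d x hJ).inter
      ((measurable_act v hS).inter ?_))
    have h1 : Continuous fun g : SLR n => |dFs σ d (act x g) (act ζ g)| :=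
      ((continuous_dFs σ d).comp
        ((continuous_act_right x).prodMk (continuous_act_right ζ))).abs
    exact measurableSet_le measurable_const h1.measurable
  have hE2m : MeasurableSet E2 := (measurableSet_KL n _).inter (measurable_act v hS)
  have hBc : Continuous fun a : ℝ × SLR n => B a.1 * a.2 :=
    ((continuous_shear f ζ hfζ).comp continuous_fst).mul continuous_snd
  have hBm : Measurable fun a : ℝ × SLR n => B a.1 * a.2 := hBc.measurable
  have hα : 0 < |x ⬝ᵥ f| := abs_pos.2 hxf
  have inner : ∀ g, ∫⁻ τ in Set.Icc 0 r, E.indicator 1 (B τ * g)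
      ≤ E2.indicator (fun _ => ENNReal.ofReal (2 / (m * |x ⬝ᵥ f|)) * volume J) g := by
    intro g
    have hTm : MeasurableSet {τ | B τ * g ∈ E} :=
      (hBm.comp (measurable_prodMk_right (y := g))) hEm
    have e1 : ∫⁻ τ in Set.Icc 0 r, E.indicator 1 (B τ * g)
        = volume ({τ | B τ * g ∈ E} ∩ Set.Icc 0 r) := by
      have : (fun τ => E.indicator (1 : SLR n → ENNReal) (B τ * g))
          = {τ | B τ * g ∈ E}.indicator 1 := by
        ext τ
        simp [Set.indicator]
      rw [this, lintegral_indicator_one hTm, Measure.restrict_apply hTm]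
    rw [e1]
    rcases Set.eq_empty_or_nonempty ({τ | B τ * g ∈ E} ∩ Set.Icc 0 r) with h0 | ⟨τ₀, hτ₀, hτ₀r⟩
    · rw [h0]; simp
    have hgE2 : g ∈ E2 := by
      constructor
      · have : g = B (-τ₀) * (B τ₀ * g) := by rw [← mul_assoc, shear_inv, one_mul]
        rw [this]
        exact mul_mem_KL (hrL τ₀ hτ₀r) hτ₀.1
      · have := hτ₀.2.2.1
        rw [act_mul, act_shear, hvf] at this
        simpa using this
    rw [Set.indicator_of_mem hgE2]
    have hline : ∀ τ, act x (B τ * g) = act x g + τ • ((x ⬝ᵥ f) • act ζ g) := fun τ => by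
      rw [act_mul, act_shear, act_add, act_smul, smul_smul]
    have hline' : ∀ τ, act x g + τ • ((x ⬝ᵥ f) • act ζ g) = act (x + (τ * (x ⬝ᵥ f)) • ζ) g :=
      fun τ => by rw [act_add, act_smul, smul_smul]
    have hζ : act ζ (B τ₀ * g) = act ζ g := by
      rw [act_mul, act_shear, dotProduct_comm, hfζ]; simp
    have hb : ∀ τ ∈ Set.Icc 0 r, m * |x ⬝ᵥ f| / 2 ≤
        |dFs σ d (act x g + τ • ((x ⬝ᵥ f) • act ζ g)) ((x ⬝ᵥ f) • act ζ g)| := by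
      intro τ hτ
      rw [dFs_smul, abs_mul, hline']
      have h1 := hlip g hgE2.1 τ hτ τ₀ hτ₀r
      have h2 := hτ₀.2.2.2
      rw [hζ, hline, hline'] at h2
      have h3 := abs_sub_abs_le_abs_sub
        (dFs σ d (act (x + (τ₀ * (x ⬝ᵥ f)) • ζ) g) (act ζ g))
        (dFs σ d (act (x + (τ * (x ⬝ᵥ f)) • ζ) g) (act ζ g))
      rw [abs_sub_comm] at h3
      have h4 : m / 2 ≤ |dFs σ d (act (x + (τ * (x ⬝ᵥ f)) • ζ) g) (act ζ g)| := by linarith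
      nlinarith
    have h1D := volume_Icc_inter_preimage_le (r := r) (m := m * |x ⬝ᵥ f| / 2) (by positivity)
      (fun τ => hasDerivAt_Fs_line σ d (act x g) ((x ⬝ᵥ f) • act ζ g) τ) hb hJ
    have e2 : 1 / (m * |x ⬝ᵥ f| / 2) = 2 / (m * |x ⬝ᵥ f|) := by field_simp
    rw [e2] at h1D
    refine (measure_mono ?_).trans h1D
    rintro τ ⟨hτ, hτr⟩
    refine ⟨hτr, ?_⟩
    have := hτ.2.1
    rw [hline] at this
    exact this
  have main : ENNReal.ofReal r * μ E ≤ ENNReal.ofReal (2 / (m * |x ⬝ᵥ f|)) * volume J * μ E2 := by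
    calc ENNReal.ofReal r * μ E = ∫⁻ τ in Set.Icc 0 r, ∫⁻ g, E.indicator 1 (B τ * g) ∂μ := by
          have : ∀ τ, ∫⁻ g, E.indicator 1 (B τ * g) ∂μ = μ E := fun τ => by
            rw [lintegral_mul_left_eq_self (fun g => E.indicator (1 : SLR n → ENNReal) g) (B τ),
              lintegral_indicator_one hEm]
          simp only [this]
          simp [mul_comm]
      _ = ∫⁻ g, (∫⁻ τ in Set.Icc 0 r, E.indicator 1 (B τ * g)) ∂μ := by
          refine lintegral_lintegral_swap ?_
          exact ((measurable_one.indicator hEm).comp hBm).aemeasurable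
      _ ≤ ∫⁻ g, E2.indicator (fun _ => ENNReal.ofReal (2 / (m * |x ⬝ᵥ f|)) * volume J) g ∂μ :=
          lintegral_mono inner
      _ = _ := by rw [lintegral_indicator_const hE2m]
  calc μ E = ENNReal.ofReal (1 / r) * (ENNReal.ofReal r * μ E) := by
        rw [← mul_assoc, ← ENNReal.ofReal_mul (by positivity), one_div_mul_cancel hr.ne']
        simp
    _ ≤ ENNReal.ofReal (1 / r) *
        (ENNReal.ofReal (2 / (m * |x ⬝ᵥ f|)) * volume J * μ E2) := by gcongr
    _ = _ := by
        rw [← mul_assoc, ← mul_assoc, ← ENNReal.ofReal_mul (by positivity)]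
        congr 3
        field_simp

theorem abs_le_one_of_dotProduct_self {n : ℕ} {a : Fin n → ℝ} (h : a ⬝ᵥ a = 1) (i : Fin n) :
    |a i| ≤ 1 := by
  rw [abs_le_one_iff_mul_self_le_one, ← h]
  exact Finset.single_le_sum (f := fun i => a i * a i) (fun i _ => mul_self_nonneg _)
    (Finset.mem_univ i)

theorem norm_le_one_of_dotProduct_self {n : ℕ} {a : Fin n → ℝ} (h : a ⬝ᵥ a = 1) : ‖a‖ ≤ 1 :=
  (pi_norm_le_iff_of_nonneg zero_le_one).2 fun i => abs_le_one_of_dotProduct_self h i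

theorem norm_single_one {n : ℕ} (i : Fin n) : ‖(Pi.single i 1 : Fin n → ℝ)‖ = 1 := by
  rw [Pi.norm_single, norm_one]

theorem abs_dotProduct_le {n : ℕ} (a b : Fin n → ℝ) : |a ⬝ᵥ b| ≤ n * ‖a‖ * ‖b‖ := by
  calc |a ⬝ᵥ b| ≤ ∑ i, |a i * b i| := Finset.abs_sum_le_sum_abs _ _
    _ ≤ ∑ _i : Fin n, ‖a‖ * ‖b‖ := by
        refine Finset.sum_le_sum fun i _ => ?_
        rw [abs_mul]
        exact mul_le_mul (norm_le_pi_norm a i) (norm_le_pi_norm b i) (abs_nonneg _)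
          (norm_nonneg _)
    _ = _ := by simp; ring

theorem exists_abs_eq_norm {n : ℕ} (hn : 0 < n) (y : Fin n → ℝ) : ∃ i, |y i| = ‖y‖ := by
  have : Nonempty (Fin n) := ⟨⟨0, hn⟩⟩
  obtain ⟨i, hi⟩ := Finite.exists_max fun i => |y i|
  exact ⟨i, le_antisymm (norm_le_pi_norm y i)
    ((pi_norm_le_iff_of_nonneg (abs_nonneg _)).2 hi)⟩

theorem decomposition_of_orthonormal {n : ℕ} {a z : Fin n → ℝ} (hza : a ⬝ᵥ z = 0)
    (w : Fin n → ℝ) :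
    w = ∑ j, (w j + (w ⬝ᵥ a) * z j) • (Pi.single j 1 - a j • a) + (w ⬝ᵥ a) • (a - z) := by
  ext i
  simp only [Pi.add_apply, Finset.sum_apply, Pi.smul_apply, Pi.sub_apply, smul_eq_mul]
  have h1 : ∑ j, (w j + (w ⬝ᵥ a) * z j) * ((Pi.single j 1 : Fin n → ℝ) i - a j * a i)
      = (w i + (w ⬝ᵥ a) * z i) - ((w ⬝ᵥ a) + (w ⬝ᵥ a) * (a ⬝ᵥ z)) * a i := by
    simp only [mul_sub, Finset.sum_sub_distrib]
    congr 1
    · simp [Pi.single_apply]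
    · simp only [dotProduct, add_mul, Finset.sum_add_distrib, Finset.sum_mul, Finset.mul_sum]
      congr 1
      · exact Finset.sum_congr rfl fun j _ => by ring
      · refine Finset.sum_congr rfl fun j _ => Finset.sum_congr rfl fun k _ => by ring
  rw [h1, hza]
  ring

theorem exists_large_direction {n : ℕ} (hn : 0 < n) {σ : Fin n → ℝ} (hσ : ∀ i, |σ i| = 1) {d : ℕ}
    (hd : 2 ≤ d) {C₁ : ℝ} (hC₁ : 1 ≤ C₁) {g : SLR n}
    (hg : mnorm ((g⁻¹ : SLR n) : Matrix (Fin n) (Fin n) ℝ) ≤ C₁)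
    {x a z : Fin n → ℝ} (haa : a ⬝ᵥ a = 1) (hzz : z ⬝ᵥ z = 1) (haz : a ⬝ᵥ z = 0) (hx : x ≠ 0) :
    (∃ j, ‖x‖ ^ (d - 1) / (C₁ ^ d * (n + 1) ^ 2) ≤
      |dFs σ d (act x g) (act (Pi.single j 1 - a j • a) g)|) ∨
    ‖x‖ ^ (d - 1) / (C₁ ^ d * (n + 1) ^ 2) ≤ |dFs σ d (act x g) (act (a - z) g)| := by
  by_contra! hcon
  obtain ⟨h1, h2⟩ := hcon
  set m := ‖x‖ ^ (d - 1) / (C₁ ^ d * (n + 1) ^ 2) with hm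
  have hx0 : 0 < ‖x‖ := norm_pos_iff.2 hx
  have hC0 : 0 < C₁ := by linarith
  have hm0 : 0 < m := by positivity
  set y := act x g with hy
  obtain ⟨i, hi⟩ := exists_abs_eq_norm hn y
  set w := act (Pi.single i 1) g⁻¹ with hw
  have hwn : ‖w‖ ≤ C₁ := by
    refine (norm_act_le _ _).trans ?_
    rw [norm_single_one, mul_one]
    exact hg
  have hD : |dFs σ d y (act w g)| = d * ‖y‖ ^ (d - 1) := by
    rw [hw, act_act_inv, dFs, Finset.sum_eq_single i]
    · simp [abs_mul, hσ, hi]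
    · intro b _ hb
      simp [hb]
    · simp
  have hyx : ‖x‖ / C₁ ≤ ‖y‖ := by
    rw [div_le_iff₀ hC0, mul_comm]
    exact (norm_le_norm_act x g).trans (by gcongr)
  have hlow : (‖x‖ / C₁) ^ (d - 1) ≤ |dFs σ d y (act w g)| := by
    rw [hD]
    calc (‖x‖ / C₁) ^ (d - 1) ≤ ‖y‖ ^ (d - 1) := by gcongr
      _ = 1 * ‖y‖ ^ (d - 1) := by ring
      _ ≤ _ := by
          gcongr
          exact_mod_cast (by omega : 1 ≤ d)
  have hwa : |w ⬝ᵥ a| ≤ n * C₁ := by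
    refine (abs_dotProduct_le w a).trans ?_
    have := norm_le_one_of_dotProduct_self haa
    calc (n : ℝ) * ‖w‖ * ‖a‖ ≤ n * C₁ * 1 := by gcongr
      _ = _ := by ring
  have hlin : dFs σ d y (act w g) = ∑ j, (w j + (w ⬝ᵥ a) * z j) *
      dFs σ d y (act (Pi.single j 1 - a j • a) g) + (w ⬝ᵥ a) * dFs σ d y (act (a - z) g) := by
    let T : (Fin n → ℝ) →ₗ[ℝ] ℝ :=
      { toFun := fun u => dFs σ d y (act u g)
        map_add' := fun u v => by rw [act_add, dFs_add]
        map_smul' := fun c u => by rw [act_smul, dFs_smul]; rfl }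
    have := congrArg T (decomposition_of_orthonormal haz w)
    rw [map_add, map_sum, map_smul] at this
    simp only [map_smul, smul_eq_mul] at this
    exact this
  have hup : |dFs σ d y (act w g)| ≤ (n * (n + 2)) * C₁ * m := by
    rw [hlin]
    calc _ ≤ |∑ j, (w j + (w ⬝ᵥ a) * z j) * dFs σ d y (act (Pi.single j 1 - a j • a) g)|
          + |(w ⬝ᵥ a) * dFs σ d y (act (a - z) g)| := abs_add_le _ _
      _ ≤ ∑ j, |(w j + (w ⬝ᵥ a) * z j) * dFs σ d y (act (Pi.single j 1 - a j • a) g)|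
          + |(w ⬝ᵥ a) * dFs σ d y (act (a - z) g)| := by
          gcongr
          exact Finset.abs_sum_le_sum_abs _ _
      _ ≤ ∑ _j : Fin n, ((n + 1) * C₁) * m + (n * C₁) * m := by
          gcongr with j
          · rw [abs_mul]
            refine mul_le_mul ?_ (h1 j).le (abs_nonneg _) (by positivity)
            have hzj := abs_le_one_of_dotProduct_self hzz j
            calc |w j + (w ⬝ᵥ a) * z j| ≤ |w j| + |(w ⬝ᵥ a) * z j| := abs_add_le _ _
              _ ≤ C₁ + n * C₁ * 1 := by
                  rw [abs_mul]
                  gcongr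
                  exact (norm_le_pi_norm w j).trans hwn
              _ = _ := by ring
          · rw [abs_mul]
            exact mul_le_mul hwa h2.le (abs_nonneg _) (by positivity)
      _ = _ := by simp; ring
  have : (‖x‖ / C₁) ^ (d - 1) = (n + 1) ^ 2 * C₁ * m := by
    rw [hm, div_pow]
    obtain ⟨k, rfl⟩ : ∃ k, d = k + 1 := ⟨d - 1, by omega⟩
    rw [Nat.add_sub_cancel]
    field_simp
    rw [pow_succ]
  nlinarith [mul_pos hC0 hm0]

/-- One more condition costs a factor `|J| / (|x·a| ‖x‖^(d-1))`. -/
theorem shear_density {n : ℕ} (hn : 0 < n) {σ : Fin n → ℝ} (hσ : ∀ i, |σ i| = 1) {d : ℕ}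
    (hd : 2 ≤ d) (μ : Measure (SLR n)) [μ.IsHaarMeasure] {L : ℝ} (hL : 1 ≤ L) :
    ∃ C > (0 : ℝ), ∀ v x a z : Fin n → ℝ, a ⬝ᵥ a = 1 → z ⬝ᵥ z = 1 → a ⬝ᵥ z = 0 → v ⬝ᵥ a = 0 →
      v ⬝ᵥ z = 0 → x ⬝ᵥ z = 0 → x ⬝ᵥ a ≠ 0 → ∀ S : Set (Fin n → ℝ), MeasurableSet S →
      ∀ J : Set ℝ, MeasurableSet J →
      μ {g | g ∈ KL n L ∧ Fs σ d (act x g) ∈ J ∧ act v g ∈ S}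
      ≤ ENNReal.ofReal (C / (|x ⬝ᵥ a| * ‖x‖ ^ (d - 1))) * volume J *
        μ {g | g ∈ KL n ((n + 1) * L) ∧ act v g ∈ S} := by
  obtain ⟨C₁, hC₁, hinv⟩ := exists_mnorm_inv_le n L
  have hC0 : 0 < C₁ := by linarith
  have hL0 : 0 < L := by linarith
  set m₀ : ℝ := 1 / (C₁ ^ d * (n + 1) ^ 2) with hm₀
  have hm₀p : 0 < m₀ := by positivity
  set L' : ℝ := (n + 1) * L with hL'
  have hL'0 : 0 < L' := by positivity
  set r : ℝ := 1 / (4 * n ^ 2 + 2 * n ^ 2 * d ^ 2 * (2 * L') ^ d / m₀ + 1) with hr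
  have hr0 : 0 < r := by positivity
  have hr1 : r * (4 * n ^ 2) ≤ 1 := by
    rw [hr, div_mul_eq_mul_div, one_mul, div_le_one (by positivity)]
    have : 0 ≤ 2 * n ^ 2 * d ^ 2 * (2 * L') ^ d / m₀ := by positivity
    linarith
  have hr2 : n ^ 2 * d ^ 2 * r * (2 * L') ^ d ≤ m₀ / 2 := by
    have : r * (2 * n ^ 2 * d ^ 2 * (2 * L') ^ d / m₀) ≤ 1 := by
      rw [hr, div_mul_eq_mul_div, one_mul, div_le_one (by positivity)]
      have : 0 ≤ 4 * (n : ℝ) ^ 2 := by positivity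
      linarith
    rw [mul_div_assoc', div_le_one hm₀p] at this
    linarith
  have hn1 : (1 : ℝ) ≤ n := by exact_mod_cast hn
  refine ⟨(n + 1) * (2 / (r * m₀)), by positivity, ?_⟩
  intro v x a z haa hzz haz hva hvz hxz hxa S hS J hJ
  have hx : x ≠ 0 := by
    rintro rfl
    simp at hxa
  have hx0 : 0 < ‖x‖ := norm_pos_iff.2 hx
  set m : ℝ := m₀ * ‖x‖ ^ (d - 1) with hm
  have hmp : 0 < m := by positivity
  have han := norm_le_one_of_dotProduct_self haa
  have hzn := norm_le_one_of_dotProduct_self hzz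
  have hxan : |x ⬝ᵥ a| ≤ n * ‖x‖ := by
    refine (abs_dotProduct_le x a).trans ?_
    calc (n : ℝ) * ‖x‖ * ‖a‖ ≤ n * ‖x‖ * 1 := by gcongr
      _ = _ := by ring
  have dir : ∀ f ζ : Fin n → ℝ, f ⬝ᵥ ζ = 0 → v ⬝ᵥ f = 0 → x ⬝ᵥ f = x ⬝ᵥ a → ‖f‖ ≤ 2 → ‖ζ‖ ≤ 2 →
      μ {g | g ∈ KL n L ∧ Fs σ d (act x g) ∈ J ∧ act v g ∈ S ∧
        m ≤ |dFs σ d (act x g) (act ζ g)|}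
      ≤ ENNReal.ofReal (2 / (r * m * |x ⬝ᵥ a|)) * volume J *
        μ {g | g ∈ KL n L' ∧ act v g ∈ S} := by
    intro f ζ hfζ hvf hxf hfn hζn
    have key := measure_shear_le σ d μ (K := n + 1) (L := L) hr0 hmp f ζ x v hfζ hvf
      (by rw [hxf]; exact hxa) ?_ ?_ hS hJ
    · rw [hxf] at key
      exact key
    · intro τ hτ
      rw [coe_shear]
      refine (mnorm_add_le _ _).trans ?_
      rw [mnorm_one, mnorm_smul, abs_neg, abs_of_nonneg hτ.1]
      have h1 := mnorm_vecMulVec_le f ζ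
      have h2 : (n : ℝ) ^ 2 * ‖f‖ * ‖ζ‖ ≤ n ^ 2 * 2 * 2 := by gcongr
      have h3 : τ * mnorm (vecMulVec f ζ) ≤ r * (n ^ 2 * 2 * 2) :=
        mul_le_mul hτ.2 (h1.trans h2) (mnorm_nonneg _) hr0.le
      linarith
    · intro g hg τ hτ τ' hτ'
      rw [hxf]
      have hgn : ∀ u : Fin n → ℝ, ‖act u g‖ ≤ L' * ‖u‖ := fun u =>
        (norm_act_le u g).trans (by
          have : mnorm (g : Matrix (Fin n) (Fin n) ℝ) ≤ L' := hg
          gcongr)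
      have hu : ∀ τ ∈ Set.Icc 0 r, ‖act (x + (τ * (x ⬝ᵥ a)) • ζ) g‖ ≤ 2 * L' * ‖x‖ := by
        intro τ hτ
        refine (hgn _).trans ?_
        have : ‖x + (τ * (x ⬝ᵥ a)) • ζ‖ ≤ 2 * ‖x‖ := by
          calc _ ≤ ‖x‖ + ‖(τ * (x ⬝ᵥ a)) • ζ‖ := norm_add_le _ _
            _ = ‖x‖ + τ * |x ⬝ᵥ a| * ‖ζ‖ := by
                rw [norm_smul, Real.norm_eq_abs, abs_mul, abs_of_nonneg hτ.1]
            _ ≤ ‖x‖ + r * (n * ‖x‖) * 2 := by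
                have := hτ.1
                have := hτ.2
                gcongr
            _ ≤ 2 * ‖x‖ := by
                have : r * n * 2 ≤ 1 := by nlinarith
                nlinarith
        calc L' * ‖x + (τ * (x ⬝ᵥ a)) • ζ‖ ≤ L' * (2 * ‖x‖) := by gcongr
          _ = _ := by ring
      have hdiff : ‖act (x + (τ * (x ⬝ᵥ a)) • ζ) g - act (x + (τ' * (x ⬝ᵥ a)) • ζ) g‖
          ≤ (r * n) * (2 * L' * ‖x‖) := by
        have e : act (x + (τ * (x ⬝ᵥ a)) • ζ) g - act (x + (τ' * (x ⬝ᵥ a)) • ζ) g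
            = act (((τ - τ') * (x ⬝ᵥ a)) • ζ) g := by
          rw [act_add, act_add, add_sub_add_left_eq_sub, act_smul, act_smul, act_smul,
            sub_mul, sub_smul]
        rw [e]
        refine (hgn _).trans ?_
        rw [norm_smul, Real.norm_eq_abs, abs_mul]
        have h1 : |τ - τ'| ≤ r := abs_le.2 ⟨by linarith [hτ.1, hτ'.2], by linarith [hτ.2, hτ'.1]⟩
        calc L' * (|τ - τ'| * |x ⬝ᵥ a| * ‖ζ‖) ≤ L' * (r * (n * ‖x‖) * 2) := by gcongr
          _ = _ := by ring
      refine (abs_dFs_sub_le hσ hd (hu τ hτ) (hu τ' hτ') hdiff).trans ?_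
      have hζg : ‖act ζ g‖ ≤ 2 * L' := by
        refine (hgn ζ).trans ?_
        rw [mul_comm]
        gcongr
      calc (n : ℝ) * d ^ 2 * (r * n) * (2 * L' * ‖x‖) ^ (d - 1) * ‖act ζ g‖
          ≤ n * d ^ 2 * (r * n) * (2 * L' * ‖x‖) ^ (d - 1) * (2 * L') := by gcongr
        _ = (n ^ 2 * d ^ 2 * r * (2 * L') ^ d) * ‖x‖ ^ (d - 1) := by
            obtain ⟨k, rfl⟩ : ∃ k, d = k + 1 := ⟨d - 1, by omega⟩
            rw [Nat.add_sub_cancel]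
            ring_nf
        _ ≤ m₀ / 2 * ‖x‖ ^ (d - 1) := by gcongr
        _ = m / 2 := by rw [hm]; ring
  set X := ENNReal.ofReal (2 / (r * m * |x ⬝ᵥ a|)) * volume J *
        μ {g | g ∈ KL n L' ∧ act v g ∈ S} with hX
  have hcover : {g | g ∈ KL n L ∧ Fs σ d (act x g) ∈ J ∧ act v g ∈ S} ⊆
      (⋃ j : Fin n, {g | g ∈ KL n L ∧ Fs σ d (act x g) ∈ J ∧ act v g ∈ S ∧
        m ≤ |dFs σ d (act x g) (act (Pi.single j 1 - a j • a) g)|}) ∪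
      {g | g ∈ KL n L ∧ Fs σ d (act x g) ∈ J ∧ act v g ∈ S ∧
        m ≤ |dFs σ d (act x g) (act (a - z) g)|} := by
    rintro g ⟨hg1, hg2, hg3⟩
    have em : ‖x‖ ^ (d - 1) / (C₁ ^ d * (n + 1) ^ 2) = m := by
      rw [hm, hm₀]; ring
    rcases exists_large_direction hn hσ hd hC₁ (hinv g hg1) haa hzz haz hx with ⟨j, hj⟩ | hj
    · left
      rw [em] at hj
      exact Set.mem_iUnion.2 ⟨j, hg1, hg2, hg3, hj⟩
    · right
      rw [em] at hj
      exact ⟨hg1, hg2, hg3, hj⟩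
  have hdirj : ∀ j : Fin n, μ {g | g ∈ KL n L ∧ Fs σ d (act x g) ∈ J ∧ act v g ∈ S ∧
        m ≤ |dFs σ d (act x g) (act (Pi.single j 1 - a j • a) g)|} ≤ X := by
    intro j
    refine dir a _ ?_ hva rfl (han.trans one_le_two) ?_
    · rw [dotProduct_sub, dotProduct_smul, haa]
      simp
    · refine (norm_sub_le _ _).trans ?_
      rw [norm_smul]
      have h1 := norm_single_one j
      have h2 : ‖a j‖ ≤ 1 := abs_le_one_of_dotProduct_self haa j
      have h3 : ‖a j‖ * ‖a‖ ≤ 1 * 1 := by gcongr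
      linarith
  have hdir0 : μ {g | g ∈ KL n L ∧ Fs σ d (act x g) ∈ J ∧ act v g ∈ S ∧
        m ≤ |dFs σ d (act x g) (act (a - z) g)|} ≤ X := by
    refine dir (a + z) (a - z) ?_ ?_ ?_ ?_ ?_
    · rw [add_dotProduct, dotProduct_sub, dotProduct_sub, haa, hzz, haz, dotProduct_comm z a, haz]
      ring
    · rw [dotProduct_add, hva, hvz, add_zero]
    · rw [dotProduct_add, hxz, add_zero]
    · exact (norm_add_le _ _).trans (by linarith)
    · exact (norm_sub_le _ _).trans (by linarith)
  calc _ ≤ _ := measure_mono hcover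
    _ ≤ (∑ _j : Fin n, X) + X := by
        refine (measure_union_le _ _).trans (add_le_add ?_ hdir0)
        refine (measure_iUnion_fintype_le _ _).trans ?_
        exact Finset.sum_le_sum fun j _ => hdirj j
    _ = ((n + 1 : ℕ) : ENNReal) * X := by
        simp [add_mul]
    _ = _ := by
        rw [hX, ← mul_assoc, ← mul_assoc, ← ENNReal.ofReal_natCast,
          ← ENNReal.ofReal_mul (by positivity)]
        congr 3
        rw [hm]
        push_cast
        field_simp

theorem dotProduct_self_eq {n : ℕ} (v : Fin n → ℝ) : v ⬝ᵥ v = eucNorm v ^ 2 := by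
  rw [eucNorm, Real.sq_sqrt (Finset.sum_nonneg fun i _ => sq_nonneg _)]
  exact Finset.sum_congr rfl fun i _ => by ring

theorem eucNorm_nonneg {n : ℕ} (v : Fin n → ℝ) : 0 ≤ eucNorm v := Real.sqrt_nonneg _

theorem norm_le_eucNorm {n : ℕ} (v : Fin n → ℝ) : ‖v‖ ≤ eucNorm v := by
  refine (pi_norm_le_iff_of_nonneg (eucNorm_nonneg v)).2 fun i => ?_
  refine Real.abs_le_sqrt ?_
  exact Finset.single_le_sum (f := fun i => v i ^ 2) (fun i _ => sq_nonneg _)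
    (Finset.mem_univ i)

theorem eucNorm_le {n : ℕ} (v : Fin n → ℝ) : eucNorm v ≤ n * ‖v‖ := by
  refine Real.sqrt_le_iff.2 ⟨by positivity, ?_⟩
  have h : ∀ i, v i ^ 2 ≤ ‖v‖ ^ 2 := fun i => by
    rw [sq_le_sq, abs_norm]
    exact norm_le_pi_norm v i
  calc ∑ i, v i ^ 2 ≤ ∑ _i : Fin n, ‖v‖ ^ 2 := Finset.sum_le_sum fun i _ => h i
    _ = n * ‖v‖ ^ 2 := by simp
    _ ≤ n ^ 2 * ‖v‖ ^ 2 := by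
        gcongr
        exact_mod_cast Nat.le_self_pow two_ne_zero n
    _ = _ := by ring

theorem eucNorm_pos {n : ℕ} {v : Fin n → ℝ} (hv : v ≠ 0) : 0 < eucNorm v :=
  (norm_pos_iff.2 hv).trans_le (norm_le_eucNorm v)

theorem exists_unit_smul {n : ℕ} {v : Fin n → ℝ} (hv : v ≠ 0) :
    ((eucNorm v)⁻¹ • v) ⬝ᵥ ((eucNorm v)⁻¹ • v) = 1 := by
  have := eucNorm_pos hv
  rw [smul_dotProduct, dotProduct_smul, dotProduct_self_eq, smul_eq_mul, smul_eq_mul]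
  field_simp

theorem exists_unit_perp {n : ℕ} (hn : 3 ≤ n) (v w : Fin n → ℝ) :
    ∃ z : Fin n → ℝ, z ⬝ᵥ z = 1 ∧ v ⬝ᵥ z = 0 ∧ w ⬝ᵥ z = 0 := by
  let T : (Fin n → ℝ) →ₗ[ℝ] (Fin 2 → ℝ) := Matrix.mulVecLin (Matrix.of ![v, w])
  have hker : LinearMap.ker T ≠ ⊥ := by
    refine LinearMap.ker_ne_bot_of_finrank_lt ?_
    simp
    omega
  obtain ⟨z, hz, hz0⟩ := (Submodule.ne_bot_iff _).1 hker
  have hz' : (Matrix.of ![v, w]).mulVec z = 0 := hz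
  have h0 : v ⬝ᵥ z = 0 := congrFun hz' 0
  have h1 : w ⬝ᵥ z = 0 := congrFun hz' 1
  refine ⟨(eucNorm z)⁻¹ • z, exists_unit_smul hz0, ?_, ?_⟩
  · rw [dotProduct_smul, h0, smul_zero]
  · rw [dotProduct_smul, h1, smul_zero]

theorem measure_KL_lt_top {n : ℕ} (μ : Measure (SLR n)) [μ.IsHaarMeasure] (L : ℝ) :
    μ (KL n L) < ⊤ := (isCompact_KL n L).measure_lt_top

/-- The measure of the set of `g` for which `F(vg) ∈ J`. -/
theorem measure_single_le {n : ℕ} (hn : 3 ≤ n) {σ : Fin n → ℝ} (hσ : ∀ i, |σ i| = 1) {d : ℕ}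
    (hd : 2 ≤ d) (μ : Measure (SLR n)) [μ.IsHaarMeasure] {L : ℝ} (hL : 1 ≤ L) :
    ∃ C > (0 : ℝ), ∀ v : Fin n → ℝ, v ≠ 0 → ∀ J : Set ℝ, MeasurableSet J →
      μ {g | g ∈ KL n L ∧ Fs σ d (act v g) ∈ J}
      ≤ ENNReal.ofReal (C / ‖v‖ ^ d) * volume J := by
  obtain ⟨C, hC, h⟩ := shear_density (by omega) hσ hd μ hL
  set M := (μ (KL n ((n + 1) * L))).toReal with hM
  refine ⟨C * (M + 1), by positivity, fun v hv J hJ => ?_⟩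
  obtain ⟨z, hzz, hvz, -⟩ := exists_unit_perp hn v 0
  have he := eucNorm_pos hv
  have hn0 : 0 < ‖v‖ := norm_pos_iff.2 hv
  have hva : v ⬝ᵥ ((eucNorm v)⁻¹ • v) = eucNorm v := by
    rw [dotProduct_smul, dotProduct_self_eq, smul_eq_mul]
    field_simp
  have key := h 0 v ((eucNorm v)⁻¹ • v) z (exists_unit_smul hv) hzz
    (by rw [smul_dotProduct, hvz, smul_zero]) (by simp) (by simp) hvz
    (by rw [hva]; exact he.ne') Set.univ MeasurableSet.univ J hJ
  simp only [Set.mem_univ, and_true, Set.ofPred_mem_eq] at key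
  rw [hva, abs_of_pos he] at key
  have hMe : μ (KL n ((n + 1) * L)) = ENNReal.ofReal M :=
    (ENNReal.ofReal_toReal (measure_KL_lt_top μ _).ne).symm
  rw [hMe] at key
  refine key.trans ?_
  rw [mul_right_comm, ← ENNReal.ofReal_mul (by positivity)]
  gcongr
  rw [div_mul_eq_mul_div]
  have h1 : ‖v‖ ^ d ≤ eucNorm v * ‖v‖ ^ (d - 1) := by
    calc ‖v‖ ^ d = ‖v‖ * ‖v‖ ^ (d - 1) := by
          rw [← pow_succ', Nat.sub_add_cancel (by omega)]
      _ ≤ _ := by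
          gcongr
          exact norm_le_eucNorm v
  have hM0 : 0 ≤ M := ENNReal.toReal_nonneg
  gcongr
  linarith

theorem exists_unit_in_span {n : ℕ} {v w : Fin n → ℝ} {r s : Fin n}
    (hrs : v r * w s - v s * w r ≠ 0) :
    ∃ a : Fin n → ℝ, a ⬝ᵥ a = 1 ∧ v ⬝ᵥ a = 0 ∧
      (∀ z : Fin n → ℝ, v ⬝ᵥ z = 0 → w ⬝ᵥ z = 0 → a ⬝ᵥ z = 0) ∧
      |v r * w s - v s * w r| / eucNorm v ≤ |w ⬝ᵥ a| := by
  have hv : v ≠ 0 := by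
    rintro rfl
    simp at hrs
  have hne : r ≠ s := by
    rintro rfl
    exact hrs (sub_self _)
  have he := eucNorm_pos hv
  set b : Fin n → ℝ := (v ⬝ᵥ v) • w - (v ⬝ᵥ w) • v with hb
  have hvb : v ⬝ᵥ b = 0 := by
    rw [hb, dotProduct_sub, dotProduct_smul, dotProduct_smul, smul_eq_mul, smul_eq_mul]
    ring
  have hbb : b ⬝ᵥ b = (v ⬝ᵥ v) * (w ⬝ᵥ b) := by
    conv_lhs => rw [hb]
    rw [sub_dotProduct, smul_dotProduct, smul_dotProduct, ← hb, hvb, smul_eq_mul, smul_zero,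
      sub_zero]
  have hbf : b r * v s - b s * v r = (v ⬝ᵥ v) * (w r * v s - w s * v r) := by
    simp only [hb, Pi.sub_apply, Pi.smul_apply, smul_eq_mul]
    ring
  have hvv : 0 < v ⬝ᵥ v := by
    rw [dotProduct_self_eq]
    positivity
  have hb0 : b ≠ 0 := by
    intro h0
    rw [h0] at hbf
    simp only [Pi.zero_apply, zero_mul, sub_self] at hbf
    rcases mul_eq_zero.1 hbf.symm with h | h
    · exact hvv.ne' h
    · exact hrs (by linarith)
  have hbe := eucNorm_pos hb0
  have two : ∀ u : Fin n → ℝ, u r ^ 2 + u s ^ 2 ≤ u ⬝ᵥ u := fun u => by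
    have := Finset.sum_le_univ_sum_of_nonneg (f := fun i => u i * u i) (s := {r, s})
      (fun i => mul_self_nonneg _)
    rw [Finset.sum_pair hne] at this
    rw [dotProduct]
    linarith
  refine ⟨(eucNorm b)⁻¹ • b, exists_unit_smul hb0, ?_, ?_, ?_⟩
  · rw [dotProduct_smul, hvb, smul_zero]
  · intro z hvz hwz
    rw [smul_dotProduct, hb, sub_dotProduct, smul_dotProduct, smul_dotProduct, hvz, hwz]
    simp
  · have h1 : (v ⬝ᵥ v) * |v r * w s - v s * w r| ≤ eucNorm b * eucNorm v := by
      have h2 : |b r * v s - b s * v r| ≤ eucNorm b * eucNorm v := by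
        refine abs_le_of_sq_le_sq ?_ (by positivity)
        rw [mul_pow, ← dotProduct_self_eq, ← dotProduct_self_eq]
        calc (b r * v s - b s * v r) ^ 2 ≤ (b r ^ 2 + b s ^ 2) * (v r ^ 2 + v s ^ 2) := by
              nlinarith [sq_nonneg (b r * v r + b s * v s)]
          _ ≤ _ := mul_le_mul (two b) (two v) (by positivity) ((by positivity : _ ≤ _).trans (two b))
      rw [hbf, abs_mul, abs_of_pos hvv] at h2
      rwa [show |v r * w s - v s * w r| = |w r * v s - w s * v r| by
        rw [← abs_neg]; congr 1; ring]
    have h3 : w ⬝ᵥ ((eucNorm b)⁻¹ • b) = eucNorm b / (v ⬝ᵥ v) := by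
      rw [dotProduct_smul, smul_eq_mul]
      rw [dotProduct_self_eq] at hbb
      field_simp
      linarith
    rw [h3, abs_of_pos (div_pos hbe hvv), div_le_div_iff₀ he hvv]
    linarith

/-- The measure of the set of `g` for which both `F(vg)` and `F(wg)` lie in `J`. -/
theorem measure_pair_le {n : ℕ} (hn : 3 ≤ n) {σ : Fin n → ℝ} (hσ : ∀ i, |σ i| = 1) {d : ℕ}
    (hd : 2 ≤ d) (μ : Measure (SLR n)) [μ.IsHaarMeasure] {L : ℝ} (hL : 1 ≤ L) :
    ∃ C > (0 : ℝ), ∀ v w : Fin n → ℝ, ∀ r s : Fin n, v r * w s - v s * w r ≠ 0 →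
      ∀ J : Set ℝ, MeasurableSet J →
      μ {g | g ∈ KL n L ∧ Fs σ d (act v g) ∈ J ∧ Fs σ d (act w g) ∈ J}
      ≤ ENNReal.ofReal (C / (|v r * w s - v s * w r| * ‖v‖ ^ (d - 1) * ‖w‖ ^ (d - 1)))
        * volume J ^ 2 := by
  obtain ⟨C, hC, h⟩ := shear_density (by omega) hσ hd μ hL
  have hL' : 1 ≤ ((n : ℝ) + 1) * L := by nlinarith [(Nat.cast_nonneg n : (0 : ℝ) ≤ n)]
  obtain ⟨C', hC', h'⟩ := measure_single_le hn hσ hd μ hL'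
  have hn0 : (0 : ℝ) < n := by exact_mod_cast (by omega : 0 < n)
  refine ⟨C * C' * n, by positivity, fun v w r s hrs J hJ => ?_⟩
  obtain ⟨a, haa, hva, hsp, hlow⟩ := exists_unit_in_span hrs
  obtain ⟨z, hzz, hvz, hwz⟩ := exists_unit_perp hn v w
  have hv : v ≠ 0 := by
    rintro rfl
    simp at hrs
  have hw : w ≠ 0 := by
    rintro rfl
    simp at hrs
  have hvn : 0 < ‖v‖ := norm_pos_iff.2 hv
  have hwn : 0 < ‖w‖ := norm_pos_iff.2 hw
  have he := eucNorm_pos hv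
  have hz0 : 0 < |v r * w s - v s * w r| := abs_pos.2 hrs
  have hlow2 : |v r * w s - v s * w r| / (n * ‖v‖) ≤ |w ⬝ᵥ a| :=
    le_trans (by gcongr; exact eucNorm_le v) hlow
  have hwa0 : 0 < |w ⬝ᵥ a| := lt_of_lt_of_le (by positivity) hlow2
  have key := h v w a z haa hzz (hsp z hvz hwz) hva hvz hwz (abs_pos.1 hwa0)
    (Fs σ d ⁻¹' J) ((continuous_Fs σ d).measurable hJ) J hJ
  have key2 := h' v hv J hJ
  have e1 : {g | g ∈ KL n L ∧ Fs σ d (act v g) ∈ J ∧ Fs σ d (act w g) ∈ J}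
      = {g | g ∈ KL n L ∧ Fs σ d (act w g) ∈ J ∧ act v g ∈ Fs σ d ⁻¹' J} := by
    ext g
    simp only [Set.mem_ofPred_eq, Set.mem_preimage]
    tauto
  rw [e1]
  refine key.trans ?_
  calc _ ≤ ENNReal.ofReal (C / (|v r * w s - v s * w r| / (n * ‖v‖) * ‖w‖ ^ (d - 1))) * volume J *
        (ENNReal.ofReal (C' / ‖v‖ ^ d) * volume J) := by
        gcongr
        exact key2
    _ = (ENNReal.ofReal (C / (|v r * w s - v s * w r| / (n * ‖v‖) * ‖w‖ ^ (d - 1))) *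
        ENNReal.ofReal (C' / ‖v‖ ^ d)) * volume J ^ 2 := by ring
    _ = _ := by
        rw [← ENNReal.ofReal_mul (by positivity)]
        congr 2
        obtain ⟨k, rfl⟩ : ∃ k, d = k + 1 := ⟨d - 1, by omega⟩
        rw [Nat.add_sub_cancel]
        field_simp
        rw [pow_succ']

/-- If `v·f = 1` and `w·f = 0`, some `k` close to the identity moves `v` to `v + u` and
fixes `w`. -/
theorem exists_move {n : ℕ} (hn : 3 ≤ n) {v w u f : Fin n → ℝ} (hvf : v ⬝ᵥ f = 1)
    (hwf : w ⬝ᵥ f = 0) (hsmall : 10 * n ^ 4 * ‖f‖ * ‖u‖ ≤ 1) :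
    ∃ k : SLR n, act v k = v + u ∧ act w k = w ∧
      mnorm ((k⁻¹ : SLR n) - 1 : Matrix (Fin n) (Fin n) ℝ) ≤ 10 * n ^ 5 * ‖f‖ * ‖u‖ := by
  obtain ⟨z, hzz, hvz, hwz⟩ := exists_unit_perp hn v w
  have hn1 : (1 : ℝ) ≤ n := by exact_mod_cast (by omega : 1 ≤ n)
  set η : ℝ := n ^ 2 * ‖f‖ * ‖u‖ with hη
  have hη0 : 0 ≤ η := by positivity
  have hηs : 10 * n ^ 2 * η ≤ 1 := by rw [hη]; linarith
  have hn2 : (1 : ℝ) ≤ n ^ 2 := one_le_pow₀ hn1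
  have hη1 : 10 * η ≤ 1 := by nlinarith
  have huf : |u ⬝ᵥ f| ≤ η := by
    refine (abs_dotProduct_le u f).trans ?_
    rw [hη]
    have : (n : ℝ) ≤ n ^ 2 := by nlinarith
    calc (n : ℝ) * ‖u‖ * ‖f‖ ≤ n ^ 2 * ‖u‖ * ‖f‖ := by gcongr
      _ = _ := by ring
  have hD : 9 / 10 ≤ 1 + u ⬝ᵥ f := by linarith [(abs_le.1 huf).1]
  set m : ℝ := 1 / (1 + u ⬝ᵥ f) - 1 with hm
  have hm1 : |m| ≤ 2 * η := by
    have : m = -(u ⬝ᵥ f) / (1 + u ⬝ᵥ f) := by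
      rw [hm]; field_simp; ring
    rw [this, abs_div, abs_neg, abs_of_pos (by linarith : 0 < 1 + u ⬝ᵥ f),
      div_le_iff₀ (by linarith)]
    nlinarith
  set X : Matrix (Fin n) (Fin n) ℝ := m • vecMulVec z z with hX
  set Y : Matrix (Fin n) (Fin n) ℝ := vecMulVec f u with hY
  have hdet : ((1 + X) * (1 + Y)).det = 1 := by
    rw [det_mul, hX, hY, ← smul_vecMulVec, vecMulVec_eq (Fin 1), vecMulVec_eq (Fin 1),
      det_one_add_replicateCol_mul_replicateRow, det_one_add_replicateCol_mul_replicateRow,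
      dotProduct_smul, hzz, hm]
    simp only [smul_eq_mul, mul_one]
    field_simp
    ring
  let k : SLR n := ⟨(1 + X) * (1 + Y), hdet⟩
  have hact : ∀ x : Fin n → ℝ, x ⬝ᵥ z = 0 → act x k = x + (x ⬝ᵥ f) • u := by
    intro x hxz
    change x ᵥ* ((1 + X) * (1 + Y)) = _
    have hX1 : x ᵥ* (1 + X) = x := by
      rw [vecMul_add, vecMul_one, hX, vecMul_smul, vecMul_vecMulVec, hxz, zero_smul, smul_zero,
        add_zero]
    rw [← vecMul_vecMul, hX1, vecMul_add, vecMul_one, hY, vecMul_vecMulVec]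
  refine ⟨k, ?_, ?_, ?_⟩
  · rw [hact v hvz, hvf, one_smul]
  · rw [hact w hwz, hwf, zero_smul, add_zero]
  · have hXn : mnorm X ≤ 2 * n ^ 2 * η := by
      rw [hX, mnorm_smul]
      have h1 := mnorm_vecMulVec_le z z
      have h2 := norm_le_one_of_dotProduct_self hzz
      have h3 : (n : ℝ) ^ 2 * ‖z‖ * ‖z‖ ≤ n ^ 2 * 1 * 1 := by gcongr
      calc |m| * mnorm (vecMulVec z z) ≤ (2 * η) * (n ^ 2 * 1 * 1) := by
            gcongr
            · exact mnorm_nonneg _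
            · exact h1.trans h3
        _ = _ := by ring
    have hYn : mnorm Y ≤ η := mnorm_vecMulVec_le f u
    have hkm : mnorm ((k : Matrix (Fin n) (Fin n) ℝ) - 1) ≤ 5 * n ^ 2 * η := by
      have e : (k : Matrix (Fin n) (Fin n) ℝ) - 1 = X + Y + X * Y := by
        change (1 + X) * (1 + Y) - 1 = _
        noncomm_ring
      rw [e]
      calc _ ≤ mnorm X + mnorm Y + mnorm X * mnorm Y :=
            (mnorm_add_le _ _).trans (add_le_add (mnorm_add_le _ _) (mnorm_mul_le _ _))
        _ ≤ 2 * n ^ 2 * η + η + (2 * n ^ 2 * η) * η := by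
            gcongr
            exact mnorm_nonneg _
        _ ≤ _ := by nlinarith [mul_nonneg (by positivity : (0 : ℝ) ≤ n ^ 2) hη0]
    set K : Matrix (Fin n) (Fin n) ℝ := ((k⁻¹ : SLR n) : Matrix (Fin n) (Fin n) ℝ) with hK
    have hKk : K * (k : Matrix (Fin n) (Fin n) ℝ) = 1 := by
      have : ((k⁻¹ * k : SLR n) : Matrix (Fin n) (Fin n) ℝ) = 1 := by
        rw [inv_mul_cancel]; rfl
      exact this
    have eK : K - 1 = -(K * ((k : Matrix (Fin n) (Fin n) ℝ) - 1)) := by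
      rw [mul_sub, hKk, mul_one, neg_sub]
    have hK1 : mnorm (K - 1) ≤ mnorm K * (5 * n ^ 2 * η) := by
      rw [eK, mnorm_neg]
      refine (mnorm_mul_le _ _).trans ?_
      gcongr
      exact mnorm_nonneg _
    have hK2 : mnorm K ≤ 2 * n := by
      have h1 : mnorm K ≤ mnorm (K - 1) + n := by
        calc mnorm K = mnorm ((K - 1) + 1) := by rw [sub_add_cancel]
          _ ≤ _ := (mnorm_add_le _ _).trans (by rw [mnorm_one])
      nlinarith [mnorm_nonneg K]
    calc mnorm (K - 1) ≤ mnorm K * (5 * n ^ 2 * η) := hK1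
      _ ≤ (2 * n) * (5 * n ^ 2 * η) := by gcongr
      _ = _ := by rw [hη]; ring

/-- The set of `g` with `F(xg) ∈ J`. -/
def hit {n : ℕ} (σ : Fin n → ℝ) (d : ℕ) (J : Set ℝ) (x : Fin n → ℝ) : Set (SLR n) :=
  {g | Fs σ d (act x g) ∈ J}

theorem measurableSet_hit {n : ℕ} (σ : Fin n → ℝ) (d : ℕ) {J : Set ℝ} (hJ : MeasurableSet J)
    (x : Fin n → ℝ) : MeasurableSet (hit σ d J x) := measurable_Fs_act σ d x hJ

/-- The weight `max 0 (L - ‖g‖)`. -/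
def rho {n : ℕ} (L : ℝ) (g : SLR n) : ENNReal :=
  ENNReal.ofReal (L - mnorm (g : Matrix (Fin n) (Fin n) ℝ))

theorem measurable_rho {n : ℕ} (L : ℝ) : Measurable (rho (n := n) L) :=
  ENNReal.measurable_ofReal.comp
    (continuous_const.sub (continuous_mnorm.comp (SLR.continuous_coe n))).measurable

theorem rho_eq_zero {n : ℕ} {L : ℝ} {g : SLR n} (hg : g ∉ KL n L) : rho L g = 0 :=
  ENNReal.ofReal_of_nonpos (by
    have : ¬ mnorm (g : Matrix (Fin n) (Fin n) ℝ) ≤ L := hg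
    linarith)

theorem abs_mnorm_mul_sub_le {n : ℕ} (h g : SLR n) :
    |mnorm ((h * g : SLR n) : Matrix (Fin n) (Fin n) ℝ) - mnorm (g : Matrix (Fin n) (Fin n) ℝ)|
      ≤ mnorm ((h : Matrix (Fin n) (Fin n) ℝ) - 1) * mnorm (g : Matrix (Fin n) (Fin n) ℝ) := by
  have e : ((h * g : SLR n) : Matrix (Fin n) (Fin n) ℝ)
      = (g : Matrix (Fin n) (Fin n) ℝ) + ((h : Matrix (Fin n) (Fin n) ℝ) - 1) * g := by
    change (h : Matrix (Fin n) (Fin n) ℝ) * (g : Matrix (Fin n) (Fin n) ℝ) = _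
    noncomm_ring
  have h1 := mnorm_mul_le ((h : Matrix (Fin n) (Fin n) ℝ) - 1) (g : Matrix (Fin n) (Fin n) ℝ)
  rw [abs_sub_le_iff]
  constructor
  · rw [e]
    linarith [mnorm_add_le (g : Matrix (Fin n) (Fin n) ℝ)
      (((h : Matrix (Fin n) (Fin n) ℝ) - 1) * g)]
  · have e2 : (g : Matrix (Fin n) (Fin n) ℝ) = ((h * g : SLR n) : Matrix (Fin n) (Fin n) ℝ)
        + -(((h : Matrix (Fin n) (Fin n) ℝ) - 1) * g) := by rw [e]; abel
    have h2 := mnorm_add_le ((h * g : SLR n) : Matrix (Fin n) (Fin n) ℝ)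
      (-(((h : Matrix (Fin n) (Fin n) ℝ) - 1) * g))
    rw [← e2, mnorm_neg] at h2
    linarith

theorem rho_le_rho_mul {n : ℕ} (L : ℝ) (h g : SLR n) :
    rho L g ≤ rho L (h * g) + (KL n L).indicator
      (fun _ => ENNReal.ofReal (mnorm ((h : Matrix (Fin n) (Fin n) ℝ) - 1) * L)) g := by
  by_cases hg : g ∈ KL n L
  · rw [Set.indicator_of_mem hg, rho, rho]
    refine (ENNReal.ofReal_le_ofReal ?_).trans ENNReal.ofReal_add_le
    have h1 := (abs_le.1 (abs_mnorm_mul_sub_le h g)).1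
    have h2 : mnorm ((h : Matrix (Fin n) (Fin n) ℝ) - 1) * mnorm (g : Matrix (Fin n) (Fin n) ℝ)
        ≤ mnorm ((h : Matrix (Fin n) (Fin n) ℝ) - 1) * L :=
      mul_le_mul_of_nonneg_left hg (mnorm_nonneg _)
    have h3 := (abs_le.1 (abs_mnorm_mul_sub_le h g)).2
    linarith
  · rw [rho_eq_zero hg]
    exact zero_le

theorem setLIntegral_le_translate {n : ℕ} (μ : Measure (SLR n)) [μ.IsHaarMeasure]
    {ψ : SLR n → ENNReal} (hψm : Measurable ψ) {K A : Set (SLR n)} (hK : MeasurableSet K)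
    (hA : MeasurableSet A) {δ : ENNReal} (k : SLR n)
    (hψ : ∀ g, ψ g ≤ ψ (k⁻¹ * g) + K.indicator (fun _ => δ) g) :
    ∫⁻ g in A, ψ g ∂μ ≤ ∫⁻ g in {g | k * g ∈ A}, ψ g ∂μ + δ * μ (K ∩ A) := by
  have hA' : MeasurableSet {g | k * g ∈ A} := (measurable_const_mul k) hA
  calc ∫⁻ g in A, ψ g ∂μ ≤ ∫⁻ g in A, (ψ (k⁻¹ * g) + K.indicator (fun _ => δ) g) ∂μ :=
        lintegral_mono fun g => hψ g
    _ = ∫⁻ g in A, ψ (k⁻¹ * g) ∂μ + ∫⁻ g in A, K.indicator (fun _ => δ) g ∂μ :=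
        lintegral_add_left (hψm.comp (measurable_const_mul _)) _
    _ = ∫⁻ g in {g | k * g ∈ A}, ψ g ∂μ + δ * μ (K ∩ A) := by
        congr 1
        · rw [← lintegral_indicator hA, ← lintegral_indicator hA',
            ← lintegral_mul_left_eq_self _ k]
          refine lintegral_congr fun g => ?_
          by_cases h : k * g ∈ A
          · rw [Set.indicator_of_mem h, Set.indicator_of_mem (s := {g | k * g ∈ A}) h]
            simp
          · rw [Set.indicator_of_notMem h, Set.indicator_of_notMem (s := {g | k * g ∈ A}) h]
        · rw [lintegral_indicator_const hK, Measure.restrict_apply hK]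

theorem hit_translate {n : ℕ} (σ : Fin n → ℝ) (d : ℕ) (J : Set ℝ) (x : Fin n → ℝ) (k : SLR n) :
    {g | k * g ∈ hit σ d J x} = hit σ d J (act x k) := by
  ext g
  change Fs σ d (act x (k * g)) ∈ J ↔ Fs σ d (act (act x k) g) ∈ J
  rw [act_mul]

/-- Moving one vector of a pair. -/
theorem setLIntegral_rho_move {n : ℕ} (hn : 3 ≤ n) (σ : Fin n → ℝ) (d : ℕ) (μ : Measure (SLR n))
    [μ.IsHaarMeasure] {L : ℝ} (hL : 0 ≤ L) {v w u f : Fin n → ℝ} (hvf : v ⬝ᵥ f = 1)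
    (hwf : w ⬝ᵥ f = 0) (hsmall : 10 * n ^ 4 * ‖f‖ * ‖u‖ ≤ 1) {J : Set ℝ} (hJ : MeasurableSet J) :
    ∫⁻ g in hit σ d J v ∩ hit σ d J w, rho L g ∂μ
      ≤ ∫⁻ g in hit σ d J (v + u) ∩ hit σ d J w, rho L g ∂μ
        + ENNReal.ofReal (10 * n ^ 5 * ‖f‖ * ‖u‖ * L) *
          μ {g | g ∈ KL n L ∧ Fs σ d (act v g) ∈ J ∧ Fs σ d (act w g) ∈ J} := by
  obtain ⟨k, hkv, hkw, hk⟩ := exists_move hn hvf hwf hsmall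
  have h1 := setLIntegral_le_translate μ (measurable_rho L) (measurableSet_KL n L)
    ((measurableSet_hit σ d hJ v).inter (measurableSet_hit σ d hJ w)) k
    (fun g => rho_le_rho_mul L k⁻¹ g)
  have e : {g | k * g ∈ hit σ d J v ∩ hit σ d J w} = hit σ d J (v + u) ∩ hit σ d J w := by
    have h2 := hit_translate σ d J v k
    have h3 := hit_translate σ d J w k
    rw [hkv] at h2
    rw [hkw] at h3
    change {g | k * g ∈ hit σ d J v} ∩ {g | k * g ∈ hit σ d J w} = _
    rw [h2, h3]
  rw [e] at h1
  refine h1.trans ?_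
  gcongr
  exact le_rfl

theorem exists_dual {n : ℕ} {v w : Fin n → ℝ} {r s : Fin n} {D t : ℝ} (hD : 0 < D)
    (hrs : D ≤ |v r * w s - v s * w r|) (hw : ‖w‖ ≤ t) :
    ∃ f : Fin n → ℝ, v ⬝ᵥ f = 1 ∧ w ⬝ᵥ f = 0 ∧ ‖f‖ ≤ 2 * t / D := by
  set z := v r * w s - v s * w r with hz
  have hz0 : z ≠ 0 := by
    intro h
    rw [h, abs_zero] at hrs
    linarith
  refine ⟨(w s / z) • Pi.single r 1 - (w r / z) • Pi.single s 1, ?_, ?_, ?_⟩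
  · rw [dotProduct_sub, dotProduct_smul, dotProduct_smul, dotProduct_single_one,
      dotProduct_single_one, smul_eq_mul, smul_eq_mul]
    field_simp
    rw [hz]; ring
  · rw [dotProduct_sub, dotProduct_smul, dotProduct_smul, dotProduct_single_one,
      dotProduct_single_one, smul_eq_mul, smul_eq_mul]
    ring
  · refine (norm_sub_le _ _).trans ?_
    rw [norm_smul, norm_smul, norm_single_one, norm_single_one, mul_one, mul_one]
    have h : ∀ i, ‖w i / z‖ ≤ t / D := fun i => by
      rw [norm_div]
      exact div_le_div₀ ((norm_nonneg _).trans hw) ((norm_le_pi_norm w i).trans hw) hD hrs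
    calc _ ≤ t / D + t / D := add_le_add (h s) (h r)
      _ = _ := by ring

/-- Regularity of the pair correlation for pairs that are far from parallel. -/
theorem pair_regularity {n : ℕ} (hn : 3 ≤ n) {σ : Fin n → ℝ} (hσ : ∀ i, |σ i| = 1) {d : ℕ}
    (hd : 2 ≤ d) (μ : Measure (SLR n)) [μ.IsHaarMeasure] {L : ℝ} (hL : 1 ≤ L) :
    ∃ C > (0 : ℝ), ∀ t S D : ℝ, 2 ≤ S → S ≤ t → 80 * n ^ 4 * t ≤ D →
      ∀ v w u u' : Fin n → ℝ, S ≤ ‖v‖ → ‖v‖ ≤ t → S ≤ ‖w‖ → ‖w‖ ≤ t → ‖u‖ ≤ 1 → ‖u'‖ ≤ 1 →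
      ∀ r s : Fin n, D ≤ |v r * w s - v s * w r| → ∀ J : Set ℝ, MeasurableSet J →
      ∫⁻ g in hit σ d J v ∩ hit σ d J w, rho L g ∂μ
      ≤ ∫⁻ g in hit σ d J (v + u) ∩ hit σ d J (w + u'), rho L g ∂μ
        + ENNReal.ofReal (C * t / (D ^ 2 * S ^ (2 * d - 2))) * volume J ^ 2 := by
  obtain ⟨C, hC, hpair⟩ := measure_pair_le hn hσ hd μ hL
  have hn1 : (1 : ℝ) ≤ n := by exact_mod_cast (by omega : 1 ≤ n)
  refine ⟨2 * (80 * n ^ 5 * L * (C * 2 ^ d)), by positivity, ?_⟩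
  intro t S D hS hSt hD v w u u' hSv hvt hSw hwt hu hu' r s hrs J hJ
  have ht : 2 ≤ t := hS.trans hSt
  have hn4 : (1 : ℝ) ≤ n ^ 4 := one_le_pow₀ hn1
  have hD0 : 0 < D := by nlinarith
  have hDt : 8 * t ≤ D := by nlinarith
  -- a generic step moving the first vector
  have step : ∀ v w u : Fin n → ℝ, S / 2 ≤ ‖v‖ → S / 2 ≤ ‖w‖ → ‖w‖ ≤ 2 * t → ‖u‖ ≤ 1 →
      D / 2 ≤ |v r * w s - v s * w r| → (S ≤ ‖v‖ ∨ S ≤ ‖w‖) →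
      ∫⁻ g in hit σ d J v ∩ hit σ d J w, rho L g ∂μ
      ≤ ∫⁻ g in hit σ d J (v + u) ∩ hit σ d J w, rho L g ∂μ
        + ENNReal.ofReal (80 * n ^ 5 * L * (C * 2 ^ d) * t / (D ^ 2 * S ^ (2 * d - 2)))
          * volume J ^ 2 := by
    intro v w u hSv hSw hwt hu hrs hor
    have hD2 : 0 < D / 2 := by positivity
    have hrs0 : v r * w s - v s * w r ≠ 0 := abs_pos.1 (lt_of_lt_of_le hD2 hrs)
    obtain ⟨f, hvf, hwf, hf⟩ := exists_dual hD2 hrs hwt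
    have hf' : ‖f‖ ≤ 8 * t / D := by
      refine hf.trans (le_of_eq ?_)
      field_simp
      ring
    have hfu : ‖f‖ * ‖u‖ ≤ 8 * t / D := by
      calc ‖f‖ * ‖u‖ ≤ (8 * t / D) * 1 := by gcongr
        _ = _ := mul_one _
    have hsmall : 10 * n ^ 4 * ‖f‖ * ‖u‖ ≤ 1 := by
      rw [mul_assoc]
      calc 10 * (n : ℝ) ^ 4 * (‖f‖ * ‖u‖) ≤ 10 * n ^ 4 * (8 * t / D) := by gcongr
        _ = 80 * n ^ 4 * t / D := by ring
        _ ≤ 1 := (div_le_one hD0).2 hD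
    refine (setLIntegral_rho_move hn σ d μ (by linarith) hvf hwf hsmall hJ).trans ?_
    refine add_le_add le_rfl ?_
    calc _ ≤ ENNReal.ofReal (80 * n ^ 5 * t / D * L) *
          (ENNReal.ofReal (C / (D / 2 * (S ^ (2 * d - 2) / 2 ^ (d - 1)))) * volume J ^ 2) := by
          gcongr
          · rw [mul_assoc (10 * (n : ℝ) ^ 5)]
            calc 10 * (n : ℝ) ^ 5 * (‖f‖ * ‖u‖) ≤ 10 * n ^ 5 * (8 * t / D) := by gcongr
              _ = _ := by ring
          · refine (hpair v w r s hrs0 J hJ).trans ?_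
            have hprod : S ^ (2 * d - 2) / 2 ^ (d - 1) ≤ ‖v‖ ^ (d - 1) * ‖w‖ ^ (d - 1) := by
              have e : S ^ (2 * d - 2) / 2 ^ (d - 1) = (S * (S / 2)) ^ (d - 1) := by
                rw [show 2 * d - 2 = (d - 1) + (d - 1) by omega, pow_add, mul_pow, div_pow]
                ring
              rw [e, ← mul_pow]
              refine pow_le_pow_left₀ (by positivity) ?_ _
              rcases hor with h | h
              · exact mul_le_mul h hSw (by linarith) (by linarith)
              · rw [mul_comm]
                exact mul_le_mul hSv h (by linarith) (by linarith)
            rw [mul_assoc |v r * w s - v s * w r|]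
            gcongr
      _ = _ := by
          rw [← mul_assoc, ← ENNReal.ofReal_mul (by positivity)]
          congr 2
          obtain ⟨e, rfl⟩ : ∃ e, d = e + 1 := ⟨d - 1, by omega⟩
          rw [Nat.add_sub_cancel]
          field_simp
          ring
  have h1 := step v w u (by linarith) (by linarith) (by linarith) hu (by linarith) (Or.inl hSv)
  have hvu : S / 2 ≤ ‖v + u‖ := by
    have := norm_sub_norm_le v (-u)
    rw [norm_neg, sub_neg_eq_add] at this
    linarith
  have hvu2 : ‖v + u‖ ≤ 2 * t := (norm_add_le _ _).trans (by linarith)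
  have hrs2 : D / 2 ≤ |w r * (v + u) s - w s * (v + u) r| := by
    have e : w r * (v + u) s - w s * (v + u) r
        = -((v r * w s - v s * w r) - (w r * u s - w s * u r)) := by
      simp only [Pi.add_apply]; ring
    rw [e, abs_neg]
    have h2 := abs_sub_abs_le_abs_sub (v r * w s - v s * w r) (w r * u s - w s * u r)
    have h3 : |w r * u s - w s * u r| ≤ 2 * t := by
      refine (abs_sub _ _).trans ?_
      rw [abs_mul, abs_mul]
      have hw' : ∀ i, |w i| ≤ t := fun i => (norm_le_pi_norm w i).trans hwt
      have hu'' : ∀ i, |u i| ≤ 1 := fun i => (norm_le_pi_norm u i).trans hu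
      have h4 : |w r| * |u s| ≤ t * 1 := mul_le_mul (hw' r) (hu'' s) (abs_nonneg _) (by linarith)
      have h5 : |w s| * |u r| ≤ t * 1 := mul_le_mul (hw' s) (hu'' r) (abs_nonneg _) (by linarith)
      linarith
    linarith
  have h2 := step w (v + u) u' (by linarith) hvu hvu2 hu' hrs2 (Or.inl hSw)
  rw [Set.inter_comm (hit σ d J w), Set.inter_comm (hit σ d J (w + u'))] at h2
  refine (h1.trans (add_le_add_left h2 _)).trans (le_of_eq ?_)
  rw [add_assoc, ← add_mul, ← ENNReal.ofReal_add (by positivity) (by positivity)]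
  congr 3
  ring

/-- Regularity of the single-vector averages for a general weight. -/
theorem single_regularity {n : ℕ} (hn : 3 ≤ n) {σ : Fin n → ℝ} (hσ : ∀ i, |σ i| = 1) {d : ℕ}
    (hd : 2 ≤ d) (μ : Measure (SLR n)) [μ.IsHaarMeasure] {L : ℝ} (hL : 1 ≤ L)
    {ψ : SLR n → ENNReal} (hψm : Measurable ψ) {κ B : ℝ} (hκ : 0 < κ) (hB : 0 < B)
    (hψ : ∀ h : SLR n, mnorm ((h : Matrix (Fin n) (Fin n) ℝ) - 1) ≤ κ → ∀ g, ψ g ≤ ψ (h * g)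
      + (KL n L).indicator
        (fun _ => ENNReal.ofReal (B * mnorm ((h : Matrix (Fin n) (Fin n) ℝ) - 1))) g) :
    ∃ C > (0 : ℝ), ∃ S₀ > (0 : ℝ), ∀ v u : Fin n → ℝ, S₀ ≤ ‖v‖ → ‖u‖ ≤ 1 →
      ∀ J : Set ℝ, MeasurableSet J →
      ∫⁻ g in hit σ d J v, ψ g ∂μ ≤ ∫⁻ g in hit σ d J (v + u), ψ g ∂μ
        + ENNReal.ofReal (C / ‖v‖ ^ (d + 1)) * volume J := by
  obtain ⟨C, hC, hsing⟩ := measure_single_le hn hσ hd μ hL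
  have hn1 : (1 : ℝ) ≤ n := by exact_mod_cast (by omega : 1 ≤ n)
  refine ⟨B * (10 * n ^ 5) * C, by positivity, 10 * n ^ 4 + 10 * n ^ 5 / κ, by positivity, ?_⟩
  intro v u hv hu J hJ
  have hv0 : 0 < ‖v‖ := lt_of_lt_of_le (by positivity) hv
  have hvne : v ≠ 0 := norm_pos_iff.1 hv0
  obtain ⟨i, hi⟩ := exists_abs_eq_norm (by omega) v
  have hvi : v i ≠ 0 := by
    rw [← abs_pos, hi]; exact hv0
  set f : Fin n → ℝ := (v i)⁻¹ • Pi.single i 1 with hf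
  have hvf : v ⬝ᵥ f = 1 := by
    rw [hf, dotProduct_smul, dotProduct_single_one, smul_eq_mul, inv_mul_cancel₀ hvi]
  have hfn : ‖f‖ = 1 / ‖v‖ := by
    rw [hf, norm_smul, norm_single_one, mul_one, norm_inv, Real.norm_eq_abs, hi, one_div]
  have hfu : ‖f‖ * ‖u‖ ≤ 1 / ‖v‖ := by
    rw [hfn]
    calc 1 / ‖v‖ * ‖u‖ ≤ 1 / ‖v‖ * 1 := by gcongr
      _ = _ := mul_one _
  have hsmall : 10 * n ^ 4 * ‖f‖ * ‖u‖ ≤ 1 := by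
    rw [mul_assoc]
    calc 10 * (n : ℝ) ^ 4 * (‖f‖ * ‖u‖) ≤ 10 * n ^ 4 * (1 / ‖v‖) := by gcongr
      _ = 10 * n ^ 4 / ‖v‖ := by ring
      _ ≤ 1 := by
          rw [div_le_one hv0]
          have : 0 ≤ 10 * (n : ℝ) ^ 5 / κ := by positivity
          linarith
  obtain ⟨k, hkv, -, hk⟩ := exists_move hn hvf (zero_dotProduct f) hsmall
  have hk' : mnorm ((k⁻¹ : SLR n) - 1 : Matrix (Fin n) (Fin n) ℝ) ≤ 10 * n ^ 5 / ‖v‖ := by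
    refine hk.trans ?_
    rw [mul_assoc]
    calc 10 * (n : ℝ) ^ 5 * (‖f‖ * ‖u‖) ≤ 10 * n ^ 5 * (1 / ‖v‖) := by gcongr
      _ = _ := by ring
  have hkκ : mnorm ((k⁻¹ : SLR n) - 1 : Matrix (Fin n) (Fin n) ℝ) ≤ κ := by
    refine hk'.trans ?_
    rw [div_le_iff₀ hv0]
    have h1 : 10 * (n : ℝ) ^ 5 / κ ≤ ‖v‖ := by
      have : 0 ≤ 10 * (n : ℝ) ^ 4 := by positivity
      linarith
    rw [div_le_iff₀ hκ] at h1
    linarith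
  have h1 := setLIntegral_le_translate μ hψm (measurableSet_KL n L)
    (measurableSet_hit σ d hJ v) k (hψ k⁻¹ hkκ)
  rw [hit_translate, hkv] at h1
  refine h1.trans ?_
  refine add_le_add le_rfl ?_
  calc _ ≤ ENNReal.ofReal (B * (10 * n ^ 5 / ‖v‖)) *
        (ENNReal.ofReal (C / ‖v‖ ^ d) * volume J) := by
        gcongr
        exact hsing v hvne J hJ
    _ = _ := by
        rw [← mul_assoc, ← ENNReal.ofReal_mul (by positivity)]
        congr 2
        field_simp
        ring

theorem card_filter_modEq_le (N : ℕ) (v : ℤ) {r : ℤ} (hr : 0 < r) :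
    ((Finset.Icc (-N : ℤ) N).filter (fun x => x ≡ v [ZMOD r])).card ≤ (2 * N + 1 : ℝ) / r + 1 := by
  have e : Finset.Icc (-N : ℤ) N = Finset.Ioc (-N - 1 : ℤ) N := by
    ext x
    simp only [Finset.mem_Icc, Finset.mem_Ioc]
    omega
  have h := Int.Ioc_filter_modEq_card (-N - 1 : ℤ) N hr v
  rw [← e] at h
  have h1 : (((Finset.Icc (-N : ℤ) N).filter (fun x => x ≡ v [ZMOD r])).card : ℝ)
      = ((max (⌊((N : ℤ) - v : ℚ) / r⌋ - ⌊((-N - 1 : ℤ) - v : ℚ) / r⌋) 0 : ℤ) : ℝ) := by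
    rw [← h]; norm_cast
  rw [h1]
  have hr' : (0 : ℚ) < r := by exact_mod_cast hr
  have h2 : ((max (⌊((N : ℤ) - v : ℚ) / r⌋ - ⌊((-N - 1 : ℤ) - v : ℚ) / r⌋) 0 : ℤ) : ℚ)
      ≤ (2 * N + 1 : ℚ) / r + 1 := by
    rw [Int.cast_max, Int.cast_sub]
    refine max_le ?_ (by push_cast; positivity)
    have h3 := Int.floor_le (((N : ℤ) - v : ℚ) / r)
    have h4 := Int.lt_floor_add_one (((-N - 1 : ℤ) - v : ℚ) / r)
    have h5 : ((N : ℤ) - v : ℚ) / r - ((-N - 1 : ℤ) - v : ℚ) / r = (2 * N + 1 : ℚ) / r := by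
      push_cast; field_simp; ring
    linarith
  exact_mod_cast h2

/-- The number of solutions of `a e - b c = z` in a box. -/
theorem card_fibre_le (N : ℕ) {a : ℤ} (ha : a ≠ 0) (b z : ℤ) :
    (((Finset.Icc (-N : ℤ) N ×ˢ Finset.Icc (-N : ℤ) N).filter
      (fun y => a * y.2 - b * y.1 = z)).card : ℝ)
      ≤ (2 * N + 1 : ℝ) * Int.gcd a b / |(a : ℝ)| + 1 := by
  set A := (Finset.Icc (-N : ℤ) N ×ˢ Finset.Icc (-N : ℤ) N).filter
    (fun y => a * y.2 - b * y.1 = z) with hA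
  rcases A.eq_empty_or_nonempty with h | ⟨⟨c0, e0⟩, h0⟩
  · rw [h]; simp; positivity
  have hg : 0 < Int.gcd a b := Int.gcd_pos_of_ne_zero_left _ ha
  set γ := Int.gcd a b with hγ
  obtain ⟨a', ha'⟩ : (γ : ℤ) ∣ a := Int.gcd_dvd_left _ _
  obtain ⟨b', hb'⟩ : (γ : ℤ) ∣ b := Int.gcd_dvd_right _ _
  have hγ0 : (γ : ℤ) ≠ 0 := by exact_mod_cast hg.ne'
  have ha0 : a' ≠ 0 := by rintro rfl; simp at ha'; exact ha ha'
  have hcop : IsCoprime a' b' := by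
    rw [Int.isCoprime_iff_gcd_eq_one]
    have := Int.gcd_div_gcd_div_gcd hg
    rw [← hγ] at this
    rwa [ha', hb', Int.mul_ediv_cancel_left _ hγ0, Int.mul_ediv_cancel_left _ hγ0] at this
  rw [hA, Finset.mem_filter] at h0
  have hinj : A.card ≤ ((Finset.Icc (-N : ℤ) N).filter (fun x => x ≡ c0 [ZMOD |a'|])).card := by
    refine Finset.card_le_card_of_injOn Prod.fst ?_ ?_
    · rintro ⟨c, e⟩ hy
      rw [Finset.mem_coe, hA, Finset.mem_filter, Finset.mem_product] at hy
      simp only [Finset.coe_filter, Set.mem_ofPred_eq]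
      refine ⟨hy.1.1, ?_⟩
      refine (Int.modEq_iff_dvd.2 ?_)
      rw [abs_dvd]
      refine hcop.dvd_of_dvd_mul_left (y := b') ?_ 
      refine ⟨e0 - e, ?_⟩
      have h1 : a * e - b * c = a * e0 - b * c0 := hy.2.trans h0.2.symm
      rw [ha', hb'] at h1
      refine mul_left_cancel₀ hγ0 ?_
      linear_combination h1
    · rintro ⟨c, e⟩ hy ⟨c', e'⟩ hy' hcc
      rw [Finset.mem_coe, hA, Finset.mem_filter] at hy hy'
      simp only at hcc
      subst hcc
      have h1 : a * e = a * e' := by linear_combination hy.2 - hy'.2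
      rw [mul_left_cancel₀ ha h1]
  calc (A.card : ℝ) ≤ ((Finset.Icc (-N : ℤ) N).filter (fun x => x ≡ c0 [ZMOD |a'|])).card := by
        exact_mod_cast hinj
    _ ≤ (2 * N + 1 : ℝ) / (|a'| : ℤ) + 1 := card_filter_modEq_le N c0 (abs_pos.2 ha0)
    _ = _ := by
        have hγr : (0 : ℝ) < γ := by exact_mod_cast hg
        have ha0r : (0 : ℝ) < |(a' : ℝ)| := by rw [abs_pos]; exact_mod_cast ha0
        rw [Int.cast_abs, ha', Int.cast_mul, abs_mul, Int.cast_natCast, abs_of_pos hγr]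
        field_simp

/-- The harmonic sum. -/
def hsum (N : ℕ) : ℝ := ∑ k ∈ Finset.Icc 1 N, (1 : ℝ) / k

theorem hsum_nonneg (N : ℕ) : 0 ≤ hsum N := Finset.sum_nonneg fun k _ => by positivity

theorem hsum_mono {N M : ℕ} (h : N ≤ M) : hsum N ≤ hsum M :=
  Finset.sum_le_sum_of_subset_of_nonneg (Finset.Icc_subset_Icc le_rfl h)
    fun k _ _ => by positivity

theorem one_le_hsum {N : ℕ} (h : 1 ≤ N) : 1 ≤ hsum N := by
  refine le_trans ?_ (hsum_mono h)
  simp [hsum]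

theorem hsum_le (N : ℕ) : hsum N ≤ 1 + Real.log N := by
  have h := harmonic_le_one_add_log N
  rw [harmonic_eq_sum_Icc] at h
  refine le_trans (le_of_eq ?_) h
  rw [hsum]
  push_cast
  exact Finset.sum_congr rfl fun k _ => one_div _

/-- Sum of an even function of a nonzero integer. -/
theorem sum_Icc_neg (N : ℕ) (f : ℕ → ℝ) :
    ∑ k ∈ Finset.Icc (-N : ℤ) N, f k.natAbs = f 0 + 2 * ∑ k ∈ Finset.Icc 1 N, f k := by
  induction N with
  | zero => simp
  | succ N ih =>
    have e : Finset.Icc (-(N + 1 : ℕ) : ℤ) (N + 1 : ℕ)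
        = insert (-(N + 1 : ℕ) : ℤ) (insert ((N + 1 : ℕ) : ℤ) (Finset.Icc (-N : ℤ) N)) := by
      ext x
      simp only [Finset.mem_insert, Finset.mem_Icc]
      push_cast
      omega
    rw [e, Finset.sum_insert, Finset.sum_insert, ih, Finset.sum_Icc_succ_top (by omega),
      Int.natAbs_neg, Int.natAbs_natCast]
    · ring
    · simp only [Finset.mem_Icc]; push_cast; omega
    · simp only [Finset.mem_insert, Finset.mem_Icc]; push_cast; omega

theorem sum_fibre_le (N : ℕ) {a : ℤ} {S : ℝ} (hS : 0 < S) (ha : S ≤ |(a : ℝ)|) (b : ℤ)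
    (hab : |a| ≤ N) (hb : |b| ≤ N) :
    ∑ y ∈ Finset.Icc (-N : ℤ) N ×ˢ Finset.Icc (-N : ℤ) N,
      (if a * y.2 - b * y.1 = 0 then (0 : ℝ) else 1 / |((a * y.2 - b * y.1 : ℤ) : ℝ)|)
      ≤ 2 * ((2 * N + 1) / S + 1) * hsum (2 * N ^ 2) := by
  have ha0 : a ≠ 0 := by
    rintro rfl
    simp at ha; linarith
  set γ := Int.gcd a b with hγ
  have hg : 0 < γ := Int.gcd_pos_of_ne_zero_left _ ha0
  have hγr : (1 : ℝ) ≤ γ := by exact_mod_cast hg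
  obtain ⟨a', ha'⟩ : (γ : ℤ) ∣ a := Int.gcd_dvd_left _ _
  obtain ⟨b', hb'⟩ : (γ : ℤ) ∣ b := Int.gcd_dvd_right _ _
  have hγ0 : (γ : ℤ) ≠ 0 := by exact_mod_cast hg.ne'
  set κ : ℤ × ℤ → ℤ := fun y => a' * y.2 - b' * y.1 with hκ
  have hz : ∀ y : ℤ × ℤ, a * y.2 - b * y.1 = γ * κ y := fun y => by
    rw [hκ, ha', hb']; ring
  set f : ℕ → ℝ := fun k => if k = 0 then 0 else 1 / (γ * k) with hf
  have hfz : ∀ y : ℤ × ℤ,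
      (if a * y.2 - b * y.1 = 0 then (0 : ℝ) else 1 / |((a * y.2 - b * y.1 : ℤ) : ℝ)|)
        = f (κ y).natAbs := fun y => by
    rw [hz, hf]
    by_cases h : κ y = 0
    · simp [h]
    · simp only [mul_eq_zero, hγ0, h, or_self, if_false, Int.natAbs_eq_zero]
      rw [Int.cast_mul, abs_mul, Int.cast_natCast, abs_of_pos (by linarith : (0 : ℝ) < γ),
        Nat.cast_natAbs, Int.cast_abs]
  have hmaps : ∀ y ∈ Finset.Icc (-N : ℤ) N ×ˢ Finset.Icc (-N : ℤ) N,
      κ y ∈ Finset.Icc (-(2 * N ^ 2 : ℕ) : ℤ) (2 * N ^ 2 : ℕ) := by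
    intro y hy
    rw [Finset.mem_product, Finset.mem_Icc, Finset.mem_Icc, ← abs_le, ← abs_le] at hy
    rw [Finset.mem_Icc, ← abs_le]
    have h1 : |(γ : ℤ) * κ y| ≤ (2 * N ^ 2 : ℕ) := by
      rw [← hz]
      refine (abs_sub _ _).trans ?_
      rw [abs_mul, abs_mul]
      have h2 : |a| * |y.2| ≤ N * N := mul_le_mul hab hy.2 (abs_nonneg _) (by positivity)
      have h3 : |b| * |y.1| ≤ N * N := mul_le_mul hb hy.1 (abs_nonneg _) (by positivity)
      push_cast
      nlinarith
    refine le_trans ?_ h1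
    rw [abs_mul, Nat.abs_cast]
    exact le_mul_of_one_le_left (abs_nonneg _) (by exact_mod_cast hg)
  rw [← Finset.sum_fiberwise_of_maps_to hmaps (fun y => (if a * y.2 - b * y.1 = 0 then (0 : ℝ)
    else 1 / |((a * y.2 - b * y.1 : ℤ) : ℝ)|))]
  have hcard : ∀ k : ℤ, (((Finset.Icc (-N : ℤ) N ×ˢ Finset.Icc (-N : ℤ) N).filter
      (fun y => κ y = k)).card : ℝ) ≤ (2 * N + 1 : ℝ) * γ / S + 1 := by
    intro k
    have h1 := card_fibre_le N ha0 b (γ * k)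
    simp only [hz] at h1
    have h2 : ∀ y : ℤ × ℤ, ((γ : ℤ) * κ y = γ * k) = (κ y = k) := fun y => by
      rw [mul_right_inj' hγ0]
    simp only [h2] at h1
    refine h1.trans ?_
    gcongr
  calc _ ≤ ∑ k ∈ Finset.Icc (-(2 * N ^ 2 : ℕ) : ℤ) (2 * N ^ 2 : ℕ),
        ((2 * N + 1 : ℝ) * γ / S + 1) * f k.natAbs := by
        refine Finset.sum_le_sum fun k _ => ?_
        have h1 : ∀ y ∈ (Finset.Icc (-N : ℤ) N ×ˢ Finset.Icc (-N : ℤ) N).filter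
            (fun y => κ y = k),
            (if a * y.2 - b * y.1 = 0 then 0 else (1 : ℝ) / |((a * y.2 - b * y.1 : ℤ) : ℝ)|)
              = f k.natAbs := fun y hy => by
          rw [hfz, (Finset.mem_filter.1 hy).2]
        refine (Finset.sum_congr rfl h1).le.trans ?_
        rw [Finset.sum_const, nsmul_eq_mul]
        refine mul_le_mul_of_nonneg_right (hcard k) ?_
        rw [hf]
        dsimp only
        split_ifs
        · exact le_rfl
        · positivity
    _ = ((2 * N + 1 : ℝ) * γ / S + 1) * (2 * (1 / γ * hsum (2 * N ^ 2))) := by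
        rw [← Finset.mul_sum, sum_Icc_neg]
        congr 1
        have h1 : ∑ k ∈ Finset.Icc 1 (2 * N ^ 2), f k = 1 / γ * hsum (2 * N ^ 2) := by
          rw [hsum, Finset.mul_sum]
          refine Finset.sum_congr rfl fun k hk => ?_
          rw [hf]
          dsimp only
          rw [if_neg (by have := (Finset.mem_Icc.1 hk).1; omega)]
          field_simp
        rw [h1, hf]
        simp only [if_true, zero_add]
    _ ≤ _ := by
        have h0 := hsum_nonneg (2 * N ^ 2)
        have h1 : ((2 * N + 1 : ℝ) * γ / S + 1) * (1 / γ) ≤ (2 * N + 1) / S + 1 := by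
          rw [add_mul]
          refine add_le_add (le_of_eq ?_) ?_
          · field_simp
          · rw [one_mul, div_le_one (by linarith)]
            exact hγr
        calc _ = 2 * (((2 * N + 1 : ℝ) * γ / S + 1) * (1 / γ)) * hsum (2 * N ^ 2) := by ring
          _ ≤ _ := by gcongr

theorem sum_gcd_le (N : ℕ) :
    ∑ y ∈ Finset.Icc (-N : ℤ) N ×ˢ Finset.Icc (-N : ℤ) N,
      (if y.1 = 0 then 0 else (Int.gcd y.1 y.2 : ℝ)) ≤ 16 * N ^ 2 * hsum N := by
  set Q := Finset.Icc (-N : ℤ) N with hQ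
  have h1 : ∀ y ∈ Q ×ˢ Q, (if y.1 = 0 then 0 else (Int.gcd y.1 y.2 : ℝ))
      ≤ ∑ g ∈ Finset.Icc 1 N, (g : ℝ) * ((if y.1 ≡ 0 [ZMOD g] then 1 else 0)
        * (if y.2 ≡ 0 [ZMOD g] then 1 else 0)) := by
    intro y hy
    split_ifs with h
    · exact Finset.sum_nonneg fun g _ => by positivity
    · have hg : 0 < Int.gcd y.1 y.2 := Int.gcd_pos_of_ne_zero_left _ h
      have hgN : Int.gcd y.1 y.2 ≤ N := by
        have h2 : Int.gcd y.1 y.2 ≤ y.1.natAbs := Int.gcd_le_natAbs_left _ h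
        rw [Finset.mem_product, hQ, Finset.mem_Icc] at hy
        omega
      refine le_trans (le_of_eq ?_) (Finset.single_le_sum (f := fun g : ℕ => (g : ℝ) *
        ((if y.1 ≡ 0 [ZMOD g] then 1 else 0) * (if y.2 ≡ 0 [ZMOD g] then 1 else 0)))
        (fun g _ => by positivity) (Finset.mem_Icc.2 ⟨hg, hgN⟩))
      rw [if_pos (Int.modEq_zero_iff_dvd.2 (Int.gcd_dvd_left _ _)),
        if_pos (Int.modEq_zero_iff_dvd.2 (Int.gcd_dvd_right _ _))]
      ring
  refine (Finset.sum_le_sum h1).trans ?_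
  rw [Finset.sum_comm, hsum, Finset.mul_sum]
  refine Finset.sum_le_sum fun g hg => ?_
  rw [Finset.mem_Icc] at hg
  have hg1 : (1 : ℝ) ≤ g := by exact_mod_cast hg.1
  have hgN : (g : ℝ) ≤ N := by exact_mod_cast hg.2
  rw [← Finset.mul_sum, Finset.sum_product, ← Finset.sum_mul_sum Q Q (fun x : ℤ => if x ≡ 0 [ZMOD g] then (1 : ℝ) else 0)
    (fun x : ℤ => if x ≡ 0 [ZMOD g] then (1 : ℝ) else 0)]
  have h3 : ∑ x ∈ Q, (if x ≡ 0 [ZMOD g] then (1 : ℝ) else 0) ≤ 4 * N / g := by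
    rw [Finset.sum_boole]
    refine (card_filter_modEq_le N 0 (by exact_mod_cast hg.1)).trans ?_
    rw [Int.cast_natCast, div_add_one (by linarith)]
    gcongr
    linarith
  have h4 : 0 ≤ ∑ x ∈ Q, (if x ≡ 0 [ZMOD g] then (1 : ℝ) else 0) :=
    Finset.sum_nonneg fun x _ => by positivity
  calc (g : ℝ) * _ ≤ g * ((4 * N / g) * (4 * N / g)) := by gcongr
    _ = _ := by field_simp; ring

/-- Sums over families of points, dominated through two pivot indices. -/
theorem sum_pivot {n : ℕ} {i s : Fin n} (his : i ≠ s) (Q X : Finset (ℤ × ℤ))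
    {φ χ : ℤ × ℤ → ℤ × ℤ → ℝ} (hφ : ∀ x y, 0 ≤ φ x y) (hχ : ∀ x y, 0 ≤ χ x y) {B : ℝ}
    (hB : ∀ x ∈ X, ∑ y ∈ Q, χ x y ≤ B) :
    ∑ q ∈ Fintype.piFinset (fun _ : Fin n => Q),
      (if q i ∈ X then φ (q i) (q s) * ∏ l ∈ (Finset.univ.erase i).erase s, χ (q i) (q l) else 0)
      ≤ B ^ (n - 2) * ∑ x ∈ X, ∑ y ∈ Q, φ x y := by
  classical
  let h : ℤ × ℤ → Fin n → ℤ × ℤ → ℝ := fun x l y =>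
    if l = i then (if y = x then 1 else 0) else if l = s then φ x y else χ x y
  have hsi : s ∈ Finset.univ.erase i := Finset.mem_erase.2 ⟨his.symm, Finset.mem_univ _⟩
  have hprod : ∀ F : Fin n → ℝ, ∏ l, F l
      = F i * (F s * ∏ l ∈ (Finset.univ.erase i).erase s, F l) := fun F => by
    rw [Finset.mul_prod_erase _ _ hsi, Finset.mul_prod_erase _ _ (Finset.mem_univ i)]
  have hne : ∀ l ∈ (Finset.univ.erase i).erase s, l ≠ i ∧ l ≠ s := fun l hl => by
    rw [Finset.mem_erase, Finset.mem_erase] at hl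
    exact ⟨hl.2.1, hl.1⟩
  have h1 : ∀ q : Fin n → ℤ × ℤ, (if q i ∈ X then φ (q i) (q s)
      * ∏ l ∈ (Finset.univ.erase i).erase s, χ (q i) (q l) else 0)
        = ∑ x ∈ X, ∏ l, h x l (q l) := by
    intro q
    have h2 : ∀ x, ∏ l, h x l (q l) = if q i = x then φ (q i) (q s)
        * ∏ l ∈ (Finset.univ.erase i).erase s, χ (q i) (q l) else 0 := by
      intro x
      rw [hprod]
      simp only [h, if_true, if_neg his.symm]
      split_ifs with hx
      · rw [one_mul, hx]
        congr 1
        refine Finset.prod_congr rfl fun l hl => ?_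
        rw [if_neg (hne l hl).1, if_neg (hne l hl).2]
      · rw [zero_mul]
    simp only [h2]
    rw [Finset.sum_ite_eq]
  simp only [h1]
  rw [Finset.sum_comm, Finset.mul_sum]
  refine Finset.sum_le_sum fun x hx => ?_
  rw [Finset.sum_prod_piFinset, hprod]
  have hi1 : ∑ y ∈ Q, h x i y ≤ 1 := by
    simp only [h, if_true]
    rw [Finset.sum_ite_eq']
    split_ifs <;> norm_num
  have hi0 : 0 ≤ ∑ y ∈ Q, h x i y := Finset.sum_nonneg fun y _ => by
    simp only [h, if_true]; positivity
  have hs : ∑ y ∈ Q, h x s y = ∑ y ∈ Q, φ x y := by simp only [h, if_true, if_neg his.symm]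
  have hs0 : 0 ≤ ∑ y ∈ Q, φ x y := Finset.sum_nonneg fun y _ => hφ _ _
  have hl : ∏ l ∈ (Finset.univ.erase i).erase s, ∑ y ∈ Q, h x l y ≤ B ^ (n - 2) := by
    have hc : ((Finset.univ.erase i).erase s).card = n - 2 := by
      rw [Finset.card_erase_of_mem hsi, Finset.card_erase_of_mem (Finset.mem_univ i),
        Finset.card_univ, Fintype.card_fin]
      omega
    rw [← hc]
    refine (Finset.prod_le_prod (g := fun _ => B) ?_ ?_).trans (le_of_eq (by simp))
    · intro l hl
      refine Finset.sum_nonneg fun y _ => ?_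
      simp only [h, if_neg (hne l hl).1, if_neg (hne l hl).2]
      exact hχ _ _
    · intro l hl
      simp only [h, if_neg (hne l hl).1, if_neg (hne l hl).2]
      exact hB x hx
  have hl0 : 0 ≤ ∏ l ∈ (Finset.univ.erase i).erase s, ∑ y ∈ Q, h x l y :=
    Finset.prod_nonneg fun l hl => Finset.sum_nonneg fun y _ => by
      simp only [h, if_neg (hne l hl).1, if_neg (hne l hl).2]
      exact hχ _ _
  rw [hs]
  calc _ ≤ 1 * ((∑ y ∈ Q, φ x y) * B ^ (n - 2)) :=
        mul_le_mul hi1 (mul_le_mul_of_nonneg_left hl hs0) (mul_nonneg hs0 hl0) zero_le_one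
    _ = _ := by ring

/-- Integer vectors in a box. -/
def vbox (n N : ℕ) : Finset (Fin n → ℤ) := Fintype.piFinset fun _ => Finset.Icc (-N : ℤ) N

theorem mem_vbox {n N : ℕ} {v : Fin n → ℤ} : v ∈ vbox n N ↔ ∀ i, |v i| ≤ N := by
  simp only [vbox, Fintype.mem_piFinset, Finset.mem_Icc, abs_le]

theorem card_Icc_neg (N : ℕ) : (Finset.Icc (-N : ℤ) N).card = 2 * N + 1 := by
  rw [Int.card_Icc]; omega

theorem card_vbox (n N : ℕ) : (vbox n N).card = (2 * N + 1) ^ n := by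
  rw [vbox, Fintype.card_piFinset]
  simp only [card_Icc_neg]
  simp

theorem sum_vbox_pair {n N : ℕ} (F : (Fin n → ℤ) → (Fin n → ℤ) → ℝ) :
    ∑ v ∈ vbox n N, ∑ w ∈ vbox n N, F v w
      = ∑ q ∈ Fintype.piFinset (fun _ : Fin n => Finset.Icc (-N : ℤ) N ×ˢ Finset.Icc (-N : ℤ) N),
        F (fun l => (q l).1) (fun l => (q l).2) := by
  rw [← Finset.sum_product']
  refine Finset.sum_nbij' (fun a l => (a.1 l, a.2 l)) (fun q => (fun l => (q l).1, fun l => (q l).2))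
    ?_ ?_ ?_ ?_ ?_
  · intro a ha
    rw [Finset.mem_product, mem_vbox, mem_vbox] at ha
    rw [Fintype.mem_piFinset]
    intro l
    rw [Finset.mem_product, Finset.mem_Icc, Finset.mem_Icc, ← abs_le, ← abs_le]
    exact ⟨ha.1 l, ha.2 l⟩
  · intro q hq
    rw [Fintype.mem_piFinset] at hq
    rw [Finset.mem_product, mem_vbox, mem_vbox]
    have := fun l => by
      have h := hq l
      rw [Finset.mem_product, Finset.mem_Icc, Finset.mem_Icc, ← abs_le, ← abs_le] at h
      exact h
    exact ⟨fun l => (this l).1, fun l => (this l).2⟩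
  · intro a _; rfl
  · intro q _; rfl
  · intro a _; rfl

theorem card_filter_abs_sub_lt (N : ℕ) (x r : ℝ) (hr : 0 ≤ r) :
    (((Finset.Icc (-N : ℤ) N).filter (fun e : ℤ => |(e : ℝ) - x| < r)).card : ℝ) ≤ 2 * r + 1 := by
  have h : (Finset.Icc (-N : ℤ) N).filter (fun e : ℤ => |(e : ℝ) - x| < r)
      ⊆ Finset.Icc ⌈x - r⌉ ⌊x + r⌋ := by
    intro e he
    rw [Finset.mem_filter, abs_lt] at he
    rw [Finset.mem_Icc, Int.ceil_le, Int.le_floor]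
    constructor <;> linarith [he.2.1, he.2.2]
  have h1 : (((Finset.Icc (-N : ℤ) N).filter (fun e : ℤ => |(e : ℝ) - x| < r)).card : ℝ)
      ≤ (⌊x + r⌋ + 1 - ⌈x - r⌉).toNat := by
    rw [← Int.card_Icc]
    exact_mod_cast Finset.card_le_card h
  refine h1.trans ?_
  have h2 : ((⌊x + r⌋ + 1 - ⌈x - r⌉).toNat : ℝ) = ((max (⌊x + r⌋ + 1 - ⌈x - r⌉) 0 : ℤ) : ℝ) := by
    rw [← Int.toNat_eq_max]; norm_cast
  rw [h2]
  push_cast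
  refine max_le ?_ (by positivity)
  linarith [Int.floor_le (x + r), Int.le_ceil (x - r)]

theorem sum_swap_inner (Q : Finset ℤ) (S : ℝ) (φ : ℤ × ℤ → ℤ × ℤ → ℝ) :
    ∑ x ∈ (Q ×ˢ Q).filter (fun x => S ≤ |(x.1 : ℝ)|), ∑ y ∈ Q ×ˢ Q, φ x y
      = ∑ u ∈ Q ×ˢ Q, (if S ≤ |(u.1 : ℝ)| then ∑ y ∈ Q ×ˢ Q, φ (u.1, y.1) (u.2, y.2) else 0) := by
  rw [Finset.sum_filter, Finset.sum_product, Finset.sum_product]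
  refine Finset.sum_congr rfl fun a _ => ?_
  by_cases h : S ≤ |(a : ℝ)|
  · simp only [h, if_true, Finset.sum_product]
    rw [Finset.sum_comm]
  · simp only [h, if_false]

theorem near_sum {n N : ℕ} {i s : Fin n} (his : i ≠ s) {S D : ℝ} (hS : 0 < S) (hD : 0 ≤ D) :
    ∑ v ∈ vbox n N, ∑ w ∈ vbox n N, (if S ≤ |(v i : ℝ)| ∧ v i * w s - v s * w i ≠ 0 ∧
      (∀ l, |((v i * w l - v l * w i : ℤ) : ℝ)| < D)
        then 1 / |((v i * w s - v s * w i : ℤ) : ℝ)| else 0)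
      ≤ ((2 * N + 1) * (2 * (D / S) + 1)) ^ (n - 2) *
        ((2 * N + 1) ^ 2 * (2 * ((2 * N + 1) / S + 1) * hsum (2 * N ^ 2))) := by
  classical
  set Q := Finset.Icc (-N : ℤ) N with hQ
  have hQm : ∀ a, a ∈ Q → |a| ≤ N := fun a ha => abs_le.2 (Finset.mem_Icc.1 ha)
  rw [sum_vbox_pair fun v w : Fin n → ℤ => (if S ≤ |(v i : ℝ)| ∧ v i * w s - v s * w i ≠ 0 ∧
      (∀ l, |((v i * w l - v l * w i : ℤ) : ℝ)| < D)
        then 1 / |((v i * w s - v s * w i : ℤ) : ℝ)| else 0)]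
  set φ : ℤ × ℤ → ℤ × ℤ → ℝ := fun x y => if x.1 * y.2 - y.1 * x.2 = 0 then 0 else
    1 / |((x.1 * y.2 - y.1 * x.2 : ℤ) : ℝ)| with hφ
  set χ : ℤ × ℤ → ℤ × ℤ → ℝ := fun x y =>
    if |((x.1 * y.2 - y.1 * x.2 : ℤ) : ℝ)| < D then 1 else 0 with hχ
  have hφ0 : ∀ x y, 0 ≤ φ x y := fun x y => by
    simp only [hφ]; split_ifs <;> positivity
  have hχ0 : ∀ x y, 0 ≤ χ x y := fun x y => by
    simp only [hχ]; split_ifs <;> positivity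
  have hB : ∀ x ∈ (Q ×ˢ Q).filter (fun x => S ≤ |(x.1 : ℝ)|),
      ∑ y ∈ Q ×ˢ Q, χ x y ≤ (2 * N + 1) * (2 * (D / S) + 1) := by
    intro x hx
    have hxS := (Finset.mem_filter.1 hx).2
    have hx0 : (0 : ℝ) < |(x.1 : ℝ)| := hS.trans_le hxS
    rw [Finset.sum_product]
    have h1 : ∀ b ∈ Q, ∑ e ∈ Q, χ x (b, e) ≤ 2 * (D / S) + 1 := by
      intro b _
      refine le_trans ?_ (card_filter_abs_sub_lt N (b * x.2 / x.1) (D / S) (by positivity))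
      rw [Finset.card_filter, Nat.cast_sum]
      refine Finset.sum_le_sum fun e _ => ?_
      simp only [hχ]
      split_ifs with h2 h3
      · simp
      · exfalso
        apply h3
        have e1 : (e : ℝ) - b * x.2 / x.1 = (x.1 * e - b * x.2) / x.1 := by
          have : (x.1 : ℝ) ≠ 0 := abs_pos.1 hx0
          field_simp
        rw [e1, abs_div]
        push_cast at h2
        exact div_lt_div₀ h2 hxS hD hS
      · simp
      · simp
    calc _ ≤ ∑ b ∈ Q, (2 * (D / S) + 1) := Finset.sum_le_sum h1
      _ = _ := by rw [Finset.sum_const, hQ, card_Icc_neg, nsmul_eq_mul]; push_cast; ring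
  refine le_trans ?_ ((sum_pivot his (Q ×ˢ Q) _ hφ0 hχ0 hB).trans ?_)
  · refine Finset.sum_le_sum fun q hq => ?_
    have hqi := Fintype.mem_piFinset.1 hq i
    split_ifs with h1 h2 h2
    · have h3 : ∏ l ∈ (Finset.univ.erase i).erase s, χ (q i) (q l) = 1 :=
        Finset.prod_eq_one fun l _ => by
          simp only [hχ]
          rw [if_pos (h1.2.2 l)]
      rw [h3, mul_one]
      simp only [hφ]
      rw [if_neg h1.2.1]
    · exact absurd (Finset.mem_filter.2 ⟨hqi, h1.1⟩) h2
    · exact mul_nonneg (hφ0 _ _) (Finset.prod_nonneg fun l _ => hχ0 _ _)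
    · exact le_rfl
  · refine mul_le_mul_of_nonneg_left ?_ (by positivity)
    rw [sum_swap_inner]
    have h1 : ∀ u ∈ Q ×ˢ Q, (if S ≤ |(u.1 : ℝ)| then
        ∑ y ∈ Q ×ˢ Q, φ (u.1, y.1) (u.2, y.2) else 0)
          ≤ 2 * ((2 * N + 1) / S + 1) * hsum (2 * N ^ 2) := by
      intro u hu
      rw [Finset.mem_product] at hu
      split_ifs with h
      · exact sum_fibre_le N hS h u.2 (hQm _ hu.1) (hQm _ hu.2)
      · have := hsum_nonneg (2 * N ^ 2)
        positivity
    refine (Finset.sum_le_sum h1).trans (le_of_eq ?_)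
    rw [Finset.sum_const, Finset.card_product, hQ, card_Icc_neg, nsmul_eq_mul]
    push_cast
    ring

theorem par_sum {n N : ℕ} {i s : Fin n} (his : i ≠ s) {S : ℝ} (hS : 0 < S) :
    ∑ v ∈ vbox n N, ∑ w ∈ vbox n N, (if S ≤ |(v i : ℝ)| ∧
      (∀ l, v i * w l - v l * w i = 0) then (1 : ℝ) else 0)
      ≤ (2 * N + 1) ^ (n - 2) *
        ((2 * N + 1) / S * (16 * N ^ 2 * hsum N) + (2 * N + 1) ^ 2) := by
  classical
  set Q := Finset.Icc (-N : ℤ) N with hQ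
  rw [sum_vbox_pair fun v w : Fin n → ℤ => (if S ≤ |(v i : ℝ)| ∧
      (∀ l, v i * w l - v l * w i = 0) then (1 : ℝ) else 0)]
  set χ : ℤ × ℤ → ℤ × ℤ → ℝ := fun x y =>
    if x.1 * y.2 - y.1 * x.2 = 0 then 1 else 0 with hχ
  have hχ0 : ∀ x y, 0 ≤ χ x y := fun x y => by
    simp only [hχ]; split_ifs <;> positivity
  have hB : ∀ x ∈ (Q ×ˢ Q).filter (fun x => S ≤ |(x.1 : ℝ)|),
      ∑ y ∈ Q ×ˢ Q, χ x y ≤ (2 * N + 1) := by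
    intro x hx
    have hxS := (Finset.mem_filter.1 hx).2
    have hx0 : x.1 ≠ 0 := by
      have := abs_pos.1 (hS.trans_le hxS)
      exact_mod_cast this
    rw [Finset.sum_product]
    have h1 : ∀ b ∈ Q, ∑ e ∈ Q, χ x (b, e) ≤ 1 := by
      intro b _
      simp only [hχ]
      rw [Finset.sum_boole]
      have : (Q.filter fun e => x.1 * e - b * x.2 = 0).card ≤ 1 := by
        rw [Finset.card_le_one]
        intro e he e' he'
        rw [Finset.mem_filter] at he he'
        refine mul_left_cancel₀ hx0 ?_
        linear_combination he.2 - he'.2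
      exact_mod_cast this
    calc _ ≤ ∑ b ∈ Q, (1 : ℝ) := Finset.sum_le_sum h1
      _ = _ := by rw [Finset.sum_const, hQ, card_Icc_neg, nsmul_eq_mul]; push_cast; ring
  refine le_trans ?_ ((sum_pivot his (Q ×ˢ Q) _ hχ0 hχ0 hB).trans ?_)
  · refine Finset.sum_le_sum fun q hq => ?_
    have hqi := Fintype.mem_piFinset.1 hq i
    split_ifs with h1 h2 h2
    · have h3 : ∏ l ∈ (Finset.univ.erase i).erase s, χ (q i) (q l) = 1 :=
        Finset.prod_eq_one fun l _ => by
          simp only [hχ]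
          rw [if_pos (h1.2 l)]
      rw [h3, mul_one]
      simp only [hχ]
      rw [if_pos (h1.2 s)]
    · exact absurd (Finset.mem_filter.2 ⟨hqi, h1.1⟩) h2
    · exact mul_nonneg (hχ0 _ _) (Finset.prod_nonneg fun l _ => hχ0 _ _)
    · exact le_rfl
  · refine mul_le_mul_of_nonneg_left ?_ (by positivity)
    rw [sum_swap_inner]
    have h1 : ∀ u ∈ Q ×ˢ Q, (if S ≤ |(u.1 : ℝ)| then
        ∑ y ∈ Q ×ˢ Q, χ (u.1, y.1) (u.2, y.2) else 0)
          ≤ (2 * N + 1) / S * (if u.1 = 0 then 0 else (Int.gcd u.1 u.2 : ℝ)) + 1 := by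
      intro u hu
      split_ifs with h h2 h2
      · exfalso
        rw [h2] at h
        simp at h
        linarith
      · simp only [hχ]
        rw [Finset.sum_boole]
        refine (card_fibre_le N h2 u.2 0).trans ?_
        gcongr ?_ + 1
        rw [div_mul_eq_mul_div]
        gcongr
      · positivity
      · positivity
    refine (Finset.sum_le_sum h1).trans ?_
    rw [Finset.sum_add_distrib, ← Finset.mul_sum, Finset.sum_const, Finset.card_product, hQ,
      card_Icc_neg, nsmul_eq_mul]
    gcongr
    · exact sum_gcd_le N
    · push_cast
      exact le_of_eq (by ring)

/-- Sum of inverse powers of the norm over a punctured box. -/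
theorem shell_sum {n d N : ℕ} (hdn : d ≤ n) :
    ∑ v ∈ (vbox n N).filter (fun v => v ≠ 0), 1 / ‖intVec v‖ ^ d
      ≤ (N : ℝ) ^ (n - d) * (1 + 2 * hsum N) ^ n := by
  have h1 : ∑ a ∈ Finset.Icc (-N : ℤ) N, (1 : ℝ) / max 1 (a.natAbs : ℝ) = 1 + 2 * hsum N := by
    rw [sum_Icc_neg N fun k => (1 : ℝ) / max 1 (k : ℝ)]
    rw [hsum]
    congr 1
    · simp
    · congr 1
      refine Finset.sum_congr rfl fun k hk => ?_
      rw [max_eq_right]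
      exact_mod_cast (Finset.mem_Icc.1 hk).1
  have h2 : (1 + 2 * hsum N) ^ n = ∑ v ∈ vbox n N, ∏ i, (1 : ℝ) / max 1 ((v i).natAbs : ℝ) := by
    rw [vbox, Finset.sum_prod_piFinset (Finset.Icc (-N : ℤ) N)
      (fun (_ : Fin n) (a : ℤ) => (1 : ℝ) / max 1 (a.natAbs : ℝ))]
    rw [Finset.prod_congr rfl fun _ _ => h1, Finset.prod_const, Finset.card_univ, Fintype.card_fin]
  rw [h2, Finset.mul_sum]
  refine (Finset.sum_le_sum ?_).trans
    (Finset.sum_le_sum_of_subset_of_nonneg (Finset.filter_subset _ _) fun v _ _ => by positivity)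
  intro v hv
  rw [Finset.mem_filter, mem_vbox] at hv
  have hv1 : 1 ≤ ‖intVec v‖ := by
    obtain ⟨i, hi⟩ := Function.ne_iff.1 hv.2
    refine le_trans ?_ (norm_le_pi_norm (intVec v) i)
    have : (1 : ℤ) ≤ |v i| := Int.one_le_abs hi
    rw [intVec, Real.norm_eq_abs, ← Int.cast_abs]
    exact_mod_cast this
  have hvN : ‖intVec v‖ ≤ N := by
    refine (pi_norm_le_iff_of_nonneg (by positivity)).2 fun i => ?_
    rw [intVec, Real.norm_eq_abs, ← Int.cast_abs]
    exact_mod_cast hv.1 i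
  have h3 : 1 / ‖intVec v‖ ^ n ≤ ∏ i, (1 : ℝ) / max 1 ((v i).natAbs : ℝ) := by
    have : 1 / ‖intVec v‖ ^ n = ∏ _i : Fin n, 1 / ‖intVec v‖ := by simp
    rw [this]
    refine Finset.prod_le_prod (fun i _ => by positivity) fun i _ => ?_
    refine one_div_le_one_div_of_le (by positivity) (max_le hv1 ?_)
    refine le_trans (le_of_eq ?_) (norm_le_pi_norm (intVec v) i)
    rw [intVec, Real.norm_eq_abs, Nat.cast_natAbs, Int.cast_abs]
  refine le_trans ?_ (mul_le_mul_of_nonneg_left h3 (by positivity))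
  have h4 : ‖intVec v‖ ^ (n - d) ≤ (N : ℝ) ^ (n - d) := pow_le_pow_left₀ (by positivity) hvN _
  have h5 : 1 / ‖intVec v‖ ^ d = ‖intVec v‖ ^ (n - d) * (1 / ‖intVec v‖ ^ n) := by
    have : ‖intVec v‖ ^ n = ‖intVec v‖ ^ (n - d) * ‖intVec v‖ ^ d := by
      rw [← pow_add, Nat.sub_add_cancel hdn]
    rw [this]
    field_simp
  rw [h5]
  gcongr

/-- The dilation factor of the substitution `y^d ↦ y^d - τ`. -/
def powShiftFactor (d : ℕ) (τ y : ℝ) : ℝ := (1 - τ / y ^ d) ^ (1 / (d : ℝ))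

/-- The substitution `y^d ↦ y^d - τ`. -/
def powShift (d : ℕ) (τ y : ℝ) : ℝ := y * powShiftFactor d τ y

theorem measurable_powShift (d : ℕ) (τ : ℝ) : Measurable (powShift d τ) := by
  unfold powShift powShiftFactor
  fun_prop

section
variable {d : ℕ} {τ y T e : ℝ}

theorem abs_div_pow_le (hT : 0 < T) (hy : T ≤ |y|) (hτ : |τ| ≤ e * T ^ d) :
    |τ / y ^ d| ≤ e := by
  have hy0 : 0 < |y| := hT.trans_le hy
  rw [abs_div, abs_pow, div_le_iff₀ (by positivity)]
  refine hτ.trans ?_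
  have he : 0 ≤ e := by
    by_contra h
    have : e * T ^ d < 0 := mul_neg_of_neg_of_pos (not_le.1 h) (by positivity)
    linarith [abs_nonneg τ]
  gcongr

theorem powShiftFactor_pos (hT : 0 < T) (hy : T ≤ |y|) (hτ : |τ| ≤ e * T ^ d)
    (he : e ≤ 1 / 2) : 0 < powShiftFactor d τ y := by
  have h := abs_le.1 (abs_div_pow_le hT hy hτ)
  exact Real.rpow_pos_of_pos (by linarith) _

theorem powShiftFactor_pow (hd : 2 ≤ d) (hT : 0 < T) (hy : T ≤ |y|)
    (hτ : |τ| ≤ e * T ^ d) (he : e ≤ 1 / 2) : powShiftFactor d τ y ^ d = 1 - τ / y ^ d := by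
  have h := abs_le.1 (abs_div_pow_le hT hy hτ)
  rw [powShiftFactor, ← Real.rpow_natCast, ← Real.rpow_mul (by linarith)]
  rw [one_div, inv_mul_cancel₀ (by positivity), Real.rpow_one]

theorem powShiftFactor_le (hd : 2 ≤ d) (hT : 0 < T) (hy : T ≤ |y|)
    (hτ : |τ| ≤ e * T ^ d) (he : e ≤ 1 / 2) (he0 : 0 ≤ e) : powShiftFactor d τ y ≤ 1 + e := by
  have h := abs_le.1 (abs_div_pow_le hT hy hτ)
  refine le_of_pow_le_pow_left₀ (n := d) (by omega) (by linarith) ?_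
  rw [powShiftFactor_pow hd hT hy hτ he]
  calc 1 - τ / y ^ d ≤ 1 + e := by linarith
    _ ≤ (1 + e) ^ d := le_self_pow₀ (by linarith) (by omega)

theorem le_powShiftFactor (hd : 2 ≤ d) (hT : 0 < T) (hy : T ≤ |y|)
    (hτ : |τ| ≤ e * T ^ d) (he : e ≤ 1 / 2) (he0 : 0 ≤ e) : 1 - e ≤ powShiftFactor d τ y := by
  have h := abs_le.1 (abs_div_pow_le hT hy hτ)
  refine le_of_pow_le_pow_left₀ (n := d) (by omega) (powShiftFactor_pos hT hy hτ he).le ?_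
  rw [powShiftFactor_pow hd hT hy hτ he]
  calc (1 - e) ^ d ≤ 1 - e := pow_le_of_le_one (by linarith) (by linarith) (by omega)
    _ ≤ _ := by linarith

theorem powShift_pow (hd : 2 ≤ d) (hT : 0 < T) (hy : T ≤ |y|)
    (hτ : |τ| ≤ e * T ^ d) (he : e ≤ 1 / 2) : powShift d τ y ^ d = y ^ d - τ := by
  have hy0 : y ≠ 0 := abs_pos.1 (hT.trans_le hy)
  rw [powShift, mul_pow, powShiftFactor_pow hd hT hy hτ he, mul_sub, mul_one,
    mul_div_cancel₀ _ (pow_ne_zero d hy0)]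

theorem hasDerivAt_powShift (hd : 2 ≤ d) (hT : 0 < T) (hy : T ≤ |y|)
    (hτ : |τ| ≤ e * T ^ d) (he : e ≤ 1 / 2) :
    HasDerivAt (powShift d τ) (1 / powShiftFactor d τ y ^ (d - 1)) y := by
  have hy0 : y ≠ 0 := abs_pos.1 (hT.trans_le hy)
  have h := abs_le.1 (abs_div_pow_le hT hy hτ)
  have hb : 0 < 1 - τ / y ^ d := by linarith
  have hθ := powShiftFactor_pos hT hy hτ he
  have hθd := powShiftFactor_pow hd hT hy hτ he
  have hd0 : (d : ℝ) ≠ 0 := by positivity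
  have h1 : HasDerivAt (fun y : ℝ => 1 - τ / y ^ d) (τ * (d * y ^ (d - 1)) / (y ^ d) ^ 2) y := by
    have := ((hasDerivAt_const y τ).div (hasDerivAt_pow d y) (pow_ne_zero d hy0)).const_sub 1
    rw [zero_mul, zero_sub, neg_div, neg_neg] at this
    exact this
  have h2 := h1.rpow_const (p := 1 / (d : ℝ)) (Or.inl hb.ne')
  have h3 := (hasDerivAt_id y).mul h2
  have h4 : (1 - τ / y ^ d) ^ (1 / (d : ℝ) - 1)
      = powShiftFactor d τ y / powShiftFactor d τ y ^ d := by
    rw [Real.rpow_sub_one hb.ne', hθd, powShiftFactor]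
  rw [h4] at h3
  change HasDerivAt (powShift d τ) (1 * powShiftFactor d τ y + y * _) y at h3
  convert h3 using 1
  obtain ⟨k, rfl⟩ : ∃ k, d = k + 1 := ⟨d - 1, by omega⟩
  rw [Nat.add_sub_cancel]
  set θ := powShiftFactor (k + 1) τ y
  have e1 : τ = y ^ (k + 1) * (1 - θ ^ (k + 1)) := by
    rw [hθd]; field_simp; ring
  have e2 : θ ^ (k + 1) ≠ 0 := (pow_pos hθ _).ne'
  have e3 : θ ^ k ≠ 0 := (pow_pos hθ _).ne'
  have e4 : y * (τ * (↑(k + 1) * y ^ k) / (y ^ (k + 1)) ^ 2 * (1 / ↑(k + 1))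
      * (θ / θ ^ (k + 1))) = (1 - θ ^ (k + 1)) / θ ^ k := by
    nth_rewrite 1 [e1]
    field_simp
    ring
  rw [e4]
  field_simp
  ring

theorem injOn_powShift (hd : 2 ≤ d) (hT : 0 < T) (hτ : |τ| ≤ e * T ^ d)
    (he : e ≤ 1 / 2) : Set.InjOn (powShift d τ) {y | T ≤ |y|} := by
  intro y hy z hz hyz
  have h1 := powShift_pow hd hT hy hτ he
  rw [hyz, powShift_pow hd hT hz hτ he] at h1
  have h2 : z ^ d = y ^ d := by linarith
  have h3 : |z| = |y| := by
    have : |z| ^ d = |y| ^ d := by rw [← abs_pow, h2, abs_pow]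
    exact (pow_left_inj₀ (abs_nonneg _) (abs_nonneg _) (by omega)).1 this
  rcases abs_eq_abs.1 h3 with h | h
  · exact h.symm
  · exfalso
    have hy0 := powShiftFactor_pos hT hy hτ he
    have e1 : powShiftFactor d τ z = powShiftFactor d τ y := by
      rw [powShiftFactor, powShiftFactor, h2]
    rw [powShift, powShift, e1] at hyz
    have e2 := mul_right_cancel₀ hy0.ne' hyz
    have e3 : 0 < |y| := hT.trans_le hy
    rw [e2] at e3 h
    have : z = 0 := by linarith
    rw [this] at e3
    simp at e3

theorem lintegral_powShift_le (hd : 2 ≤ d) (hT : 0 < T) (hτ : |τ| ≤ e * T ^ d)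
    (he : e ≤ 1 / 2) (he0 : 0 ≤ e) (H : ℝ → ENNReal) :
    ∫⁻ y in {y | T ≤ |y|}, H (powShift d τ y) ≤ ENNReal.ofReal ((1 + e) ^ d) * ∫⁻ y, H y := by
  have hs : MeasurableSet {y : ℝ | T ≤ |y|} := measurableSet_le measurable_const (by fun_prop)
  have h1 := lintegral_image_eq_lintegral_abs_deriv_mul hs
    (fun y hy => (hasDerivAt_powShift hd hT hy hτ he).hasDerivWithinAt)
    (injOn_powShift hd hT hτ he) H
  have h2 : ∫⁻ y in powShift d τ '' {y | T ≤ |y|}, H y ≤ ∫⁻ y, H y := setLIntegral_le_lintegral _ _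
  rw [h1] at h2
  refine le_trans ?_ (mul_le_mul_right h2 _)
  rw [← lintegral_const_mul' _ _ ENNReal.ofReal_ne_top]
  refine setLIntegral_mono_ae' hs (ae_of_all _ fun y hy => ?_)
  rw [← mul_assoc, ← ENNReal.ofReal_mul (by positivity)]
  refine le_mul_of_one_le_left (by simp) ?_
  rw [ENNReal.one_le_ofReal]
  have hθ := powShiftFactor_pos hT hy hτ he
  have hθ1 := powShiftFactor_le hd hT hy hτ he he0
  rw [abs_of_pos (by positivity), mul_one_div, one_le_div (by positivity)]
  calc powShiftFactor d τ y ^ (d - 1) ≤ (1 + e) ^ (d - 1) := pow_le_pow_left₀ hθ.le hθ1 _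
    _ ≤ (1 + e) ^ d := pow_le_pow_right₀ (by linarith) (by omega)

end

/-- Shift of the value of `Fs` by `-s`, moving only the coordinate `i`. -/
def coordShift {n : ℕ} (σ : Fin n → ℝ) (d : ℕ) (i : Fin n) (s : ℝ) (y : Fin n → ℝ) : Fin n → ℝ :=
  Function.update y i (powShift d (σ i * s) (y i))

theorem measurable_coordShift {n : ℕ} (σ : Fin n → ℝ) (d : ℕ) (i : Fin n) (s : ℝ) :
    Measurable (coordShift σ d i s) := by
  refine measurable_pi_iff.2 fun j => ?_
  by_cases h : j = i
  · subst h
    simp only [coordShift, Function.update_self]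
    exact (measurable_powShift d _).comp (measurable_pi_apply j)
  · simp only [coordShift, Function.update_of_ne h]
    exact measurable_pi_apply j

theorem lintegral_coordShift_le {n : ℕ} {σ : Fin n → ℝ} (hσ : ∀ i, |σ i| = 1) {d : ℕ}
    (hd : 2 ≤ d) (i : Fin n) {s T e : ℝ} (hT : 0 < T) (hs : |s| ≤ e * T ^ d)
    (he : e ≤ 1 / 2) (he0 : 0 ≤ e) {H : (Fin n → ℝ) → ENNReal} (hH : Measurable H) :
    ∫⁻ y in {y : Fin n → ℝ | T ≤ |y i|}, H (coordShift σ d i s y)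
      ≤ ENNReal.ofReal ((1 + e) ^ d) * ∫⁻ y, H y := by
  have hA : MeasurableSet {y : Fin n → ℝ | T ≤ |y i|} :=
    measurableSet_le measurable_const (by fun_prop)
  rw [← lintegral_indicator hA, ← lintegral_const_mul _ hH]
  rw [volume_pi]
  refine lintegral_le_of_lmarginal_le {i} ((hH.comp (measurable_coordShift σ d i s)).indicator hA)
    (hH.const_mul _) ?_
  intro y
  rw [lmarginal_singleton, lmarginal_singleton]
  have hτ : |σ i * s| ≤ e * T ^ d := by rw [abs_mul, hσ, one_mul]; exact hs
  have h1 := lintegral_powShift_le hd hT hτ he he0 fun b => H (Function.update y i b)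
  have hB : MeasurableSet {y : ℝ | T ≤ |y|} := measurableSet_le measurable_const (by fun_prop)
  have h2 := lintegral_const_mul (μ := volume) (ENNReal.ofReal ((1 + e) ^ d))
    (f := fun a => H (Function.update y i a)) (hH.comp (measurable_update y))
  rw [← lintegral_indicator hB, ← h2] at h1
  refine le_trans (le_of_eq ?_) h1
  refine lintegral_congr fun a => ?_
  by_cases h : T ≤ |a|
  · rw [Set.indicator_of_mem (by simpa using h), Set.indicator_of_mem (by exact h)]
    simp [coordShift]
  · rw [Set.indicator_of_notMem (by simpa using h), Set.indicator_of_notMem (by exact h)]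

theorem Fs_coordShift {n : ℕ} {σ : Fin n → ℝ} (hσ : ∀ i, |σ i| = 1) {d : ℕ}
    (hd : 2 ≤ d) (i : Fin n) {s T e : ℝ} (hT : 0 < T) (hs : |s| ≤ e * T ^ d)
    (he : e ≤ 1 / 2) {y : Fin n → ℝ} (hy : T ≤ |y i|) :
    Fs σ d (coordShift σ d i s y) = Fs σ d y - s := by
  have hτ : |σ i * s| ≤ e * T ^ d := by rw [abs_mul, hσ, one_mul]; exact hs
  unfold Fs
  rw [← Finset.add_sum_erase _ _ (Finset.mem_univ i),
    ← Finset.add_sum_erase (Finset.univ) (fun j => σ j * y j ^ d) (Finset.mem_univ i)]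
  have h1 : ∑ j ∈ Finset.univ.erase i, σ j * coordShift σ d i s y j ^ d
      = ∑ j ∈ Finset.univ.erase i, σ j * y j ^ d :=
    Finset.sum_congr rfl fun j hj => by
      rw [coordShift, Function.update_of_ne (Finset.ne_of_mem_erase hj)]
  have h2 : σ i * σ i = 1 := by
    rw [← abs_mul_abs_self, hσ, one_mul]
  rw [h1, coordShift, Function.update_self, powShift_pow hd hT hy hτ he]
  linear_combination (-s) * h2

theorem eucNorm_eq_norm {n : ℕ} (v : Fin n → ℝ) : eucNorm v = ‖WithLp.toLp 2 v‖ := by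
  rw [EuclideanSpace.norm_eq, eucNorm]
  simp

theorem eucNorm_add_le {n : ℕ} (v w : Fin n → ℝ) : eucNorm (v + w) ≤ eucNorm v + eucNorm w := by
  simp only [eucNorm_eq_norm, WithLp.toLp_add]
  exact norm_add_le _ _

theorem eucNorm_smul {n : ℕ} (c : ℝ) (v : Fin n → ℝ) : eucNorm (c • v) = |c| * eucNorm v := by
  simp only [eucNorm_eq_norm, WithLp.toLp_smul, norm_smul, Real.norm_eq_abs]

theorem continuous_eucNorm {n : ℕ} : Continuous (eucNorm : (Fin n → ℝ) → ℝ) := by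
  unfold eucNorm
  fun_prop

theorem continuous_act_left {n : ℕ} (g : SLR n) : Continuous (fun x : Fin n → ℝ => act x g) :=
  continuous_act.comp (Continuous.prodMk_left g)

theorem measurePreserving_act {n : ℕ} (g : SLR n) :
    MeasurePreserving (fun x : Fin n → ℝ => act x g) volume volume := by
  refine ⟨(continuous_act_left g).measurable, ?_⟩
  have h := Real.map_matrix_volume_pi_eq_smul_volume_pi
    (M := (g : Matrix (Fin n) (Fin n) ℝ)ᵀ) (by rw [Matrix.det_transpose, g.det_coe]; simp)
  rw [Matrix.det_transpose, g.det_coe] at h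
  simp only [inv_one, abs_one, ENNReal.ofReal_one, one_smul] at h
  have e : (fun x : Fin n → ℝ => act x g) = ⇑(toLin' (g : Matrix (Fin n) (Fin n) ℝ)ᵀ) := by
    ext x
    simp [act, Matrix.mulVec_transpose]
  rw [e]
  exact h

theorem volume_norm_le {n : ℕ} {R : ℝ} (hR : 0 ≤ R) :
    volume {y : Fin n → ℝ | ‖y‖ ≤ R} = ENNReal.ofReal ((2 * R) ^ n) := by
  have : {y : Fin n → ℝ | ‖y‖ ≤ R} = Metric.closedBall 0 R := by
    ext; simp
  rw [this, Real.volume_pi_closedBall _ hR, Fintype.card_fin]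

/-- The volume of the region of the ball of radius `t` where the form takes values in `J`. -/
def regVol {n : ℕ} (σ : Fin n → ℝ) (d : ℕ) (g : SLR n) (J : Set ℝ) (t : ℝ) : ENNReal :=
  volume {x : Fin n → ℝ | eucNorm x ≤ t ∧ Fs σ d (act x g) ∈ J}

theorem measurableSet_region {n : ℕ} (σ : Fin n → ℝ) (d : ℕ) (g h : SLR n) {J : Set ℝ}
    (hJ : MeasurableSet J) (t : ℝ) :
    MeasurableSet {x : Fin n → ℝ | eucNorm (act x h) ≤ t ∧ Fs σ d (act x g) ∈ J} := by
  refine (measurableSet_le (f := fun x : Fin n → ℝ => eucNorm (act x h))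
    (continuous_eucNorm.comp (continuous_act_left h)).measurable measurable_const).inter ?_
  · exact ((continuous_Fs σ d).comp (continuous_act_left g)).measurable hJ

theorem regVol_eq {n : ℕ} (σ : Fin n → ℝ) (d : ℕ) (g : SLR n) {J : Set ℝ}
    (hJ : MeasurableSet J) (t : ℝ) :
    regVol σ d g J t = volume {y : Fin n → ℝ | eucNorm (act y g⁻¹) ≤ t ∧ Fs σ d y ∈ J} := by
  have h := measurableSet_region σ d g 1 hJ t
  simp only [act_one] at h
  rw [regVol, ← (measurePreserving_act g⁻¹).measure_preimage h.nullMeasurableSet]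
  simp only [Set.preimage, Set.mem_ofPred_eq, act_act_inv]

theorem regVol_mono {n : ℕ} (σ : Fin n → ℝ) (d : ℕ) (g : SLR n) {J K : Set ℝ} {s t : ℝ}
    (hJ : J ⊆ K) (hst : s ≤ t) : regVol σ d g J s ≤ regVol σ d g K t :=
  measure_mono fun _ hx => ⟨hx.1.trans hst, hJ hx.2⟩

theorem regVol_le {n : ℕ} (σ : Fin n → ℝ) (d : ℕ) (g : SLR n) (J : Set ℝ) {t : ℝ} (ht : 0 ≤ t) :
    regVol σ d g J t ≤ ENNReal.ofReal ((2 * t) ^ n) := by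
  rw [← volume_norm_le ht]
  exact measure_mono fun _ hx => (norm_le_eucNorm _).trans hx.1

/-- The weight of the coordinate `i`. -/
def wgt {n : ℕ} (m : ℕ) (i : Fin n) (y : Fin n → ℝ) : ℝ := y i ^ m / ∑ j, y j ^ m

section
variable {n m : ℕ}

theorem sum_pow_nonneg (hm : Even m) (y : Fin n → ℝ) : 0 ≤ ∑ j, y j ^ m :=
  Finset.sum_nonneg fun j _ => hm.pow_nonneg (y j)

theorem wgt_nonneg (hm : Even m) (i : Fin n) (y : Fin n → ℝ) : 0 ≤ wgt m i y :=
  div_nonneg (hm.pow_nonneg _) (sum_pow_nonneg hm y)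

theorem sum_wgt_le (y : Fin n → ℝ) : ∑ i, wgt m i y ≤ 1 := by
  simp only [wgt]
  rw [← Finset.sum_div]
  exact div_self_le_one _

theorem norm_pow_le_sum (hm : Even m) (hm0 : m ≠ 0) (y : Fin n → ℝ) : ‖y‖ ^ m ≤ ∑ j, y j ^ m := by
  rcases Nat.eq_zero_or_pos n with rfl | hn
  · rw [Subsingleton.elim y 0, norm_zero, zero_pow hm0]
    simp
  · obtain ⟨i, hi⟩ := exists_abs_eq_norm hn y
    rw [← hi, hm.pow_abs]
    exact Finset.single_le_sum (f := fun j => y j ^ m) (fun j _ => hm.pow_nonneg (y j))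
      (Finset.mem_univ i)

theorem sum_wgt_eq (hm : Even m) (hm0 : m ≠ 0) {y : Fin n → ℝ} (hy : 0 < ‖y‖) : ∑ i, wgt m i y = 1 := by
  simp only [wgt]
  rw [← Finset.sum_div]
  exact div_self ((pow_pos hy m).trans_le (norm_pow_le_sum hm hm0 y)).ne'

theorem wgt_le (hm : Even m) (hm0 : m ≠ 0) {y : Fin n → ℝ} {T R : ℝ} (hR : 0 < R) (hy : R ≤ ‖y‖) {i : Fin n}
    (hi : |y i| ≤ T) : wgt m i y ≤ (T / R) ^ m := by
  rw [wgt, div_pow, ← hm.pow_abs (y i)]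
  refine div_le_div₀ (by rw [← hm.pow_abs]; positivity) (pow_le_pow_left₀ (abs_nonneg _) hi m)
    (by positivity) ?_
  exact (pow_le_pow_left₀ hR.le hy m).trans (norm_pow_le_sum hm hm0 y)

theorem wgt_le_wgt_coordShift (hm : Even m) {σ : Fin n → ℝ} (hσ : ∀ i, |σ i| = 1) {d : ℕ}
    (hd : 2 ≤ d) (i : Fin n) {s T e : ℝ} (hT : 0 < T) (hs : |s| ≤ e * T ^ d)
    (he : e ≤ 1 / 2) (he0 : 0 ≤ e) {y : Fin n → ℝ} (hy : T ≤ |y i|) :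
    (1 - e) ^ m * wgt m i y ≤ wgt m i (coordShift σ d i s y) := by
  have hτ : |σ i * s| ≤ e * T ^ d := by rw [abs_mul, hσ, one_mul]; exact hs
  have hθ := le_powShiftFactor hd hT hy hτ he he0
  have h1 : ∑ j ∈ Finset.univ.erase i, coordShift σ d i s y j ^ m
      = ∑ j ∈ Finset.univ.erase i, y j ^ m :=
    Finset.sum_congr rfl fun j hj => by
      rw [coordShift, Function.update_of_ne (Finset.ne_of_mem_erase hj)]
  rw [wgt, wgt, ← Finset.add_sum_erase _ _ (Finset.mem_univ i),
    ← Finset.add_sum_erase (Finset.univ) (fun j => coordShift σ d i s y j ^ m) (Finset.mem_univ i),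
    h1]
  have h2 : coordShift σ d i s y i = y i * powShiftFactor d (σ i * s) (y i) := by
    rw [coordShift, Function.update_self, powShift]
  rw [h2, mul_pow]
  set θ := powShiftFactor d (σ i * s) (y i)
  have hr : 0 ≤ ∑ j ∈ Finset.univ.erase i, y j ^ m :=
    Finset.sum_nonneg fun j _ => hm.pow_nonneg (y j)
  set r := ∑ j ∈ Finset.univ.erase i, y j ^ m
  have hyi : y i ≠ 0 := abs_pos.1 (hT.trans_le hy)
  have ha : 0 < y i ^ m := hm.pow_pos hyi
  set a := y i ^ m
  have hθ0 : 0 < θ := by linarith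
  have hθm : (1 - e) ^ m ≤ θ ^ m := pow_le_pow_left₀ (by linarith) hθ m
  have he1 : (1 - e) ^ m ≤ 1 := pow_le_one₀ (by linarith) (by linarith)
  have hθm0 : 0 < θ ^ m := pow_pos hθ0 m
  rw [← mul_div_assoc, div_le_div_iff₀ (by positivity) (by positivity)]
  have e1 : (1 - e) ^ m * (θ ^ m * a) ≤ 1 * (θ ^ m * a) :=
    mul_le_mul_of_nonneg_right he1 (by positivity)
  have e2 : (1 - e) ^ m * r ≤ θ ^ m * r := mul_le_mul_of_nonneg_right hθm hr
  have e3 := mul_le_mul_of_nonneg_left (add_le_add e1 e2) ha.le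
  linarith

end

theorem measurable_wgt {n m : ℕ} (i : Fin n) : Measurable (wgt m i : (Fin n → ℝ) → ℝ) := by
  unfold wgt
  fun_prop

theorem norm_coordShift_sub_le {n : ℕ} {σ : Fin n → ℝ} (hσ : ∀ i, |σ i| = 1) {d : ℕ}
    (hd : 2 ≤ d) (i : Fin n) {s T e : ℝ} (hT : 0 < T) (hs : |s| ≤ e * T ^ d)
    (he : e ≤ 1 / 2) (he0 : 0 ≤ e) {y : Fin n → ℝ} (hy : T ≤ |y i|) :
    ‖coordShift σ d i s y - y‖ ≤ e * ‖y‖ := by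
  have hτ : |σ i * s| ≤ e * T ^ d := by rw [abs_mul, hσ, one_mul]; exact hs
  have h1 := le_powShiftFactor hd hT hy hτ he he0
  have h2 := powShiftFactor_le hd hT hy hτ he he0
  refine (pi_norm_le_iff_of_nonneg (by positivity)).2 fun j => ?_
  by_cases h : j = i
  · subst h
    rw [Pi.sub_apply, coordShift, Function.update_self, powShift, Real.norm_eq_abs]
    have h3 : y j * powShiftFactor d (σ j * s) (y j) - y j
        = (powShiftFactor d (σ j * s) (y j) - 1) * y j := by ring
    rw [h3, abs_mul]
    have h4 : |powShiftFactor d (σ j * s) (y j) - 1| ≤ e := abs_le.2 ⟨by linarith, by linarith⟩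
    exact mul_le_mul h4 (norm_le_pi_norm y j) (abs_nonneg _) he0
  · rw [Pi.sub_apply, coordShift, Function.update_of_ne h, sub_self, norm_zero]
    positivity

theorem eucNorm_act_coordShift_le {n : ℕ} {σ : Fin n → ℝ} (hσ : ∀ i, |σ i| = 1) {d : ℕ}
    (hd : 2 ≤ d) (i : Fin n) {s T e L t : ℝ} (hT : 0 < T) (hs : |s| ≤ e * T ^ d)
    (he : e ≤ 1 / 2) (he0 : 0 ≤ e) {g : SLR n} (hg : mnorm (g : Matrix (Fin n) (Fin n) ℝ) ≤ L)
    (hg' : mnorm ((g⁻¹ : SLR n) : Matrix (Fin n) (Fin n) ℝ) ≤ L)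
    {y : Fin n → ℝ} (hy : T ≤ |y i|) (hyt : eucNorm (act y g⁻¹) ≤ t) :
    eucNorm (act (coordShift σ d i s y) g⁻¹) ≤ (1 + n * L ^ 2 * e) * t := by
  have hL : 0 ≤ L := (mnorm_nonneg _).trans hg
  have h1 : ‖y‖ ≤ L * t := by
    have h := norm_le_norm_act y g⁻¹
    rw [inv_inv] at h
    exact h.trans (mul_le_mul hg ((norm_le_eucNorm _).trans hyt) (norm_nonneg _) hL)
  have h2 : coordShift σ d i s y = y + (coordShift σ d i s y - y) := by abel
  rw [h2, act_add]
  refine (eucNorm_add_le _ _).trans ?_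
  have h3 := norm_coordShift_sub_le hσ hd i hT hs he he0 hy
  have h4 : eucNorm (act (coordShift σ d i s y - y) g⁻¹) ≤ n * (L * (e * (L * t))) := by
    refine (eucNorm_le _).trans ?_
    gcongr
    refine (norm_act_le _ _).trans ?_
    refine mul_le_mul hg' (h3.trans ?_) (norm_nonneg _) hL
    gcongr
  linarith

theorem region_indicator_le {n : ℕ} {σ : Fin n → ℝ} (hσ : ∀ i, |σ i| = 1) {d : ℕ}
    (hd : 2 ≤ d) {m : ℕ} (hm : Even m) (hm0 : m ≠ 0)
    {s T e L t R : ℝ} (hT : 0 < T) (hR : 0 < R) (hs : |s| ≤ e * T ^ d)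
    (he : e ≤ 1 / 2) (he0 : 0 ≤ e) {g : SLR n} (hg : mnorm (g : Matrix (Fin n) (Fin n) ℝ) ≤ L)
    (hg' : mnorm ((g⁻¹ : SLR n) : Matrix (Fin n) (Fin n) ℝ) ≤ L) (J : Set ℝ) (y : Fin n → ℝ) :
    {y : Fin n → ℝ | eucNorm (act y g⁻¹) ≤ t ∧ Fs σ d y ∈ J}.indicator
        (fun _ => (1 : ENNReal)) y
      ≤ (∑ i, {y : Fin n → ℝ | T ≤ |y i|}.indicator (fun y =>
          {y : Fin n → ℝ | eucNorm (act y g⁻¹) ≤ (1 + n * L ^ 2 * e) * t ∧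
            Fs σ d y ∈ {u | u + s ∈ J}}.indicator
          (fun y => ENNReal.ofReal (((1 - e) ^ m)⁻¹ * wgt m i y)) (coordShift σ d i s y)) y)
        + {y : Fin n → ℝ | ‖y‖ ≤ R}.indicator (fun _ => (1 : ENNReal)) y
        + {y : Fin n → ℝ | ‖y‖ ≤ L * t}.indicator
            (fun _ => ENNReal.ofReal (n * (T / R) ^ m)) y := by
  by_cases hy : eucNorm (act y g⁻¹) ≤ t ∧ Fs σ d y ∈ J
  swap
  · rw [Set.indicator_of_notMem (by exact hy)]
    exact zero_le
  rw [Set.indicator_of_mem (by exact hy)]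
  by_cases hyR : ‖y‖ ≤ R
  · rw [Set.indicator_of_mem (s := {y : Fin n → ℝ | ‖y‖ ≤ R}) (by exact hyR)]
    exact le_add_right le_add_self
  have hyL : ‖y‖ ≤ L * t := by
    have h := norm_le_norm_act y g⁻¹
    rw [inv_inv] at h
    exact h.trans (mul_le_mul hg ((norm_le_eucNorm _).trans hy.1) (norm_nonneg _)
      ((mnorm_nonneg _).trans hg))
  rw [Set.indicator_of_mem (s := {y : Fin n → ℝ | ‖y‖ ≤ L * t}) (by exact hyL)]
  have hR' := not_le.1 hyR
  have h1 := sum_wgt_eq hm hm0 (hR.trans hR')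
  have h2 : (1 : ENNReal) = ∑ i, ENNReal.ofReal (wgt m i y) := by
    rw [← ENNReal.ofReal_sum_of_nonneg (fun i _ => wgt_nonneg hm i y), h1, ENNReal.ofReal_one]
  have h3 : ENNReal.ofReal (n * (T / R) ^ m) = ∑ _i : Fin n, ENNReal.ofReal ((T / R) ^ m) := by
    rw [← ENNReal.ofReal_sum_of_nonneg (fun i _ => by positivity)]
    simp
  have h4 : ∀ a b : ENNReal, a + b ≤ a + 0 + b := fun a b => by simp
  refine le_trans ?_ (add_le_add (le_self_add (a := _)
    (b := {y : Fin n → ℝ | ‖y‖ ≤ R}.indicator (fun _ => (1 : ENNReal)) y)) le_rfl)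
  rw [h3, ← Finset.sum_add_distrib, h2]
  refine Finset.sum_le_sum fun i _ => ?_
  by_cases hi : T ≤ |y i|
  · refine le_add_right ?_
    rw [Set.indicator_of_mem (by exact hi), Set.indicator_of_mem]
    · refine ENNReal.ofReal_le_ofReal ?_
      rw [le_inv_mul_iff₀ (pow_pos (by linarith) m)]
      exact wgt_le_wgt_coordShift hm hσ hd i hT hs he he0 hi
    · refine ⟨eucNorm_act_coordShift_le hσ hd i hT hs he he0 hg hg' hi hy.1, ?_⟩
      rw [Fs_coordShift hσ hd i hT hs he hi]
      simpa using hy.2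
  · exact le_add_left (ENNReal.ofReal_le_ofReal (wgt_le hm hm0 hR hR'.le (not_le.1 hi).le))

theorem regVol_shift_le {n : ℕ} {σ : Fin n → ℝ} (hσ : ∀ i, |σ i| = 1) {d : ℕ}
    (hd : 2 ≤ d) {m : ℕ} (hm : Even m) (hm0 : m ≠ 0)
    {s T e L t R : ℝ} (hT : 0 < T) (hR : 0 < R) (hs : |s| ≤ e * T ^ d)
    (he : e ≤ 1 / 2) (he0 : 0 ≤ e) (ht : 0 ≤ t) {g : SLR n}
    (hg : mnorm (g : Matrix (Fin n) (Fin n) ℝ) ≤ L)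
    (hg' : mnorm ((g⁻¹ : SLR n) : Matrix (Fin n) (Fin n) ℝ) ≤ L) {J : Set ℝ}
    (hJ : MeasurableSet J) :
    regVol σ d g J t ≤ ENNReal.ofReal ((1 + 2 * e) ^ (m + d)) *
        regVol σ d g {u | u + s ∈ J} ((1 + n * L ^ 2 * e) * t)
      + ENNReal.ofReal ((2 * R) ^ n + n * (T / R) ^ m * (2 * (L * t)) ^ n) := by
  have hL : 0 ≤ L := (mnorm_nonneg _).trans hg
  have hJs : MeasurableSet {u | u + s ∈ J} := (measurable_id.add_const s) hJ
  set t' := (1 + n * L ^ 2 * e) * t with ht'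
  set A' := {y : Fin n → ℝ | eucNorm (act y g⁻¹) ≤ t' ∧ Fs σ d y ∈ {u | u + s ∈ J}} with hA'
  have hA'm : MeasurableSet A' := by
    have := measurableSet_region σ d 1 g⁻¹ hJs t'
    simpa only [act_one] using this
  have hAm := measurableSet_region σ d 1 g⁻¹ hJ t
  simp only [act_one] at hAm
  have hW : ∀ i, Measurable (A'.indicator
      (fun y => ENNReal.ofReal (((1 - e) ^ m)⁻¹ * wgt m i y))) := fun i =>
    (ENNReal.measurable_ofReal.comp ((measurable_wgt i).const_mul _)).indicator hA'm
  have hTm : ∀ i, MeasurableSet {y : Fin n → ℝ | T ≤ |y i|} := fun i =>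
    measurableSet_le measurable_const (by fun_prop)
  have hN : ∀ r : ℝ, MeasurableSet {y : Fin n → ℝ | ‖y‖ ≤ r} := fun r =>
    measurableSet_le (by fun_prop) measurable_const
  rw [regVol_eq σ d g hJ, regVol_eq σ d g hJs, ← hA']
  rw [← lintegral_indicator_one hAm]
  refine (lintegral_mono (region_indicator_le (R := R) hσ hd hm hm0 hT hR hs he he0 hg hg' J)).trans ?_
  rw [← ht', ← hA']
  rw [lintegral_add_right _ (measurable_const.indicator (hN _)),
    lintegral_add_right _ (measurable_const.indicator (hN _)), lintegral_indicator_const (hN _),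
    lintegral_indicator_const (hN _), volume_norm_le hR.le, volume_norm_le (by positivity), one_mul,
    add_assoc, ← ENNReal.ofReal_mul (by positivity), ← ENNReal.ofReal_add (by positivity)
    (by positivity)]
  refine add_le_add ?_ le_rfl
  have hWs : ∀ i, Measurable ({y : Fin n → ℝ | T ≤ |y i|}.indicator (fun y => A'.indicator
      (fun y => ENNReal.ofReal (((1 - e) ^ m)⁻¹ * wgt m i y)) (coordShift σ d i s y))) := fun i =>
    ((hW i).comp (measurable_coordShift σ d i s)).indicator (hTm i)
  rw [lintegral_finsetSum _ fun i _ => hWs i]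
  calc _ ≤ ∑ i : Fin n, ENNReal.ofReal ((1 + e) ^ d) * ∫⁻ y, A'.indicator
          (fun y => ENNReal.ofReal (((1 - e) ^ m)⁻¹ * wgt m i y)) y := by
        refine Finset.sum_le_sum fun i _ => ?_
        rw [lintegral_indicator (hTm i)]
        exact lintegral_coordShift_le hσ hd i hT hs he he0 (hW i)
    _ = ENNReal.ofReal ((1 + e) ^ d) * ∫⁻ y, ∑ i : Fin n, A'.indicator
      (fun y => ENNReal.ofReal (((1 - e) ^ m)⁻¹ * wgt m i y)) y := by
        rw [lintegral_finsetSum _ (fun i _ => hW i), Finset.mul_sum]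
    _ ≤ ENNReal.ofReal ((1 + e) ^ d) * ∫⁻ y, A'.indicator
      (fun _ => ENNReal.ofReal (((1 - e) ^ m)⁻¹)) y := by
        refine mul_le_mul_right (lintegral_mono fun y => ?_) _
        by_cases hy : y ∈ A'
        · simp only [Set.indicator_of_mem hy]
          have h1e : 0 < (1 - e) ^ m := pow_pos (by linarith) m
          rw [← ENNReal.ofReal_sum_of_nonneg (fun i _ => mul_nonneg (by positivity)
            (wgt_nonneg hm i y)), ← Finset.mul_sum]
          exact ENNReal.ofReal_le_ofReal
            (mul_le_of_le_one_right (by positivity) (sum_wgt_le y))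
        · simp only [Set.indicator_of_notMem hy, Finset.sum_const_zero, le_refl]
    _ = ENNReal.ofReal ((1 + e) ^ d * ((1 - e) ^ m)⁻¹) * volume A' := by
        rw [lintegral_indicator_const hA'm, ← mul_assoc, ← ENNReal.ofReal_mul (by positivity)]
    _ ≤ _ := by
        refine mul_le_mul_left (ENNReal.ofReal_le_ofReal ?_) _
        have h1 : (1 - e)⁻¹ ≤ 1 + 2 * e := by
          rw [inv_le_iff_one_le_mul₀ (by linarith)]
          nlinarith
        rw [← inv_pow, mul_comm, pow_add]
        refine mul_le_mul (pow_le_pow_left₀ (inv_nonneg.2 (by linarith)) h1 m)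
          (pow_le_pow_left₀ (by linarith) (by linarith) d) (by positivity) (by positivity)

theorem lintegral_regVol_inter {n : ℕ} (σ : Fin n → ℝ) (d : ℕ) (g : SLR n) {J : Set ℝ}
    (hJ : MeasurableSet J) (t : ℝ) {S : Set (ℝ × ℝ)} (hS : MeasurableSet S) {c : ENNReal}
    (hc : ∀ a, volume {s | (a, s) ∈ S} = c) :
    ∫⁻ s, regVol σ d g (J ∩ {u | (u, s) ∈ S}) t = regVol σ d g J t * c := by
  have hm : Measurable fun x : Fin n → ℝ => Fs σ d (act x g) :=
    ((continuous_Fs σ d).comp (continuous_act_left g)).measurable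
  have hA := measurableSet_region σ d g 1 hJ t
  simp only [act_one] at hA
  set A := {x : Fin n → ℝ | eucNorm x ≤ t ∧ Fs σ d (act x g) ∈ J} with hAdef
  set P := {p : (Fin n → ℝ) × ℝ | p.1 ∈ A ∧ (Fs σ d (act p.1 g), p.2) ∈ S} with hP
  have hPm : MeasurableSet P :=
    (measurable_fst hA).inter (((hm.comp measurable_fst).prodMk measurable_snd) hS)
  have h1 : ∀ s, regVol σ d g (J ∩ {u | (u, s) ∈ S}) t = volume ((fun x => (x, s)) ⁻¹' P) :=
    fun s => by
      rw [regVol]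
      congr 1
      ext x
      simp only [hP, hAdef, Set.mem_ofPred_eq, Set.mem_inter_iff, Set.mem_preimage]
      tauto
  simp_rw [h1]
  rw [← Measure.prod_apply_symm hPm, Measure.prod_apply hPm]
  have h2 : ∀ x, volume (Prod.mk x ⁻¹' P) = A.indicator (fun _ => c) x := fun x => by
    by_cases hx : x ∈ A
    · rw [Set.indicator_of_mem hx, ← hc (Fs σ d (act x g))]
      congr 1
      ext s
      simp [hP, hx]
    · rw [Set.indicator_of_notMem hx]
      convert measure_empty (μ := (volume : Measure ℝ))
      ext s
      simp [hP, hx]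
  simp_rw [h2]
  rw [lintegral_indicator_const hA, mul_comm, regVol]

theorem regVol_cross {n : ℕ} {σ : Fin n → ℝ} (hσ : ∀ i, |σ i| = 1) {d : ℕ}
    (hd : 2 ≤ d) {m : ℕ} (hm : Even m) (hm0 : m ≠ 0)
    {M T e L t R : ℝ} (hT : 0 < T) (hR : 0 < R) (hs : 2 * M ≤ e * T ^ d)
    (he : e ≤ 1 / 2) (he0 : 0 ≤ e) (ht : 0 ≤ t) {g : SLR n}
    (hg : mnorm (g : Matrix (Fin n) (Fin n) ℝ) ≤ L)
    (hg' : mnorm ((g⁻¹ : SLR n) : Matrix (Fin n) (Fin n) ℝ) ≤ L) {J K : Set ℝ}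
    (hJ : MeasurableSet J) (hK : MeasurableSet K) (hJM : J ⊆ Set.Icc (-M) M)
    (hKM : K ⊆ Set.Icc (-M) M) :
    volume K * regVol σ d g J t ≤ ENNReal.ofReal ((1 + 2 * e) ^ (m + d)) *
        (volume J * regVol σ d g K ((1 + n * L ^ 2 * e) * t))
      + ENNReal.ofReal (4 * M * ((2 * R) ^ n + n * (T / R) ^ m * (2 * (L * t)) ^ n)) := by
  have hL : 0 ≤ L := (mnorm_nonneg _).trans hg
  have h1 := lintegral_regVol_inter σ d g hJ t (S := {p : ℝ × ℝ | p.1 - p.2 ∈ K})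
    ((measurable_fst.sub measurable_snd) hK) (c := volume K) fun a => by
      have := (Measure.measurePreserving_sub_left volume a).measure_preimage hK.nullMeasurableSet
      exact this
  have h2 := lintegral_regVol_inter σ d g hK ((1 + n * L ^ 2 * e) * t)
    (S := {p : ℝ × ℝ | p.1 + p.2 ∈ J})
    ((measurable_fst.add measurable_snd) hJ) (c := volume J) fun a => by
      have := (measurePreserving_add_left volume a).measure_preimage hJ.nullMeasurableSet
      exact this
  set E := (2 * R) ^ n + n * (T / R) ^ m * (2 * (L * t)) ^ n with hE
  have hE0 : 0 ≤ E := by positivity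
  rw [mul_comm (volume K), ← h1, mul_comm (volume J), ← h2]
  have h3 : ENNReal.ofReal (4 * M * E) =
      ∫⁻ s, (Set.Icc (-(2 * M)) (2 * M)).indicator (fun _ => ENNReal.ofReal E) s := by
    rw [lintegral_indicator_const measurableSet_Icc, Real.volume_Icc,
      ← ENNReal.ofReal_mul hE0]
    congr 1
    ring
  rw [h3, ← lintegral_const_mul' _ _ ENNReal.ofReal_ne_top,
    ← lintegral_add_right _ (measurable_const.indicator measurableSet_Icc)]
  refine lintegral_mono fun s => ?_
  dsimp only
  by_cases hsM : s ∈ Set.Icc (-(2 * M)) (2 * M)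
  · rw [Set.indicator_of_mem hsM]
    have hJK : MeasurableSet (J ∩ {u | (u, s) ∈ {p : ℝ × ℝ | p.1 - p.2 ∈ K}}) :=
      hJ.inter ((measurable_id.sub_const s) hK)
    have h4 := regVol_shift_le hσ hd hm hm0 hT hR ((abs_le.2 hsM).trans hs) he he0 ht hg hg' hJK
    refine h4.trans (add_le_add (mul_le_mul_right (regVol_mono σ d g ?_ le_rfl) _) le_rfl)
    intro u hu
    simp only [Set.mem_ofPred_eq, Set.mem_inter_iff, add_sub_cancel_right] at hu ⊢
    exact ⟨hu.2, hu.1⟩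
  · have h5 : J ∩ {u | (u, s) ∈ {p : ℝ × ℝ | p.1 - p.2 ∈ K}} = ∅ := by
      rw [Set.eq_empty_iff_forall_notMem]
      rintro u ⟨hu1, hu2⟩
      have a1 := hJM hu1
      have a2 := hKM hu2
      simp only [Set.mem_Icc] at a1 a2
      exact hsM ⟨by linarith, by linarith⟩
    rw [h5, regVol]
    simp

theorem one_add_pow_le {x : ℝ} (hx0 : 0 ≤ x) (hx1 : x ≤ 1) (k : ℕ) :
    (1 + x) ^ k ≤ 1 + 2 ^ k * x := by
  have h : (1 + x) ^ k ≤ 1 + (2 ^ k - 1) * x := by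
    induction k with
    | zero => simp
    | succ k ih =>
      have h2 : (1 : ℝ) ≤ 2 ^ k := one_le_pow₀ (by norm_num)
      calc (1 + x) ^ (k + 1) = (1 + x) ^ k * (1 + x) := pow_succ _ _
        _ ≤ (1 + (2 ^ k - 1) * x) * (1 + x) := mul_le_mul_of_nonneg_right ih (by linarith)
        _ ≤ 1 + (2 ^ (k + 1) - 1) * x := by
          rw [pow_succ]
          nlinarith [mul_nonneg (mul_nonneg (sub_nonneg.2 h2) hx0) (sub_nonneg.2 hx1)]
  linarith

theorem exists_rpow_neg_le {θ δ : ℝ} (hθ : 0 < θ) (hδ : 0 < δ) :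
    ∃ t₀ ≥ (1 : ℝ), ∀ t ≥ t₀, t ^ (-θ) ≤ δ := by
  have h := (tendsto_rpow_neg_atTop hθ).eventually (eventually_le_nhds hδ)
  obtain ⟨a, ha⟩ := eventually_atTop.1 h
  exact ⟨max 1 a, le_max_left _ _, fun t ht => ha t ((le_max_right _ _).trans ht)⟩

theorem exists_regVol_cross {n : ℕ} (hn : 0 < n) {σ : Fin n → ℝ} (hσ : ∀ i, |σ i| = 1) {d : ℕ}
    (hd : 2 ≤ d) (hdn : d ≤ n) {β : ℝ} (hβ : 0 < β) :
    ∃ θ > (0 : ℝ), θ ≤ β / 2 ∧ ∀ L M : ℝ, 1 ≤ L → 1 ≤ M → ∃ C ≥ (1 : ℝ), ∃ t₀ ≥ (1 : ℝ),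
      (∀ t ≥ t₀, C * t ^ (-θ) ≤ 1) ∧ ∀ g ∈ KL n L, ∀ t ≥ t₀, ∀ J K : Set ℝ, MeasurableSet J →
        MeasurableSet K → J ⊆ Set.Icc (-M) M → K ⊆ Set.Icc (-M) M →
        volume K * regVol σ d g J t ≤ ENNReal.ofReal (1 + C * t ^ (-θ)) *
          (volume J * regVol σ d g K ((1 + C * t ^ (-θ)) * t)) + ENNReal.ofReal (C * t ^ β) := by
  have hn0 : (0 : ℝ) < n := by exact_mod_cast hn
  have hd0 : (0 : ℝ) < d := by positivity
  set τ : ℝ := β / (2 * n) with hτ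
  have hτ0 : 0 < τ := by positivity
  obtain ⟨k, hk⟩ := exists_nat_ge (n / τ)
  set m := 2 * (k + 1) with hmdef
  have hm : Even m := even_two_mul _
  have hm0 : m ≠ 0 := by omega
  have hmτ : (n : ℝ) ≤ m * τ := by
    rw [div_le_iff₀ hτ0] at hk
    have : (k : ℝ) ≤ m := by rw [hmdef]; push_cast; linarith
    exact hk.trans (mul_le_mul_of_nonneg_right this hτ0.le)
  refine ⟨d * τ, by positivity, ?_, ?_⟩
  · rw [hτ, mul_div_assoc', div_le_div_iff₀ (by positivity) (by norm_num)]
    have : (d : ℝ) ≤ n := by exact_mod_cast hdn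
    nlinarith
  intro L₀ M hL₀ hM
  obtain ⟨L₁, hL₁, hinv⟩ := exists_mnorm_inv_le n L₀
  set L := max L₀ L₁ with hL
  have hL0 : 0 ≤ L := by rw [hL]; exact le_max_of_le_left (by linarith)
  set C : ℝ := 1 + 2 ^ (m + d) * (4 * M) + n * L ^ 2 * (2 * M)
    + 4 * M * (2 ^ n + n * (2 * L) ^ n) with hC
  have hM0 : 0 < M := by linarith
  have c1 : (0 : ℝ) ≤ 2 ^ (m + d) * (4 * M) := by positivity
  have c2 : (0 : ℝ) ≤ n * L ^ 2 * (2 * M) := by positivity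
  have c3 : (0 : ℝ) ≤ 4 * M * (2 ^ n + n * (2 * L) ^ n) := by positivity
  have hC1 : 1 ≤ C := by rw [hC]; linarith
  obtain ⟨t₁, ht₁, h1⟩ := exists_rpow_neg_le (θ := d * τ) (δ := 1 / (4 * M)) (by positivity)
    (by positivity)
  obtain ⟨t₂, ht₂, h2⟩ := exists_rpow_neg_le (θ := d * τ) (δ := 1 / C) (by positivity)
    (by positivity)
  refine ⟨C, hC1, max t₁ t₂, le_max_of_le_left ht₁, fun t ht => ?_, ?_⟩
  · have := h2 t ((le_max_right _ _).trans ht)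
    rw [le_div_iff₀ (by positivity)] at this
    linarith
  intro g hg t ht J K hJ hK hJM hKM
  have ht1 : 1 ≤ t := (le_max_of_le_left ht₁).trans ht
  have ht0 : 0 < t := by linarith
  set x := t ^ (-(d * τ)) with hx
  have hx0 : 0 < x := Real.rpow_pos_of_pos ht0 _
  have hxM : x * (4 * M) ≤ 1 := by
    have := h1 t ((le_max_left _ _).trans ht)
    rwa [le_div_iff₀ (by positivity)] at this
  have hTd : (t ^ τ) ^ d = t ^ (d * τ) := by
    rw [← Real.rpow_natCast, ← Real.rpow_mul ht0.le, mul_comm]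
  have hmul : x * t ^ (d * τ) = 1 := by
    rw [hx, ← Real.rpow_add ht0]; simp
  have key := regVol_cross hσ hd hm hm0 (M := M) (T := t ^ τ) (R := t ^ (2 * τ)) (e := 2 * M * x)
    (L := L) (t := t) (by positivity) (by positivity)
    (by rw [hTd, mul_assoc, hmul, mul_one]) (by linarith) (by positivity) ht0.le
    (hg.trans (le_max_left _ _)) ((hinv g hg).trans (le_max_right _ _)) hJ hK hJM hKM
  refine key.trans (add_le_add (mul_le_mul' (ENNReal.ofReal_le_ofReal ?_) (mul_le_mul_right
    (regVol_mono σ d g subset_rfl (mul_le_mul_of_nonneg_right ?_ ht0.le)) _))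
    (ENNReal.ofReal_le_ofReal ?_))
  · refine (one_add_pow_le (by positivity) (by linarith) _).trans ?_
    have : 2 ^ (m + d) * (2 * (2 * M * x)) = 2 ^ (m + d) * (4 * M) * x := by ring
    rw [this]
    gcongr
    rw [hC]; linarith
  · have : n * L ^ 2 * (2 * M * x) = n * L ^ 2 * (2 * M) * x := by ring
    rw [this]
    gcongr
    rw [hC]; linarith
  · have e1 : (t ^ (2 * τ)) ^ n = t ^ β := by
      rw [← Real.rpow_natCast, ← Real.rpow_mul ht0.le, hτ]
      congr 1
      field_simp
    have e2 : (t ^ τ / t ^ (2 * τ)) ^ m * t ^ n ≤ 1 := by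
      rw [← Real.rpow_sub ht0, ← Real.rpow_natCast (t ^ _), ← Real.rpow_mul ht0.le,
        ← Real.rpow_natCast t, ← Real.rpow_add ht0]
      exact Real.rpow_le_one_of_one_le_of_nonpos ht1 (by linarith)
    have e3 : 1 ≤ t ^ β := Real.one_le_rpow ht1 hβ.le
    have e4 : (2 * t ^ (2 * τ)) ^ n + n * (t ^ τ / t ^ (2 * τ)) ^ m * (2 * (L * t)) ^ n
        ≤ (2 ^ n + n * (2 * L) ^ n) * t ^ β := by
      have : n * (t ^ τ / t ^ (2 * τ)) ^ m * (2 * (L * t)) ^ n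
          = n * (2 * L) ^ n * ((t ^ τ / t ^ (2 * τ)) ^ m * t ^ n) := by
        rw [← mul_assoc 2 L t, mul_pow (2 * L) t]; ring
      rw [mul_pow, e1, this, add_mul]
      have := mul_le_mul_of_nonneg_left (e2.trans e3) (by positivity : 0 ≤ n * (2 * L) ^ n)
      linarith
    calc _ ≤ 4 * M * ((2 ^ n + n * (2 * L) ^ n) * t ^ β) :=
          mul_le_mul_of_nonneg_left e4 (by positivity)
      _ = 4 * M * (2 ^ n + n * (2 * L) ^ n) * t ^ β := by ring
      _ ≤ C * t ^ β := by
        gcongr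
        rw [hC]; linarith

theorem exists_limit_of_dyadic {q : ℝ → ℝ} {D θ t₁ : ℝ} (hD : 0 ≤ D) (hθ : 0 < θ) (ht₁ : 1 ≤ t₁)
    (hq : ∀ t ≥ t₁, ∀ b ∈ Set.Icc (2 : ℝ) 4, |q (b * t) - q t| ≤ D * t ^ (-θ)) :
    ∃ l, ∀ t ≥ 2 * t₁, |q t - l| ≤ D * (1 + 1 / (1 - 2 ^ (-θ))) * 4 ^ θ * t ^ (-θ) := by
  have ht0 : 0 < t₁ := by linarith
  set r : ℝ := 2 ^ (-θ) with hr
  have hr0 : 0 < r := by positivity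
  have hr1 : r < 1 := Real.rpow_lt_one_of_one_lt_of_neg (by norm_num) (by linarith)
  have hpow : ∀ j : ℕ, (2 ^ j * t₁) ^ (-θ) = t₁ ^ (-θ) * r ^ j := fun j => by
    rw [Real.mul_rpow (by positivity) ht0.le, hr, ← Real.rpow_natCast, ← Real.rpow_natCast,
      ← Real.rpow_mul (by norm_num), ← Real.rpow_mul (by norm_num), mul_comm (j : ℝ), mul_comm]
  have hge : ∀ j : ℕ, t₁ ≤ 2 ^ j * t₁ := fun j =>
    le_mul_of_one_le_left ht0.le (one_le_pow₀ (by norm_num))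
  have hstep : ∀ j : ℕ, dist (q (2 ^ j * t₁)) (q (2 ^ (j + 1) * t₁)) ≤ D * t₁ ^ (-θ) * r ^ j :=
    fun j => by
      have h := hq _ (hge j) 2 ⟨le_rfl, by norm_num⟩
      rw [hpow, ← mul_assoc, ← mul_assoc, ← pow_succ'] at h
      rwa [dist_comm, Real.dist_eq]
  obtain ⟨l, hl⟩ := cauchySeq_tendsto_of_complete (cauchySeq_of_le_geometric r _ hr1 hstep)
  have hlim := dist_le_of_le_geometric_of_tendsto r _ hr1 hstep hl
  refine ⟨l, fun t ht => ?_⟩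
  obtain ⟨j, hj1, hj2⟩ := exists_nat_pow_near (x := t / (2 * t₁)) (y := (2 : ℝ))
    (by rw [one_le_div (by positivity)]; exact ht) (by norm_num)
  rw [le_div_iff₀ (by positivity)] at hj1
  rw [div_lt_iff₀ (by positivity), pow_succ] at hj2
  set u := 2 ^ j * t₁ with hu
  have hu0 : 0 < u := by positivity
  have h1 := hq u (hge j) (t / u) ⟨by rw [le_div_iff₀ hu0, hu]; linarith,
    by rw [div_le_iff₀ hu0, hu]; linarith⟩
  rw [div_mul_cancel₀ _ hu0.ne'] at h1
  have h2 := hlim j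
  rw [Real.dist_eq, ← hu, mul_assoc, ← hpow, ← hu] at h2
  have h3 : u ^ (-θ) ≤ 4 ^ θ * t ^ (-θ) := by
    have : (4 : ℝ) ^ θ * t ^ (-θ) = (t / 4) ^ (-θ) := by
      rw [Real.div_rpow (by linarith) (by norm_num), Real.rpow_neg (by norm_num : (0 : ℝ) ≤ 4),
        div_inv_eq_mul, mul_comm]
    rw [this]
    exact Real.rpow_le_rpow_of_nonpos (by linarith) (by rw [hu]; linarith) (by linarith)
  have h4 : 0 < 1 - r := by linarith
  calc |q t - l| ≤ |q t - q u| + |q u - l| := abs_sub_le _ _ _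
    _ ≤ D * u ^ (-θ) + D * u ^ (-θ) / (1 - r) := add_le_add h1 h2
    _ = D * (1 + 1 / (1 - r)) * u ^ (-θ) := by ring
    _ ≤ D * (1 + 1 / (1 - r)) * (4 ^ θ * t ^ (-θ)) :=
      mul_le_mul_of_nonneg_left h3 (by positivity)
    _ = _ := by ring

theorem growth_step {f : ℝ → ℝ} {k : ℕ} (hk : 1 ≤ k) {C θ t₀ : ℝ} (hC : 1 ≤ C) (hθ : 0 < θ)
    (hθ1 : θ ≤ 1 / 2) (ht₀ : 1 ≤ t₀) (hf0 : ∀ t, 0 ≤ f t) (hmono : Monotone f)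
    (h1 : ∀ t ≥ t₀, ∀ a ∈ Set.Icc (1 : ℝ) 8,
      a ^ k * f t ≤ (1 + C * t ^ (-θ)) * f (a * ((1 + C * t ^ (-θ)) * t)) + C * t ^ (1 / 2 : ℝ))
    (h2 : ∀ t ≥ t₀, ∀ a ∈ Set.Icc (1 : ℝ) 8,
      f (a * t) ≤ (1 + C * t ^ (-θ)) * (a ^ k * f ((1 + C * t ^ (-θ)) * t)) + C * t ^ (1 / 2 : ℝ))
    {t b : ℝ} (ht : 2 * t₀ ≤ t) (htC : 2 * C * t ^ (-θ) ≤ 1) (hb : b ∈ Set.Icc (2 : ℝ) 4) :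
    f (b * t) / (b * t) ^ k + 1
        ≤ (1 + 2 ^ (k + 2) * C * t ^ (-θ)) * (f t / t ^ k + 1) ∧
      f t / t ^ k + 1
        ≤ (1 + 2 ^ (k + 2) * C * t ^ (-θ)) * (f (b * t) / (b * t) ^ k + 1) := by
  obtain ⟨hb2, hb4⟩ := hb
  have ht0 : 0 < t := by linarith
  have hb0 : 0 < b := by linarith
  have hC0 : 0 < C := by linarith
  set x := t ^ (-θ) with hx
  have hx0 : 0 < x := Real.rpow_pos_of_pos ht0 _
  have hhalf : t ^ (1 / 2 : ℝ) ≤ t ^ k * x := by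
    rw [hx, ← Real.rpow_natCast, ← Real.rpow_add ht0]
    refine Real.rpow_le_rpow_of_exponent_le (by linarith) ?_
    have : (1 : ℝ) ≤ k := by exact_mod_cast hk
    linarith
  have htk : 0 < t ^ k := pow_pos ht0 k
  have hbk : 1 ≤ b ^ k := one_le_pow₀ (by linarith)
  have hbk0 : 0 < b ^ k := by linarith
  have hp2 : (2 : ℝ) ≤ 2 ^ (k + 2) := by
    calc (2 : ℝ) = 2 ^ 1 := by norm_num
      _ ≤ 2 ^ (k + 2) := pow_le_pow_right₀ (by norm_num) (by omega)
  have hm0 : 0 ≤ f t / t ^ k := div_nonneg (hf0 _) htk.le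
  have hm1 : 0 ≤ f (b * t) / (b * t) ^ k := div_nonneg (hf0 _) (by positivity)
  have fin : ∀ {e y z : ℝ}, 0 ≤ e → e ≤ 2 * C * x → 0 ≤ z →
      y ≤ (1 + e) ^ (k + 1) * z + C * x → y + 1 ≤ (1 + 2 ^ (k + 2) * C * x) * (z + 1) := by
    intro e y z he he1 hz hy
    have h3 := one_add_pow_le he (he1.trans htC) (k + 1)
    have h4 : (2 : ℝ) ^ (k + 1) * e ≤ 2 ^ (k + 2) * C * x := by
      rw [pow_succ _ (k + 1)]
      calc (2 : ℝ) ^ (k + 1) * e ≤ 2 ^ (k + 1) * (2 * C * x) := by gcongr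
        _ = _ := by ring
    have h5 : (1 + e) ^ (k + 1) * z ≤ (1 + 2 ^ (k + 2) * C * x) * z :=
      mul_le_mul_of_nonneg_right (by linarith) hz
    have h6 : C * x ≤ 2 ^ (k + 2) * C * x := by
      rw [mul_assoc]
      exact le_mul_of_one_le_left (by positivity) (by linarith)
    linarith
  constructor
  · set e := 2 * C * x with he
    have he0 : 0 < e := by positivity
    set u := t / (1 + e) with hu
    have hut : u * (1 + e) = t := div_mul_cancel₀ _ (by positivity)
    have hu2 : t / 2 ≤ u := by
      rw [hu]
      exact div_le_div_of_nonneg_left ht0.le (by linarith) (by linarith)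
    have hu0 : 0 < u := by linarith
    have hule : u ≤ t := by nlinarith
    have hux : C * u ^ (-θ) ≤ e := by
      have e1 : u ^ (-θ) ≤ (t / 2) ^ (-θ) :=
        Real.rpow_le_rpow_of_nonpos (by linarith) hu2 (by linarith)
      have e2 : (t / 2) ^ (-θ) = 2 ^ θ * x := by
        rw [Real.div_rpow ht0.le (by norm_num), Real.rpow_neg (by norm_num : (0 : ℝ) ≤ 2),
          div_inv_eq_mul, mul_comm]
      have e3 : (2 : ℝ) ^ θ ≤ 2 := by
        calc (2 : ℝ) ^ θ ≤ 2 ^ (1 : ℝ) :=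
              Real.rpow_le_rpow_of_exponent_le (by norm_num) (by linarith)
          _ = 2 := Real.rpow_one 2
      rw [e2] at e1
      have e4 : (2 : ℝ) ^ θ * x ≤ 2 * x := mul_le_mul_of_nonneg_right e3 hx0.le
      rw [he]
      nlinarith
    have h3 := h2 u (by linarith) (b * (1 + e)) ⟨by nlinarith, by nlinarith⟩
    have e5 : b * (1 + e) * u = b * t := by rw [mul_assoc, mul_comm (1 + e), hut]
    rw [e5] at h3
    have e6 : f ((1 + C * u ^ (-θ)) * u) ≤ f t := by
      refine hmono ?_
      rw [← hut, mul_comm]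
      exact mul_le_mul_of_nonneg_left (by linarith) hu0.le
    have e7 : u ^ (1 / 2 : ℝ) ≤ t ^ k * x :=
      (Real.rpow_le_rpow hu0.le hule (by norm_num)).trans hhalf
    have hCu : 0 ≤ C * u ^ (-θ) := by positivity
    have e8 : f (b * t) ≤ (1 + e) * ((b * (1 + e)) ^ k * f t) + C * (t ^ k * x) := by
      refine h3.trans (add_le_add ?_ (mul_le_mul_of_nonneg_left e7 hC0.le))
      refine mul_le_mul (by linarith) (mul_le_mul_of_nonneg_left e6 (by positivity)) ?_
        (by positivity)
      exact mul_nonneg (by positivity) (hf0 _)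
    refine fin he0.le le_rfl hm0 ?_
    rw [div_le_iff₀ (by positivity)]
    refine e8.trans ?_
    have e9 : (1 + e) * ((b * (1 + e)) ^ k * f t)
        = (1 + e) ^ (k + 1) * (f t / t ^ k) * (b * t) ^ k := by
      rw [mul_pow, mul_pow, pow_succ]; field_simp
    have e10 : C * (t ^ k * x) ≤ C * x * (b * t) ^ k := by
      have : C * x * (b * t) ^ k = b ^ k * (C * (t ^ k * x)) := by rw [mul_pow]; ring
      rw [this]
      exact le_mul_of_one_le_left (by positivity) hbk
    rw [e9, add_mul]
    linarith
  · set e := C * x with he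
    have he0 : 0 < e := by positivity
    have he1 : e ≤ 1 := by linarith
    have h3 := h1 t (by linarith) (b / (1 + e))
      ⟨by rw [le_div_iff₀ (by positivity)]; linarith,
        by rw [div_le_iff₀ (by positivity)]; linarith⟩
    have e1 : b / (1 + e) * ((1 + e) * t) = b * t := by field_simp
    rw [← he, e1] at h3
    refine fin he0.le (by linarith) hm1 ?_
    rw [div_le_iff₀ htk]
    have e2 : f t = (b / (1 + e)) ^ k * f t * ((1 + e) / b) ^ k := by
      rw [mul_right_comm, ← mul_pow]
      have : b / (1 + e) * ((1 + e) / b) = 1 := by field_simp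
      rw [this, one_pow, one_mul]
    have e3 : ((1 + e) / b) ^ k ≤ 1 :=
      pow_le_one₀ (by positivity) (by rw [div_le_one hb0]; linarith)
    rw [e2]
    refine (mul_le_mul_of_nonneg_right h3 (by positivity)).trans ?_
    have e4 : (1 + e) * f (b * t) * ((1 + e) / b) ^ k
        = (1 + e) ^ (k + 1) * (f (b * t) / (b * t) ^ k) * t ^ k := by
      rw [mul_pow, div_pow, pow_succ]; field_simp
    have e5 : C * t ^ (1 / 2 : ℝ) * ((1 + e) / b) ^ k ≤ C * (t ^ k * x) * 1 :=
      mul_le_mul (mul_le_mul_of_nonneg_left hhalf hC0.le) e3 (by positivity) (by positivity)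
    rw [add_mul, e4, add_mul, he]
    linarith

theorem growth_limit {n k : ℕ} (hk : 1 ≤ k) {C θ t₀ : ℝ} (hC : 1 ≤ C) (hθ : 0 < θ)
    (hθ1 : θ ≤ 1 / 2) (ht₀ : 1 ≤ t₀) :
    ∃ C' ≥ (1 : ℝ), ∀ f : ℝ → ℝ, (∀ t, 0 ≤ f t) → Monotone f → (∀ t ≥ 0, f t ≤ (2 * t) ^ n) →
    (∀ t ≥ t₀, ∀ a ∈ Set.Icc (1 : ℝ) 8,
      a ^ k * f t ≤ (1 + C * t ^ (-θ)) * f (a * ((1 + C * t ^ (-θ)) * t)) + C * t ^ (1 / 2 : ℝ)) →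
    (∀ t ≥ t₀, ∀ a ∈ Set.Icc (1 : ℝ) 8,
      f (a * t) ≤ (1 + C * t ^ (-θ)) * (a ^ k * f ((1 + C * t ^ (-θ)) * t))
        + C * t ^ (1 / 2 : ℝ)) →
    ∃ c ≤ C', ∀ t ≥ C', |f t - c * t ^ k| ≤ C' * (t ^ k * t ^ (-θ)) := by
  obtain ⟨t₁, ht₁, hs⟩ := exists_rpow_neg_le (δ := 1 / (2 * C)) hθ (by positivity)
  set D := 2 ^ (k + 2) * C with hD
  have hD0 : 0 < D := by positivity
  set t₂ := max (2 * t₀) t₁ with ht₂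
  have ht₂1 : 1 ≤ t₂ := le_max_of_le_right ht₁
  have hr1 : (2 : ℝ) ^ (-θ) < 1 := Real.rpow_lt_one_of_one_lt_of_neg (by norm_num) (by linarith)
  set D' := D * (1 + 1 / (1 - 2 ^ (-θ))) * 4 ^ θ with hD'
  have hD'0 : 0 < D' := by
    have : 0 < 1 - (2 : ℝ) ^ (-θ) := by linarith
    positivity
  obtain ⟨t₃, ht₃, hs3⟩ := exists_rpow_neg_le (δ := 1 / D') hθ (by positivity)
  set t₄ := max (2 * t₂) t₃ with ht₄
  have ht₄1 : 1 ≤ t₄ := le_max_of_le_right ht₃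
  set B := ((2 * t₄) ^ n + 1) * Real.exp 1 with hB
  have hB0 : 0 < B := by positivity
  refine ⟨1 + t₄ + B + 2 * B * D', by nlinarith [mul_pos hB0 hD'0], ?_⟩
  intro f hf0 hmono hfn h1 h2
  have hQ : ∀ t, 0 < t → 1 ≤ f t / t ^ k + 1 := fun t ht => by
    have := div_nonneg (hf0 t) (pow_pos ht k).le
    linarith
  obtain ⟨l, hl⟩ := exists_limit_of_dyadic (q := fun t => Real.log (f t / t ^ k + 1)) hD0.le hθ
    ht₂1 fun t ht b hb => by
      have ht0 : 0 < t := by linarith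
      have htC : 2 * C * t ^ (-θ) ≤ 1 := by
        have := hs t ((le_max_right _ _).trans ht)
        rw [le_div_iff₀ (by positivity)] at this
        linarith
      obtain ⟨g1, g2⟩ := growth_step hk hC hθ hθ1 ht₀ hf0 hmono h1 h2
        ((le_max_left _ _).trans ht) htC hb
      have q1 := hQ t ht0
      have q2 := hQ (b * t) (mul_pos (by linarith [hb.1]) ht0)
      rw [← hD] at g1 g2
      have hx0 : 0 ≤ D * t ^ (-θ) := by positivity
      have e1 := Real.log_le_log (by linarith) g1
      have e2 := Real.log_le_log (by linarith) g2
      rw [Real.log_mul (by linarith) (by linarith)] at e1 e2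
      have e3 := Real.log_le_sub_one_of_pos (show 0 < 1 + D * t ^ (-θ) by linarith)
      rw [abs_le]
      constructor <;> linarith
  rw [← hD'] at hl
  have hsmall : ∀ t ≥ t₄, |Real.log (f t / t ^ k + 1) - l| ≤ D' * t ^ (-θ) ∧ D' * t ^ (-θ) ≤ 1 := by
    intro t ht
    refine ⟨hl t ((le_max_left _ _).trans ht), ?_⟩
    have := hs3 t ((le_max_right _ _).trans ht)
    rw [le_div_iff₀ hD'0] at this
    linarith
  have hlB : Real.exp l ≤ B := by
    obtain ⟨a1, a2⟩ := hsmall t₄ le_rfl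
    have a3 := (abs_le.1 a1).1
    have q1 := hQ t₄ (by linarith)
    have a4 : f t₄ / t₄ ^ k + 1 ≤ (2 * t₄) ^ n + 1 := by
      have := div_le_self (hf0 t₄) (one_le_pow₀ ht₄1 (n := k))
      linarith [hfn t₄ (by linarith)]
    calc Real.exp l ≤ Real.exp (Real.log (f t₄ / t₄ ^ k + 1) + 1) := Real.exp_le_exp.2 (by linarith)
      _ = (f t₄ / t₄ ^ k + 1) * Real.exp 1 := by rw [Real.exp_add, Real.exp_log (by linarith)]
      _ ≤ B := mul_le_mul_of_nonneg_right a4 (Real.exp_pos 1).le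
  have hBD : 0 < 2 * B * D' := by positivity
  refine ⟨Real.exp l - 1, by linarith, fun t ht => ?_⟩
  have ht4 : t₄ ≤ t := by linarith
  have ht0 : 0 < t := by linarith
  obtain ⟨a1, a2⟩ := hsmall t ht4
  have q1 := hQ t ht0
  have htk : 0 < t ^ k := pow_pos ht0 k
  have hx0 : 0 < t ^ (-θ) := Real.rpow_pos_of_pos ht0 _
  set s := Real.log (f t / t ^ k + 1) - l with hsdef
  have a5 : f t - (Real.exp l - 1) * t ^ k = Real.exp l * (Real.exp s - 1) * t ^ k := by
    have : Real.exp l * Real.exp s = f t / t ^ k + 1 := by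
      rw [← Real.exp_add, hsdef, add_sub_cancel, Real.exp_log (by linarith)]
    have h6 : f t = (f t / t ^ k) * t ^ k := by field_simp
    linear_combination h6 - t ^ k * this
  have a6 := Real.abs_exp_sub_one_le (a1.trans a2)
  rw [a5, abs_mul, abs_mul, abs_of_pos (Real.exp_pos l), abs_of_pos htk]
  calc Real.exp l * |Real.exp s - 1| * t ^ k ≤ B * (2 * (D' * t ^ (-θ))) * t ^ k := by
        gcongr
        linarith
    _ = 2 * B * D' * (t ^ k * t ^ (-θ)) := by ring
    _ ≤ _ := by
      gcongr
      linarith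

theorem regVol_ne_top {n : ℕ} (σ : Fin n → ℝ) (d : ℕ) (g : SLR n) (J : Set ℝ) (t : ℝ) :
    regVol σ d g J t ≠ ⊤ :=
  ((regVol_mono σ d g subset_rfl (le_max_left t 0)).trans
    (regVol_le σ d g J (le_max_right t 0))).trans_lt ENNReal.ofReal_lt_top |>.ne

theorem Fs_smul {n : ℕ} (σ : Fin n → ℝ) (d : ℕ) (a : ℝ) (x : Fin n → ℝ) :
    Fs σ d (a • x) = a ^ d * Fs σ d x := by
  simp only [Fs, Pi.smul_apply, smul_eq_mul, mul_pow, Finset.mul_sum]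
  exact Finset.sum_congr rfl fun i _ => by ring

theorem regVol_scale {n : ℕ} (σ : Fin n → ℝ) (d : ℕ) (g : SLR n) {a : ℝ} (ha : 0 < a) (t : ℝ) :
    (regVol σ d g (Set.Icc 0 1) (a * t)).toReal
      = a ^ n * (regVol σ d g (Set.Icc 0 (a ^ d)⁻¹) t).toReal := by
  have h := Measure.addHaar_preimage_smul (volume : Measure (Fin n → ℝ)) ha.ne'
    {x : Fin n → ℝ | eucNorm x ≤ a * t ∧ Fs σ d (act x g) ∈ Set.Icc 0 1}
  have h1 : ((a • ·) : (Fin n → ℝ) → Fin n → ℝ) ⁻¹'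
      {x : Fin n → ℝ | eucNorm x ≤ a * t ∧ Fs σ d (act x g) ∈ Set.Icc 0 1}
      = {x : Fin n → ℝ | eucNorm x ≤ t ∧ Fs σ d (act x g) ∈ Set.Icc 0 (a ^ d)⁻¹} := by
    ext x
    have had : 0 < a ^ d := by positivity
    simp only [Set.mem_preimage, Set.mem_ofPred_eq, eucNorm_smul, act_smul, Fs_smul, abs_of_pos ha,
      Set.mem_Icc, mul_le_mul_iff_right₀ ha, mul_nonneg_iff_of_pos_left had]
    rw [← one_div, le_div_iff₀' had]
  rw [h1, Module.finrank_fin_fun] at h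
  have han : 0 < a ^ n := by positivity
  unfold regVol
  rw [h, ENNReal.toReal_mul, ENNReal.toReal_ofReal (abs_nonneg _), abs_of_pos (by positivity),
    ← mul_assoc, mul_inv_cancel₀ han.ne', one_mul]

theorem exists_regVol_cross_real {n : ℕ} (hn : 0 < n) {σ : Fin n → ℝ} (hσ : ∀ i, |σ i| = 1)
    {d : ℕ} (hd : 2 ≤ d) (hdn : d ≤ n) {β : ℝ} (hβ : 0 < β) :
    ∃ θ > (0 : ℝ), θ ≤ β / 2 ∧ ∀ L M : ℝ, 1 ≤ L → 1 ≤ M → ∃ C ≥ (1 : ℝ), ∃ t₀ ≥ (1 : ℝ),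
      (∀ t ≥ t₀, C * t ^ (-θ) ≤ 1) ∧ ∀ g ∈ KL n L, ∀ t ≥ t₀, ∀ J K : Set ℝ, MeasurableSet J →
        MeasurableSet K → J ⊆ Set.Icc (-M) M → K ⊆ Set.Icc (-M) M →
        (volume K).toReal * (regVol σ d g J t).toReal ≤ (1 + C * t ^ (-θ)) *
          ((volume J).toReal * (regVol σ d g K ((1 + C * t ^ (-θ)) * t)).toReal) + C * t ^ β := by
  obtain ⟨θ, hθ, hθβ, h⟩ := exists_regVol_cross hn hσ hd hdn hβ
  refine ⟨θ, hθ, hθβ, fun L M hL hM => ?_⟩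
  obtain ⟨C, hC, t₀, ht₀, h1, h2⟩ := h L M hL hM
  refine ⟨C, hC, t₀, ht₀, h1, fun g hg t ht J K hJ hK hJM hKM => ?_⟩
  have h3 := h2 g hg t ht J K hJ hK hJM hKM
  have hfin : ∀ {A : Set ℝ}, A ⊆ Set.Icc (-M) M → volume A ≠ ⊤ := fun hA =>
    ((measure_mono hA).trans_lt (by rw [Real.volume_Icc]; exact ENNReal.ofReal_lt_top)).ne
  have ht0 : 0 < t := by linarith
  have hx : 0 ≤ C * t ^ (-θ) := by positivity
  have h4 : ENNReal.ofReal (1 + C * t ^ (-θ)) *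
      (volume J * regVol σ d g K ((1 + C * t ^ (-θ)) * t)) ≠ ⊤ :=
    ENNReal.mul_ne_top ENNReal.ofReal_ne_top (ENNReal.mul_ne_top (hfin hJM) (regVol_ne_top _ _ _ _ _))
  have h5 := ENNReal.toReal_mono (ENNReal.add_ne_top.2 ⟨h4, ENNReal.ofReal_ne_top⟩) h3
  rw [ENNReal.toReal_add h4 ENNReal.ofReal_ne_top, ENNReal.toReal_mul, ENNReal.toReal_mul,
    ENNReal.toReal_mul, ENNReal.toReal_ofReal (by linarith),
    ENNReal.toReal_ofReal (by positivity)] at h5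
  exact h5

theorem regVol_toReal_mono {n : ℕ} (σ : Fin n → ℝ) (d : ℕ) (g : SLR n) {J K : Set ℝ} {s t : ℝ}
    (hJ : J ⊆ K) (hst : s ≤ t) : (regVol σ d g J s).toReal ≤ (regVol σ d g K t).toReal :=
  ENNReal.toReal_mono (regVol_ne_top _ _ _ _ _) (regVol_mono σ d g hJ hst)

theorem exists_unit_asymptotic {n : ℕ} {σ : Fin n → ℝ} (hσ : ∀ i, |σ i| = 1)
    {d : ℕ} (hd : 2 ≤ d) (hdn : d < n) :
    ∃ θ > (0 : ℝ), ∀ L : ℝ, ∃ C ≥ (1 : ℝ), ∀ g ∈ KL n L, ∃ c ≤ C, ∀ t ≥ C,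
      |(regVol σ d g (Set.Icc 0 1) t).toReal - c * t ^ (n - d)| ≤ C * (t ^ (n - d) * t ^ (-θ)) := by
  obtain ⟨θ, hθ, hθβ, h⟩ := exists_regVol_cross_real (by omega) hσ hd hdn.le
    (show (0 : ℝ) < 1 / 2 by norm_num)
  refine ⟨θ, hθ, fun L => ?_⟩
  obtain ⟨C, hC, t₀, ht₀, h1, h2⟩ := h (max 1 L) 1 (le_max_left _ _) le_rfl
  have h8 : (1 : ℝ) ≤ 8 ^ n := one_le_pow₀ (by norm_num)
  have hCC : C ≤ 8 ^ n * C := le_mul_of_one_le_left (by linarith) h8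
  obtain ⟨C', hC', h3⟩ := growth_limit (n := n) (k := n - d) (C := 8 ^ n * C) (θ := θ) (t₀ := t₀)
    (by omega) (by linarith) hθ (by linarith) ht₀
  refine ⟨C', hC', fun g hg => ?_⟩
  replace hg := KL_mono (le_max_right 1 L) hg
  have hI : Set.Icc (0 : ℝ) 1 ⊆ Set.Icc (-1) 1 := Set.Icc_subset_Icc (by norm_num) le_rfl
  have hIa : ∀ a ∈ Set.Icc (1 : ℝ) 8, Set.Icc (0 : ℝ) (a ^ d)⁻¹ ⊆ Set.Icc (-1) 1 := fun a ha =>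
    Set.Icc_subset_Icc (by norm_num) (inv_le_one_of_one_le₀ (one_le_pow₀ ha.1))
  have hpow : ∀ a ∈ Set.Icc (1 : ℝ) 8, a ^ n * (a ^ d)⁻¹ = a ^ (n - d) := fun a ha => by
    have : a ≠ 0 := by linarith [ha.1]
    rw [pow_sub₀ a this hdn.le]
  refine h3 _ (fun _ => ENNReal.toReal_nonneg) (fun _ _ hst => regVol_toReal_mono _ _ _ subset_rfl hst)
    (fun t ht => ?_) (fun t ht a ha => ?_) fun t ht a ha => ?_
  · exact ENNReal.toReal_le_of_le_ofReal (by positivity) (regVol_le σ d g _ ht)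
  · have ht0 : 0 < t := by linarith
    have ha0 : 0 < a := by linarith [ha.1]
    have had : 0 < (a ^ d)⁻¹ := by positivity
    have h4 := h2 g hg t ht (Set.Icc 0 1) (Set.Icc 0 (a ^ d)⁻¹) measurableSet_Icc measurableSet_Icc
      hI (hIa a ha)
    rw [Real.volume_Icc, Real.volume_Icc, sub_zero, sub_zero, ENNReal.toReal_ofReal had.le,
      ENNReal.ofReal_one, ENNReal.toReal_one, one_mul] at h4
    have h5 := mul_le_mul_of_nonneg_left h4 (pow_pos ha0 n).le
    rw [← mul_assoc, hpow a ha, mul_add, mul_left_comm, ← regVol_scale σ d g ha0] at h5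
    refine h5.trans (add_le_add ?_ ?_)
    · refine mul_le_mul ?_ (regVol_toReal_mono _ _ _ subset_rfl ?_) ENNReal.toReal_nonneg
        (by positivity)
      · gcongr
      · gcongr
    · rw [← mul_assoc]
      gcongr
      exact ha.2
  · have ht0 : 0 < t := by linarith
    have ha0 : 0 < a := by linarith [ha.1]
    have had : 0 < (a ^ d)⁻¹ := by positivity
    have h4 := h2 g hg t ht (Set.Icc 0 (a ^ d)⁻¹) (Set.Icc 0 1) measurableSet_Icc measurableSet_Icc
      (hIa a ha) hI
    rw [Real.volume_Icc, Real.volume_Icc, sub_zero, sub_zero, ENNReal.toReal_ofReal had.le,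
      ENNReal.ofReal_one, ENNReal.toReal_one, one_mul] at h4
    have h5 := mul_le_mul_of_nonneg_left h4 (pow_pos ha0 n).le
    rw [← regVol_scale σ d g ha0, mul_add, mul_left_comm, ← mul_assoc (a ^ n) (a ^ d)⁻¹,
      hpow a ha] at h5
    refine h5.trans (add_le_add ?_ ?_)
    · refine mul_le_mul (by gcongr) (mul_le_mul_of_nonneg_left
        (regVol_toReal_mono _ _ _ subset_rfl ?_) (by positivity))
        (mul_nonneg (by positivity) ENNReal.toReal_nonneg) (by positivity)
      gcongr
    · rw [← mul_assoc]
      gcongr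
      exact ha.2

/-- The limiting density of the region on which the form takes values in a bounded set. -/
def regDensity {n : ℕ} (σ : Fin n → ℝ) (d : ℕ) (g : SLR n) : ℝ :=
  limUnder atTop fun j : ℕ => (regVol σ d g (Set.Icc 0 1) (2 ^ j)).toReal / (2 ^ j) ^ (n - d)

theorem tendsto_div_of_asymptotic {f : ℝ → ℝ} {k : ℕ} {c C θ : ℝ} (hθ : 0 < θ)
    (hf : ∀ t ≥ C, |f t - c * t ^ k| ≤ C * (t ^ k * t ^ (-θ))) :
    Tendsto (fun t => f t / t ^ k) atTop (nhds c) := by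
  rw [tendsto_iff_norm_sub_tendsto_zero]
  have h := (tendsto_rpow_neg_atTop hθ).const_mul C
  rw [mul_zero] at h
  refine squeeze_zero' (Eventually.of_forall fun t => norm_nonneg _) ?_ h
  filter_upwards [eventually_ge_atTop (max C 1)] with t ht
  have ht0 : 0 < t := lt_of_lt_of_le one_pos ((le_max_right _ _).trans ht)
  have htk : 0 < t ^ k := pow_pos ht0 k
  have e : f t / t ^ k - c = (f t - c * t ^ k) / t ^ k := by field_simp
  rw [e, Real.norm_eq_abs, abs_div, abs_of_pos htk, div_le_iff₀ htk]
  calc _ ≤ _ := hf t ((le_max_left _ _).trans ht)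
    _ = _ := by ring

theorem exists_regDensity_asymptotic {n : ℕ} {σ : Fin n → ℝ} (hσ : ∀ i, |σ i| = 1)
    {d : ℕ} (hd : 2 ≤ d) (hdn : d < n) :
    ∃ θ > (0 : ℝ), ∀ L : ℝ, ∃ C ≥ (1 : ℝ), ∀ g ∈ KL n L, regDensity σ d g ≤ C ∧ ∀ t ≥ C,
      |(regVol σ d g (Set.Icc 0 1) t).toReal - regDensity σ d g * t ^ (n - d)|
        ≤ C * (t ^ (n - d) * t ^ (-θ)) := by
  obtain ⟨θ, hθ, h⟩ := exists_unit_asymptotic hσ hd hdn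
  refine ⟨θ, hθ, fun L => ?_⟩
  obtain ⟨C, hC, h1⟩ := h L
  refine ⟨C, hC, fun g hg => ?_⟩
  obtain ⟨c, hc, h2⟩ := h1 g hg
  have h3 := (tendsto_div_of_asymptotic hθ h2).comp
    (tendsto_pow_atTop_atTop_of_one_lt (one_lt_two (α := ℝ)))
  have h4 : regDensity σ d g = c := h3.limUnder_eq
  rw [h4]
  exact ⟨hc, h2⟩

theorem tendsto_regDensity {n : ℕ} {σ : Fin n → ℝ} (hσ : ∀ i, |σ i| = 1)
    {d : ℕ} (hd : 2 ≤ d) (hdn : d < n) (g : SLR n) :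
    Tendsto (fun t : ℝ => (regVol σ d g (Set.Icc 0 1) t).toReal / t ^ (n - d)) atTop
      (nhds (regDensity σ d g)) := by
  obtain ⟨θ, hθ, h⟩ := exists_regDensity_asymptotic hσ hd hdn
  obtain ⟨C, hC, h1⟩ := h (mnorm (g : Matrix (Fin n) (Fin n) ℝ))
  exact tendsto_div_of_asymptotic hθ (h1 g (le_refl (mnorm (g : Matrix (Fin n) (Fin n) ℝ)))).2

theorem regDensity_nonneg {n : ℕ} {σ : Fin n → ℝ} (hσ : ∀ i, |σ i| = 1)
    {d : ℕ} (hd : 2 ≤ d) (hdn : d < n) (g : SLR n) : 0 ≤ regDensity σ d g := by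
  refine ge_of_tendsto (tendsto_regDensity hσ hd hdn g) ?_
  filter_upwards [eventually_ge_atTop 0] with t ht
  exact div_nonneg ENNReal.toReal_nonneg (pow_nonneg ht _)

theorem measurable_regVol {n : ℕ} (σ : Fin n → ℝ) (d : ℕ) {J : Set ℝ} (hJ : MeasurableSet J)
    (t : ℝ) : Measurable fun g : SLR n => regVol σ d g J t := by
  have h : MeasurableSet {p : SLR n × (Fin n → ℝ) | eucNorm p.2 ≤ t ∧ Fs σ d (act p.2 p.1) ∈ J} := by
    refine (measurableSet_le (f := fun p : SLR n × (Fin n → ℝ) => eucNorm p.2)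
      (continuous_eucNorm.measurable.comp measurable_snd) measurable_const).inter ?_
    have h2 : Continuous fun p : SLR n × (Fin n → ℝ) => Fs σ d (act p.2 p.1) :=
      (continuous_Fs σ d).comp (continuous_act.comp continuous_swap)
    exact h2.measurable hJ
  exact measurable_measure_prodMk_left h

theorem measurable_regDensity {n : ℕ} {σ : Fin n → ℝ} (hσ : ∀ i, |σ i| = 1)
    {d : ℕ} (hd : 2 ≤ d) (hdn : d < n) : Measurable (regDensity σ d : SLR n → ℝ) := by
  refine measurable_of_tendsto_metrizable
    (f := fun (j : ℕ) g => (regVol σ d g (Set.Icc 0 1) (2 ^ j)).toReal / (2 ^ j) ^ (n - d))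
    (fun j => ((measurable_regVol σ d measurableSet_Icc _).ennreal_toReal).div_const _) ?_
  rw [tendsto_pi_nhds]
  exact fun g => (tendsto_regDensity hσ hd hdn g).comp
    (tendsto_pow_atTop_atTop_of_one_lt (one_lt_two (α := ℝ)))

theorem one_sub_le_inv_one_add_pow {x : ℝ} (hx0 : 0 ≤ x) (hx1 : x ≤ 1) (k : ℕ) :
    1 - 2 ^ k * x ≤ ((1 + x) ^ k)⁻¹ := by
  have h := one_add_pow_le hx0 hx1 k
  have h1 : (0 : ℝ) < (1 + x) ^ k := by positivity
  have h2 : 0 ≤ 2 ^ k * x := by positivity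
  rw [← one_div, le_div_iff₀ h1]
  by_cases h3 : 2 ^ k * x ≤ 1
  · nlinarith [mul_le_mul_of_nonneg_left h (sub_nonneg.2 h3)]
  · nlinarith [mul_nonneg (sub_nonneg.2 (not_le.1 h3).le) h1.le]

theorem le_add_const_of_growth {k : ℕ} {e E x c C₁ C₂ Q C j T b W : ℝ} (he0 : 0 ≤ e) (he1 : e ≤ 1)
    (hex : e ≤ E * x) (hc0 : 0 ≤ c) (hc : c ≤ C₂) (hj : 0 ≤ j) (hT : 0 ≤ T) (hx : 0 ≤ x)
    (hb : 0 ≤ b) (hQ : 1 ≤ Q) (hC₁ : C₁ ≤ C) (hC : 2 ^ (k + 1) * C₂ * E + 2 ^ (k + 1) * C₂ * Q ≤ C)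
    (hW : W ≤ (1 + e) * (j * ((1 + e) ^ k * T * (c + C₂ * x))) + C₁ * b) :
    W ≤ c * j * T + C * (j * T * x + b) := by
  have hA : 0 ≤ (2 : ℝ) ^ (k + 1) := by positivity
  have h14 := one_add_pow_le he0 he1 (k + 1)
  have h15 : (1 + e) ^ (k + 1) ≤ 2 ^ (k + 1) := pow_le_pow_left₀ (by linarith) (by linarith) _
  have hC₂ : 0 ≤ C₂ := hc0.trans hc
  have hEx : 0 ≤ E * x := he0.trans hex
  generalize (2 : ℝ) ^ (k + 1) = A at *
  calc W ≤ (1 + e) * (j * ((1 + e) ^ k * T * (c + C₂ * x))) + C₁ * b := hW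
    _ = j * T * ((1 + e) ^ (k + 1) * c + (1 + e) ^ (k + 1) * (C₂ * x)) + C₁ * b := by ring
    _ ≤ j * T * ((1 + A * e) * c + A * (C₂ * x)) + C * b := by gcongr
    _ ≤ j * T * (c + C * x) + C * b := by
      have h16 : A * e * c ≤ A * (E * x) * C₂ := by gcongr
      have h17 := mul_le_mul_of_nonneg_right hC hx
      have h18 : A * C₂ * x ≤ A * C₂ * Q * x := by
        refine mul_le_mul_of_nonneg_right (le_mul_of_one_le_right (by positivity) hQ) hx
      have h19 : (1 + A * e) * c + A * (C₂ * x) ≤ c + C * x := by linarith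
      exact add_le_add_left (mul_le_mul_of_nonneg_left h19 (mul_nonneg hj hT)) _
    _ = _ := by ring

theorem sub_const_le_of_growth {k : ℕ} {e E x c C₁ C₂ Q C j T b W : ℝ} (he0 : 0 ≤ e) (he1 : e ≤ 1)
    (hex : e ≤ E * x) (hc0 : 0 ≤ c) (hc : c ≤ C₂) (hj : 0 ≤ j) (hT : 0 ≤ T) (hx : 0 ≤ x)
    (hb : 0 ≤ b) (hQ : 1 ≤ Q) (hC₁0 : 0 ≤ C₁) (hC₁ : C₁ ≤ C)
    (hC : 2 ^ (k + 1) * C₂ * E + 2 ^ (k + 1) * C₂ * Q ≤ C)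
    (hW : j * (T * ((1 + e) ^ k)⁻¹ * (c - C₂ * (Q * x))) ≤ (1 + e) * W + C₁ * b) :
    c * j * T - C * (j * T * x + b) ≤ W := by
  have hC₂ : 0 ≤ C₂ := hc0.trans hc
  have hEx : 0 ≤ E * x := he0.trans hex
  have hA1 : (1 : ℝ) ≤ 2 ^ (k + 1) := one_le_pow₀ (by norm_num)
  have h15 := one_sub_le_inv_one_add_pow he0 he1 (k + 1)
  have hz : ((1 + e) ^ (k + 1))⁻¹ = ((1 + e) ^ k)⁻¹ * (1 + e)⁻¹ := by rw [pow_succ, mul_inv]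
  have hz1 : ((1 + e) ^ (k + 1))⁻¹ ≤ 1 := inv_le_one_of_one_le₀ (one_le_pow₀ (by linarith))
  have h19 := mul_le_mul_of_nonneg_right hW (inv_nonneg.2 (show 0 ≤ 1 + e by linarith))
  have h20 : ((1 + e) * W + C₁ * b) * (1 + e)⁻¹ = W + C₁ * b * (1 + e)⁻¹ := by
    have : 1 + e ≠ 0 := by linarith
    field_simp
  have h21 : C₁ * b * (1 + e)⁻¹ ≤ C₁ * b :=
    mul_le_of_le_one_right (by positivity) (inv_le_one_of_one_le₀ (by linarith))
  have h22 : j * (T * ((1 + e) ^ k)⁻¹ * (c - C₂ * (Q * x))) * (1 + e)⁻¹ =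
      j * T * (((1 + e) ^ (k + 1))⁻¹ * (c - C₂ * (Q * x))) := by
    rw [hz]; ring
  generalize ((1 + e) ^ (k + 1))⁻¹ = z at *
  generalize (2 : ℝ) ^ (k + 1) = A at *
  have h23 : c - C * x ≤ z * (c - C₂ * (Q * x)) := by
    have h26 : A * e * c ≤ A * (E * x) * C₂ := by gcongr
    have h27 : (1 - A * e) * c ≤ z * c := by gcongr
    have h28 : z * (C₂ * (Q * x)) ≤ A * (C₂ * (Q * x)) := by gcongr; linarith
    have h17 := mul_le_mul_of_nonneg_right hC hx
    linarith
  have h25 := mul_le_mul_of_nonneg_left h23 (show 0 ≤ j * T by positivity)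
  have h26 := mul_le_mul_of_nonneg_right hC₁ hb
  linarith

theorem two_mul_const_bounds {k : ℕ} {C₁ C₂ P Q : ℝ} (h₁ : 1 ≤ C₁) (h₂ : 1 ≤ C₂) (hP : 1 ≤ P)
    (hQ : 1 ≤ Q) :
    2 ^ (k + 1) * C₂ * (C₁ * P) + 2 ^ (k + 1) * C₂ * Q ≤ C₁ * C₂ * P * Q * 2 ^ (k + 2) ∧
      C₁ ≤ C₁ * C₂ * P * Q * 2 ^ (k + 2) := by
  have hA1 : (1 : ℝ) ≤ 2 ^ (k + 1) := one_le_pow₀ (by norm_num)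
  rw [pow_succ 2 (k + 1)]
  generalize (2 : ℝ) ^ (k + 1) = A at *
  have hE : 1 ≤ C₁ * P := one_le_mul_of_one_le_of_one_le h₁ hP
  have hF : 1 ≤ A * C₂ := one_le_mul_of_one_le_of_one_le hA1 h₂
  have h3 : C₁ * P + Q ≤ C₁ * P * Q * 2 := by
    nlinarith [mul_nonneg (sub_nonneg.2 hE) (sub_nonneg.2 hQ)]
  have h4 := mul_le_mul_of_nonneg_left h3 (show 0 ≤ A * C₂ by linarith)
  have h5 : C₁ ≤ C₁ * P := le_mul_of_one_le_right (by linarith) hP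
  have h6 : C₁ * P + Q ≤ A * C₂ * (C₁ * P + Q) := le_mul_of_one_le_left (by linarith) hF
  constructor <;> linarith

theorem exists_regVol_asymptotic {n : ℕ} {σ : Fin n → ℝ} (hσ : ∀ i, |σ i| = 1)
    {d : ℕ} (hd : 2 ≤ d) (hdn : d < n) {β : ℝ} (hβ : 0 < β) :
    ∃ θ > (0 : ℝ), ∀ L M : ℝ, 1 ≤ L → 1 ≤ M → ∃ C ≥ (1 : ℝ), ∀ g ∈ KL n L, ∀ t ≥ C,
      ∀ J : Set ℝ, MeasurableSet J → J ⊆ Set.Icc (-M) M →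
        |(regVol σ d g J t).toReal - regDensity σ d g * (volume J).toReal * t ^ (n - d)|
          ≤ C * ((volume J).toReal * t ^ (n - d) * t ^ (-θ) + t ^ β) := by
  obtain ⟨θ₁, hθ₁, -, h₁⟩ := exists_regVol_cross_real (by omega) hσ hd hdn.le hβ
  obtain ⟨θ₂, hθ₂, h₂⟩ := exists_regDensity_asymptotic hσ hd hdn
  refine ⟨min θ₁ θ₂, lt_min hθ₁ hθ₂, fun L M hL hM => ?_⟩
  obtain ⟨C₁, hC₁, t₁, ht₁, h3, h4⟩ := h₁ L M hL hM
  obtain ⟨C₂, hC₂, h5⟩ := h₂ L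
  set P : ℝ := 2 ^ θ₁ with hP
  set Q : ℝ := 2 ^ θ₂ with hQ
  have hP1 : 1 ≤ P := Real.one_le_rpow (by norm_num) hθ₁.le
  have hQ1 : 1 ≤ Q := Real.one_le_rpow (by norm_num) hθ₂.le
  obtain ⟨t₂, ht₂, h6⟩ := exists_rpow_neg_le hθ₁ (δ := (C₁ * P)⁻¹) (by positivity)
  set k := n - d with hk
  set C := C₁ * C₂ * P * Q * 2 ^ (k + 2) with hC
  refine ⟨C + 2 * t₁ + t₂ + 2 * C₂, by nlinarith [show (0 : ℝ) ≤ C by positivity],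
    fun g hg t ht J hJ hJM => ?_⟩
  have hC0 : 0 ≤ C := by positivity
  have ht0 : 1 ≤ t := by linarith
  have ht1 : 2 * t₁ ≤ t := by linarith
  have ht2 : t₂ ≤ t := by linarith
  have ht3 : 2 * C₂ ≤ t := by linarith
  obtain ⟨hcC, h7⟩ := h5 g hg
  have hc0 := regDensity_nonneg hσ hd hdn g
  set c := regDensity σ d g with hc
  set j := (volume J).toReal with hj
  have hj0 : 0 ≤ j := ENNReal.toReal_nonneg
  set V := fun u => (regVol σ d g (Set.Icc 0 1) u).toReal with hV
  set W := fun u => (regVol σ d g J u).toReal with hW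
  have hI : Set.Icc (0 : ℝ) 1 ⊆ Set.Icc (-M) M := Set.Icc_subset_Icc (by linarith) hM
  have hI1 : (volume (Set.Icc (0 : ℝ) 1)).toReal = 1 := by simp
  set x := t ^ (-min θ₁ θ₂) with hx
  have hx1 : t ^ (-θ₁) ≤ x :=
    Real.rpow_le_rpow_of_exponent_le ht0 (neg_le_neg (min_le_left _ _))
  have hx2 : t ^ (-θ₂) ≤ x :=
    Real.rpow_le_rpow_of_exponent_le ht0 (neg_le_neg (min_le_right _ _))
  have hx0 : 0 < x := by positivity
  have hk0 : 0 < t ^ k := by positivity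
  have hb0 : 0 < t ^ β := by positivity
  set e := C₁ * P * t ^ (-θ₁) with he
  have he0 : 0 ≤ e := by positivity
  have he1 : e ≤ 1 := by
    have := h6 t ht2
    rw [← one_div, le_div_iff₀' (by positivity)] at this
    exact this
  have hex : e ≤ C₁ * P * x := mul_le_mul_of_nonneg_left hx1 (by positivity)
  obtain ⟨hCge, hC₁C⟩ := two_mul_const_bounds (k := k) hC₁ hC₂ hP1 hQ1
  have hupper : W t ≤ c * j * t ^ k + C * (j * t ^ k * x + t ^ β) := by
    have h8 := h4 g hg t (by linarith) J (Set.Icc 0 1) hJ measurableSet_Icc hJM hI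
    rw [hI1, one_mul] at h8
    have h9 : C₁ * t ^ (-θ₁) ≤ e := by
      rw [he, mul_right_comm]
      exact le_mul_of_one_le_right (by positivity) hP1
    have h10 : V ((1 + C₁ * t ^ (-θ₁)) * t) ≤ V ((1 + e) * t) :=
      regVol_toReal_mono _ _ _ subset_rfl (by gcongr)
    have h11 := (abs_le.1 (h7 ((1 + e) * t) (by nlinarith))).2
    have h12 : ((1 + e) * t) ^ (-θ₂) ≤ x := le_trans
      (Real.rpow_le_rpow_of_nonpos (by linarith) (by nlinarith) (by linarith)) hx2
    have h13 : V ((1 + e) * t) ≤ (1 + e) ^ k * t ^ k * (c + C₂ * x) := by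
      rw [← mul_pow]
      have : C₂ * (((1 + e) * t) ^ k * ((1 + e) * t) ^ (-θ₂)) ≤ C₂ * (((1 + e) * t) ^ k * x) := by
        gcongr
      simp only [hV]
      linarith
    have h14 : W t ≤ (1 + e) * (j * ((1 + e) ^ k * t ^ k * (c + C₂ * x))) + C₁ * t ^ β := by
      refine h8.trans (add_le_add_left (mul_le_mul (by linarith)
        (mul_le_mul_of_nonneg_left (h10.trans h13) hj0)
        (mul_nonneg hj0 ENNReal.toReal_nonneg) (by linarith)) _)
    exact le_add_const_of_growth he0 he1 hex hc0 hcC hj0 hk0.le hx0.le hb0.le hQ1 hC₁C hCge h14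
  have hlower : c * j * t ^ k - C * (j * t ^ k * x + t ^ β) ≤ W t := by
    set u := t / (1 + e) with hu
    have hu0 : (1 + e) * u = t := by rw [hu]; field_simp
    have hut : u ≤ t := by rw [hu]; exact div_le_self (by linarith) (by linarith)
    have hu2 : t / 2 ≤ u := by rw [hu]; gcongr; linarith
    have hup : 0 < u := by linarith
    have h8 := h4 g hg u (by linarith) (Set.Icc 0 1) J measurableSet_Icc hJ hI hJM
    rw [hI1, one_mul] at h8
    have hpow : ∀ θ : ℝ, 0 < θ → u ^ (-θ) ≤ 2 ^ θ * t ^ (-θ) := fun θ hθ => by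
      calc u ^ (-θ) ≤ (t / 2) ^ (-θ) :=
            Real.rpow_le_rpow_of_nonpos (by linarith) hu2 (by linarith)
        _ = _ := by
          rw [Real.div_rpow (by linarith) (by norm_num), Real.rpow_neg (x := 2) (by norm_num) θ,
            div_inv_eq_mul, mul_comm]
    have h9 : C₁ * u ^ (-θ₁) ≤ e := by
      rw [he, mul_assoc]
      gcongr
      exact hpow θ₁ hθ₁
    have h10 : W ((1 + C₁ * u ^ (-θ₁)) * u) ≤ W t := by
      refine regVol_toReal_mono _ _ _ subset_rfl ?_
      rw [← hu0]
      gcongr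
    have h11 := (abs_le.1 (h7 u (by linarith))).1
    have h12 : u ^ (-θ₂) ≤ Q * x := (hpow θ₂ hθ₂).trans (by gcongr)
    have h13 : u ^ k * (c - C₂ * (Q * x)) ≤ V u := by
      have : C₂ * (u ^ k * u ^ (-θ₂)) ≤ C₂ * (u ^ k * (Q * x)) := by gcongr
      simp only [hV]
      linarith
    have hWt : 0 ≤ W t := ENNReal.toReal_nonneg
    have hub : u ^ β ≤ t ^ β := Real.rpow_le_rpow hup.le hut hβ.le
    have h14 : j * V u ≤ (1 + e) * W t + C₁ * t ^ β :=
      h8.trans (add_le_add (mul_le_mul (by linarith) h10 ENNReal.toReal_nonneg (by linarith))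
        (mul_le_mul_of_nonneg_left hub (by linarith)))
    have h16 : j * (u ^ k * (c - C₂ * (Q * x))) ≤ (1 + e) * W t + C₁ * t ^ β :=
      (mul_le_mul_of_nonneg_left h13 hj0).trans h14
    rw [hu, div_pow, div_eq_mul_inv] at h16
    exact sub_const_le_of_growth he0 he1 hex hc0 hcC hj0 hk0.le hx0.le hb0.le hQ1 (by linarith) hC₁C
      hCge h16
  have hrest : 0 ≤ (2 * t₁ + t₂ + 2 * C₂) * (j * t ^ k * x + t ^ β) := by positivity
  have e1 : (C + 2 * t₁ + t₂ + 2 * C₂) * (j * t ^ k * x + t ^ β)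
      = C * (j * t ^ k * x + t ^ β) + (2 * t₁ + t₂ + 2 * C₂) * (j * t ^ k * x + t ^ β) := by ring
  rw [e1]
  exact abs_le.2 ⟨by linarith, by linarith⟩

theorem volume_slice_le {n : ℕ} {σ : Fin n → ℝ} (hσ : ∀ i, |σ i| = 1) {d : ℕ} (hd : 2 ≤ d)
    (i : Fin n) {r m : ℝ} (hr : 0 < r) (hm0 : 0 ≤ m) (hm : m ≤ 1 / 2 * (r / 2) ^ d) :
    volume {y : Fin n → ℝ | ‖y‖ ≤ r ∧ r / 2 ≤ |y i| ∧ Fs σ d y ∈ Set.Icc m (m + 1)}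
      ≤ ENNReal.ofReal ((1 + 1 / 2) ^ d) *
        volume {y : Fin n → ℝ | ‖y‖ ≤ 2 * r ∧ Fs σ d y ∈ Set.Icc 0 1} := by
  have hT : 0 < r / 2 := by positivity
  have hs : |m| ≤ 1 / 2 * (r / 2) ^ d := by rwa [abs_of_nonneg hm0]
  have hF := (continuous_Fs σ d).measurable
  have hW : MeasurableSet {y : Fin n → ℝ | ‖y‖ ≤ 2 * r ∧ Fs σ d y ∈ Set.Icc 0 1} :=
    (measurableSet_le (f := fun y : Fin n → ℝ => ‖y‖) measurable_norm measurable_const).inter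
      (hF measurableSet_Icc)
  have h := lintegral_coordShift_le hσ hd i hT hs le_rfl (by norm_num)
    (H := Set.indicator {y : Fin n → ℝ | ‖y‖ ≤ 2 * r ∧ Fs σ d y ∈ Set.Icc 0 1} fun _ => 1)
    (measurable_const.indicator hW)
  rw [lintegral_indicator_const hW, one_mul] at h
  refine le_trans ?_ h
  have hA : MeasurableSet {y : Fin n → ℝ | ‖y‖ ≤ r ∧ r / 2 ≤ |y i| ∧ Fs σ d y ∈ Set.Icc m (m + 1)} :=
    (measurableSet_le (f := fun y : Fin n → ℝ => ‖y‖) measurable_norm measurable_const).inter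
      ((measurableSet_le (g := fun y : Fin n → ℝ => |y i|) measurable_const (by fun_prop)).inter
      (hF measurableSet_Icc))
  rw [← lintegral_indicator_one hA, ← lintegral_indicator
    (measurableSet_le (g := fun y : Fin n → ℝ => |y i|) measurable_const (by fun_prop))]
  refine lintegral_mono fun y => ?_
  refine Set.indicator_le (fun y hy => ?_) y
  obtain ⟨h1, h2, h3⟩ := hy
  have h4 := norm_coordShift_sub_le hσ hd i hT hs le_rfl (by norm_num) h2
  have h5 := Fs_coordShift hσ hd i hT hs le_rfl h2
  rw [Set.indicator_of_mem (show y ∈ {y : Fin n → ℝ | r / 2 ≤ |y i|} from h2),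
    Set.indicator_of_mem]
  · exact le_rfl
  refine ⟨?_, ?_⟩
  · have := norm_sub_norm_le (coordShift σ d i m y) y
    linarith
  · rw [h5]
    exact ⟨by linarith [h3.1], by linarith [h3.2]⟩

theorem volume_strip_le {n : ℕ} {σ : Fin n → ℝ} (hσ : ∀ i, |σ i| = 1) {d : ℕ} (hd : 2 ≤ d)
    (i : Fin n) {r : ℝ} (hr : 0 < r) :
    volume {y : Fin n → ℝ | ‖y‖ ≤ r ∧ r / 2 ≤ |y i| ∧
        Fs σ d y ∈ Set.Icc 0 (1 / 2 * (r / 2) ^ d)}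
      ≤ ENNReal.ofReal ((1 / 2 * (r / 2) ^ d + 1) * (1 + 1 / 2) ^ d) *
        volume {y : Fin n → ℝ | ‖y‖ ≤ 2 * r ∧ Fs σ d y ∈ Set.Icc 0 1} := by
  set D := 1 / 2 * (r / 2) ^ d with hD
  have hD0 : 0 ≤ D := by positivity
  have hsub : {y : Fin n → ℝ | ‖y‖ ≤ r ∧ r / 2 ≤ |y i| ∧ Fs σ d y ∈ Set.Icc 0 D} ⊆
      ⋃ m ∈ Finset.range (⌊D⌋₊ + 1),
        {y : Fin n → ℝ | ‖y‖ ≤ r ∧ r / 2 ≤ |y i| ∧ Fs σ d y ∈ Set.Icc (m : ℝ) (m + 1)} := by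
    rintro y ⟨h1, h2, h3⟩
    refine Set.mem_biUnion (x := ⌊Fs σ d y⌋₊) ?_ ⟨h1, h2, Nat.floor_le h3.1, (Nat.lt_floor_add_one _).le⟩
    rw [Finset.mem_coe, Finset.mem_range, Nat.lt_add_one_iff]
    exact Nat.floor_mono h3.2
  refine (measure_mono hsub).trans ((measure_biUnion_finset_le _ _).trans ?_)
  refine (Finset.sum_le_sum fun m hm => volume_slice_le hσ hd i hr (Nat.cast_nonneg m) ?_).trans ?_
  · rw [Finset.mem_range, Nat.lt_add_one_iff, Nat.le_floor_iff hD0] at hm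
    exact hm
  · rw [Finset.sum_const, Finset.card_range, nsmul_eq_mul, ← mul_assoc,
      ENNReal.ofReal_mul (by positivity)]
    gcongr
    rw [← ENNReal.ofReal_natCast]
    refine ENNReal.ofReal_le_ofReal ?_
    push_cast
    linarith [Nat.floor_le hD0]

theorem exists_strip_point {n : ℕ} {σ : Fin n → ℝ} {d : ℕ} (hd : 2 ≤ d) {i j : Fin n}
    (hi : σ i = 1) (hj : σ j = -1) :
    ∃ y : Fin n → ℝ, ‖y‖ < 1 ∧ 1 / 2 < |y i| ∧ Fs σ d y ∈ Set.Ioo 0 (1 / 2 * (1 / 2) ^ d) := by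
  have hij : i ≠ j := fun h => by rw [h, hj] at hi; norm_num at hi
  have hd0 : d ≠ 0 := by omega
  set δ : ℝ := 1 / 2 * (1 / 2) ^ d with hδ
  have hδ0 : 0 < δ := by positivity
  have h34 : (1 / 2 : ℝ) ^ d ≤ (3 / 4) ^ d := pow_le_pow_left₀ (by norm_num) (by norm_num) d
  have h12 : (0 : ℝ) < (1 / 2) ^ d := by positivity
  set z : ℝ := ((3 / 4) ^ d - δ / 2) ^ ((d : ℝ)⁻¹) with hz
  have hz0 : 0 ≤ z := Real.rpow_nonneg (by linarith) _
  have hzd : z ^ d = (3 / 4) ^ d - δ / 2 := Real.rpow_inv_natCast_pow (by linarith) hd0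
  have hz1 : z < 3 / 4 := lt_of_pow_lt_pow_left₀ d (by norm_num) (by rw [hzd]; linarith)
  set y : Fin n → ℝ := fun k => if k = i then 3 / 4 else if k = j then z else 0 with hy
  have hyi : y i = 3 / 4 := by simp [hy]
  have hyj : y j = z := by simp [hy, hij.symm]
  have hF : Fs σ d y = δ / 2 := by
    unfold Fs
    rw [Finset.sum_eq_add_of_mem i j (Finset.mem_univ _) (Finset.mem_univ _) hij]
    · rw [hyi, hyj, hi, hj, hzd]; ring
    · rintro k - ⟨hki, hkj⟩
      simp [hy, hki, hkj, hd0]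
  refine ⟨y, ?_, ?_, ?_⟩
  · rw [pi_norm_lt_iff one_pos]
    intro k
    simp only [hy]
    split_ifs
    · norm_num
    · rw [Real.norm_eq_abs, abs_of_nonneg hz0]; linarith
    · norm_num
  · rw [hyi]; norm_num [abs_of_pos]
  · rw [hF]; exact ⟨by linarith, by linarith⟩

theorem exists_volume_strip_ge {n : ℕ} {σ : Fin n → ℝ} {d : ℕ} (hd : 2 ≤ d) {i j : Fin n}
    (hi : σ i = 1) (hj : σ j = -1) :
    ∃ u > (0 : ℝ), ∀ r > (0 : ℝ), ENNReal.ofReal (r ^ n * u) ≤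
      volume {y : Fin n → ℝ | ‖y‖ ≤ r ∧ r / 2 ≤ |y i| ∧
        Fs σ d y ∈ Set.Icc 0 (1 / 2 * (r / 2) ^ d)} := by
  set U : Set (Fin n → ℝ) := {y | ‖y‖ < 1 ∧ 1 / 2 < |y i| ∧
    Fs σ d y ∈ Set.Ioo 0 (1 / 2 * (1 / 2) ^ d)} with hU
  have hUo : IsOpen U := by
    refine (isOpen_lt continuous_norm continuous_const).inter
      ((isOpen_lt (g := fun y : Fin n → ℝ => |y i|) continuous_const
        (by fun_prop)).inter (isOpen_Ioo.preimage (continuous_Fs σ d)))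
  have hUp : 0 < volume U := hUo.measure_pos _ (exists_strip_point hd hi hj)
  have hUf : volume U ≠ ⊤ := by
    refine ((measure_mono (fun y hy => ?_)).trans_lt
      (measure_ball_lt_top (x := (0 : Fin n → ℝ)) (r := 1))).ne
    rw [mem_ball_zero_iff]
    exact hy.1
  refine ⟨(volume U).toReal, ENNReal.toReal_pos hUp.ne' hUf, fun r hr => ?_⟩
  have h := Measure.addHaar_smul (volume : Measure (Fin n → ℝ)) r U
  rw [Module.finrank_fin_fun, abs_of_pos (by positivity)] at h
  rw [ENNReal.ofReal_mul (by positivity), ENNReal.ofReal_toReal hUf, ← h]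
  refine measure_mono ?_
  rintro _ ⟨y, ⟨h1, h2, h3⟩, rfl⟩
  have hrd : 0 < r ^ d := by positivity
  refine ⟨?_, ?_, ?_⟩
  · simp only [norm_smul, Real.norm_eq_abs, abs_of_pos hr]
    nlinarith
  · simp only [Pi.smul_apply, smul_eq_mul, abs_mul, abs_of_pos hr]
    nlinarith
  · simp only [Fs_smul]
    refine ⟨by nlinarith [h3.1], ?_⟩
    have e : 1 / 2 * (r / 2) ^ d = r ^ d * (1 / 2 * (1 / 2) ^ d) := by
      rw [show r / 2 = r * (1 / 2) by ring, mul_pow]; ring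
    rw [e]
    exact mul_le_mul_of_nonneg_left h3.2.le hrd.le

theorem regDensity_pos {n : ℕ} {σ : Fin n → ℝ} (hσ : ∀ i, |σ i| = 1)
    {d : ℕ} (hd : 2 ≤ d) (hdn : d < n) {i j : Fin n} (hi : σ i = 1) (hj : σ j = -1) (g : SLR n) :
    0 < regDensity σ d g := by
  obtain ⟨u, hu, h1⟩ := exists_volume_strip_ge hd hi hj
  set B := 2 * n * (1 + mnorm ((g⁻¹ : SLR n) : Matrix (Fin n) (Fin n) ℝ)) with hB
  have hn1 : (1 : ℝ) ≤ n := by exact_mod_cast (by omega : 1 ≤ n)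
  have hm0 := mnorm_nonneg ((g⁻¹ : SLR n) : Matrix (Fin n) (Fin n) ℝ)
  have hB0 : 0 < B := by positivity
  set a := u / (2 * (1 + 1 / 2) ^ d) * (B⁻¹) ^ (n - d) with ha
  have ha0 : 0 < a := by positivity
  refine ha0.trans_le (ge_of_tendsto (tendsto_regDensity hσ hd hdn g) ?_)
  filter_upwards [eventually_ge_atTop B] with t ht
  have ht0 : 0 < t := by linarith
  set r := t / B with hr
  have hr1 : 1 ≤ r := (one_le_div hB0).2 ht
  have hr0 : 0 < r := by linarith
  have h2 := (h1 r hr0).trans (volume_strip_le hσ hd i hr0)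
  have h3 : volume {y : Fin n → ℝ | ‖y‖ ≤ 2 * r ∧ Fs σ d y ∈ Set.Icc 0 1} ≤
      regVol σ d g (Set.Icc 0 1) t := by
    rw [regVol_eq σ d g measurableSet_Icc]
    refine measure_mono fun y hy => ⟨?_, hy.2⟩
    calc eucNorm (act y g⁻¹) ≤ n * ‖act y g⁻¹‖ := eucNorm_le _
      _ ≤ n * (mnorm ((g⁻¹ : SLR n) : Matrix (Fin n) (Fin n) ℝ) * ‖y‖) := by
        gcongr
        exact norm_act_le _ _
      _ ≤ n * ((1 + mnorm ((g⁻¹ : SLR n) : Matrix (Fin n) (Fin n) ℝ)) * (2 * r)) := by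
        gcongr
        · linarith
        · exact hy.1
      _ = B * r := by rw [hB]; ring
      _ = t := by rw [hr]; field_simp
  have h4 := h2.trans (mul_le_mul_right h3 _)
  rw [← ENNReal.ofReal_toReal (regVol_ne_top σ d g (Set.Icc 0 1) t), ← ENNReal.ofReal_mul
    (by positivity), ENNReal.ofReal_le_ofReal_iff (by positivity)] at h4
  set W := (regVol σ d g (Set.Icc 0 1) t).toReal with hW
  have hW0 : 0 ≤ W := ENNReal.toReal_nonneg
  have hrd : 1 ≤ r ^ d := one_le_pow₀ hr1
  have h5 : 1 / 2 * (r / 2) ^ d + 1 ≤ 2 * r ^ d := by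
    have : (r / 2) ^ d ≤ r ^ d := pow_le_pow_left₀ (by positivity) (by linarith) d
    linarith
  have h6 : r ^ n * u ≤ 2 * r ^ d * (1 + 1 / 2) ^ d * W := h4.trans (by gcongr)
  rw [le_div_iff₀ (by positivity)]
  have e1 : t = B * r := by rw [hr]; field_simp
  have e2 : r ^ n = r ^ (n - d) * r ^ d := by rw [← pow_add]; congr 1; omega
  rw [ha, mul_assoc, ← mul_pow, e1, inv_mul_cancel_left₀ hB0.ne', div_mul_eq_mul_div,
    div_le_iff₀ (by positivity)]
  rw [e2] at h6
  refine le_of_mul_le_mul_right ?_ (show 0 < r ^ d by linarith)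
  linarith

theorem eucNorm_le_act {n : ℕ} (h : SLR n) (x : Fin n → ℝ) :
    eucNorm x ≤ (1 + n * (mnorm ((h⁻¹ : SLR n) : Matrix (Fin n) (Fin n) ℝ) *
      mnorm ((h : Matrix (Fin n) (Fin n) ℝ) - 1))) * eucNorm (act x h) := by
  set y := act x h with hy
  have e : x = y + act (y - act y h) h⁻¹ := by
    have : act (y - act y h) h⁻¹ = act y h⁻¹ - y := by
      simp only [sub_eq_add_neg, act_add]
      rw [show -act y h = (-1 : ℝ) • act y h by simp, act_smul, act_inv_act y h]
      simp
    rw [this, hy, act_inv_act]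
    abel
  have h2 : y - act y h = -(y ᵥ* ((h : Matrix (Fin n) (Fin n) ℝ) - 1)) := by
    simp [act, Matrix.vecMul_sub]
  calc eucNorm x = eucNorm (y + act (y - act y h) h⁻¹) := by rw [← e]
    _ ≤ eucNorm y + n * ‖act (y - act y h) h⁻¹‖ :=
      (eucNorm_add_le _ _).trans (add_le_add le_rfl (eucNorm_le _))
    _ ≤ eucNorm y + n * (mnorm ((h⁻¹ : SLR n) : Matrix (Fin n) (Fin n) ℝ) *
        (mnorm ((h : Matrix (Fin n) (Fin n) ℝ) - 1) * eucNorm y)) := by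
      gcongr
      refine (norm_act_le _ _).trans ?_
      refine mul_le_mul_of_nonneg_left ?_ (mnorm_nonneg _)
      rw [h2, norm_neg]
      exact (norm_vecMul_le _ _).trans (mul_le_mul_of_nonneg_left (norm_le_eucNorm _) (mnorm_nonneg _))
    _ = _ := by ring

theorem regVol_mul_left_le {n : ℕ} (σ : Fin n → ℝ) (d : ℕ) (g h : SLR n) {J : Set ℝ}
    (hJ : MeasurableSet J) {t e : ℝ}
    (he : n * (mnorm ((h⁻¹ : SLR n) : Matrix (Fin n) (Fin n) ℝ) *
      mnorm ((h : Matrix (Fin n) (Fin n) ℝ) - 1)) ≤ e) :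
    regVol σ d g J t ≤ regVol σ d (h * g) J ((1 + e) * t) := by
  have hm := measurableSet_region σ d g 1 hJ t
  simp only [act_one] at hm
  unfold regVol
  rw [← (measurePreserving_act h).measure_preimage hm.nullMeasurableSet]
  refine measure_mono fun x hx => ⟨?_, ?_⟩
  · have h1 : eucNorm (act x h) ≤ t := hx.1
    have he0 : 0 ≤ e := le_trans (mul_nonneg (Nat.cast_nonneg n)
      (mul_nonneg (mnorm_nonneg _) (mnorm_nonneg _))) he
    exact (eucNorm_le_act h x).trans (mul_le_mul (by linarith) h1 (eucNorm_nonneg _) (by linarith))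
  · rw [act_mul]
    exact hx.2

theorem regDensity_le_mul_left {n : ℕ} {σ : Fin n → ℝ} (hσ : ∀ i, |σ i| = 1)
    {d : ℕ} (hd : 2 ≤ d) (hdn : d < n) (g h : SLR n) {e : ℝ}
    (he : n * (mnorm ((h⁻¹ : SLR n) : Matrix (Fin n) (Fin n) ℝ) *
      mnorm ((h : Matrix (Fin n) (Fin n) ℝ) - 1)) ≤ e) :
    regDensity σ d g ≤ (1 + e) ^ (n - d) * regDensity σ d (h * g) := by
  have he0 : 0 ≤ e := le_trans (mul_nonneg (Nat.cast_nonneg n)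
    (mul_nonneg (mnorm_nonneg _) (mnorm_nonneg _))) he
  have h1 := (tendsto_regDensity hσ hd hdn (h * g)).comp
    (tendsto_id.const_mul_atTop (show 0 < 1 + e by linarith))
  refine le_of_tendsto_of_tendsto (tendsto_regDensity hσ hd hdn g)
    (h1.const_mul ((1 + e) ^ (n - d))) ?_
  filter_upwards [eventually_gt_atTop 0] with t ht
  have h2 := ENNReal.toReal_mono (regVol_ne_top _ _ _ _ _)
    (regVol_mul_left_le σ d g h (measurableSet_Icc (a := (0 : ℝ)) (b := 1)) (t := t) he)
  have h3 : 0 < (1 + e) ^ (n - d) := by positivity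
  simp only [Function.comp_apply, id, mul_pow]
  rw [← div_div, mul_div_assoc', mul_div_cancel₀ _ h3.ne']
  gcongr

/-- The density-weighted cutoff is Lipschitz along left translations. -/
theorem exists_rho_mul_regDensity_le {n : ℕ} {σ : Fin n → ℝ} (hσ : ∀ i, |σ i| = 1)
    {d : ℕ} (hd : 2 ≤ d) (hdn : d < n) {L : ℝ} (hL : 1 ≤ L) :
    ∃ κ > (0 : ℝ), ∃ B > (0 : ℝ), ∀ h : SLR n,
      mnorm ((h : Matrix (Fin n) (Fin n) ℝ) - 1) ≤ κ → ∀ g : SLR n,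
      rho L g * ENNReal.ofReal (regDensity σ d g) ≤
        rho L (h * g) * ENNReal.ofReal (regDensity σ d (h * g)) + (KL n L).indicator
          (fun _ => ENNReal.ofReal (B * mnorm ((h : Matrix (Fin n) (Fin n) ℝ) - 1))) g := by
  obtain ⟨C₁, hC₁, h1⟩ := exists_mnorm_inv_le n (n + 1)
  obtain ⟨θ, hθ, h2⟩ := exists_regDensity_asymptotic hσ hd hdn
  obtain ⟨C₂, hC₂, h3⟩ := h2 ((n + 1) * L)
  have hn1 : (1 : ℝ) ≤ n := by exact_mod_cast (by omega : 1 ≤ n)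
  refine ⟨(n * C₁)⁻¹, by positivity, L * (2 ^ (n - d) * (n * C₁) * C₂) + L * C₂, by positivity,
    fun h hh g => ?_⟩
  by_cases hg : g ∈ KL n L
  swap
  · rw [rho, ENNReal.ofReal_of_nonpos, zero_mul]
    · exact zero_le
    · have : ¬ mnorm (g : Matrix (Fin n) (Fin n) ℝ) ≤ L := hg
      linarith
  have h4 := rho_le_rho_mul L h g
  rw [Set.indicator_of_mem hg] at h4 ⊢
  set m := mnorm ((h : Matrix (Fin n) (Fin n) ℝ) - 1) with hm
  have hm0 : 0 ≤ m := mnorm_nonneg _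
  have hm1 : m ≤ 1 := hh.trans (inv_le_one_of_one_le₀ (one_le_mul_of_one_le_of_one_le hn1 hC₁))
  have hhK : h ∈ KL n (n + 1) := by
    have := mnorm_add_le ((h : Matrix (Fin n) (Fin n) ℝ) - 1) 1
    rw [sub_add_cancel, mnorm_one] at this
    show mnorm _ ≤ _
    linarith
  have hgK : g ∈ KL n ((n + 1) * L) := KL_mono (by nlinarith) hg
  have hhg : h * g ∈ KL n ((n + 1) * L) := mul_mem_KL hhK hg
  have hc1 := (h3 g hgK).1
  have hc2 := (h3 _ hhg).1
  have hc20 := regDensity_nonneg hσ hd hdn (h * g)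
  have he1 : n * C₁ * m ≤ 1 := by
    rwa [← one_div, le_div_iff₀' (by positivity)] at hh
  have h5 := regDensity_le_mul_left hσ hd hdn g h (e := n * C₁ * m) (by
    rw [mul_assoc]
    have := h1 h hhK
    gcongr)
  have h6 := one_add_pow_le (show 0 ≤ n * C₁ * m by positivity) he1 (n - d)
  have h7 : regDensity σ d g ≤ regDensity σ d (h * g) + 2 ^ (n - d) * (n * C₁ * m) * C₂ := by
    have h8 : 0 ≤ 2 ^ (n - d) * (n * C₁ * m) := by positivity
    nlinarith [mul_le_mul_of_nonneg_right h6 hc20, mul_le_mul_of_nonneg_left hc2 h8]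
  have h9 : rho L (h * g) ≤ ENNReal.ofReal L :=
    ENNReal.ofReal_le_ofReal (by linarith [mnorm_nonneg ((h * g : SLR n) : Matrix (Fin n) (Fin n) ℝ)])
  calc rho L g * ENNReal.ofReal (regDensity σ d g)
      ≤ (rho L (h * g) + ENNReal.ofReal (m * L)) * ENNReal.ofReal (regDensity σ d g) := by gcongr
    _ = rho L (h * g) * ENNReal.ofReal (regDensity σ d g)
        + ENNReal.ofReal (m * L) * ENNReal.ofReal (regDensity σ d g) := by rw [add_mul]
    _ ≤ rho L (h * g) * (ENNReal.ofReal (regDensity σ d (h * g))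
          + ENNReal.ofReal (2 ^ (n - d) * (n * C₁ * m) * C₂))
        + ENNReal.ofReal (m * L) * ENNReal.ofReal C₂ := by
      rw [← ENNReal.ofReal_add hc20 (by positivity)]
      gcongr
    _ ≤ rho L (h * g) * ENNReal.ofReal (regDensity σ d (h * g))
          + ENNReal.ofReal L * ENNReal.ofReal (2 ^ (n - d) * (n * C₁ * m) * C₂)
        + ENNReal.ofReal (m * L) * ENNReal.ofReal C₂ := by
      rw [mul_add]
      gcongr
    _ = _ := by
      rw [add_assoc, ← ENNReal.ofReal_mul (by positivity), ← ENNReal.ofReal_mul (by positivity),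
        ← ENNReal.ofReal_add (by positivity) (by positivity)]
      congr 2
      ring

/-- The half-open unit cube. -/
def unitCube (n : ℕ) : Set (Fin n → ℝ) := Set.univ.pi fun _ => Set.Ico 0 1

theorem measurableSet_unitCube (n : ℕ) : MeasurableSet (unitCube n) :=
  MeasurableSet.univ_pi fun _ => measurableSet_Ico

theorem volume_unitCube (n : ℕ) : volume (unitCube n) = 1 := by
  rw [unitCube, volume_pi_pi]
  simp

theorem norm_le_one_of_mem_unitCube {n : ℕ} {u : Fin n → ℝ} (hu : u ∈ unitCube n) : ‖u‖ ≤ 1 := by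
  refine (pi_norm_le_iff_of_nonneg zero_le_one).2 fun i => ?_
  have h := hu i (Set.mem_univ i)
  rw [Real.norm_eq_abs, abs_of_nonneg h.1]
  exact h.2.le

theorem sub_floor_mem_unitCube {n : ℕ} (x : Fin n → ℝ) :
    x - intVec (fun i => ⌊x i⌋) ∈ unitCube n := fun i _ => by
  simp only [Pi.sub_apply, intVec]
  exact ⟨Int.fract_nonneg _, Int.fract_lt_one _⟩

theorem eq_floor_of_sub_mem_unitCube {n : ℕ} {x : Fin n → ℝ} {v : Fin n → ℤ}
    (h : x - intVec v ∈ unitCube n) : v = fun i => ⌊x i⌋ := by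
  ext i
  have h1 := h i (Set.mem_univ i)
  simp only [Pi.sub_apply, intVec, Set.mem_Ico] at h1
  exact (Int.floor_eq_iff.2 ⟨by linarith, by linarith⟩).symm

/-- The volume of the part of the unit cell at `v` where the form takes values in `J`. -/
def cellVol {n : ℕ} (σ : Fin n → ℝ) (d : ℕ) (J : Set ℝ) (v : Fin n → ℤ) (g : SLR n) : ENNReal :=
  volume {u : Fin n → ℝ | u ∈ unitCube n ∧ g ∈ hit σ d J (intVec v + u)}

theorem measurableSet_prod_hit {n : ℕ} (σ : Fin n → ℝ) (d : ℕ) {J : Set ℝ} (hJ : MeasurableSet J)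
    (x : Fin n → ℝ) : MeasurableSet {p : (Fin n → ℝ) × SLR n | p.2 ∈ hit σ d J (x + p.1)} := by
  have h : Continuous fun p : (Fin n → ℝ) × SLR n => Fs σ d (act (x + p.1) p.2) :=
    (continuous_Fs σ d).comp (continuous_act.comp
      ((continuous_const.add continuous_fst).prodMk continuous_snd))
  exact h.measurable hJ

theorem measurable_cellVol {n : ℕ} (σ : Fin n → ℝ) (d : ℕ) {J : Set ℝ} (hJ : MeasurableSet J)
    (v : Fin n → ℤ) : Measurable (cellVol σ d J v) :=
  measurable_measure_prodMk_right (μ := (volume : Measure (Fin n → ℝ)))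
    (s := {p : (Fin n → ℝ) × SLR n | p.1 ∈ unitCube n ∧ p.2 ∈ hit σ d J (intVec v + p.1)})
    ((measurable_fst (measurableSet_unitCube n)).inter (measurableSet_prod_hit σ d hJ _))

theorem lintegral_unitCube_hit {n : ℕ} (σ : Fin n → ℝ) (d : ℕ) {J : Set ℝ} (hJ : MeasurableSet J)
    (v : Fin n → ℤ) (μ : Measure (SLR n)) [SFinite μ] {ψ : SLR n → ENNReal} (hψ : Measurable ψ) :
    ∫⁻ u in unitCube n, ∫⁻ g in hit σ d J (intVec v + u), ψ g ∂μ
      = ∫⁻ g, ψ g * cellVol σ d J v g ∂μ := by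
  have hm := measurableSet_prod_hit σ d hJ (intVec v)
  have h1 : ∀ u, ∫⁻ g in hit σ d J (intVec v + u), ψ g ∂μ
      = ∫⁻ g, {p : (Fin n → ℝ) × SLR n | p.2 ∈ hit σ d J (intVec v + p.1)}.indicator
          (fun p => ψ p.2) (u, g) ∂μ := fun u => by
    rw [← lintegral_indicator (measurableSet_hit σ d hJ _)]
    rfl
  have hmm : Measurable (Function.uncurry fun (u : Fin n → ℝ) (g : SLR n) =>
      {p : (Fin n → ℝ) × SLR n | p.2 ∈ hit σ d J (intVec v + p.1)}.indicator
        (fun p => ψ p.2) (u, g)) := (hψ.comp measurable_snd).indicator hm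
  simp_rw [h1]
  rw [lintegral_lintegral_swap hmm.aemeasurable]
  refine lintegral_congr fun g => ?_
  have hmg : MeasurableSet {u : Fin n → ℝ | g ∈ hit σ d J (intVec v + u)} :=
    (measurable_id.prodMk measurable_const) hm
  have h2 : ∀ u, {p : (Fin n → ℝ) × SLR n | p.2 ∈ hit σ d J (intVec v + p.1)}.indicator
      (fun p => ψ p.2) (u, g)
      = {u : Fin n → ℝ | g ∈ hit σ d J (intVec v + u)}.indicator (fun _ => ψ g) u := fun u => rfl
  simp_rw [h2]
  rw [lintegral_indicator_const hmg, Measure.restrict_apply hmg, cellVol, Set.inter_comm]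
  rfl

theorem lintegral_unitCube_hit_inter {n : ℕ} (σ : Fin n → ℝ) (d : ℕ) {J : Set ℝ}
    (hJ : MeasurableSet J) (v w : Fin n → ℤ) (μ : Measure (SLR n)) [SFinite μ]
    {ψ : SLR n → ENNReal} (hψ : Measurable ψ) :
    ∫⁻ u' in unitCube n, ∫⁻ u in unitCube n,
        ∫⁻ g in hit σ d J (intVec v + u) ∩ hit σ d J (intVec w + u'), ψ g ∂μ
      = ∫⁻ g, ψ g * (cellVol σ d J v g * cellVol σ d J w g) ∂μ := by
  have h1 : ∀ u' u, ∫⁻ g in hit σ d J (intVec v + u) ∩ hit σ d J (intVec w + u'), ψ g ∂μ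
      = ∫⁻ g in hit σ d J (intVec v + u), (hit σ d J (intVec w + u')).indicator ψ g ∂μ :=
    fun u' u => by
      rw [setLIntegral_indicator (measurableSet_hit σ d hJ _), Set.inter_comm]
  simp_rw [h1]
  have h2 : ∀ u', ∫⁻ u in unitCube n,
      ∫⁻ g in hit σ d J (intVec v + u), (hit σ d J (intVec w + u')).indicator ψ g ∂μ
      = ∫⁻ g in hit σ d J (intVec w + u'), ψ g * cellVol σ d J v g ∂μ := fun u' => by
    rw [lintegral_unitCube_hit σ d hJ v μ (hψ.indicator (measurableSet_hit σ d hJ _)),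
      ← lintegral_indicator (measurableSet_hit σ d hJ _)]
    refine lintegral_congr fun g => ?_
    by_cases hg : g ∈ hit σ d J (intVec w + u') <;> simp [hg]
  simp_rw [h2]
  rw [lintegral_unitCube_hit σ d hJ w μ (ψ := fun g => ψ g * cellVol σ d J v g)
    (hψ.mul (measurable_cellVol σ d hJ v))]
  simp_rw [mul_assoc]

theorem cellVol_eq {n : ℕ} (σ : Fin n → ℝ) (d : ℕ) {J : Set ℝ} (v : Fin n → ℤ) (g : SLR n) :
    cellVol σ d J v g
      = volume {x : Fin n → ℝ | x - intVec v ∈ unitCube n ∧ Fs σ d (act x g) ∈ J} := by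
  rw [cellVol, ← measure_preimage_add_right volume (-intVec v)]
  congr 1
  ext x
  simp only [Set.mem_preimage, Set.mem_ofPred_eq, hit, sub_eq_add_neg, add_comm x,
    add_neg_cancel_left]

theorem measurableSet_cell {n : ℕ} (σ : Fin n → ℝ) (d : ℕ) {J : Set ℝ} (hJ : MeasurableSet J)
    (v : Fin n → ℤ) (g : SLR n) :
    MeasurableSet {x : Fin n → ℝ | x - intVec v ∈ unitCube n ∧ Fs σ d (act x g) ∈ J} :=
  ((measurable_id.sub_const _) (measurableSet_unitCube n)).inter
    (((continuous_Fs σ d).comp (continuous_act_left g)).measurable hJ)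

theorem abs_eucNorm_sub_le {n : ℕ} {x : Fin n → ℝ} {v : Fin n → ℤ}
    (h : x - intVec v ∈ unitCube n) : |eucNorm x - eucNorm (intVec v)| ≤ n := by
  have h1 := norm_le_one_of_mem_unitCube h
  have h2 : eucNorm (x - intVec v) ≤ n := (eucNorm_le _).trans
    (mul_le_of_le_one_right (Nat.cast_nonneg n) h1)
  have h3 := eucNorm_add_le (intVec v) (x - intVec v)
  have h4 := eucNorm_add_le x ((-1 : ℝ) • (x - intVec v))
  rw [add_sub_cancel] at h3
  rw [eucNorm_smul, abs_neg, abs_one, one_mul, neg_one_smul, neg_sub, add_sub_cancel] at h4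
  rw [abs_le]
  constructor <;> linarith

theorem sum_cellVol_le {n : ℕ} (σ : Fin n → ℝ) (d : ℕ) {J : Set ℝ} (hJ : MeasurableSet J)
    (g : SLR n) {t : ℝ} {A : Finset (Fin n → ℤ)} (hA : ∀ v ∈ A, eucNorm (intVec v) ≤ t) :
    ∑ v ∈ A, cellVol σ d J v g ≤ regVol σ d g J (t + n) := by
  simp_rw [cellVol_eq]
  rw [← measure_biUnion_finset]
  · refine measure_mono (Set.iUnion₂_subset fun v hv x hx => ⟨?_, hx.2⟩)
    have := (abs_le.1 (abs_eucNorm_sub_le hx.1)).2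
    linarith [hA v hv]
  · intro v _ w _ hvw
    refine Set.disjoint_left.2 fun x hx hy => hvw ?_
    rw [eq_floor_of_sub_mem_unitCube hx.1, eq_floor_of_sub_mem_unitCube hy.1]
  · exact fun v _ => measurableSet_cell σ d hJ v g

/-- Integer vectors in the Euclidean ball of radius `t` with sup norm larger than `S`. -/
def annulus (n : ℕ) (S t : ℝ) : Finset (Fin n → ℤ) :=
  open Classical in
  (vbox n ⌊t⌋₊).filter fun v => S < ‖intVec v‖ ∧ eucNorm (intVec v) ≤ t

theorem mem_vbox_of_eucNorm_le {n : ℕ} {t : ℝ} {v : Fin n → ℤ} (h : eucNorm (intVec v) ≤ t) :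
    v ∈ vbox n ⌊t⌋₊ := by
  rw [mem_vbox]
  intro i
  have h1 : |((v i : ℤ) : ℝ)| ≤ t := by
    have := norm_le_pi_norm (intVec v) i
    rw [Real.norm_eq_abs] at this
    exact this.trans ((norm_le_eucNorm _).trans h)
  have h2 : (v i).natAbs ≤ ⌊t⌋₊ := by
    rw [Nat.le_floor_iff ((abs_nonneg _).trans h1), Nat.cast_natAbs, Int.cast_abs]
    exact h1
  rw [← Int.natCast_natAbs]
  exact_mod_cast h2

theorem mem_annulus {n : ℕ} {S t : ℝ} {v : Fin n → ℤ} :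
    v ∈ annulus n S t ↔ S < ‖intVec v‖ ∧ eucNorm (intVec v) ≤ t := by
  classical
  rw [annulus, Finset.mem_filter]
  exact ⟨fun h => h.2, fun h => ⟨mem_vbox_of_eucNorm_le h.2, h⟩⟩

theorem regVol_le_sum_cellVol {n : ℕ} (hn : 0 < n) (σ : Fin n → ℝ) (d : ℕ) (J : Set ℝ)
    (g : SLR n) (S t : ℝ) :
    regVol σ d g J (t - n) ≤
      ∑ v ∈ annulus n S t, cellVol σ d J v g + regVol σ d g J (n * (S + 1)) := by
  simp_rw [cellVol_eq]
  refine le_trans (measure_mono ?_) ((measure_union_le (⋃ v ∈ annulus n S t,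
    {x : Fin n → ℝ | x - intVec v ∈ unitCube n ∧ Fs σ d (act x g) ∈ J})
    {x : Fin n → ℝ | eucNorm x ≤ n * (S + 1) ∧ Fs σ d (act x g) ∈ J}).trans
      (add_le_add (measure_biUnion_finset_le _ _) le_rfl))
  rintro x ⟨hx1, hx2⟩
  by_cases h : eucNorm x ≤ n * (S + 1)
  · exact Or.inr ⟨h, hx2⟩
  left
  have h1 := sub_floor_mem_unitCube x
  refine Set.mem_biUnion (x := fun i => ⌊x i⌋) ?_ ⟨h1, hx2⟩
  rw [Finset.mem_coe, mem_annulus]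
  have h2 := abs_le.1 (abs_eucNorm_sub_le h1)
  have h3 := norm_le_one_of_mem_unitCube h1
  refine ⟨?_, by linarith⟩
  have hn0 : (0 : ℝ) < n := by exact_mod_cast hn
  have h4 : S + 1 < ‖x‖ := by
    have := (not_le.1 h).trans_le (eucNorm_le x)
    exact lt_of_mul_lt_mul_left this hn0.le
  have h5 := norm_sub_norm_le x (intVec fun i => ⌊x i⌋)
  linarith

theorem setLIntegral_rho_le {n : ℕ} (μ : Measure (SLR n)) {L : ℝ} {A : Set (SLR n)} :
    ∫⁻ g in A, rho L g ∂μ ≤ ENNReal.ofReal L * μ (KL n L ∩ A) := by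
  have h : ∀ g, rho L g ≤ (KL n L).indicator (fun _ => ENNReal.ofReal L) g := fun g => by
    by_cases hg : g ∈ KL n L
    · rw [Set.indicator_of_mem hg]
      exact ENNReal.ofReal_le_ofReal (by linarith [mnorm_nonneg (g : Matrix (Fin n) (Fin n) ℝ)])
    · rw [rho_eq_zero hg]
      exact zero_le
  refine (lintegral_mono h).trans ?_
  rw [lintegral_indicator_const (measurableSet_KL n L),
    Measure.restrict_apply (measurableSet_KL n L)]

/-- Weight of a pair of integer vectors that are nearly parallel with pivot `i`. -/
def nearWeight {n : ℕ} (S D : ℝ) (i s : Fin n) (v w : Fin n → ℤ) : ℝ :=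
  open Classical in
  if S ≤ |(v i : ℝ)| ∧ v i * w s - v s * w i ≠ 0 ∧
      (∀ l, |((v i * w l - v l * w i : ℤ) : ℝ)| < D)
    then 1 / |((v i * w s - v s * w i : ℤ) : ℝ)| else 0

/-- Indicator of a pair of parallel integer vectors with pivot `i`. -/
def parWeight {n : ℕ} (S : ℝ) (i : Fin n) (v w : Fin n → ℤ) : ℝ :=
  open Classical in
  if S ≤ |(v i : ℝ)| ∧ (∀ l, v i * w l - v l * w i = 0) then 1 else 0

theorem nearWeight_nonneg {n : ℕ} (S D : ℝ) (i s : Fin n) (v w : Fin n → ℤ) :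
    0 ≤ nearWeight S D i s v w := by
  rw [nearWeight]
  split_ifs <;> positivity

theorem parWeight_nonneg {n : ℕ} (S : ℝ) (i : Fin n) (v w : Fin n → ℤ) :
    0 ≤ parWeight S i v w := by
  rw [parWeight]
  split_ifs <;> positivity

theorem lintegral_hit_inter_le {n : ℕ} (hn : 3 ≤ n) {σ : Fin n → ℝ} (hσ : ∀ i, |σ i| = 1) {d : ℕ}
    (hd : 2 ≤ d) (μ : Measure (SLR n)) [μ.IsHaarMeasure] {L : ℝ} (hL : 1 ≤ L) :
    ∃ C > (0 : ℝ), ∀ t S D : ℝ, 2 ≤ S → S ≤ t → 80 * n ^ 4 * t ≤ D →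
      ∀ v w : Fin n → ℤ, S ≤ ‖intVec v‖ → ‖intVec v‖ ≤ t → S ≤ ‖intVec w‖ → ‖intVec w‖ ≤ t →
      ∀ J : Set ℝ, MeasurableSet J →
      ∫⁻ g in hit σ d J (intVec v) ∩ hit σ d J (intVec w), rho L g ∂μ
      ≤ ∫⁻ g, rho L g * (cellVol σ d J v g * cellVol σ d J w g) ∂μ
        + ENNReal.ofReal (C * t / (D ^ 2 * S ^ (2 * d - 2))) * volume J ^ 2
        + ∑ i, ∑ s, ENNReal.ofReal (C / S ^ (2 * d - 2) * nearWeight S D i s v w) * volume J ^ 2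
        + ∑ i, ENNReal.ofReal (C / S ^ d * parWeight S i v w) * volume J := by
  obtain ⟨C₁, hC₁, h₁⟩ := pair_regularity hn hσ hd μ hL
  obtain ⟨C₂, hC₂, h₂⟩ := measure_pair_le hn hσ hd μ hL
  obtain ⟨C₃, hC₃, h₃⟩ := measure_single_le hn hσ hd μ hL
  have hL0 : 0 < L := by linarith
  refine ⟨C₁ + L * C₂ + L * C₃, by positivity, fun t S D hS hSt hD v w hv hvt hw hwt J hJ => ?_⟩
  have hS0 : 0 < S := by linarith
  have ht0 : 0 < t := by linarith
  have hD0 : 0 < D := lt_of_lt_of_le (by positivity) hD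
  by_cases hfar : ∃ r s, D ≤ |intVec v r * intVec w s - intVec v s * intVec w r|
  · obtain ⟨r, s, hrs⟩ := hfar
    refine le_trans ?_ (le_self_add.trans le_self_add)
    have hc : ∀ K : ENNReal, ∫⁻ _ in unitCube n, K = K := fun K => by
      rw [setLIntegral_const, volume_unitCube, mul_one]
    set E := ENNReal.ofReal ((C₁ + L * C₂ + L * C₃) * t / (D ^ 2 * S ^ (2 * d - 2)))
      * volume J ^ 2 with hE
    rw [← lintegral_unitCube_hit_inter σ d hJ v w μ (measurable_rho L)]
    calc ∫⁻ g in hit σ d J (intVec v) ∩ hit σ d J (intVec w), rho L g ∂μ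
        = ∫⁻ _ in unitCube n, ∫⁻ _ in unitCube n,
          ∫⁻ g in hit σ d J (intVec v) ∩ hit σ d J (intVec w), rho L g ∂μ := by rw [hc, hc]
      _ ≤ ∫⁻ u' in unitCube n, (∫⁻ u in unitCube n,
          ∫⁻ g in hit σ d J (intVec v + u) ∩ hit σ d J (intVec w + u'), rho L g ∂μ) + E := by
          refine setLIntegral_mono' (measurableSet_unitCube n) fun u' hu' => ?_
          refine (setLIntegral_mono' (measurableSet_unitCube n) fun u hu => ?_).trans_eq
            ((lintegral_add_right _ (measurable_const (a := E))).trans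
              (congrArg _ (hc E)))
          refine (h₁ t S D hS hSt hD _ _ u u' hv hvt hw hwt (norm_le_one_of_mem_unitCube hu)
            (norm_le_one_of_mem_unitCube hu') r s hrs J hJ).trans (add_le_add le_rfl ?_)
          refine mul_le_mul_left (ENNReal.ofReal_le_ofReal ?_) _
          gcongr
          nlinarith [mul_pos hL0 hC₂, mul_pos hL0 hC₃]
      _ = _ := by rw [lintegral_add_right _ measurable_const, hc]
  · push Not at hfar
    obtain ⟨i, hi⟩ := exists_abs_eq_norm (by omega) (intVec v)
    have hcast : ∀ s, intVec v i * intVec w s - intVec v s * intVec w i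
        = ((v i * w s - v s * w i : ℤ) : ℝ) := fun s => by
      simp only [intVec]
      push_cast
      ring
    have hSi : S ≤ |((v i : ℤ) : ℝ)| := hv.trans_eq hi.symm
    refine (setLIntegral_rho_le μ).trans ?_
    by_cases hpar : ∀ l, v i * w l - v l * w i = 0
    · refine le_trans ?_ le_add_self
      refine le_trans ?_ (Finset.single_le_sum (fun _ _ => zero_le) (Finset.mem_univ i))
      have hp : parWeight S i v w = 1 := by
        rw [parWeight, if_pos ⟨hSi, hpar⟩]
      have hv0 : intVec v ≠ 0 := fun h => by
        rw [h, norm_zero] at hv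
        linarith
      calc ENNReal.ofReal L * μ (KL n L ∩ (hit σ d J (intVec v) ∩ hit σ d J (intVec w)))
          ≤ ENNReal.ofReal L * (ENNReal.ofReal (C₃ / ‖intVec v‖ ^ d) * volume J) := by
            refine mul_le_mul_right ((measure_mono ?_).trans (h₃ _ hv0 J hJ)) _
            exact fun g hg => ⟨hg.1, hg.2.1⟩
        _ ≤ _ := by
            rw [← mul_assoc, ← ENNReal.ofReal_mul hL0.le, hp, mul_one]
            refine mul_le_mul_left (ENNReal.ofReal_le_ofReal ?_) _
            rw [← mul_div_assoc]
            have : L * C₃ ≤ C₁ + L * C₂ + L * C₃ := by nlinarith [mul_pos hL0 hC₂]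
            gcongr
    · push Not at hpar
      obtain ⟨s, hs⟩ := hpar
      refine le_trans ?_ (le_add_right le_add_self)
      refine le_trans ?_ (Finset.single_le_sum (fun _ _ => zero_le) (Finset.mem_univ i))
      refine le_trans ?_ (Finset.single_le_sum (fun _ _ => zero_le) (Finset.mem_univ s))
      have hp : nearWeight S D i s v w = 1 / |((v i * w s - v s * w i : ℤ) : ℝ)| := by
        rw [nearWeight, if_pos ⟨hSi, hs, fun l => by rw [← hcast]; exact hfar i l⟩]
      have hz : intVec v i * intVec w s - intVec v s * intVec w i ≠ 0 := by
        rw [hcast]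
        exact_mod_cast hs
      have hz' : 0 < |((v i * w s - v s * w i : ℤ) : ℝ)| := by
        rw [← hcast]
        exact abs_pos.2 hz
      calc ENNReal.ofReal L * μ (KL n L ∩ (hit σ d J (intVec v) ∩ hit σ d J (intVec w)))
          ≤ ENNReal.ofReal L * (ENNReal.ofReal (C₂ / (|((v i * w s - v s * w i : ℤ) : ℝ)|
            * ‖intVec v‖ ^ (d - 1) * ‖intVec w‖ ^ (d - 1))) * volume J ^ 2) := by
            rw [← hcast]
            refine mul_le_mul_right ((measure_mono ?_).trans (h₂ _ _ i s hz J hJ)) _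
            exact fun g hg => ⟨hg.1, hg.2.1, hg.2.2⟩
        _ ≤ _ := by
            rw [← mul_assoc, ← ENNReal.ofReal_mul hL0.le, hp]
            refine mul_le_mul_left (ENNReal.ofReal_le_ofReal ?_) _
            have h4 : S ^ (2 * d - 2) = S ^ (d - 1) * S ^ (d - 1) := by
              rw [← pow_add]
              congr 1
              omega
            have h5 : L * C₂ ≤ C₁ + L * C₂ + L * C₃ := by nlinarith [mul_pos hL0 hC₃]
            rw [← mul_div_assoc, div_mul_div_comm, mul_one, h4,
              mul_comm (S ^ (d - 1) * S ^ (d - 1)), mul_assoc |_|]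
            gcongr


/-- The number of integer vectors in `A` at which the form takes values in `J`. -/
def count {n : ℕ} (σ : Fin n → ℝ) (d : ℕ) (J : Set ℝ) (A : Finset (Fin n → ℤ)) (g : SLR n) :
    ENNReal := ∑ v ∈ A, (hit σ d J (intVec v)).indicator 1 g

theorem measurable_count {n : ℕ} (σ : Fin n → ℝ) (d : ℕ) {J : Set ℝ} (hJ : MeasurableSet J)
    (A : Finset (Fin n → ℤ)) : Measurable (count σ d J A) :=
  Finset.measurable_fun_sum _ fun _ _ => measurable_one.indicator (measurableSet_hit σ d hJ _)

theorem lintegral_mul_count {n : ℕ} (σ : Fin n → ℝ) (d : ℕ) {J : Set ℝ} (hJ : MeasurableSet J)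
    (A : Finset (Fin n → ℤ)) (μ : Measure (SLR n)) {ψ : SLR n → ENNReal} (hψ : Measurable ψ) :
    ∫⁻ g, ψ g * count σ d J A g ∂μ = ∑ v ∈ A, ∫⁻ g in hit σ d J (intVec v), ψ g ∂μ := by
  simp_rw [count, Finset.mul_sum]
  have hm : ∀ v ∈ A, Measurable fun g => ψ g * (hit σ d J (intVec v)).indicator 1 g :=
    fun v _ => hψ.mul (measurable_one.indicator (measurableSet_hit σ d hJ _))
  rw [lintegral_finsetSum _ hm]
  refine Finset.sum_congr rfl fun v _ => ?_
  rw [← lintegral_indicator (measurableSet_hit σ d hJ _)]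
  refine lintegral_congr fun g => ?_
  by_cases hg : g ∈ hit σ d J (intVec v) <;> simp [hg]

theorem lintegral_mul_count_sq {n : ℕ} (σ : Fin n → ℝ) (d : ℕ) {J : Set ℝ} (hJ : MeasurableSet J)
    (A : Finset (Fin n → ℤ)) (μ : Measure (SLR n)) {ψ : SLR n → ENNReal} (hψ : Measurable ψ) :
    ∫⁻ g, ψ g * count σ d J A g ^ 2 ∂μ = ∑ v ∈ A, ∑ w ∈ A,
      ∫⁻ g in hit σ d J (intVec v) ∩ hit σ d J (intVec w), ψ g ∂μ := by
  have h1 : ∀ g, ψ g * count σ d J A g ^ 2 = (ψ g * count σ d J A g) * count σ d J A g :=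
    fun g => by ring
  simp_rw [h1]
  rw [lintegral_mul_count σ d hJ A μ (ψ := fun g => ψ g * count σ d J A g)
    (hψ.mul (measurable_count σ d hJ A))]
  refine Finset.sum_congr rfl fun v _ => ?_
  rw [lintegral_mul_count σ d hJ A _ hψ]
  refine Finset.sum_congr rfl fun w _ => ?_
  rw [Measure.restrict_restrict (measurableSet_hit σ d hJ _), Set.inter_comm]

theorem sum_annulus_le {n : ℕ} {S t : ℝ} (f : (Fin n → ℤ) → (Fin n → ℤ) → ℝ)
    (hf : ∀ v w, 0 ≤ f v w) :
    ∑ v ∈ annulus n S t, ∑ w ∈ annulus n S t, f v w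
      ≤ ∑ v ∈ vbox n ⌊t⌋₊, ∑ w ∈ vbox n ⌊t⌋₊, f v w := by
  have hsub : annulus n S t ⊆ vbox n ⌊t⌋₊ := fun v hv =>
    mem_vbox_of_eucNorm_le (mem_annulus.1 hv).2
  exact (Finset.sum_le_sum fun v _ => Finset.sum_le_sum_of_subset_of_nonneg hsub
    fun w _ _ => hf v w).trans (Finset.sum_le_sum_of_subset_of_nonneg hsub
      fun v _ _ => Finset.sum_nonneg fun w _ => hf v w)

theorem two_mul_floor_le {t : ℝ} (ht : 1 ≤ t) : (2 * (⌊t⌋₊ : ℝ) + 1) ≤ 3 * t := by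
  have := Nat.floor_le (by linarith : 0 ≤ t)
  linarith

theorem card_annulus_le (n : ℕ) {S t : ℝ} (ht : 1 ≤ t) :
    ((annulus n S t).card : ℝ) ≤ (3 * t) ^ n := by
  have h1 : (annulus n S t).card ≤ (vbox n ⌊t⌋₊).card :=
    Finset.card_le_card fun v hv => mem_vbox_of_eucNorm_le (mem_annulus.1 hv).2
  rw [card_vbox] at h1
  calc ((annulus n S t).card : ℝ) ≤ (((2 * ⌊t⌋₊ + 1) ^ n : ℕ) : ℝ) := by exact_mod_cast h1
    _ = (2 * (⌊t⌋₊ : ℝ) + 1) ^ n := by push_cast; rfl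
    _ ≤ (3 * t) ^ n := pow_le_pow_left₀ (by positivity) (two_mul_floor_le ht) n

theorem sum_nearWeight_le {n : ℕ} (i s : Fin n) {S D t : ℝ} (hS : 1 ≤ S) (hSt : S ≤ t)
    (htD : t ≤ D) :
    ∑ v ∈ annulus n S t, ∑ w ∈ annulus n S t, nearWeight S D i s v w
      ≤ (9 * (t * D / S)) ^ (n - 2) * (72 * (t ^ 3 / S) * hsum (2 * ⌊t⌋₊ ^ 2)) := by
  have hS0 : 0 < S := by linarith
  have ht0 : 0 < t := by linarith
  have hD0 : 0 < D := by linarith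
  have hH := hsum_nonneg (2 * ⌊t⌋₊ ^ 2)
  by_cases his : i = s
  · subst his
    have : ∀ v w : Fin n → ℤ, nearWeight S D i i v w = 0 := fun v w => by
      rw [nearWeight, if_neg]
      rintro ⟨-, h, -⟩
      exact h (by ring)
    simp_rw [this]
    rw [Finset.sum_const_zero, Finset.sum_const_zero]
    positivity
  refine (sum_annulus_le _ fun v w => nearWeight_nonneg S D i s v w).trans ?_
  refine (near_sum his hS0 hD0.le).trans ?_
  have h1 := two_mul_floor_le (hS.trans hSt)
  have h2 : 1 ≤ D / S := (one_le_div hS0).2 (hSt.trans htD)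
  have h3 : 1 ≤ t / S := (one_le_div hS0).2 hSt
  have h4 : (2 * (⌊t⌋₊ : ℝ) + 1) * (2 * (D / S) + 1) ≤ 9 * (t * D / S) :=
    calc (2 * (⌊t⌋₊ : ℝ) + 1) * (2 * (D / S) + 1) ≤ (3 * t) * (3 * (D / S)) := by
          gcongr
          linarith
      _ = _ := by ring
  have h5 : (2 * (⌊t⌋₊ : ℝ) + 1) ^ 2 * (2 * ((2 * (⌊t⌋₊ : ℝ) + 1) / S + 1)
      * hsum (2 * ⌊t⌋₊ ^ 2)) ≤ 72 * (t ^ 3 / S) * hsum (2 * ⌊t⌋₊ ^ 2) :=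
    calc (2 * (⌊t⌋₊ : ℝ) + 1) ^ 2 * (2 * ((2 * (⌊t⌋₊ : ℝ) + 1) / S + 1)
        * hsum (2 * ⌊t⌋₊ ^ 2))
        ≤ (3 * t) ^ 2 * (2 * (3 * t / S + t / S) * hsum (2 * ⌊t⌋₊ ^ 2)) := by gcongr
      _ = _ := by ring
  gcongr

theorem sum_parWeight_le {n : ℕ} (hn : 3 ≤ n) (i : Fin n) {S t : ℝ} (hS : 1 ≤ S) (hSt : S ≤ t) :
    ∑ v ∈ annulus n S t, ∑ w ∈ annulus n S t, parWeight S i v w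
      ≤ (3 * t) ^ (n - 2) * (57 * (t ^ 3 / S) * hsum (2 * ⌊t⌋₊ ^ 2)) := by
  have hS0 : 0 < S := by linarith
  have ht1 : 1 ≤ t := hS.trans hSt
  have ht0 : 0 < t := by linarith
  have : Nontrivial (Fin n) := Fin.nontrivial_iff_two_le.2 (by omega)
  obtain ⟨s, hs⟩ := exists_ne i
  refine (sum_annulus_le _ fun v w => parWeight_nonneg S i v w).trans ?_
  refine (par_sum hs.symm hS0).trans ?_
  have hN : 1 ≤ ⌊t⌋₊ := (Nat.one_le_floor_iff _).2 ht1
  have h1 := two_mul_floor_le ht1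
  have h3 : 1 ≤ t / S := (one_le_div hS0).2 hSt
  have h4 : hsum ⌊t⌋₊ ≤ hsum (2 * ⌊t⌋₊ ^ 2) := hsum_mono (by nlinarith)
  have h5 : 1 ≤ hsum (2 * ⌊t⌋₊ ^ 2) := one_le_hsum (Nat.mul_pos two_pos (pow_pos hN 2))
  have h8 := hsum_nonneg ⌊t⌋₊
  have h6 : (2 * (⌊t⌋₊ : ℝ) + 1) / S * (16 * (⌊t⌋₊ : ℝ) ^ 2 * hsum ⌊t⌋₊)
      + (2 * (⌊t⌋₊ : ℝ) + 1) ^ 2 ≤ 57 * (t ^ 3 / S) * hsum (2 * ⌊t⌋₊ ^ 2) := by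
    have h7 : (⌊t⌋₊ : ℝ) ≤ t := Nat.floor_le ht0.le
    calc (2 * (⌊t⌋₊ : ℝ) + 1) / S * (16 * (⌊t⌋₊ : ℝ) ^ 2 * hsum ⌊t⌋₊)
        + (2 * (⌊t⌋₊ : ℝ) + 1) ^ 2
        ≤ (3 * t) / S * (16 * t ^ 2 * hsum (2 * ⌊t⌋₊ ^ 2))
          + (3 * t) ^ 2 * (t / S * hsum (2 * ⌊t⌋₊ ^ 2)) := by
          refine add_le_add (by gcongr) ?_
          calc (2 * (⌊t⌋₊ : ℝ) + 1) ^ 2 ≤ (3 * t) ^ 2 := by gcongr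
            _ ≤ _ := le_mul_of_one_le_right (by positivity) (one_le_mul_of_one_le_of_one_le h3 h5)
      _ = _ := by ring
  gcongr


theorem norm_mem_annulus {n : ℕ} {S t : ℝ} {v : Fin n → ℤ} (hv : v ∈ annulus n S t) :
    S ≤ ‖intVec v‖ ∧ ‖intVec v‖ ≤ t :=
  ⟨(mem_annulus.1 hv).1.le, (norm_le_eucNorm _).trans (mem_annulus.1 hv).2⟩

theorem lintegral_rho_mul_count_sq_le {n : ℕ} (hn : 3 ≤ n) {σ : Fin n → ℝ}
    (hσ : ∀ i, |σ i| = 1) {d : ℕ} (hd : 2 ≤ d) (μ : Measure (SLR n)) [μ.IsHaarMeasure] {L : ℝ}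
    (hL : 1 ≤ L) :
    ∃ C > (0 : ℝ), ∀ t S D : ℝ, 2 ≤ S → S ≤ t → 80 * n ^ 4 * t ≤ D →
      ∀ J : Set ℝ, MeasurableSet J → ∀ j : ℝ, 0 ≤ j → volume J = ENNReal.ofReal j →
      ∫⁻ g, rho L g * count σ d J (annulus n S t) g ^ 2 ∂μ
      ≤ ∫⁻ g, rho L g * regVol σ d g J (t + n) ^ 2 ∂μ
        + ENNReal.ofReal (C * (((3 * t) ^ n) ^ 2 * (t / (D ^ 2 * S ^ (2 * d - 2))) * j ^ 2
          + 1 / S ^ (2 * d - 2) * ((9 * (t * D / S)) ^ (n - 2)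
            * (72 * (t ^ 3 / S) * hsum (2 * ⌊t⌋₊ ^ 2))) * j ^ 2
          + 1 / S ^ d * ((3 * t) ^ (n - 2) * (57 * (t ^ 3 / S) * hsum (2 * ⌊t⌋₊ ^ 2))) * j)) := by
  obtain ⟨C, hC, h⟩ := lintegral_hit_inter_le hn hσ hd μ hL
  refine ⟨n ^ 2 * C, by positivity, fun t S D hS hSt hD J hJ j hj hJj => ?_⟩
  have hS0 : 0 < S := by linarith
  have ht0 : 0 < t := by linarith
  have hn1 : (1 : ℝ) ≤ n := by exact_mod_cast (by omega : 1 ≤ n)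
  have hn4 : (1 : ℝ) ≤ (n : ℝ) ^ 4 := one_le_pow₀ hn1
  have htD : t ≤ D := by nlinarith
  have hD0 : 0 < D := by linarith
  have hH := hsum_nonneg (2 * ⌊t⌋₊ ^ 2)
  set A := annulus n S t with hA
  set H := hsum (2 * ⌊t⌋₊ ^ 2) with hHdef
  set e₁ := C * t / (D ^ 2 * S ^ (2 * d - 2)) with he₁
  have he₁0 : 0 ≤ e₁ := by positivity
  have hnw : ∀ (i s : Fin n) (v w : Fin n → ℤ), 0 ≤ C / S ^ (2 * d - 2) * nearWeight S D i s v w * j ^ 2 :=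
    fun i s v w => by
      have := nearWeight_nonneg S D i s v w
      positivity
  have hpw : ∀ (i : Fin n) (v w : Fin n → ℤ), 0 ≤ C / S ^ d * parWeight S i v w * j := fun i v w => by
    have := parWeight_nonneg S i v w
    positivity
  have hnw' : ∀ v w : Fin n → ℤ, 0 ≤ ∑ i, ∑ s, C / S ^ (2 * d - 2) * nearWeight S D i s v w * j ^ 2 :=
    fun v w => Finset.sum_nonneg fun i _ => Finset.sum_nonneg fun s _ => hnw i s v w
  have hpw' : ∀ v w : Fin n → ℤ, 0 ≤ ∑ i, C / S ^ d * parWeight S i v w * j :=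
    fun v w => Finset.sum_nonneg fun i _ => hpw i v w
  have hej : 0 ≤ e₁ * j ^ 2 := by positivity
  have hpair : ∀ v ∈ A, ∀ w ∈ A,
      ∫⁻ g in hit σ d J (intVec v) ∩ hit σ d J (intVec w), rho L g ∂μ
      ≤ ∫⁻ g, rho L g * (cellVol σ d J v g * cellVol σ d J w g) ∂μ
        + ENNReal.ofReal (e₁ * j ^ 2
          + ∑ i, ∑ s, C / S ^ (2 * d - 2) * nearWeight S D i s v w * j ^ 2
          + ∑ i, C / S ^ d * parWeight S i v w * j) := fun v hv w hw => by
    have hv' := norm_mem_annulus hv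
    have hw' := norm_mem_annulus hw
    refine (h t S D hS hSt hD v w hv'.1 hv'.2 hw'.1 hw'.2 J hJ).trans_eq ?_
    rw [ENNReal.ofReal_add (add_nonneg hej (hnw' v w)) (hpw' v w),
      ENNReal.ofReal_add hej (hnw' v w),
      ENNReal.ofReal_sum_of_nonneg (fun i _ => Finset.sum_nonneg fun s _ => hnw i s v w),
      ENNReal.ofReal_sum_of_nonneg (fun i _ => hpw i v w)]
    have h1 : ∀ i, ENNReal.ofReal (∑ s, C / S ^ (2 * d - 2) * nearWeight S D i s v w * j ^ 2)
        = ∑ s, ENNReal.ofReal (C / S ^ (2 * d - 2) * nearWeight S D i s v w * j ^ 2) := fun i =>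
      ENNReal.ofReal_sum_of_nonneg (fun s _ => hnw i s v w)
    simp_rw [h1, hJj, ENNReal.ofReal_mul' (pow_nonneg hj 2), ENNReal.ofReal_mul' hj,
      ENNReal.ofReal_pow hj, add_assoc, he₁]
  have hreal : ∑ v ∈ A, ∑ w ∈ A, (e₁ * j ^ 2
      + ∑ i, ∑ s, C / S ^ (2 * d - 2) * nearWeight S D i s v w * j ^ 2
      + ∑ i, C / S ^ d * parWeight S i v w * j)
      ≤ n ^ 2 * C * (((3 * t) ^ n) ^ 2 * (t / (D ^ 2 * S ^ (2 * d - 2))) * j ^ 2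
          + 1 / S ^ (2 * d - 2) * ((9 * (t * D / S)) ^ (n - 2) * (72 * (t ^ 3 / S) * H)) * j ^ 2
          + 1 / S ^ d * ((3 * t) ^ (n - 2) * (57 * (t ^ 3 / S) * H)) * j) := by
    have hfar : ∑ _v ∈ A, ∑ _w ∈ A, e₁ * j ^ 2
        ≤ n ^ 2 * C * (((3 * t) ^ n) ^ 2 * (t / (D ^ 2 * S ^ (2 * d - 2))) * j ^ 2) := by
      rw [Finset.sum_const, Finset.sum_const, nsmul_eq_mul, nsmul_eq_mul]
      have hc := card_annulus_le n (S := S) (t := t) (by linarith)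
      calc (A.card : ℝ) * (A.card * (e₁ * j ^ 2))
          ≤ (3 * t) ^ n * ((3 * t) ^ n * (e₁ * j ^ 2)) := by gcongr
        _ = 1 * (C * (((3 * t) ^ n) ^ 2 * (t / (D ^ 2 * S ^ (2 * d - 2))) * j ^ 2)) := by
            rw [he₁]
            ring
        _ ≤ n ^ 2 * (C * (((3 * t) ^ n) ^ 2 * (t / (D ^ 2 * S ^ (2 * d - 2))) * j ^ 2)) := by
            gcongr
            exact one_le_pow₀ hn1
        _ = _ := by ring
    have hnear : ∑ v ∈ A, ∑ w ∈ A, ∑ i, ∑ s, C / S ^ (2 * d - 2) * nearWeight S D i s v w * j ^ 2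
        ≤ n ^ 2 * C * (1 / S ^ (2 * d - 2) * ((9 * (t * D / S)) ^ (n - 2)
          * (72 * (t ^ 3 / S) * H)) * j ^ 2) := by
      have h1 : ∑ v ∈ A, ∑ w ∈ A, ∑ i, ∑ s, C / S ^ (2 * d - 2) * nearWeight S D i s v w * j ^ 2
          = ∑ i : Fin n, ∑ s : Fin n, C / S ^ (2 * d - 2) * j ^ 2
            * ∑ v ∈ A, ∑ w ∈ A, nearWeight S D i s v w := by
        simp_rw [Finset.mul_sum]
        rw [Finset.sum_congr rfl fun v _ => Finset.sum_comm]
        rw [Finset.sum_comm]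
        refine Finset.sum_congr rfl fun i _ => ?_
        rw [Finset.sum_congr rfl fun v _ => Finset.sum_comm]
        rw [Finset.sum_comm]
        refine Finset.sum_congr rfl fun s _ => Finset.sum_congr rfl fun v _ =>
          Finset.sum_congr rfl fun w _ => by ring
      rw [h1]
      calc _ ≤ ∑ _i : Fin n, ∑ _s : Fin n, C / S ^ (2 * d - 2) * j ^ 2
            * ((9 * (t * D / S)) ^ (n - 2) * (72 * (t ^ 3 / S) * H)) := by
            refine Finset.sum_le_sum fun i _ => Finset.sum_le_sum fun s _ => ?_
            exact mul_le_mul_of_nonneg_left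
              (sum_nearWeight_le i s (by linarith) hSt htD) (by positivity)
        _ = _ := by
            simp only [Finset.sum_const, Finset.card_univ, Fintype.card_fin, nsmul_eq_mul]
            ring
    have hpar : ∑ v ∈ A, ∑ w ∈ A, ∑ i, C / S ^ d * parWeight S i v w * j
        ≤ n ^ 2 * C * (1 / S ^ d * ((3 * t) ^ (n - 2) * (57 * (t ^ 3 / S) * H)) * j) := by
      have h1 : ∑ v ∈ A, ∑ w ∈ A, ∑ i, C / S ^ d * parWeight S i v w * j
          = ∑ i : Fin n, C / S ^ d * j * ∑ v ∈ A, ∑ w ∈ A, parWeight S i v w := by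
        simp_rw [Finset.mul_sum]
        rw [Finset.sum_congr rfl fun v _ => Finset.sum_comm]
        rw [Finset.sum_comm]
        refine Finset.sum_congr rfl fun i _ => Finset.sum_congr rfl fun v _ =>
          Finset.sum_congr rfl fun w _ => by ring
      rw [h1]
      calc _ ≤ ∑ _i : Fin n, C / S ^ d * j
            * ((3 * t) ^ (n - 2) * (57 * (t ^ 3 / S) * H)) := by
            refine Finset.sum_le_sum fun i _ => ?_
            exact mul_le_mul_of_nonneg_left
              (sum_parWeight_le hn i (by linarith) hSt) (by positivity)
        _ = n * (C * (1 / S ^ d * ((3 * t) ^ (n - 2) * (57 * (t ^ 3 / S) * H)) * j)) := by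
            simp only [Finset.sum_const, Finset.card_univ, Fintype.card_fin, nsmul_eq_mul]
            ring
        _ ≤ (n : ℝ) ^ 2 * (C * (1 / S ^ d * ((3 * t) ^ (n - 2)
              * (57 * (t ^ 3 / S) * H)) * j)) := by
            gcongr
            exact le_self_pow₀ hn1 two_ne_zero
        _ = _ := by ring
    simp_rw [Finset.sum_add_distrib]
    linarith
  have hnonneg : ∀ v w : Fin n → ℤ, 0 ≤ e₁ * j ^ 2
      + ∑ i, ∑ s, C / S ^ (2 * d - 2) * nearWeight S D i s v w * j ^ 2
      + ∑ i, C / S ^ d * parWeight S i v w * j := fun v w =>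
    add_nonneg (add_nonneg hej (hnw' v w)) (hpw' v w)
  rw [lintegral_mul_count_sq σ d hJ A μ (measurable_rho L)]
  refine (Finset.sum_le_sum fun v hv => Finset.sum_le_sum fun w hw => hpair v hv w hw).trans ?_
  simp_rw [Finset.sum_add_distrib (M := ENNReal)]
  refine add_le_add ?_ ?_
  · have hm : ∀ v w, Measurable fun g => rho L g * (cellVol σ d J v g * cellVol σ d J w g) :=
      fun v w => (measurable_rho L).mul
        ((measurable_cellVol σ d hJ v).mul (measurable_cellVol σ d hJ w))
    have hm2 : ∀ v ∈ A, Measurable fun g =>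
        ∑ w ∈ A, rho L g * (cellVol σ d J v g * cellVol σ d J w g) :=
      fun v _ => Finset.measurable_fun_sum _ fun w _ => hm v w
    rw [Finset.sum_congr rfl fun v _ => (lintegral_finsetSum A fun w _ => hm v w).symm,
      ← lintegral_finsetSum A hm2]
    refine lintegral_mono fun g => ?_
    simp_rw [← Finset.mul_sum]
    rw [← Finset.sum_mul, ← sq]
    refine mul_le_mul_right (pow_le_pow_left' (sum_cellVol_le σ d hJ g fun v hv => ?_) 2) _
    exact (mem_annulus.1 hv).2
  · refine le_trans (le_of_eq ?_) (ENNReal.ofReal_le_ofReal hreal)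
    rw [ENNReal.ofReal_sum_of_nonneg
      (fun v _ => Finset.sum_nonneg fun w _ => hnonneg v w)]
    exact Finset.sum_congr rfl fun v _ =>
      (ENNReal.ofReal_sum_of_nonneg fun w _ => hnonneg v w).symm

theorem lintegral_mul_regVol_le {n : ℕ} (hn : 3 ≤ n) {σ : Fin n → ℝ} (hσ : ∀ i, |σ i| = 1)
    {d : ℕ} (hd : 2 ≤ d) (μ : Measure (SLR n)) [μ.IsHaarMeasure] {L : ℝ} (hL : 1 ≤ L)
    {ψ : SLR n → ENNReal} (hψm : Measurable ψ) {κ B : ℝ} (hκ : 0 < κ) (hB : 0 < B)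
    (hψ : ∀ h : SLR n, mnorm ((h : Matrix (Fin n) (Fin n) ℝ) - 1) ≤ κ → ∀ g, ψ g ≤ ψ (h * g)
      + (KL n L).indicator
        (fun _ => ENNReal.ofReal (B * mnorm ((h : Matrix (Fin n) (Fin n) ℝ) - 1))) g) :
    ∃ C > (0 : ℝ), ∃ S₀ > (0 : ℝ), ∀ t S : ℝ, S₀ ≤ S → 1 ≤ t →
      ∀ J : Set ℝ, MeasurableSet J → ∀ j : ℝ, 0 ≤ j → volume J = ENNReal.ofReal j →
      ∫⁻ g, ψ g * regVol σ d g J (t - n) ∂μ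
      ≤ ∫⁻ g, ψ g * count σ d J (annulus n S t) g ∂μ
        + ∫⁻ g, ψ g * regVol σ d g J (n * (S + 1)) ∂μ
        + ENNReal.ofReal (C * ((3 * t) ^ n / S ^ (d + 1) * j)) := by
  obtain ⟨C, hC, S₀, hS₀, h⟩ := single_regularity hn hσ hd μ hL hψm hκ hB hψ
  refine ⟨C * 2 ^ (d + 1), by positivity, S₀ + 2, by positivity,
    fun t S hS ht J hJ j hj hJj => ?_⟩
  have hS0 : 0 < S := by linarith
  have hc : ∀ K : ENNReal, ∫⁻ _ in unitCube n, K = K := fun K => by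
    rw [setLIntegral_const, volume_unitCube, mul_one]
  set e := C * 2 ^ (d + 1) / S ^ (d + 1) * j with he
  have he0 : 0 ≤ e := by positivity
  have hcell : ∀ v ∈ annulus n S t, ∫⁻ g, ψ g * cellVol σ d J v g ∂μ
      ≤ ∫⁻ g in hit σ d J (intVec v), ψ g ∂μ + ENNReal.ofReal e := fun v hv => by
    have hv' := (norm_mem_annulus hv).1
    rw [← lintegral_unitCube_hit σ d hJ v μ hψm]
    calc _ ≤ ∫⁻ _ in unitCube n, (∫⁻ g in hit σ d J (intVec v), ψ g ∂μ + ENNReal.ofReal e) := by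
          refine setLIntegral_mono' (measurableSet_unitCube n) fun u hu => ?_
          have hu1 := norm_le_one_of_mem_unitCube hu
          have h1 : S / 2 ≤ ‖intVec v + u‖ := by
            have := norm_sub_le (intVec v + u) u
            rw [add_sub_cancel_right] at this
            linarith
          have h2 := h (intVec v + u) (-u) (by
            have := norm_sub_le (intVec v + u) u
            rw [add_sub_cancel_right] at this
            linarith) (by rwa [norm_neg]) J hJ
          rw [add_neg_cancel_right] at h2
          refine h2.trans (add_le_add le_rfl ?_)
          rw [hJj, ← ENNReal.ofReal_mul (by positivity)]
          refine ENNReal.ofReal_le_ofReal (mul_le_mul_of_nonneg_right ?_ hj)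
          calc C / ‖intVec v + u‖ ^ (d + 1) ≤ C / (S / 2) ^ (d + 1) := by gcongr
            _ = _ := by rw [div_pow, div_div_eq_mul_div]
      _ = _ := hc _
  have hm : ∀ v ∈ annulus n S t, Measurable fun g => ψ g * cellVol σ d J v g :=
    fun v _ => hψm.mul (measurable_cellVol σ d hJ v)
  have hmr : Measurable fun g => ψ g * regVol σ d g J (n * (S + 1)) :=
    hψm.mul (measurable_regVol σ d hJ _)
  calc ∫⁻ g, ψ g * regVol σ d g J (t - n) ∂μ
      ≤ ∫⁻ g, (∑ v ∈ annulus n S t, ψ g * cellVol σ d J v g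
        + ψ g * regVol σ d g J (n * (S + 1))) ∂μ := by
        refine lintegral_mono fun g => ?_
        rw [← Finset.mul_sum, ← mul_add]
        exact mul_le_mul_right (regVol_le_sum_cellVol (by omega) σ d J g S t) _
    _ = ∑ v ∈ annulus n S t, ∫⁻ g, ψ g * cellVol σ d J v g ∂μ
        + ∫⁻ g, ψ g * regVol σ d g J (n * (S + 1)) ∂μ := by
        rw [lintegral_add_right _ hmr, lintegral_finsetSum _ hm]
    _ ≤ ∑ v ∈ annulus n S t, (∫⁻ g in hit σ d J (intVec v), ψ g ∂μ + ENNReal.ofReal e)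
        + ∫⁻ g, ψ g * regVol σ d g J (n * (S + 1)) ∂μ :=
        add_le_add (Finset.sum_le_sum hcell) le_rfl
    _ ≤ _ := by
        rw [Finset.sum_add_distrib, ← lintegral_mul_count σ d hJ _ μ hψm, add_right_comm]
        refine add_le_add le_rfl ?_
        rw [Finset.sum_const, nsmul_eq_mul, ← ENNReal.ofReal_natCast,
          ← ENNReal.ofReal_mul (Nat.cast_nonneg _)]
        refine ENNReal.ofReal_le_ofReal ?_
        calc ((annulus n S t).card : ℝ) * e ≤ (3 * t) ^ n * e :=
              mul_le_mul_of_nonneg_right (card_annulus_le n ht) he0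
          _ = _ := by
              rw [he]
              ring

theorem lintegral_rho_mul_count_small_le {n : ℕ} (hn : 3 ≤ n) {σ : Fin n → ℝ}
    (hσ : ∀ i, |σ i| = 1) {d : ℕ} (hd : 2 ≤ d) (hdn : d < n) (μ : Measure (SLR n))
    [μ.IsHaarMeasure] {L : ℝ} (hL : 1 ≤ L) :
    ∃ C > (0 : ℝ), ∀ S : ℝ, 1 ≤ S → ∀ J : Set ℝ, MeasurableSet J → ∀ j : ℝ, 0 ≤ j →
      volume J = ENNReal.ofReal j →
      ∫⁻ g, rho L g * count σ d J (vbox n ⌊S⌋₊) g ∂μ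
      ≤ ENNReal.ofReal (C * (j * (S ^ (n - d) * (1 + 2 * hsum ⌊S⌋₊) ^ n) + 1)) := by
  obtain ⟨C, hC, h⟩ := measure_single_le hn hσ hd μ hL
  have hK := (measure_KL_lt_top (n := n) μ L).ne
  have hL0 : 0 < L := by linarith
  set m := (μ (KL n L)).toReal with hm
  have hm0 : 0 ≤ m := ENNReal.toReal_nonneg
  refine ⟨L * C + L * m, by positivity, fun S hS J hJ j hj hJj => ?_⟩
  have hS0 : 0 < S := by linarith
  rw [lintegral_mul_count σ d hJ _ μ (measurable_rho L)]
  have hH := hsum_nonneg ⌊S⌋₊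
  have hz : ∫⁻ g in hit σ d J (intVec (0 : Fin n → ℤ)), rho L g ∂μ ≤ ENNReal.ofReal (L * m) := by
    refine (setLIntegral_rho_le μ).trans ?_
    rw [ENNReal.ofReal_mul hL0.le, hm, ENNReal.ofReal_toReal hK]
    exact mul_le_mul_right (measure_mono Set.inter_subset_left) _
  have hnz : ∀ v ∈ (vbox n ⌊S⌋₊).filter (fun v => v ≠ 0),
      ∫⁻ g in hit σ d J (intVec v), rho L g ∂μ
      ≤ ENNReal.ofReal (L * C * j * (1 / ‖intVec v‖ ^ d)) := fun v hv => by
    have hv0 : intVec v ≠ 0 := fun h0 => (Finset.mem_filter.1 hv).2 (by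
      ext i
      have := congrFun h0 i
      simpa [intVec] using this)
    refine (setLIntegral_rho_le μ).trans ((mul_le_mul_right (h _ hv0 J hJ) _).trans_eq ?_)
    rw [hJj, ← ENNReal.ofReal_mul (by positivity), ← ENNReal.ofReal_mul hL0.le]
    congr 1
    ring
  rw [← Finset.sum_filter_add_sum_filter_not _ (fun v : Fin n → ℤ => v ≠ 0)]
  have hfil : (vbox n ⌊S⌋₊).filter (fun v => ¬ v ≠ 0) = {0} := by
    ext v
    simp only [Finset.mem_filter, Finset.mem_singleton, not_not, and_iff_right_iff_imp]
    rintro rfl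
    rw [mem_vbox]
    intro i
    simp
  rw [hfil, Finset.sum_singleton]
  refine (add_le_add (Finset.sum_le_sum hnz) hz).trans ?_
  rw [← ENNReal.ofReal_sum_of_nonneg (fun v _ => by positivity), ← Finset.mul_sum,
    ← ENNReal.ofReal_add (by positivity) (by positivity)]
  refine ENNReal.ofReal_le_ofReal ?_
  have h1 : (⌊S⌋₊ : ℝ) ^ (n - d) * (1 + 2 * hsum ⌊S⌋₊) ^ n
      ≤ S ^ (n - d) * (1 + 2 * hsum ⌊S⌋₊) ^ n := by
    gcongr
    exact Nat.floor_le hS0.le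
  have h2 := (shell_sum (n := n) (d := d) (N := ⌊S⌋₊) hdn.le).trans h1
  set W := S ^ (n - d) * (1 + 2 * hsum ⌊S⌋₊) ^ n with hW
  have hW0 : 0 ≤ W := by positivity
  have h3 : L * C * j * ∑ v ∈ (vbox n ⌊S⌋₊).filter (fun v => v ≠ 0), 1 / ‖intVec v‖ ^ d
      ≤ L * C * j * W := by gcongr
  have h4 : 0 ≤ L * m * (j * W) := by positivity
  have h5 : 0 ≤ L * C := by positivity
  linarith

theorem lintegral_sq_sub_le {α : Type*} [MeasurableSpace α] (μ : Measure α) {ρ : α → ENNReal}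
    (hρ : Measurable ρ) {N c : α → ℝ} (hN : Measurable N) (hc : Measurable c)
    (hN0 : ∀ x, 0 ≤ N x) (hc0 : ∀ x, 0 ≤ c x) {X a b : ℝ} (hX : 0 ≤ X) (ha : 0 ≤ a) (hb : 0 ≤ b)
    (hfin : ∫⁻ x, ρ x * ENNReal.ofReal (c x ^ 2) ∂μ ≠ ⊤)
    (h₁ : ∫⁻ x, ρ x * ENNReal.ofReal (N x ^ 2) ∂μ
      ≤ ENNReal.ofReal (X ^ 2) * ∫⁻ x, ρ x * ENNReal.ofReal (c x ^ 2) ∂μ + ENNReal.ofReal a)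
    (h₂ : ENNReal.ofReal X * ∫⁻ x, ρ x * ENNReal.ofReal (c x ^ 2) ∂μ
      ≤ ∫⁻ x, ρ x * ENNReal.ofReal (c x * N x) ∂μ + ENNReal.ofReal b) :
    ∫⁻ x, ρ x * ENNReal.ofReal ((N x - c x * X) ^ 2) ∂μ ≤ ENNReal.ofReal (a + 2 * X * b) := by
  set Q := ∫⁻ x, ρ x * ENNReal.ofReal (c x ^ 2) ∂μ with hQ
  set V := ∫⁻ x, ρ x * ENNReal.ofReal ((N x - c x * X) ^ 2) ∂μ with hV
  set R := ∫⁻ x, ρ x * ENNReal.ofReal (c x * N x) ∂μ with hR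
  have hm1 : Measurable fun x => ρ x * ENNReal.ofReal (c x * N x) :=
    hρ.mul (hc.mul hN).ennreal_ofReal
  have hm2 : Measurable fun x => ρ x * ENNReal.ofReal (c x ^ 2) :=
    hρ.mul (hc.pow_const 2).ennreal_ofReal
  have hid : V + ENNReal.ofReal (2 * X) * R
      = ∫⁻ x, ρ x * ENNReal.ofReal (N x ^ 2) ∂μ + ENNReal.ofReal (X ^ 2) * Q := by
    rw [hV, hR, hQ, ← lintegral_const_mul _ hm1, ← lintegral_const_mul _ hm2,
      ← lintegral_add_right _ (hm1.const_mul _), ← lintegral_add_right _ (hm2.const_mul _)]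
    refine lintegral_congr fun x => ?_
    have hcx := hc0 x
    have hNx := hN0 x
    rw [mul_left_comm, ← mul_add, mul_left_comm, ← mul_add, ← ENNReal.ofReal_mul (by positivity),
      ← ENNReal.ofReal_mul (by positivity), ← ENNReal.ofReal_add (by positivity) (by positivity),
      ← ENNReal.ofReal_add (by positivity) (by positivity)]
    congr 2
    ring
  have hXQ : ENNReal.ofReal (2 * X ^ 2) * Q
      ≤ ENNReal.ofReal (2 * X) * R + ENNReal.ofReal (2 * X * b) := by
    calc ENNReal.ofReal (2 * X ^ 2) * Q = ENNReal.ofReal (2 * X) * (ENNReal.ofReal X * Q) := by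
          rw [← mul_assoc, ← ENNReal.ofReal_mul (by positivity)]
          congr 2
          ring
      _ ≤ ENNReal.ofReal (2 * X) * (R + ENNReal.ofReal b) := mul_le_mul_right h₂ _
      _ = _ := by rw [mul_add, ← ENNReal.ofReal_mul (by positivity)]
  have hcancel : ENNReal.ofReal (2 * X ^ 2) * Q ≠ ⊤ := ENNReal.mul_ne_top ENNReal.ofReal_ne_top hfin
  refine (ENNReal.add_le_add_iff_right hcancel).1 ?_
  calc V + ENNReal.ofReal (2 * X ^ 2) * Q
      ≤ V + (ENNReal.ofReal (2 * X) * R + ENNReal.ofReal (2 * X * b)) := add_le_add le_rfl hXQ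
    _ = (∫⁻ x, ρ x * ENNReal.ofReal (N x ^ 2) ∂μ + ENNReal.ofReal (X ^ 2) * Q)
        + ENNReal.ofReal (2 * X * b) := by rw [← add_assoc, hid]
    _ ≤ ((ENNReal.ofReal (X ^ 2) * Q + ENNReal.ofReal a) + ENNReal.ofReal (X ^ 2) * Q)
        + ENNReal.ofReal (2 * X * b) := add_le_add (add_le_add h₁ le_rfl) le_rfl
    _ = _ := by
        rw [ENNReal.ofReal_add ha (by positivity), two_mul (X ^ 2),
          ENNReal.ofReal_add (by positivity) (by positivity)]
        ring

theorem lintegral_abs_le_of_sq {α : Type*} [MeasurableSpace α] (μ : Measure α) {ρ : α → ENNReal}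
    (hρ : Measurable ρ) {f : α → ℝ} {s : ℝ} (hs : 0 < s) :
    ∫⁻ x, ρ x * ENNReal.ofReal |f x| ∂μ
      ≤ ENNReal.ofReal s⁻¹ * ∫⁻ x, ρ x * ENNReal.ofReal (f x ^ 2) ∂μ
        + ENNReal.ofReal s * ∫⁻ x, ρ x ∂μ := by
  rw [← lintegral_const_mul' _ _ ENNReal.ofReal_ne_top, ← lintegral_const_mul _ hρ,
    ← lintegral_add_right _ (hρ.const_mul _)]
  refine lintegral_mono fun x => ?_
  calc ρ x * ENNReal.ofReal |f x| ≤ ρ x * ENNReal.ofReal (s⁻¹ * f x ^ 2 + s) := by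
        refine mul_le_mul_right (ENNReal.ofReal_le_ofReal ?_) _
        rw [← sq_abs (f x)]
        rcases le_total |f x| s with h | h
        · have : 0 ≤ s⁻¹ * |f x| ^ 2 := by positivity
          linarith
        · have h1 : |f x| * s ≤ |f x| ^ 2 := by
            rw [sq]
            exact mul_le_mul_of_nonneg_left h (abs_nonneg _)
          have h2 : |f x| ≤ s⁻¹ * |f x| ^ 2 := by
            rw [inv_mul_eq_div, le_div_iff₀ hs]
            exact h1
          linarith
    _ = _ := by
        rw [ENNReal.ofReal_add (by positivity) hs.le, ENNReal.ofReal_mul (by positivity)]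
        ring

theorem rpow_neg_le_rpow_neg_min {t : ℝ} (ht : 1 ≤ t) (θ : ℝ) : t ^ (-θ) ≤ t ^ (-min θ 1) :=
  Real.rpow_le_rpow_of_exponent_le ht (neg_le_neg (min_le_left _ _))

theorem inv_le_rpow_neg_min {t : ℝ} (ht : 1 ≤ t) (θ : ℝ) : t⁻¹ ≤ t ^ (-min θ 1) := by
  rw [← Real.rpow_neg_one]
  exact Real.rpow_le_rpow_of_exponent_le ht (neg_le_neg (min_le_right _ _))

theorem asymptotic_shift_up {c j C t a θ β r : ℝ} {k : ℕ} (hc : c ≤ C) (hC : 0 ≤ C) (hj : 0 ≤ j)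
    (ht : 1 ≤ t) (ha : 0 ≤ a) (hat : a ≤ t) (hθ : 0 < θ) (hβ : 0 < β)
    (hr : r ≤ c * j * (t + a) ^ k + C * (j * (t + a) ^ k * (t + a) ^ (-θ) + (t + a) ^ β)) :
    r ≤ c * (j * t ^ k) + C * (2 ^ k * a + 2 ^ k + 2 ^ β) * (j * t ^ k * t ^ (-min θ 1) + t ^ β) := by
  have ht0 : 0 < t := by linarith
  have h1 : (t + a) ^ k ≤ t ^ k * (1 + 2 ^ k * (a * t⁻¹)) := by
    have h := one_add_pow_le (x := a * t⁻¹) (by positivity)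
      (by rw [← div_eq_mul_inv]; exact (div_le_one ht0).2 hat) k
    calc (t + a) ^ k = t ^ k * (1 + a * t⁻¹) ^ k := by
          rw [← mul_pow]
          congr 1
          field_simp
      _ ≤ _ := by gcongr
  have h2 : (t + a) ^ k ≤ 2 ^ k * t ^ k := by
    rw [← mul_pow]
    gcongr
    linarith
  have h3 : (t + a) ^ (-θ) ≤ t ^ (-min θ 1) :=
    (Real.rpow_le_rpow_of_nonpos ht0 (by linarith) (by linarith)).trans
      (rpow_neg_le_rpow_neg_min ht θ)
  have h4 : (t + a) ^ β ≤ 2 ^ β * t ^ β := by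
    rw [← Real.mul_rpow (by norm_num) ht0.le]
    exact Real.rpow_le_rpow (by positivity) (by linarith) hβ.le
  have h5 := inv_le_rpow_neg_min ht θ
  set T := t ^ (-min θ 1) with hT
  have hT0 : 0 < T := by positivity
  have hB0 : 0 < t ^ β := by positivity
  have e1 : c * j * (t + a) ^ k ≤ c * (j * t ^ k) + C * (2 ^ k * a) * (j * t ^ k * T) := by
    have h6 : (t + a) ^ k - t ^ k ≤ t ^ k * (2 ^ k * (a * T)) := by
      have : t ^ k * (2 ^ k * (a * t⁻¹)) ≤ t ^ k * (2 ^ k * (a * T)) := by gcongr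
      linarith
    have h7 : 0 ≤ (t + a) ^ k - t ^ k := sub_nonneg.2 (by gcongr; linarith)
    have h8 : c * j * ((t + a) ^ k - t ^ k) ≤ C * j * (t ^ k * (2 ^ k * (a * T))) := by
      calc c * j * ((t + a) ^ k - t ^ k) ≤ C * j * ((t + a) ^ k - t ^ k) := by gcongr
        _ ≤ _ := by gcongr
    linarith
  have e2 : j * (t + a) ^ k * (t + a) ^ (-θ) ≤ 2 ^ k * (j * t ^ k * T) := by
    calc j * (t + a) ^ k * (t + a) ^ (-θ) ≤ j * (2 ^ k * t ^ k) * T := by gcongr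
      _ = _ := by ring
  have e3 : C * (j * (t + a) ^ k * (t + a) ^ (-θ) + (t + a) ^ β)
      ≤ C * (2 ^ k * (j * t ^ k * T) + 2 ^ β * t ^ β) := by gcongr
  have hP : 0 ≤ j * t ^ k * T := by positivity
  have p1 : 0 ≤ C * (2 ^ β * (j * t ^ k * T)) := by positivity
  have p2 : 0 ≤ C * ((2 ^ k * a + 2 ^ k) * t ^ β) := by positivity
  linarith

theorem asymptotic_shift_down {c j C t a θ β r : ℝ} {k : ℕ} (hc : c ≤ C) (hC : 0 ≤ C)
    (hj : 0 ≤ j) (ht : 2 ≤ t) (ha : 0 ≤ a) (hat : 2 * a ≤ t) (hθ : 0 < θ) (hβ : 0 < β)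
    (hr : c * j * (t - a) ^ k
      ≤ r + C * (j * (t - a) ^ k * (t - a) ^ (-θ) + (t - a) ^ β)) :
    c * (j * t ^ k) ≤ r + C * (k * a + 3) * (j * t ^ k * t ^ (-min θ 1) + t ^ β) := by
  have ht0 : 0 < t := by linarith
  have hm1 : 0 ≤ min θ 1 := le_min hθ.le zero_le_one
  have h1 : t ^ k * (1 - k * (a * t⁻¹)) ≤ (t - a) ^ k := by
    have h0 : a * t⁻¹ ≤ 1 := by
      rw [← div_eq_mul_inv]
      exact (div_le_one ht0).2 (by linarith)
    have h := one_add_mul_le_pow (a := -(a * t⁻¹)) (by linarith) k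
    calc t ^ k * (1 - k * (a * t⁻¹)) = t ^ k * (1 + k * -(a * t⁻¹)) := by ring
      _ ≤ t ^ k * (1 + -(a * t⁻¹)) ^ k := by gcongr
      _ = (t - a) ^ k := by
          rw [← mul_pow]
          congr 1
          field_simp
          ring
  have h2 : (t - a) ^ k ≤ t ^ k := pow_le_pow_left₀ (by linarith) (by linarith) k
  have h3 : (t - a) ^ (-θ) ≤ 2 * t ^ (-min θ 1) := by
    calc (t - a) ^ (-θ) ≤ (t - a) ^ (-min θ 1) := rpow_neg_le_rpow_neg_min (by linarith) θ
      _ ≤ (2⁻¹ * t) ^ (-min θ 1) :=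
          Real.rpow_le_rpow_of_nonpos (by positivity) (by linarith) (by linarith)
      _ = 2 ^ min θ 1 * t ^ (-min θ 1) := by
          rw [Real.mul_rpow (by norm_num) ht0.le, Real.inv_rpow (by norm_num),
            Real.rpow_neg (by norm_num), inv_inv]
      _ ≤ 2 * t ^ (-min θ 1) := by
          refine mul_le_mul_of_nonneg_right ?_ (by positivity)
          calc (2 : ℝ) ^ min θ 1 ≤ 2 ^ (1 : ℝ) :=
                Real.rpow_le_rpow_of_exponent_le (by norm_num) (min_le_right _ _)
            _ = 2 := Real.rpow_one 2
  have h4 : (t - a) ^ β ≤ t ^ β := Real.rpow_le_rpow (by linarith) (by linarith) hβ.le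
  have h5 := inv_le_rpow_neg_min (by linarith : 1 ≤ t) θ
  set T := t ^ (-min θ 1) with hT
  have hT0 : 0 < T := by positivity
  have hB0 : 0 < t ^ β := by positivity
  have e1 : c * (j * t ^ k) - c * j * (t - a) ^ k ≤ C * (k * a) * (j * t ^ k * T) := by
    have h6 : t ^ k - (t - a) ^ k ≤ t ^ k * (k * (a * T)) := by
      have : t ^ k * (k * (a * t⁻¹)) ≤ t ^ k * (k * (a * T)) := by gcongr
      linarith
    have h8 : c * j * (t ^ k - (t - a) ^ k) ≤ C * j * (t ^ k * (k * (a * T))) := by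
      have : 0 ≤ t ^ k - (t - a) ^ k := sub_nonneg.2 h2
      calc c * j * (t ^ k - (t - a) ^ k) ≤ C * j * (t ^ k - (t - a) ^ k) := by gcongr
        _ ≤ _ := by gcongr
    linarith
  have e2 : j * (t - a) ^ k * (t - a) ^ (-θ) ≤ 2 * (j * t ^ k * T) := by
    have : 0 ≤ t - a := by linarith
    calc j * (t - a) ^ k * (t - a) ^ (-θ) ≤ j * t ^ k * (2 * T) := by gcongr
      _ = _ := by ring
  have e3 : C * (j * (t - a) ^ k * (t - a) ^ (-θ) + (t - a) ^ β)
      ≤ C * (2 * (j * t ^ k * T) + t ^ β) := by gcongr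
  have hP : 0 ≤ j * t ^ k * T := by positivity
  have p1 : 0 ≤ C * (j * t ^ k * T) := by positivity
  have p2 : 0 ≤ C * ((k * a + 2) * t ^ β) := by positivity
  linarith

theorem asymptotic_upper {c j C T S t b θ β r : ℝ} {k : ℕ} (hc : c ≤ C) (hC : 0 ≤ C)
    (hj : 0 ≤ j) (hT : 1 ≤ T) (hTS : T ≤ b * S) (hS : 0 ≤ S) (hSt : S ≤ t) (hb : 0 ≤ b)
    (hθ : 0 < θ) (hβ : 0 < β)
    (hr : r ≤ c * j * T ^ k + C * (j * T ^ k * T ^ (-θ) + T ^ β)) :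
    r ≤ C * (2 * b ^ k + b ^ β) * (j * S ^ k + t ^ β) := by
  have hT0 : 0 < T := by linarith
  have ht0 : 0 ≤ t := hS.trans hSt
  have h1 : T ^ k ≤ b ^ k * S ^ k := by
    rw [← mul_pow]
    gcongr
  have h2 : T ^ (-θ) ≤ 1 := Real.rpow_le_one_of_one_le_of_nonpos hT (by linarith)
  have h3 : T ^ β ≤ b ^ β * t ^ β := by
    rw [← Real.mul_rpow hb ht0]
    exact Real.rpow_le_rpow hT0.le (hTS.trans (by gcongr)) hβ.le
  have h4 : c * j * T ^ k ≤ C * j * (b ^ k * S ^ k) := by gcongr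
  have h5 : C * (j * T ^ k * T ^ (-θ) + T ^ β) ≤ C * (j * (b ^ k * S ^ k) * 1 + b ^ β * t ^ β) := by
    gcongr
  have p1 : 0 ≤ C * (b ^ β * (j * S ^ k)) := by positivity
  have p2 : 0 ≤ C * (2 * b ^ k * t ^ β) := by positivity
  linarith

theorem exists_regVol_bounds {n : ℕ} {σ : Fin n → ℝ} (hσ : ∀ i, |σ i| = 1)
    {d : ℕ} (hd : 2 ≤ d) (hdn : d < n) {β : ℝ} (hβ : 0 < β) :
    ∃ θ > (0 : ℝ), θ ≤ 1 ∧ ∀ L M : ℝ, 1 ≤ L → 1 ≤ M → ∃ K ≥ (1 : ℝ), ∀ g ∈ KL n L,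
      regDensity σ d g ≤ K ∧ ∀ t ≥ K, ∀ J : Set ℝ, MeasurableSet J → J ⊆ Set.Icc (-M) M →
        (regVol σ d g J (t + n)).toReal ≤ regDensity σ d g * ((volume J).toReal * t ^ (n - d))
          + K * ((volume J).toReal * t ^ (n - d) * t ^ (-θ) + t ^ β) ∧
        regDensity σ d g * ((volume J).toReal * t ^ (n - d)) ≤ (regVol σ d g J (t - n)).toReal
          + K * ((volume J).toReal * t ^ (n - d) * t ^ (-θ) + t ^ β) ∧
        ∀ S, K ≤ S → S ≤ t → (regVol σ d g J (n * (S + 1))).toReal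
          ≤ K * ((volume J).toReal * S ^ (n - d) + t ^ β) := by
  obtain ⟨θ₀, hθ₀, h⟩ := exists_regVol_asymptotic hσ hd hdn hβ
  obtain ⟨θ₁, hθ₁, h'⟩ := exists_regDensity_asymptotic hσ hd hdn
  refine ⟨min θ₀ 1, lt_min hθ₀ one_pos, min_le_right _ _, fun L M hL hM => ?_⟩
  obtain ⟨C, hC, h⟩ := h L M hL hM
  obtain ⟨C', hC', h'⟩ := h' L
  set C₁ := C + C' with hC₁
  have hC₁0 : 0 < C₁ := by linarith
  have hn0 : (0 : ℝ) ≤ n := Nat.cast_nonneg n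
  have hn1 : (1 : ℝ) ≤ n := by exact_mod_cast (by omega : 1 ≤ n)
  have b1 : 0 ≤ (2 : ℝ) ^ (n - d) * n + 2 ^ (n - d) + 2 ^ β := by positivity
  have b2 : 0 ≤ ((n - d : ℕ) : ℝ) * n + 3 := by positivity
  have b3 : 0 ≤ 2 * (2 * (n : ℝ)) ^ (n - d) + (2 * (n : ℝ)) ^ β := by positivity
  set B₁ := (2 : ℝ) ^ (n - d) * n + 2 ^ (n - d) + 2 ^ β with hB₁
  set B₂ := ((n - d : ℕ) : ℝ) * n + 3 with hB₂
  set B₃ := 2 * (2 * (n : ℝ)) ^ (n - d) + (2 * (n : ℝ)) ^ β with hB₃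
  have hC₁1 : 1 ≤ C₁ := by linarith
  have k1 : C₁ * B₁ ≤ C₁ * (B₁ + B₂ + B₃ + 2 * n + 2) := by gcongr; linarith
  have k2 : C₁ * B₂ ≤ C₁ * (B₁ + B₂ + B₃ + 2 * n + 2) := by gcongr; linarith
  have k3 : C₁ * B₃ ≤ C₁ * (B₁ + B₂ + B₃ + 2 * n + 2) := by gcongr; linarith
  have k4 : C₁ + 2 * n + 1 ≤ C₁ * (B₁ + B₂ + B₃ + 2 * n + 2) := by
    have : C₁ * (2 * n + 2) ≤ C₁ * (B₁ + B₂ + B₃ + 2 * n + 2) := by gcongr; linarith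
    nlinarith
  set K := C₁ * (B₁ + B₂ + B₃ + 2 * n + 2) with hK
  have hCC : C ≤ C₁ := by linarith
  refine ⟨K, by linarith, fun g hg => ?_⟩
  have hcC : regDensity σ d g ≤ C₁ := (h' g hg).1.trans (by linarith)
  refine ⟨by linarith, fun t ht J hJ hJM => ?_⟩
  have ht0 : 0 < t := by linarith
  have hj : 0 ≤ (volume J).toReal := ENNReal.toReal_nonneg
  have hr : ∀ T ≥ C, |(regVol σ d g J T).toReal
      - regDensity σ d g * (volume J).toReal * T ^ (n - d)|
      ≤ C₁ * ((volume J).toReal * T ^ (n - d) * T ^ (-θ₀) + T ^ β) := fun T hT => by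
    have hT0 : 0 < T := by linarith
    refine (h g hg T hT J hJ hJM).trans ?_
    gcongr
  have hP : 0 ≤ (volume J).toReal * t ^ (n - d) * t ^ (-min θ₀ 1) + t ^ β := by positivity
  refine ⟨?_, ?_, fun S hS hSt => ?_⟩
  · have hu := (abs_le.1 (hr (t + n) (by linarith))).2
    exact (asymptotic_shift_up hcC hC₁0.le hj (by linarith) hn0 (by linarith) hθ₀ hβ
      (by linarith)).trans (add_le_add le_rfl (mul_le_mul_of_nonneg_right k1 hP))
  · have hu := (abs_le.1 (hr (t - n) (by linarith))).1
    exact (asymptotic_shift_down hcC hC₁0.le hj (by linarith) hn0 (by linarith) hθ₀ hβ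
      (by linarith)).trans (add_le_add le_rfl (mul_le_mul_of_nonneg_right k2 hP))
  · have hS0 : 0 < S := by linarith
    have hTC : C ≤ n * (S + 1) := by nlinarith
    have hu := (abs_le.1 (hr (n * (S + 1)) hTC)).2
    refine (asymptotic_upper (T := n * (S + 1)) (b := 2 * n) hcC hC₁0.le hj (by linarith)
      (by nlinarith) hS0.le hSt (by positivity) hθ₀ hβ (by linarith)).trans
      (mul_le_mul_of_nonneg_right k3 (by positivity))

theorem lintegral_rho_ne_top {n : ℕ} (μ : Measure (SLR n)) [μ.IsHaarMeasure] (L : ℝ) :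
    ∫⁻ g, rho L g ∂μ ≠ ⊤ := by
  have h := setLIntegral_rho_le μ (L := L) (A := Set.univ)
  rw [Measure.restrict_univ, Set.inter_univ] at h
  exact (h.trans_lt (ENNReal.mul_lt_top ENNReal.ofReal_lt_top (measure_KL_lt_top μ L))).ne

theorem lintegral_rho_mul_le {n : ℕ} (μ : Measure (SLR n)) [μ.IsHaarMeasure] (L : ℝ)
    {f F : SLR n → ENNReal} {e : ℝ} (he : 0 ≤ e)
    (h : ∀ g ∈ KL n L, f g ≤ F g + ENNReal.ofReal e) :
    ∫⁻ g, rho L g * f g ∂μ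
      ≤ ∫⁻ g, rho L g * F g ∂μ + ENNReal.ofReal (e * (∫⁻ g, rho L g ∂μ).toReal) := by
  rw [ENNReal.ofReal_mul he, ENNReal.ofReal_toReal (lintegral_rho_ne_top μ L),
    ← lintegral_const_mul _ (measurable_rho L),
    ← lintegral_add_right _ ((measurable_rho L).const_mul _)]
  refine lintegral_mono fun g => ?_
  by_cases hg : g ∈ KL n L
  · calc rho L g * f g ≤ rho L g * (F g + ENNReal.ofReal e) := mul_le_mul_right (h g hg) _
      _ = _ := by ring
  · simp [rho_eq_zero hg]

theorem count_ne_top {n : ℕ} (σ : Fin n → ℝ) (d : ℕ) (J : Set ℝ) (A : Finset (Fin n → ℤ))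
    (g : SLR n) : count σ d J A g ≠ ⊤ := by
  refine (ENNReal.sum_lt_top.2 fun v _ => ?_).ne
  exact (Set.indicator_le_self' (fun _ _ => zero_le) g).trans_lt ENNReal.one_lt_top

theorem second_moment_error {m K C₁ C₂ X e f E₁ E₂ E₃ E₄ P n3 : ℝ} {n : ℕ} (hm : 0 ≤ m)
    (hX : 0 ≤ X) (he : 0 ≤ e) (hf : 0 ≤ f) (hE₁ : 0 ≤ E₁) (hE₂ : 0 ≤ E₂) (hE₃ : 0 ≤ E₃)
    (hE₄ : 0 ≤ E₄) (hC₁ : 0 ≤ C₁) (hC₂ : 0 ≤ C₂) (hn3 : n3 = 9 ^ n)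
    (hP : P = m * (2 * K ^ 2) + m * K ^ 2 + n3 * C₁ * 72 + 2 * C₂ * n3) :
    (2 * K * X * (K * e) + (K * e) ^ 2) * m + C₁ * (n3 * E₂ + n3 * 72 * E₃ + n3 * 57 * E₄)
      + 2 * X * (K * (K * e) * m + (K * (K * f) * m + C₂ * (n3 * E₁)))
    ≤ 2 * P * (X * e + e ^ 2 + X * f + X * E₁ + E₂ + E₃ + E₄) := by
  have h9 : 0 ≤ n3 := by rw [hn3]; positivity
  subst hP
  have q1 : 0 ≤ X * e := by positivity
  have q2 : 0 ≤ e ^ 2 := by positivity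
  have q3 : 0 ≤ X * f := by positivity
  have q4 : 0 ≤ X * E₁ := by positivity
  have r1 : 0 ≤ m * K ^ 2 := by positivity
  have r2 : 0 ≤ n3 * C₁ := by positivity
  have r3 : 0 ≤ C₂ * n3 := by positivity
  have s1 := mul_nonneg r1 q1
  have s2 := mul_nonneg r1 q2
  have s3 := mul_nonneg r1 q3
  have s4 := mul_nonneg r1 q4
  have s5 := mul_nonneg r1 hE₂
  have s6 := mul_nonneg r1 hE₃
  have s7 := mul_nonneg r1 hE₄
  have t1 := mul_nonneg r2 q1
  have t2 := mul_nonneg r2 q2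
  have t3 := mul_nonneg r2 q3
  have t4 := mul_nonneg r2 q4
  have t5 := mul_nonneg r2 hE₂
  have t6 := mul_nonneg r2 hE₃
  have t7 := mul_nonneg r2 hE₄
  have u1 := mul_nonneg r3 q1
  have u2 := mul_nonneg r3 q2
  have u3 := mul_nonneg r3 q3
  have u4 := mul_nonneg r3 q4
  have u5 := mul_nonneg r3 hE₂
  have u6 := mul_nonneg r3 hE₃
  have u7 := mul_nonneg r3 hE₄
  linarith

theorem mul_pow_le_nine_pow {a x : ℝ} {n k : ℕ} (ha0 : 0 ≤ a) (ha : a ≤ 9) (hx : 0 ≤ x)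
    (hk : k ≤ n) : (a * x) ^ k ≤ 9 ^ n * x ^ k := by
  rw [mul_pow]
  refine mul_le_mul_of_nonneg_right ?_ (by positivity)
  exact (pow_le_pow_left₀ ha0 ha k).trans (pow_le_pow_right₀ (by norm_num) hk)

theorem pair_error_le {C t D S H j : ℝ} {n d : ℕ} (hC : 0 ≤ C) (ht : 0 ≤ t) (hD : 0 ≤ D)
    (hS : 0 < S) (hH : 0 ≤ H) (hj : 0 ≤ j) :
    C * (((3 * t) ^ n) ^ 2 * (t / (D ^ 2 * S ^ (2 * d - 2))) * j ^ 2
          + 1 / S ^ (2 * d - 2) * ((9 * (t * D / S)) ^ (n - 2) * (72 * (t ^ 3 / S) * H)) * j ^ 2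
          + 1 / S ^ d * ((3 * t) ^ (n - 2) * (57 * (t ^ 3 / S) * H)) * j)
    ≤ C * (9 ^ n * ((t ^ n) ^ 2 * (t / (D ^ 2 * S ^ (2 * d - 2))) * j ^ 2)
      + 9 ^ n * 72 * ((t * D / S) ^ (n - 2) * (t ^ 3 / S * H) * j ^ 2 / S ^ (2 * d - 2))
      + 9 ^ n * 57 * (t ^ (n - 2) * (t ^ 3 / S * H) * j / S ^ d)) := by
  have h1 : ((3 * t) ^ n) ^ 2 ≤ 9 ^ n * (t ^ n) ^ 2 := by
    rw [mul_pow, mul_pow, ← pow_mul, mul_comm n 2, pow_mul]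
    norm_num
  have h2 : (9 * (t * D / S)) ^ (n - 2) ≤ 9 ^ n * (t * D / S) ^ (n - 2) :=
    mul_pow_le_nine_pow (by norm_num) le_rfl (by positivity) (by omega)
  have h3 : (3 * t) ^ (n - 2) ≤ 9 ^ n * t ^ (n - 2) :=
    mul_pow_le_nine_pow (by norm_num) (by norm_num) ht (by omega)
  calc _ ≤ C * ((9 ^ n * (t ^ n) ^ 2) * (t / (D ^ 2 * S ^ (2 * d - 2))) * j ^ 2
          + 1 / S ^ (2 * d - 2) * ((9 ^ n * (t * D / S) ^ (n - 2))
            * (72 * (t ^ 3 / S) * H)) * j ^ 2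
          + 1 / S ^ d * ((9 ^ n * t ^ (n - 2)) * (57 * (t ^ 3 / S) * H)) * j) := by gcongr
    _ = _ := by ring

theorem exists_second_moment_bound {n : ℕ} (hn : 3 ≤ n) {σ : Fin n → ℝ} (hσ : ∀ i, |σ i| = 1)
    {d : ℕ} (hd : 2 ≤ d) (hdn : d < n) (μ : Measure (SLR n)) [μ.IsHaarMeasure] {β : ℝ}
    (hβ : 0 < β) :
    ∃ θ > (0 : ℝ), θ ≤ 1 ∧ ∀ L M : ℝ, 1 ≤ L → 1 ≤ M → ∃ K ≥ (1 : ℝ), ∀ t S D : ℝ,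
      K ≤ S → S ≤ t → K * t ≤ D → ∀ J : Set ℝ, MeasurableSet J → J ⊆ Set.Icc (-M) M →
      ∀ j X e H : ℝ, j = (volume J).toReal → X = j * t ^ (n - d) → e = X * t ^ (-θ) + t ^ β →
        H = hsum (2 * ⌊t⌋₊ ^ 2) →
      ∫⁻ g, rho L g * ENNReal.ofReal
        (((count σ d J (annulus n S t) g).toReal - regDensity σ d g * X) ^ 2) ∂μ
      ≤ ENNReal.ofReal (K * (X * e + e ^ 2 + X * (j * S ^ (n - d) + t ^ β)
        + X * (t ^ n / S ^ (d + 1) * j)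
        + (t ^ n) ^ 2 * (t / (D ^ 2 * S ^ (2 * d - 2))) * j ^ 2
        + (t * D / S) ^ (n - 2) * (t ^ 3 / S * H) * j ^ 2 / S ^ (2 * d - 2)
        + t ^ (n - 2) * (t ^ 3 / S * H) * j / S ^ d)) := by
  obtain ⟨θ, hθ, hθ1, hreg⟩ := exists_regVol_bounds hσ hd hdn hβ
  refine ⟨θ, hθ, hθ1, fun L M hL hM => ?_⟩
  obtain ⟨K, hK, hreg⟩ := hreg L M hL hM
  obtain ⟨C₁, hC₁, hsq⟩ := lintegral_rho_mul_count_sq_le hn hσ hd μ hL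
  have hcm : Measurable (regDensity (n := n) σ d) := measurable_regDensity hσ hd hdn
  have hc0 := regDensity_nonneg (n := n) hσ hd hdn
  have hψm : Measurable fun g : SLR n => rho L g * ENNReal.ofReal (regDensity σ d g) :=
    (measurable_rho L).mul hcm.ennreal_ofReal
  obtain ⟨κ, hκ, B, hB, hψ⟩ := exists_rho_mul_regDensity_le hσ hd hdn hL
  obtain ⟨C₂, hC₂, S₀, hS₀, hlow⟩ := lintegral_mul_regVol_le hn hσ hd μ hL hψm hκ hB hψ
  set m := (∫⁻ g, rho (n := n) L g ∂μ).toReal with hm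
  have hm0 : 0 ≤ m := ENNReal.toReal_nonneg
  set P := m * (2 * K ^ 2) + m * K ^ 2 + 9 ^ n * C₁ * 72 + 2 * C₂ * 9 ^ n with hP
  have hP0 : 0 ≤ P := by positivity
  have hn4 : (0 : ℝ) ≤ 80 * (n : ℝ) ^ 4 := by positivity
  refine ⟨2 * P + (K + S₀ + 2 + 80 * (n : ℝ) ^ 4), by linarith,
    fun t S D hS hSt hD J hJ hJM j X e H hj hX he hH => ?_⟩
  have ht1 : 1 ≤ t := by linarith
  have ht0 : 0 < t := by linarith
  have hS0 : 0 < S := by linarith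
  have hj0 : 0 ≤ j := hj ▸ ENNReal.toReal_nonneg
  have hX0 : 0 ≤ X := by rw [hX]; positivity
  have he0 : 0 ≤ e := by rw [he]; positivity
  have hH0 : 0 ≤ H := hH ▸ hsum_nonneg _
  have hJtop : volume J ≠ ⊤ := ((measure_mono hJM).trans_lt (by
    rw [Real.volume_Icc]
    exact ENNReal.ofReal_lt_top)).ne
  have hJj : volume J = ENNReal.ofReal j := by rw [hj, ENNReal.ofReal_toReal hJtop]
  have hD1 : 80 * (n : ℝ) ^ 4 * t ≤ D :=
    (mul_le_mul_of_nonneg_right (by linarith) ht0.le).trans hD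
  have hD0 : 0 ≤ D := le_trans (by positivity) hD1
  set f := j * S ^ (n - d) + t ^ β with hf
  have hf0 : 0 ≤ f := by positivity
  set N : SLR n → ℝ := fun g => (count σ d J (annulus n S t) g).toReal with hN
  have hNof : ∀ g, count σ d J (annulus n S t) g = ENNReal.ofReal (N g) := fun g =>
    (ENNReal.ofReal_toReal (count_ne_top _ _ _ _ _)).symm
  have hregof : ∀ g T, regVol σ d g J T = ENNReal.ofReal (regVol σ d g J T).toReal := fun g T =>
    (ENNReal.ofReal_toReal (regVol_ne_top _ _ _ _ _)).symm
  have hN0 : ∀ g, 0 ≤ N g := fun g => ENNReal.toReal_nonneg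
  have hNm : Measurable N := (measurable_count σ d hJ _).ennreal_toReal
  have hreg' := fun g (hg : g ∈ KL n L) => (hreg g hg).2 t (by linarith) J hJ hJM
  rw [← hj, ← hX, ← he] at hreg'
  have hQ : ∫⁻ g, rho L g * ENNReal.ofReal (regDensity σ d g ^ 2) ∂μ ≠ ⊤ := by
    refine ((lintegral_rho_mul_le μ L (F := fun _ => 0) (sq_nonneg K) fun g hg => ?_).trans_lt
      ?_).ne
    · rw [zero_add]
      exact ENNReal.ofReal_le_ofReal (pow_le_pow_left₀ (hc0 g) (hreg g hg).1 2)
    · simp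
  have h₁ : ∫⁻ g, rho L g * ENNReal.ofReal (N g ^ 2) ∂μ
      ≤ ENNReal.ofReal (X ^ 2) * ∫⁻ g, rho L g * ENNReal.ofReal (regDensity σ d g ^ 2) ∂μ
        + ENNReal.ofReal ((2 * K * X * (K * e) + (K * e) ^ 2) * m
          + C₁ * (9 ^ n * ((t ^ n) ^ 2 * (t / (D ^ 2 * S ^ (2 * d - 2))) * j ^ 2)
            + 9 ^ n * 72 * ((t * D / S) ^ (n - 2) * (t ^ 3 / S * H) * j ^ 2 / S ^ (2 * d - 2))
            + 9 ^ n * 57 * (t ^ (n - 2) * (t ^ 3 / S * H) * j / S ^ d))) := by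
    have h1 := hsq t S D (by linarith) hSt hD1 J hJ j hj0 hJj
    rw [← hH] at h1
    have h2 : ∫⁻ g, rho L g * regVol σ d g J (t + n) ^ 2 ∂μ
        ≤ ∫⁻ g, rho L g * ENNReal.ofReal (X ^ 2 * regDensity σ d g ^ 2) ∂μ
          + ENNReal.ofReal ((2 * K * X * (K * e) + (K * e) ^ 2) * m) := by
      refine lintegral_rho_mul_le μ L (by positivity) fun g hg => ?_
      rw [hregof, ← ENNReal.ofReal_pow ENNReal.toReal_nonneg,
        ← ENNReal.ofReal_add (by positivity) (by positivity)]
      refine ENNReal.ofReal_le_ofReal ?_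
      have h3 := (hreg' g hg).1
      have h4 := (hreg g hg).1
      have h5 := hc0 g
      calc (regVol σ d g J (t + n)).toReal ^ 2 ≤ (regDensity σ d g * X + K * e) ^ 2 :=
            pow_le_pow_left₀ ENNReal.toReal_nonneg h3 2
        _ = X ^ 2 * regDensity σ d g ^ 2 + (2 * regDensity σ d g * X * (K * e) + (K * e) ^ 2) := by
            ring
        _ ≤ _ := by gcongr
    have h3 : ∫⁻ g, rho L g * ENNReal.ofReal (X ^ 2 * regDensity σ d g ^ 2) ∂μ
        = ENNReal.ofReal (X ^ 2) * ∫⁻ g, rho L g * ENNReal.ofReal (regDensity σ d g ^ 2) ∂μ := by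
      rw [← lintegral_const_mul' _ _ ENNReal.ofReal_ne_top]
      refine lintegral_congr fun g => ?_
      rw [ENNReal.ofReal_mul (sq_nonneg X)]
      ring
    have h4 : ∫⁻ g, rho L g * ENNReal.ofReal (N g ^ 2) ∂μ
        = ∫⁻ g, rho L g * count σ d J (annulus n S t) g ^ 2 ∂μ :=
      lintegral_congr fun g => by rw [hNof, ENNReal.ofReal_pow (hN0 g)]
    rw [h4, ENNReal.ofReal_add (by positivity) (by positivity), ← add_assoc, ← h3]
    refine h1.trans (add_le_add h2 (ENNReal.ofReal_le_ofReal ?_))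
    exact pair_error_le hC₁.le ht0.le hD0 hS0 hH0 hj0
  have h₂ : ENNReal.ofReal X * ∫⁻ g, rho L g * ENNReal.ofReal (regDensity σ d g ^ 2) ∂μ
      ≤ ∫⁻ g, rho L g * ENNReal.ofReal (regDensity σ d g * N g) ∂μ
        + ENNReal.ofReal (K * (K * e) * m + (K * (K * f) * m
          + C₂ * (9 ^ n * (t ^ n / S ^ (d + 1) * j)))) := by
    have h1 : ENNReal.ofReal X * ∫⁻ g, rho L g * ENNReal.ofReal (regDensity σ d g ^ 2) ∂μ
        = ∫⁻ g, rho L g * ENNReal.ofReal (regDensity σ d g * (regDensity σ d g * X)) ∂μ := by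
      rw [← lintegral_const_mul' _ _ ENNReal.ofReal_ne_top]
      refine lintegral_congr fun g => ?_
      rw [mul_left_comm, ← ENNReal.ofReal_mul hX0]
      congr 2
      ring
    have h2 : ∫⁻ g, rho L g * ENNReal.ofReal (regDensity σ d g * (regDensity σ d g * X)) ∂μ
        ≤ ∫⁻ g, rho L g * (ENNReal.ofReal (regDensity σ d g) * regVol σ d g J (t - n)) ∂μ
          + ENNReal.ofReal (K * (K * e) * m) := by
      refine lintegral_rho_mul_le μ L (by positivity) fun g hg => ?_
      have h3 := (hreg' g hg).2.1
      have h4 := (hreg g hg).1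
      have h5 := hc0 g
      rw [hregof, ← ENNReal.ofReal_mul h5,
        ← ENNReal.ofReal_add (mul_nonneg h5 ENNReal.toReal_nonneg) (by positivity)]
      refine ENNReal.ofReal_le_ofReal ?_
      have h6 := mul_le_mul_of_nonneg_left h3 h5
      have h7 : regDensity σ d g * (K * e) ≤ K * (K * e) := by gcongr
      linarith
    have h3 : ∫⁻ g, rho L g * (ENNReal.ofReal (regDensity σ d g)
          * regVol σ d g J (n * (S + 1))) ∂μ
        ≤ ∫⁻ g, rho L g * (0 : ENNReal) ∂μ + ENNReal.ofReal (K * (K * f) * m) := by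
      refine lintegral_rho_mul_le μ L (F := fun _ => 0) (by positivity) fun g hg => ?_
      have h3 := (hreg' g hg).2.2 S (by linarith) hSt
      have h4 := (hreg g hg).1
      have h5 := hc0 g
      rw [hregof, ← ENNReal.ofReal_mul h5, zero_add]
      refine ENNReal.ofReal_le_ofReal ?_
      exact mul_le_mul h4 h3 ENNReal.toReal_nonneg (by positivity)
    have h4 := hlow t S (by linarith) ht1 J hJ j hj0 hJj
    simp_rw [mul_assoc (rho L _)] at h4
    have h5 : ∫⁻ g, rho L g * ENNReal.ofReal (regDensity σ d g * N g) ∂μ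
        = ∫⁻ g, rho L g * (ENNReal.ofReal (regDensity σ d g)
          * count σ d J (annulus n S t) g) ∂μ :=
      lintegral_congr fun g => by rw [hNof, ENNReal.ofReal_mul (hc0 g)]
    have h6 : C₂ * ((3 * t) ^ n / S ^ (d + 1) * j) ≤ C₂ * (9 ^ n * (t ^ n / S ^ (d + 1) * j)) := by
      have := mul_pow_le_nine_pow (n := n) (a := 3) (by norm_num) (by norm_num) ht0.le le_rfl
      calc C₂ * ((3 * t) ^ n / S ^ (d + 1) * j) ≤ C₂ * ((9 ^ n * t ^ n) / S ^ (d + 1) * j) := by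
            gcongr
        _ = _ := by ring
    simp only [mul_zero, lintegral_zero, zero_add] at h3
    rw [h1, h5]
    calc _ ≤ _ := h2
      _ ≤ (∫⁻ g, rho L g * (ENNReal.ofReal (regDensity σ d g)
          * count σ d J (annulus n S t) g) ∂μ + ENNReal.ofReal (K * (K * f) * m)
          + ENNReal.ofReal (C₂ * (9 ^ n * (t ^ n / S ^ (d + 1) * j))))
          + ENNReal.ofReal (K * (K * e) * m) :=
        add_le_add (h4.trans (add_le_add (add_le_add le_rfl h3) (ENNReal.ofReal_le_ofReal h6)))
          le_rfl
      _ = _ := by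
        rw [ENNReal.ofReal_add (by positivity) (by positivity),
          ENNReal.ofReal_add (p := K * (K * f) * m) (by positivity) (by positivity)]
        ring
  refine (lintegral_sq_sub_le μ (measurable_rho L) hNm hcm hN0 hc0 hX0 (by positivity)
    (by positivity) hQ h₁ h₂).trans (ENNReal.ofReal_le_ofReal ?_)
  have hE₁ : 0 ≤ t ^ n / S ^ (d + 1) * j := by positivity
  have hE₂ : 0 ≤ (t ^ n) ^ 2 * (t / (D ^ 2 * S ^ (2 * d - 2))) * j ^ 2 := by positivity
  have hE₃ : 0 ≤ (t * D / S) ^ (n - 2) * (t ^ 3 / S * H) * j ^ 2 / S ^ (2 * d - 2) := by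
    positivity
  have hE₄ : 0 ≤ t ^ (n - 2) * (t ^ 3 / S * H) * j / S ^ d := by positivity
  refine (second_moment_error hm0 hX0 he0 hf0 hE₁ hE₂ hE₃ hE₄ hC₁.le hC₂.le rfl hP).trans ?_
  refine mul_le_mul_of_nonneg_right (by linarith) ?_
  positivity

theorem hsum_le_rpow {ε : ℝ} (hε : 0 < ε) {t : ℝ} (ht : 1 ≤ t) :
    hsum (2 * ⌊t⌋₊ ^ 2) ≤ (2 + 2 / ε) * t ^ ε := by
  have h1 : 1 ≤ ⌊t⌋₊ := Nat.one_le_floor_iff t |>.2 ht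
  have hf : (0 : ℝ) < (⌊t⌋₊ : ℝ) := by exact_mod_cast h1
  have h3 := hsum_le (2 * ⌊t⌋₊ ^ 2)
  have h4 : Real.log ((2 * ⌊t⌋₊ ^ 2 : ℕ) : ℝ) ≤ 1 + 2 * (t ^ ε / ε) := by
    push_cast
    rw [Real.log_mul (by norm_num) (by positivity), Real.log_pow]
    have h5 : Real.log (⌊t⌋₊ : ℝ) ≤ t ^ ε / ε :=
      (Real.log_le_log hf (Nat.floor_le (by linarith))).trans
        (Real.log_le_rpow_div (by linarith) hε)
    have h6 := Real.log_le_sub_one_of_pos (x := 2) (by norm_num)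
    push_cast
    linarith
  have h5 := Real.one_le_rpow ht hε.le
  have h6 : (2 + 2 / ε) * t ^ ε = 2 * t ^ ε + 2 * (t ^ ε / ε) := by ring
  rw [h6]
  linarith

set_option maxHeartbeats 1600000 in
theorem second_moment_exponents {n d : ℕ} (hn : 3 ≤ n) (hd : 2 ≤ d) (hdn : d < n)
    {γ κ θ δ ε η t j X e H S D c A : ℝ} (hκ : κ = n - d - γ) (hδ : 0 < δ)
    (hεδ : ε ≤ δ) (hδ1 : δ * (2 * d + 2 * n + 5) ≤ 1 / 8)
    (hδ2 : δ * (2 * d + 2 * n + 5) ≤ γ / 4) (hη : 0 < η) (hη1 : 2 * η ≤ θ)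
    (hη3 : 2 * η ≤ δ / 2) (hη4 : 2 * η ≤ 1 / 8) (ht : 1 ≤ t) (hc : 1 ≤ c) (hA : 1 ≤ A)
    (hj0 : 0 ≤ j) (hj : j ≤ c * t ^ (-κ)) (hX : X = j * t ^ (n - d))
    (he : e = X * t ^ (-θ) + t ^ (γ / 2)) (hH : H ≤ A * t ^ ε)
    (hS : S = t ^ (1 - δ)) (hD : D = t ^ (7 / 4 : ℝ)) :
    X * e + e ^ 2 + X * (j * S ^ (n - d) + t ^ (γ / 2))
        + X * (t ^ n / S ^ (d + 1) * j)
        + (t ^ n) ^ 2 * (t / (D ^ 2 * S ^ (2 * d - 2))) * j ^ 2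
        + (t * D / S) ^ (n - 2) * (t ^ 3 / S * H) * j ^ 2 / S ^ (2 * d - 2)
        + t ^ (n - 2) * (t ^ 3 / S * H) * j / S ^ d
      ≤ 20 * (c ^ 2 * A) * t ^ (2 * γ - 2 * η) := by
  have ht0 : 0 < t := by linarith
  have hP : ∀ a : ℝ, 0 < t ^ a := fun a => Real.rpow_pos_of_pos ht0 a
  have hmono : ∀ {a b : ℝ}, a ≤ b → t ^ a ≤ t ^ b := fun h => Real.rpow_le_rpow_of_exponent_le ht h
  have hadd : ∀ a b : ℝ, t ^ a * t ^ b = t ^ (a + b) := fun a b => (Real.rpow_add ht0 a b).symm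
  have hsub : ∀ a b : ℝ, t ^ a / t ^ b = t ^ (a - b) := fun a b => (Real.rpow_sub ht0 a b).symm
  have hpow : ∀ (a : ℝ) (m : ℕ), (t ^ a) ^ m = t ^ (a * m) := fun a m => by
    rw [Real.rpow_mul ht0.le, Real.rpow_natCast]
  have hnat : ∀ m : ℕ, t ^ m = t ^ (m : ℝ) := fun m => (Real.rpow_natCast t m).symm
  have hone : t = t ^ (1 : ℝ) := (Real.rpow_one t).symm
  have hn3 : (3 : ℝ) ≤ n := by exact_mod_cast hn
  have hd2 : (2 : ℝ) ≤ d := by exact_mod_cast hd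
  have hdn1 : (d : ℝ) + 1 ≤ n := by exact_mod_cast hdn
  have e1 : ((n - d : ℕ) : ℝ) = n - d := Nat.cast_sub hdn.le
  have e2 : ((n - 2 : ℕ) : ℝ) = n - 2 := by rw [Nat.cast_sub (by omega)]; norm_num
  have e3 : ((2 * d - 2 : ℕ) : ℝ) = 2 * d - 2 := by rw [Nat.cast_sub (by omega)]; push_cast; ring
  have hS0 : 0 < S := hS ▸ hP _
  have hD0 : 0 < D := hD ▸ hP _
  have hX0 : 0 ≤ X := by rw [hX]; positivity
  have hc2 : c ≤ c ^ 2 := by nlinarith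
  have hδd : 0 ≤ δ * d := by positivity
  have hδn : δ * 3 ≤ δ * n := by gcongr
  have hXle : X ≤ c * t ^ γ := by
    calc X ≤ c * t ^ (-κ) * t ^ (n - d) := by rw [hX]; gcongr
      _ = c * t ^ γ := by
        rw [hnat, e1, mul_assoc, hadd]; congr 2; rw [hκ]; ring
  have hele : e ≤ 2 * c * t ^ (γ - 2 * η) := by
    have h1 : X * t ^ (-θ) ≤ c * t ^ (γ - 2 * η) := by
      calc X * t ^ (-θ) ≤ c * t ^ γ * t ^ (-θ) := mul_le_mul_of_nonneg_right hXle (hP _).le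
        _ = c * t ^ (γ - θ) := by rw [mul_assoc, hadd]; rfl
        _ ≤ _ := by exact mul_le_mul_of_nonneg_left (hmono (by linarith)) (by linarith)
    have h2 : t ^ (γ / 2) ≤ c * t ^ (γ - 2 * η) :=
      (hmono (by linarith)).trans (le_mul_of_one_le_left (hP _).le hc)
    rw [he]; linarith
  have he0 : 0 ≤ e := by rw [he]; have := hP (-θ); have := hP (γ / 2); positivity
  set W := c ^ 2 * A * t ^ (2 * γ - 2 * η) with hW
  have hcW : ∀ {a : ℝ}, a ≤ 2 * γ - 2 * η → c ^ 2 * A * t ^ a ≤ W := fun h => by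
    rw [hW]; exact mul_le_mul_of_nonneg_left (hmono h) (by positivity)
  have hcW1 : ∀ {a : ℝ}, a ≤ 2 * γ - 2 * η → c ^ 2 * t ^ a ≤ W := fun {a} h => by
    refine le_trans ?_ (hcW h)
    have := hP a
    exact mul_le_mul_of_nonneg_right (le_mul_of_one_le_right (by positivity) hA) this.le
  have T1 : X * e ≤ 2 * W := by
    calc X * e ≤ c * t ^ γ * (2 * c * t ^ (γ - 2 * η)) := by
          have := hP γ
          gcongr
      _ = 2 * (c ^ 2 * (t ^ γ * t ^ (γ - 2 * η))) := by ring
      _ ≤ 2 * W := by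
        rw [hadd]
        have := hcW1 (a := γ + (γ - 2 * η)) (by linarith)
        linarith
  have T2 : e ^ 2 ≤ 4 * W := by
    calc e ^ 2 ≤ (2 * c * t ^ (γ - 2 * η)) ^ 2 := by gcongr
      _ = 4 * (c ^ 2 * (t ^ (γ - 2 * η) * t ^ (γ - 2 * η))) := by ring
      _ ≤ 4 * W := by
        rw [hadd]
        have := hcW1 (a := γ - 2 * η + (γ - 2 * η)) (by linarith)
        linarith
  have T3 : X * (j * S ^ (n - d) + t ^ (γ / 2)) ≤ 2 * W := by
    have h1 : j * S ^ (n - d) ≤ c * t ^ (γ - 2 * η) := by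
      calc j * S ^ (n - d) ≤ c * t ^ (-κ) * S ^ (n - d) := by gcongr
        _ = c * t ^ (γ - δ * (n - d)) := by
          rw [hS, hpow, e1, mul_assoc, hadd]; congr 2; rw [hκ]; ring
        _ ≤ _ := by
          have : δ * 1 ≤ δ * (n - d) := by gcongr; linarith
          exact mul_le_mul_of_nonneg_left (hmono (by linarith)) (by linarith)
    have h2 : t ^ (γ / 2) ≤ c * t ^ (γ - 2 * η) :=
      (hmono (by linarith)).trans (le_mul_of_one_le_left (hP _).le hc)
    calc X * (j * S ^ (n - d) + t ^ (γ / 2))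
        ≤ c * t ^ γ * (c * t ^ (γ - 2 * η) + c * t ^ (γ - 2 * η)) := by
          have := hP γ
          have := hP (γ / 2)
          gcongr
      _ = 2 * (c ^ 2 * (t ^ γ * t ^ (γ - 2 * η))) := by ring
      _ ≤ 2 * W := by
        rw [hadd]
        have := hcW1 (a := γ + (γ - 2 * η)) (by linarith)
        linarith
  have T4 : X * (t ^ n / S ^ (d + 1) * j) ≤ W := by
    calc X * (t ^ n / S ^ (d + 1) * j)
        ≤ c * t ^ γ * (t ^ n / S ^ (d + 1) * (c * t ^ (-κ))) := by
          have := hP γ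
          gcongr
      _ = c ^ 2 * (t ^ γ * (t ^ n / S ^ (d + 1) * t ^ (-κ))) := by ring
      _ ≤ W := by
        rw [hS, hpow, hnat, hsub, hadd, hadd]
        refine hcW1 ?_
        push_cast
        rw [hκ]
        linarith
  have T5 : (t ^ n) ^ 2 * (t / (D ^ 2 * S ^ (2 * d - 2))) * j ^ 2 ≤ W := by
    calc (t ^ n) ^ 2 * (t / (D ^ 2 * S ^ (2 * d - 2))) * j ^ 2
        ≤ (t ^ n) ^ 2 * (t / (D ^ 2 * S ^ (2 * d - 2))) * (c * t ^ (-κ)) ^ 2 := by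
          gcongr
      _ = c ^ 2 * ((t ^ n) ^ 2 * (t / (D ^ 2 * S ^ (2 * d - 2))) * (t ^ (-κ)) ^ 2) := by ring
      _ = c ^ 2 * t ^ ((n : ℝ) * (2 : ℕ) + (1 - ((7 / 4 : ℝ) * (2 : ℕ)
          + (1 - δ) * (2 * d - 2))) + -κ * (2 : ℕ)) := by
        rw [hS, hD, hpow, hpow, e3, hadd, hpow, hnat n, hpow]
        nth_rewrite 2 [hone]
        rw [hsub, hadd, hadd]
      _ ≤ W := by
        refine hcW1 ?_
        push_cast
        rw [hκ]
        linarith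
  have T6 : (t * D / S) ^ (n - 2) * (t ^ 3 / S * H) * j ^ 2 / S ^ (2 * d - 2) ≤ W := by
    calc (t * D / S) ^ (n - 2) * (t ^ 3 / S * H) * j ^ 2 / S ^ (2 * d - 2)
        ≤ (t * D / S) ^ (n - 2) * (t ^ 3 / S * (A * t ^ ε)) * (c * t ^ (-κ)) ^ 2
          / S ^ (2 * d - 2) := by
          have := hP ε
          gcongr
      _ = c ^ 2 * A * (((t * D / S) ^ (n - 2) * (t ^ 3 / S * t ^ ε) * (t ^ (-κ)) ^ 2)
          / S ^ (2 * d - 2)) := by ring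
      _ = c ^ 2 * A * t ^ ((1 + (7 / 4 : ℝ) - (1 - δ)) * (n - 2) + ((3 : ℕ) - (1 - δ) + ε)
          + -κ * (2 : ℕ) - (1 - δ) * (2 * d - 2)) := by
        rw [hS, hD, hpow, hpow, e3, hnat 3]
        nth_rewrite 1 [hone]
        rw [hadd, hsub, hpow, e2, hsub, hadd, hadd, hadd, hsub]
      _ ≤ W := by
        refine hcW ?_
        push_cast
        rw [hκ]
        linarith
  have T7 : t ^ (n - 2) * (t ^ 3 / S * H) * j / S ^ d ≤ W := by
    calc t ^ (n - 2) * (t ^ 3 / S * H) * j / S ^ d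
        ≤ t ^ (n - 2) * (t ^ 3 / S * (A * t ^ ε)) * (c * t ^ (-κ)) / S ^ d := by
          have := hP ε
          gcongr
      _ = c * A * (t ^ (n - 2) * (t ^ 3 / S * t ^ ε) * t ^ (-κ) / S ^ d) := by ring
      _ ≤ c ^ 2 * A * (t ^ (n - 2) * (t ^ 3 / S * t ^ ε) * t ^ (-κ) / S ^ d) := by
        have := hP ε
        have := hP (-κ)
        gcongr
      _ = c ^ 2 * A * t ^ (((n : ℝ) - 2) + ((3 : ℕ) - (1 - δ) + ε) + -κ - (1 - δ) * d) := by
        rw [hS, hpow, hnat 3, hnat (n - 2), e2, hsub, hadd, hadd, hadd, hsub]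
      _ ≤ W := by
        refine hcW ?_
        push_cast
        rw [hκ]
        linarith
  have hW' : 20 * (c ^ 2 * A) * t ^ (2 * γ - 2 * η) = 20 * W := by rw [hW]; ring
  have hW0 : 0 ≤ W := by rw [hW]; have := hP (2 * γ - 2 * η); positivity
  rw [hW']
  linarith

theorem small_count_exponents {n d : ℕ} (hdn : d < n)
    {γ κ δ ε η t j H S c A : ℝ} (hκ : κ = n - d - γ) (hδ : 0 < δ)
    (hε : 0 < ε) (hεδ : ε * (2 * n) = δ) (hη : 0 < η) (hη2 : 2 * η ≤ γ / 2)
    (hη3 : 2 * η ≤ δ / 2) (ht : 1 ≤ t) (hc : 1 ≤ c) (hA : 1 ≤ A)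
    (hj : j ≤ c * t ^ (-κ)) (hH0 : 0 ≤ H) (hH : H ≤ A * t ^ ε)
    (hS : S = t ^ (1 - δ)) :
    j * (S ^ (n - d) * (1 + 2 * H) ^ n) + 1 ≤ (c * (3 * A) ^ n + 1) * t ^ (γ - η) := by
  have ht0 : 0 < t := by linarith
  have hP : ∀ a : ℝ, 0 < t ^ a := fun a => Real.rpow_pos_of_pos ht0 a
  have hmono : ∀ {a b : ℝ}, a ≤ b → t ^ a ≤ t ^ b := fun h => Real.rpow_le_rpow_of_exponent_le ht h
  have hadd : ∀ a b : ℝ, t ^ a * t ^ b = t ^ (a + b) := fun a b => (Real.rpow_add ht0 a b).symm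
  have hpow : ∀ (a : ℝ) (m : ℕ), (t ^ a) ^ m = t ^ (a * m) := fun a m => by
    rw [Real.rpow_mul ht0.le, Real.rpow_natCast]
  have e1 : ((n - d : ℕ) : ℝ) = n - d := Nat.cast_sub hdn.le
  have hS0 : 0 < S := hS ▸ hP _
  have hdn1 : (d : ℝ) + 1 ≤ n := by exact_mod_cast hdn
  have h1 : 1 ≤ t ^ (γ - η) := Real.one_le_rpow ht (by linarith)
  have h2 : 1 + 2 * H ≤ 3 * A * t ^ ε := by
    have h3 := Real.one_le_rpow ht hε.le
    have h4 : 1 ≤ A * t ^ ε := one_le_mul_of_one_le_of_one_le hA h3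
    linarith
  have h3 : j * (S ^ (n - d) * (1 + 2 * H) ^ n) ≤ c * (3 * A) ^ n * t ^ (γ - η) := by
    calc j * (S ^ (n - d) * (1 + 2 * H) ^ n)
        ≤ c * t ^ (-κ) * (S ^ (n - d) * (3 * A * t ^ ε) ^ n) := by
          have := hP (-κ)
          gcongr
      _ = c * (3 * A) ^ n * (t ^ (-κ) * (S ^ (n - d) * (t ^ ε) ^ n)) := by
        rw [mul_pow]; ring
      _ ≤ _ := by
        rw [hS, hpow, hpow, e1, hadd, hadd]
        refine mul_le_mul_of_nonneg_left (hmono ?_) (by positivity)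
        rw [hκ]
        have : δ * 1 ≤ δ * (n - d) := by gcongr; linarith
        linarith
  linarith

theorem hsum_le_of_le_sq {S t : ℝ} (ht : 1 ≤ t) (hSt : S ≤ t) :
    hsum ⌊S⌋₊ ≤ hsum (2 * ⌊t⌋₊ ^ 2) := by
  refine hsum_mono ((Nat.floor_le_floor hSt).trans ?_)
  have h1 : 1 ≤ ⌊t⌋₊ := Nat.one_le_floor_iff t |>.2 ht
  nlinarith

theorem abs_count_sub_le {n : ℕ} (σ : Fin n → ℝ) (d : ℕ) (J : Set ℝ) {S t : ℝ} (hS : 0 ≤ S)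
    (g : SLR n) (x : ℝ) :
    ENNReal.ofReal |(count σ d J (annulus n (-1) t) g).toReal - x|
      ≤ ENNReal.ofReal |(count σ d J (annulus n S t) g).toReal - x|
        + count σ d J (vbox n ⌊S⌋₊) g := by
  have hsub : annulus n S t ⊆ annulus n (-1) t := fun v hv => by
    rw [mem_annulus] at hv ⊢
    exact ⟨by linarith [hv.1], hv.2⟩
  have hsub' : annulus n (-1) t ⊆ annulus n S t ∪ vbox n ⌊S⌋₊ := fun v hv => by
    rw [Finset.mem_union]
    by_cases h : S < ‖intVec v‖
    · exact Or.inl (mem_annulus.2 ⟨h, (mem_annulus.1 hv).2⟩)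
    · refine Or.inr (mem_vbox.2 fun i => ?_)
      have h1 : |(v i : ℝ)| ≤ S := (norm_le_pi_norm (intVec v) i).trans (not_lt.1 h)
      have h2 : (((v i).natAbs : ℕ) : ℝ) ≤ S := by
        rw [Nat.cast_natAbs]
        exact_mod_cast h1
      have h3 := Nat.le_floor h2
      rw [Int.abs_eq_natAbs]
      exact_mod_cast h3
  have h1 : count σ d J (annulus n S t) g ≤ count σ d J (annulus n (-1) t) g :=
    Finset.sum_le_sum_of_subset hsub
  have h2 : count σ d J (annulus n (-1) t) g
      ≤ count σ d J (annulus n S t) g + count σ d J (vbox n ⌊S⌋₊) g := by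
    refine (Finset.sum_le_sum_of_subset hsub').trans ?_
    rw [count, count, ← Finset.sum_union_inter]
    exact le_self_add
  have t1 := ENNReal.toReal_mono (count_ne_top σ d J _ g) h1
  have t2 := ENNReal.toReal_mono (ENNReal.add_ne_top.2
    ⟨count_ne_top σ d J _ g, count_ne_top σ d J _ g⟩) h2
  rw [ENNReal.toReal_add (count_ne_top σ d J _ g) (count_ne_top σ d J _ g)] at t2
  rw [← ENNReal.ofReal_toReal (count_ne_top σ d J (vbox n ⌊S⌋₊) g),
    ← ENNReal.ofReal_add (abs_nonneg _) ENNReal.toReal_nonneg]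
  refine ENNReal.ofReal_le_ofReal ?_
  rw [abs_le]
  have h3 := neg_abs_le ((count σ d J (annulus n S t) g).toReal - x)
  have h4 := le_abs_self ((count σ d J (annulus n S t) g).toReal - x)
  constructor <;> linarith

theorem exists_first_moment_bound {n : ℕ} (hn : 3 ≤ n) {σ : Fin n → ℝ} (hσ : ∀ i, |σ i| = 1)
    {d : ℕ} (hd : 2 ≤ d) (hdn : d < n) (μ : Measure (SLR n)) [μ.IsHaarMeasure] {γ κ : ℝ}
    (hγ : 0 < γ) (hκ : κ = n - d - γ) :
    ∃ η > (0 : ℝ), 2 * η ≤ γ ∧ ∀ L M c : ℝ, 1 ≤ L → 1 ≤ M → 1 ≤ c →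
      ∃ C > (0 : ℝ), ∃ t₀ ≥ (1 : ℝ), ∀ t ≥ t₀, ∀ J : Set ℝ, MeasurableSet J →
        J ⊆ Set.Icc (-M) M → (volume J).toReal ≤ c * t ^ (-κ) →
        ∫⁻ g, rho L g * ENNReal.ofReal |(count σ d J (annulus n (-1) t) g).toReal
          - regDensity σ d g * ((volume J).toReal * t ^ (n - d))| ∂μ
        ≤ ENNReal.ofReal (C * t ^ (γ - η)) := by
  obtain ⟨θ, hθ, hθ1, hsm⟩ := exists_second_moment_bound hn hσ hd hdn μ (half_pos hγ)
  set b : ℝ := 2 * d + 2 * n + 5 with hb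
  have hn3 : (3 : ℝ) ≤ n := by exact_mod_cast hn
  have hb0 : 5 ≤ b := by
    have : (0 : ℝ) ≤ d := by positivity
    linarith
  set δ := min (1 / 8) (γ / 4) / b with hδ
  have hm0 : 0 < min (1 / 8) (γ / 4) := by positivity
  have hδ0 : 0 < δ := by positivity
  have hδb : δ * b = min (1 / 8) (γ / 4) := div_mul_cancel₀ _ (by linarith)
  have hδ1 : δ * b ≤ 1 / 8 := hδb.trans_le (min_le_left _ _)
  have hδ2 : δ * b ≤ γ / 4 := hδb.trans_le (min_le_right _ _)
  have hδb5 : δ * 5 ≤ δ * b := by gcongr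
  set ε := δ / (2 * n) with hε
  have hε0 : 0 < ε := by positivity
  have hεδ : ε * (2 * n) = δ := div_mul_cancel₀ _ (by positivity)
  have hεδ' : ε ≤ δ := by
    have : ε * 1 ≤ ε * (2 * n) := by gcongr; linarith
    linarith
  set η := min θ (δ / 2) / 2 with hη
  have hη0 : 0 < η := by positivity
  have h2η : 2 * η = min θ (δ / 2) := by rw [hη]; ring
  have hη1 : 2 * η ≤ θ := h2η.trans_le (min_le_left _ _)
  have hη3 : 2 * η ≤ δ / 2 := h2η.trans_le (min_le_right _ _)
  refine ⟨η, hη0, by linarith, fun L M c hL hM hc => ?_⟩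
  obtain ⟨K, hK, hsm⟩ := hsm L M hL hM
  obtain ⟨C₁, hC₁, hsmall⟩ := lintegral_rho_mul_count_small_le hn hσ hd hdn μ hL
  set A : ℝ := 2 + 2 / ε with hA
  have hA1 : 1 ≤ A := by
    have : 0 < 2 / ε := by positivity
    linarith
  set m := (∫⁻ g, rho (n := n) L g ∂μ).toReal with hm
  have hmn : 0 ≤ m := ENNReal.toReal_nonneg
  have hmof : ENNReal.ofReal m = ∫⁻ g, rho (n := n) L g ∂μ :=
    ENNReal.ofReal_toReal (lintegral_rho_ne_top μ L)
  obtain ⟨t₀, ht₀, hKt⟩ := exists_rpow_neg_le (θ := 1 / 2) (δ := K⁻¹) (by norm_num)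
    (by positivity)
  refine ⟨K * (20 * (c ^ 2 * A)) + m + C₁ * (c * (3 * A) ^ n + 1), by positivity, t₀, ht₀,
    fun t ht J hJ hJM hjc => ?_⟩
  have ht1 : 1 ≤ t := ht₀.trans ht
  have ht0 : 0 < t := by linarith
  have hK2 : K ≤ t ^ (1 / 2 : ℝ) := by
    have h1 := hKt t ht
    rw [Real.rpow_neg ht0.le] at h1
    exact (inv_le_inv₀ (by positivity) (by linarith)).1 h1
  set j := (volume J).toReal with hj
  have hj0 : 0 ≤ j := ENNReal.toReal_nonneg
  have hJj : volume J = ENNReal.ofReal j := by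
    refine (ENNReal.ofReal_toReal (ne_top_of_le_ne_top ?_ (measure_mono hJM))).symm
    rw [Real.volume_Icc]
    exact ENNReal.ofReal_ne_top
  set S := t ^ (1 - δ) with hS
  have hKS : K ≤ S := hK2.trans (Real.rpow_le_rpow_of_exponent_le ht1 (by linarith))
  have hSt : S ≤ t := by
    conv_rhs => rw [← Real.rpow_one t]
    exact Real.rpow_le_rpow_of_exponent_le ht1 (by linarith)
  have hD : K * t ≤ t ^ (7 / 4 : ℝ) := by
    calc K * t ≤ t ^ (1 / 2 : ℝ) * t ^ (1 : ℝ) := by rw [Real.rpow_one]; gcongr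
      _ = t ^ (3 / 2 : ℝ) := by rw [← Real.rpow_add ht0]; norm_num
      _ ≤ _ := Real.rpow_le_rpow_of_exponent_le ht1 (by norm_num)
  have hH := hsum_le_rpow hε0 ht1
  have hV := hsm t S _ hKS hSt hD J hJ hJM j _ _ _ rfl rfl rfl rfl
  have hV2 := second_moment_exponents (κ := κ) hn hd hdn hκ hδ0 hεδ' hδ1 hδ2 hη0 hη1 hη3
    (by linarith) ht1 hc hA1 hj0 hjc rfl rfl hH hS rfl
  have hV' := hV.trans (ENNReal.ofReal_le_ofReal (mul_le_mul_of_nonneg_left hV2 (by linarith)))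
  have hN := hsmall S (hK.le.trans hKS) J hJ j hj0 hJj
  have hN2 := small_count_exponents hdn hκ hδ0 hε0 hεδ hη0 (by linarith) hη3 ht1 hc hA1 hjc
    (hsum_nonneg ⌊S⌋₊) ((hsum_le_of_le_sq ht1 hSt).trans hH) hS
  have hN' := hN.trans (ENNReal.ofReal_le_ofReal (mul_le_mul_of_nonneg_left hN2 hC₁.le))
  have hs : 0 < t ^ (γ - η) := Real.rpow_pos_of_pos ht0 _
  have hab := lintegral_abs_le_of_sq μ (measurable_rho (n := n) L) (f := fun g =>
    (count σ d J (annulus n S t) g).toReal - regDensity σ d g * (j * t ^ (n - d))) hs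
  have hsq : t ^ (2 * γ - 2 * η) = t ^ (γ - η) * t ^ (γ - η) := by
    rw [← Real.rpow_add ht0]; congr 1; ring
  have hab' : ∫⁻ g, rho L g * ENNReal.ofReal |(count σ d J (annulus n S t) g).toReal
      - regDensity σ d g * (j * t ^ (n - d))| ∂μ
      ≤ ENNReal.ofReal ((K * (20 * (c ^ 2 * A)) + m) * t ^ (γ - η)) := by
    refine hab.trans ?_
    rw [← hmof, ← ENNReal.ofReal_mul hs.le]
    refine (add_le_add (mul_le_mul_right hV' _) le_rfl).trans ?_
    rw [← ENNReal.ofReal_mul (by positivity), ← ENNReal.ofReal_add (by positivity) (by positivity)]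
    refine ENNReal.ofReal_le_ofReal (le_of_eq ?_)
    rw [hsq]
    field_simp
  calc _ ≤ ∫⁻ g, (rho L g * ENNReal.ofReal |(count σ d J (annulus n S t) g).toReal
        - regDensity σ d g * (j * t ^ (n - d))| + rho L g * count σ d J (vbox n ⌊S⌋₊) g) ∂μ := by
        refine lintegral_mono fun g => ?_
        rw [← mul_add]
        exact mul_le_mul_right (abs_count_sub_le σ d J (by linarith) g _) _
    _ = _ := lintegral_add_right _ ((measurable_rho L).mul (measurable_count σ d hJ _))
    _ ≤ _ := add_le_add hab' hN'
    _ = _ := by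
      rw [← ENNReal.ofReal_add (by positivity) (by positivity)]
      congr 1
      ring

theorem ae_tendsto_zero_of_lintegral_le {α : Type*} [MeasurableSpace α] (μ : Measure α)
    {u : ℕ → α → ENNReal} (hu : ∀ k, Measurable (u k)) {b : ℕ → ℝ} (hb : Summable b)
    (h : ∀ᶠ k in atTop, ∫⁻ x, u k x ∂μ ≤ ENNReal.ofReal (b k)) :
    ∀ᵐ x ∂μ, Tendsto (fun k => u k x) atTop (nhds 0) := by
  obtain ⟨k₀, hk₀⟩ := eventually_atTop.1 h
  have h1 : ∫⁻ x, ∑' k, u (k + k₀) x ∂μ ≠ ⊤ := by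
    rw [lintegral_tsum fun k => (hu _).aemeasurable]
    have hs : Summable fun k => b (k + k₀) := (summable_nat_add_iff k₀).2 hb
    refine ne_top_of_le_ne_top (hs.tsum_ofReal_ne_top) ?_
    exact ENNReal.tsum_le_tsum fun k => hk₀ _ (by omega)
  have hm : Measurable fun x => ∑' k, u (k + k₀) x := Measurable.tsum fun k => hu _
  filter_upwards [ae_lt_top hm h1] with x hx
  exact (tendsto_add_atTop_iff_nat (f := fun k => u k x) k₀).1
    (ENNReal.tendsto_atTop_zero_of_tsum_ne_top hx.ne)

theorem rho_pos {n : ℕ} {L : ℝ} {g : SLR n} (h : mnorm (g : Matrix (Fin n) (Fin n) ℝ) < L) :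
    0 < rho L g := by
  rw [rho, ENNReal.ofReal_pos]
  linarith

theorem ae_eventually_count_le {n : ℕ} (hn : 3 ≤ n) {σ : Fin n → ℝ} (hσ : ∀ i, |σ i| = 1)
    {d : ℕ} (hd : 2 ≤ d) (hdn : d < n) (μ : Measure (SLR n)) [μ.IsHaarMeasure] {γ κ : ℝ}
    (hγ : 0 < γ) (hκ : κ = n - d - γ) :
    ∃ η > (0 : ℝ), η ≤ γ ∧ ∀ (T : ℕ → ℝ) (J : ℕ → Set ℝ) (M c : ℝ), 1 ≤ M → 1 ≤ c →
      (∀ k, 1 ≤ T k) → Tendsto T atTop atTop → (Summable fun k => T k ^ (-η)) →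
      (∀ k, MeasurableSet (J k)) → (∀ k, J k ⊆ Set.Icc (-M) M) →
      (∀ k, (volume (J k)).toReal ≤ c * T k ^ (-κ)) →
      ∀ᵐ g ∂μ, ∀ᶠ k in atTop, |(count σ d (J k) (annulus n (-1) (T k)) g).toReal
        - regDensity σ d g * ((volume (J k)).toReal * T k ^ (n - d))| ≤ T k ^ (γ - η) := by
  obtain ⟨η, hη, hηγ, h⟩ := exists_first_moment_bound hn hσ hd hdn μ hγ hκ
  refine ⟨η / 2, by positivity, by linarith, fun T J M c hM hc hT1 hT hsum hJ hJM hvol => ?_⟩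
  have hT0 : ∀ k, 0 < T k := fun k => by linarith [hT1 k]
  set f : ℕ → SLR n → ENNReal := fun k g => ENNReal.ofReal
    |(count σ d (J k) (annulus n (-1) (T k)) g).toReal
        - regDensity σ d g * ((volume (J k)).toReal * T k ^ (n - d))| with hf
  have hfm : ∀ k, Measurable (f k) := fun k =>
    ((((measurable_count σ d (hJ k) _).ennreal_toReal).sub
      ((measurable_regDensity hσ hd hdn).mul_const _)).abs).ennreal_ofReal
  have key : ∀ L : ℕ, ∀ᵐ g ∂μ, Tendsto (fun k => rho ((L : ℝ) + 1) g * f k g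
      * ENNReal.ofReal (T k ^ (-(γ - η / 2)))) atTop (nhds 0) := by
    intro L
    obtain ⟨C, hC, t₀, ht₀, hint⟩ := h (L + 1) M c (by linarith [(Nat.cast_nonneg L : (0 : ℝ) ≤ L)])
      hM hc
    refine ae_tendsto_zero_of_lintegral_le μ (fun k => ((measurable_rho _).mul (hfm k)).mul_const _)
      (hsum.mul_left C) ?_
    filter_upwards [hT.eventually_ge_atTop t₀] with k hk
    have hm : Measurable fun g : SLR n => rho ((L : ℝ) + 1) g * f k g :=
      (measurable_rho _).mul (hfm k)
    rw [lintegral_mul_const _ hm]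
    refine (mul_le_mul_left (hint (T k) hk (J k) (hJ k) (hJM k) (hvol k)) _).trans ?_
    rw [← ENNReal.ofReal_mul (mul_nonneg hC.le (Real.rpow_nonneg (hT0 k).le _)), mul_assoc,
      ← Real.rpow_add (hT0 k)]
    refine ENNReal.ofReal_le_ofReal (le_of_eq ?_)
    congr 2
    ring
  filter_upwards [ae_all_iff.2 key] with g hg
  obtain ⟨L, hL⟩ := exists_nat_gt (mnorm (g : Matrix (Fin n) (Fin n) ℝ))
  have hpos : 0 < rho ((L : ℝ) + 1) g := rho_pos (by linarith)
  have htop : rho ((L : ℝ) + 1) g ≠ ⊤ := ENNReal.ofReal_ne_top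
  filter_upwards [(hg L).eventually_lt_const hpos] with k hk
  have hP := Real.rpow_pos_of_pos (hT0 k) (γ - η / 2)
  by_contra! hcon
  have h1 : 1 ≤ f k g * ENNReal.ofReal (T k ^ (-(γ - η / 2))) := by
    rw [hf, ← ENNReal.ofReal_mul (abs_nonneg _), ← ENNReal.ofReal_one]
    refine ENNReal.ofReal_le_ofReal ?_
    rw [Real.rpow_neg (hT0 k).le, ← div_eq_mul_inv, le_div_iff₀ hP, one_mul]
    exact hcon.le
  have h2 : rho ((L : ℝ) + 1) g * 1 ≤ rho ((L : ℝ) + 1) g * f k g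
      * ENNReal.ofReal (T k ^ (-(γ - η / 2))) := by
    rw [mul_assoc]
    exact mul_le_mul_right h1 _
  rw [mul_one] at h2
  exact absurd hk (not_lt.2 h2)

theorem sandwich_rpow {u s γ κ : ℝ} {A m : ℕ} (hA : 1 ≤ A) (hu : 1 ≤ u) (hus : u ≤ s)
    (hsu : s ≤ u + 1) (hγ : 0 ≤ γ) (hκ : κ = m - γ) :
    (u ^ A) ^ (-κ) * ((u + 1) ^ A) ^ m
        ≤ (s ^ A) ^ γ * (1 + 2 ^ (A * m + 1) * (s ^ A) ^ (-(1 / (A : ℝ)))) ∧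
      (s ^ A) ^ γ * (1 - 2 ^ (A * m + 1) * (s ^ A) ^ (-(1 / (A : ℝ))))
        ≤ ((u + 1) ^ A) ^ (-κ) * (u ^ A) ^ m := by
  have hu0 : 0 < u := by linarith
  have hs0 : 0 < s := by linarith
  have hroot : (s ^ A) ^ (-(1 / (A : ℝ))) = s⁻¹ := by
    have hA0 : (A : ℝ) ≠ 0 := by positivity
    rw [← Real.rpow_natCast s A, ← Real.rpow_mul hs0.le,
      show (A : ℝ) * -(1 / (A : ℝ)) = -1 by field_simp, Real.rpow_neg_one]
  have hx0 : 0 ≤ u⁻¹ := by positivity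
  have hx1 : u⁻¹ ≤ 1 := inv_le_one_of_one_le₀ hu
  have hxs : u⁻¹ ≤ 2 * s⁻¹ := by
    rw [← div_eq_mul_inv, inv_le_comm₀ hu0 (by positivity), inv_div]
    linarith
  have hpow := one_add_pow_le hx0 hx1 (A * m)
  have hr : (u + 1) ^ A = (1 + u⁻¹) ^ A * u ^ A := by
    rw [← mul_pow]; congr 1; field_simp
  have hUV : ∀ x : ℝ, 0 < x → x ^ (-κ) * x ^ m = x ^ γ := fun x hx => by
    rw [← Real.rpow_natCast x m, ← Real.rpow_add hx, hκ]; congr 1; ring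
  have hU : 0 < u ^ A := by positivity
  have hV : 0 < (u + 1) ^ A := by positivity
  have hW : 0 < s ^ A := by positivity
  have hUW : (u ^ A) ^ γ ≤ (s ^ A) ^ γ := by gcongr
  have hWV : (s ^ A) ^ γ ≤ ((u + 1) ^ A) ^ γ := by gcongr
  have hbd : (1 + u⁻¹) ^ (A * m) ≤ 1 + 2 ^ (A * m + 1) * s⁻¹ := by
    refine hpow.trans ?_
    have : (2 : ℝ) ^ (A * m) * u⁻¹ ≤ 2 ^ (A * m) * (2 * s⁻¹) := by gcongr
    rw [pow_succ]
    linarith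
  have hW0 : 0 < (s ^ A) ^ γ := Real.rpow_pos_of_pos hW _
  rw [hroot]
  constructor
  · calc (u ^ A) ^ (-κ) * ((u + 1) ^ A) ^ m
        = ((u ^ A) ^ (-κ) * (u ^ A) ^ m) * (1 + u⁻¹) ^ (A * m) := by
          rw [hr, mul_pow, pow_mul]; ring
      _ = (u ^ A) ^ γ * (1 + u⁻¹) ^ (A * m) := by rw [hUV _ hU]
      _ ≤ (s ^ A) ^ γ * (1 + u⁻¹) ^ (A * m) := by gcongr
      _ ≤ _ := by gcongr
  · set y := (1 + u⁻¹) ^ (A * m) with hy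
    have hy1 : 1 ≤ y := one_le_pow₀ (by linarith)
    have h1 : ((u + 1) ^ A) ^ (-κ) * (u ^ A) ^ m * y = ((u + 1) ^ A) ^ γ := by
      rw [← hUV _ hV, hy, pow_mul]
      nth_rewrite 3 [hr]
      rw [mul_pow]; ring
    have h2 : ((u + 1) ^ A) ^ (-κ) * (u ^ A) ^ m = ((u + 1) ^ A) ^ γ / y := by
      rw [← h1]; field_simp
    rw [h2, le_div_iff₀ (by linarith)]
    have h3 : (1 - 2 ^ (A * m + 1) * s⁻¹) * y ≤ 1 := by
      have h4 : 1 - 2 ^ (A * m + 1) * s⁻¹ ≤ 2 - y := by linarith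
      nlinarith [mul_le_mul_of_nonneg_right h4 (by linarith : 0 ≤ y), sq_nonneg (y - 1)]
    calc (s ^ A) ^ γ * (1 - 2 ^ (A * m + 1) * s⁻¹) * y
        = (s ^ A) ^ γ * ((1 - 2 ^ (A * m + 1) * s⁻¹) * y) := by ring
      _ ≤ (s ^ A) ^ γ * 1 := by gcongr
      _ ≤ _ := by rw [mul_one]; exact hWV

theorem count_eq_NF (p q d : ℕ) (g : SLR (p + q)) (J : Set ℝ) (t : ℝ) :
    (count (fun i : Fin (p + q) => if (i : ℕ) < p then (1 : ℝ) else -1) d J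
      (annulus (p + q) (-1) t) g).toReal = NF p q d g J t := by
  classical
  have h1 : {v : Fin (p + q) → ℤ | Fg p q d g (intVec v) ∈ J ∧ eucNorm (intVec v) ≤ t}
      = ((annulus (p + q) (-1) t).filter fun v => Fg p q d g (intVec v) ∈ J : Finset _) := by
    ext v
    rw [Finset.coe_filter]
    constructor
    · exact fun h => ⟨mem_annulus.2 ⟨by linarith [norm_nonneg (intVec v)], h.2⟩, h.1⟩
    · exact fun h => ⟨h.2, (mem_annulus.1 h.1).2⟩
  rw [NF, h1, Nat.card_coe_set_eq, Set.ncard_coe_finset, Finset.card_filter, count]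
  rw [ENNReal.toReal_sum fun v _ => by
    by_cases hv : g ∈ hit (fun i : Fin (p + q) => if (i : ℕ) < p then (1 : ℝ) else -1) d J (intVec v)
    · simp [hv]
    · simp [hv]]
  push_cast
  refine Finset.sum_congr rfl fun v _ => ?_
  by_cases hv : Fg p q d g (intVec v) ∈ J
  · rw [if_pos hv, Set.indicator_of_mem (show g ∈ hit _ d J (intVec v) from hv)]
    simp
  · rw [if_neg hv, Set.indicator_of_notMem (show g ∉ hit _ d J (intVec v) from hv)]
    simp

theorem NF_mono (p q d : ℕ) (g : SLR (p + q)) {J J' : Set ℝ} (hJ : J ⊆ J') {t t' : ℝ}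
    (ht : t ≤ t') : NF p q d g J t ≤ NF p q d g J' t' := by
  refine Nat.card_mono ?_ fun v hv => ⟨hJ hv.1, hv.2.trans ht⟩
  exact (annulus (p + q) (-1) t').finite_toSet.subset fun v hv =>
    mem_annulus.2 ⟨by linarith [norm_nonneg (intVec v)], hv.2⟩

theorem sandwich_error {a c t γ κ η E x y x' y' N N₁ N₂ B ν α : ℝ} (ha : 0 ≤ a) (hc : 0 ≤ c)
    (ht : 1 ≤ t) (hB : 0 ≤ B) (hE : 0 ≤ E) (hνη : ν ≤ η) (hνα : ν ≤ α)
    (hx : x * x' ≤ t ^ γ * (1 + E * t ^ (-α))) (hy : t ^ γ * (1 - E * t ^ (-α)) ≤ y * y')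
    (h₁ : |N₁ - a * (c * x * x')| ≤ B * t ^ (γ - η))
    (h₂ : |N₂ - a * (c * y * y')| ≤ B * t ^ (γ - η)) (hN₁ : N ≤ N₁) (hN₂ : N₂ ≤ N)
    {z : ℝ} (hz : t ^ (-κ) * z = t ^ γ) :
    |N - a * (c * t ^ (-κ)) * z| ≤ (a * c * E + B) * t ^ (γ - ν) := by
  have ht0 : 0 < t := by linarith
  have e1 : t ^ (γ - η) ≤ t ^ (γ - ν) := Real.rpow_le_rpow_of_exponent_le ht (by linarith)
  have e2 : t ^ γ * t ^ (-α) ≤ t ^ (γ - ν) := by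
    rw [← Real.rpow_add ht0]
    exact Real.rpow_le_rpow_of_exponent_le ht (by linarith)
  have e3 : B * t ^ (γ - η) ≤ B * t ^ (γ - ν) := by gcongr
  have hac : 0 ≤ a * c := mul_nonneg ha hc
  have e4 : a * c * E * (t ^ γ * t ^ (-α)) ≤ a * c * E * t ^ (γ - ν) := by gcongr
  have e5 := mul_le_mul_of_nonneg_left hx hac
  have e6 := mul_le_mul_of_nonneg_left hy hac
  have e7 : a * (c * t ^ (-κ)) * z = a * c * t ^ γ := by rw [← hz]; ring
  obtain ⟨h3, h4⟩ := abs_le.1 h₁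
  obtain ⟨h5, h6⟩ := abs_le.1 h₂
  rw [e7, abs_le]
  constructor <;> nlinarith

theorem summable_pow_rpow_neg {η : ℝ} {A : ℕ} (h : 2 ≤ A * η) :
    Summable fun k : ℕ => (((k : ℝ) + 1) ^ A) ^ (-η) := by
  have h1 : Summable fun k : ℕ => ((k + 1 : ℕ) : ℝ) ^ (-(A * η)) :=
    (summable_nat_add_iff 1).2 (Real.summable_nat_rpow.2 (by linarith))
  refine h1.congr fun k => ?_
  push_cast
  rw [← Real.rpow_natCast _ A, ← Real.rpow_mul (by positivity)]
  congr 1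
  ring

theorem rpow_neg_le_of_le_mul {x y b κ : ℝ} (hx : 0 < x) (hy : 0 < y) (hb : 0 < b) (hκ : 0 ≤ κ)
    (h : y ≤ b * x) : x ^ (-κ) ≤ b ^ κ * y ^ (-κ) := by
  have h1 : y ^ κ ≤ b ^ κ * x ^ κ := by
    rw [← Real.mul_rpow hb.le hx.le]
    gcongr
  have hx' := Real.rpow_pos_of_pos hx κ
  have hy' := Real.rpow_pos_of_pos hy κ
  rw [Real.rpow_neg hx.le, Real.rpow_neg hy.le, ← div_eq_mul_inv, le_div_iff₀ hy', ← div_eq_inv_mul,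
    div_le_iff₀ hx']
  exact h1

/-- Theorem 1 of the paper: effective counting for shrinking targets, for almost all
forms `F = g·F₀ ∈ Y_{p,q}^{(d)}`. -/
theorem counting_shrinking_targets
    (p q d : ℕ) (hp : 1 ≤ p) (hq : 1 ≤ q) (hd2 : 2 ≤ d) (hdeven : Even d)
    (hnd : d < p + q)
    (κ : ℝ) (hκ0 : 0 < κ) (hκ : κ < (p + q : ℝ) - d)
    (I : ℝ → Set ℝ) (c : ℝ) (hc : 0 < c)
    (hImeas : ∀ t > (0 : ℝ), MeasurableSet (I t))
    (hIbdd : ∀ t > (0 : ℝ), Bornology.IsBounded (I t))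
    (hIdec : ∀ s t : ℝ, 0 < s → s ≤ t → I t ⊆ I s)
    (hIvol : ∀ t > (0 : ℝ), volume (I t) = ENNReal.ofReal (c * t ^ (-κ)))
    (μ : Measure (SLR (p + q))) [μ.IsHaarMeasure] :
    ∃ ν > (0 : ℝ), ∀ᵐ g ∂μ, ∃ cF > (0 : ℝ), ∃ CF > (0 : ℝ), ∃ t₀ : ℝ, ∀ t ≥ t₀,
      |(NF p q d g (I t) t : ℝ) - cF * (volume (I t)).toReal * t ^ ((p + q : ℝ) - d)|
        ≤ CF * t ^ ((p + q : ℝ) - d - κ - ν) := by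
  set γ : ℝ := (p + q : ℝ) - d - κ with hγ
  set σ : Fin (p + q) → ℝ := fun i => if (i : ℕ) < p then (1 : ℝ) else -1 with hσ
  have hσ1 : ∀ i, |σ i| = 1 := fun i => by
    rw [hσ]
    by_cases h : (i : ℕ) < p <;> simp [h]
  have hγ0 : 0 < γ := by linarith
  have hκγ : κ = ((p + q : ℕ) : ℝ) - d - γ := by rw [hγ]; push_cast; ring
  have hm : ((p + q - d : ℕ) : ℝ) = (p + q : ℝ) - d := by
    rw [Nat.cast_sub hnd.le]; push_cast; ring
  obtain ⟨η, hη, hηγ, hae⟩ := ae_eventually_count_le (by omega) hσ1 hd2 hnd μ hγ0 hκγ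
  obtain ⟨A, hA1, hAη⟩ : ∃ A : ℕ, 1 ≤ A ∧ 2 ≤ A * η := by
    obtain ⟨A, hA⟩ := exists_nat_gt (max 1 (2 / η))
    refine ⟨A, ?_, ?_⟩
    · exact_mod_cast (le_max_left _ _).trans hA.le
    · rw [← div_le_iff₀ hη]
      exact (le_max_right _ _).trans hA.le
  obtain ⟨r, hr⟩ := (hIbdd 1 one_pos).subset_closedBall 0
  set T : ℕ → ℝ := fun k => ((k : ℝ) + 1) ^ A with hT
  have hT1 : ∀ k, 1 ≤ T k := fun k => one_le_pow₀ (by linarith [(Nat.cast_nonneg k : (0 : ℝ) ≤ k)])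
  have hT0 : ∀ k, 0 < T k := fun k => by linarith [hT1 k]
  have hTt : Tendsto T atTop atTop :=
    (tendsto_pow_atTop (by omega)).comp (tendsto_atTop_add_const_right _ 1 tendsto_natCast_atTop_atTop)
  have hTs : Summable fun k => T k ^ (-η) := summable_pow_rpow_neg hAη
  have hT2 : ∀ k, T (k + 1) ≤ 2 ^ A * T k := fun k => by
    rw [hT, ← mul_pow]
    push_cast
    have := (Nat.cast_nonneg k : (0 : ℝ) ≤ k)
    gcongr
    linarith
  have hTm : ∀ k, T k ≤ T (k + 1) := fun k => by
    rw [hT]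
    push_cast
    gcongr
    linarith
  have hvol : ∀ t > (0 : ℝ), (volume (I t)).toReal = c * t ^ (-κ) := fun t ht => by
    rw [hIvol t ht, ENNReal.toReal_ofReal (mul_nonneg hc.le (Real.rpow_nonneg ht.le _))]
  have hIM : ∀ k, I (T k) ⊆ Set.Icc (-max 1 r) (max 1 r) := fun k => by
    refine (hIdec 1 (T k) one_pos (hT1 k)).trans (hr.trans ?_)
    rw [Real.closedBall_eq_Icc]
    exact Set.Icc_subset_Icc (by linarith [le_max_right 1 r]) (by linarith [le_max_right 1 r])
  have hb : (0 : ℝ) < (2 ^ A) ^ κ := Real.rpow_pos_of_pos (by positivity) _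
  have H₁ := hae (fun k => T (k + 1)) (fun k => I (T k)) (max 1 r) (1 + c * (2 ^ A) ^ κ)
    (le_max_left _ _) (by linarith [mul_pos hc hb]) (fun k => hT1 _)
    ((tendsto_add_atTop_iff_nat 1).2 hTt) ((summable_nat_add_iff 1).2 hTs)
    (fun k => hImeas _ (hT0 k)) hIM (fun k => by
      rw [hvol _ (hT0 k)]
      have h1 := rpow_neg_le_of_le_mul (hT0 k) (hT0 (k + 1)) (by positivity) hκ0.le (hT2 k)
      have h2 := Real.rpow_nonneg (hT0 (k + 1)).le (-κ)
      have h3 := mul_le_mul_of_nonneg_left h1 hc.le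
      linarith)
  have H₂ := hae T (fun k => I (T (k + 1))) (max 1 r) (1 + c)
    (le_max_left _ _) (by linarith) hT1 hTt hTs
    (fun k => hImeas _ (hT0 _)) (fun k => hIM _) (fun k => by
      rw [hvol _ (hT0 _)]
      have h1 := Real.rpow_le_rpow_of_nonpos (hT0 k) (hTm k) (by linarith : -κ ≤ 0)
      have h2 := Real.rpow_nonneg (hT0 k).le (-κ)
      have h3 := mul_le_mul_of_nonneg_left h1 hc.le
      linarith)
  refine ⟨min η (1 / A), lt_min hη (by positivity), ?_⟩
  filter_upwards [H₁, H₂] with g h₁ h₂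
  have ha : 0 < regDensity σ d g :=
    regDensity_pos hσ1 hd2 hnd (i := ⟨0, by omega⟩) (j := ⟨p, by omega⟩) (if_pos hp)
      (if_neg (by simp)) g
  obtain ⟨k₀, hk₀⟩ := eventually_atTop.1 (h₁.and h₂)
  have hB : (0 : ℝ) < (2 ^ A) ^ (γ - η) := Real.rpow_pos_of_pos (by positivity) _
  have hB1 : (1 : ℝ) ≤ (2 ^ A) ^ (γ - η) :=
    Real.one_le_rpow (one_le_pow₀ (by norm_num)) (by linarith)
  refine ⟨regDensity σ d g, ha, regDensity σ d g * c * 2 ^ (A * (p + q - d) + 1)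
    + (2 ^ A) ^ (γ - η), by positivity, T k₀, fun t ht => ?_⟩
  have ht1 : 1 ≤ t := (hT1 k₀).trans ht
  have ht0 : 0 < t := by linarith
  set s := t ^ (1 / (A : ℝ)) with hs
  have hsA : s ^ A = t := by
    rw [hs, one_div, Real.rpow_inv_natCast_pow ht0.le (by omega)]
  have hs0 : 0 ≤ s := Real.rpow_nonneg ht0.le _
  have hks : (k₀ : ℝ) + 1 ≤ s := by
    refine le_of_pow_le_pow_left₀ (n := A) (by omega) hs0 ?_
    rw [hsA]
    exact ht
  obtain ⟨k, hk⟩ : ∃ k, ⌊s⌋₊ = k + 1 := Nat.exists_eq_succ_of_ne_zero (by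
    have : k₀ + 1 ≤ ⌊s⌋₊ := Nat.le_floor (by push_cast; exact hks)
    omega)
  have hkk : k₀ ≤ k := by
    have : k₀ + 1 ≤ ⌊s⌋₊ := Nat.le_floor (by push_cast; exact hks)
    omega
  have hus : (k : ℝ) + 1 ≤ s := by
    have := Nat.floor_le hs0
    rw [hk] at this
    exact_mod_cast this
  have hsu : s ≤ (k : ℝ) + 1 + 1 := by
    have := (Nat.lt_floor_add_one s).le
    rw [hk] at this
    exact_mod_cast this
  have hTk : T k ≤ t := by
    rw [← hsA]
    exact pow_le_pow_left₀ (by positivity) hus A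
  have hTk1 : t ≤ T (k + 1) := by
    rw [← hsA, hT]
    push_cast
    exact pow_le_pow_left₀ hs0 hsu A
  obtain ⟨hx, hy⟩ := sandwich_rpow (m := p + q - d) (κ := κ) hA1
    (by linarith [(Nat.cast_nonneg k : (0 : ℝ) ≤ k)]) hus hsu hγ0.le (by rw [hm]; linarith)
  rw [hsA] at hx hy
  obtain ⟨h3, h4⟩ := hk₀ k hkk
  rw [hvol _ (hT0 _), count_eq_NF] at h3 h4
  have hT' : T (k + 1) = ((k : ℝ) + 1 + 1) ^ A := by rw [hT]; push_cast; rfl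
  have hb1 : T (k + 1) ^ (γ - η) ≤ (2 ^ A) ^ (γ - η) * t ^ (γ - η) := by
    rw [← Real.mul_rpow (by positivity) ht0.le]
    refine Real.rpow_le_rpow (hT0 _).le ((hT2 k).trans ?_) (by linarith)
    gcongr
  have hb2 : T k ^ (γ - η) ≤ (2 ^ A) ^ (γ - η) * t ^ (γ - η) :=
    (Real.rpow_le_rpow (hT0 _).le hTk (by linarith)).trans
      (le_mul_of_one_le_left (Real.rpow_nonneg ht0.le _) hB1)
  rw [hvol t ht0]
  refine sandwich_error (N₁ := NF p q d g (I (T k)) (T (k + 1)))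
    (N₂ := NF p q d g (I (T (k + 1))) (T k)) ha.le hc.le ht1 hB.le (by positivity)
    (min_le_left _ _) (min_le_right _ _) hx hy ?_ ?_ ?_ ?_ ?_
  · rw [← hT']; exact h3.trans hb1
  · rw [← hT']; exact h4.trans hb2
  · exact_mod_cast NF_mono p q d g (hIdec _ _ (hT0 k) hTk) hTk1
  · exact_mod_cast NF_mono p q d g (hIdec _ _ ht0 hTk1) hTk
  · rw [← Real.rpow_add ht0, hγ]
    congr 1
    ring

end
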